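/- Let K be a field of characteristic different from 2. If |gen(D)| = 1 for every finite-dimensional central division K-algebra D of exponent 2, then |gen(D')| = 1 for every finite-dimensional central division algebra D' of exponent 2 over the rational function field K(x) in one variable over K. -/

import Mathlib

open scoped TensorProduct

universe u

/-- `M` is a *maximal subfield* of the division algebra `D` over `K`:
a commutative `K`-subalgebra that is closed under inverses (hence a field)
and maximal among commutative `K`-subalgebras. -/
def IsMaximalSubfield (K : Type*) [Field K] (D : Type*) [DivisionRing D] [Algebra K D]
    (M : Subalgebra K D) : Prop :=
  (∀ x ∈ M, ∀ y ∈ M, x * y = y * x) ∧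
  (∀ x ∈ M, x⁻¹ ∈ M) ∧
  ∀ N : Subalgebra K D, (∀ x ∈ N, ∀ y ∈ N, x * y = y * x) → M ≤ N → N = M

/-- `D` and `D'` have the same maximal subfields, up to `K`-isomorphism:
every maximal subfield of one is `K`-isomorphic to a maximal subfield of the other.
This says exactly that a field extension of `K` is `K`-isomorphic to a maximal
subfield of `D` iff it is `K`-isomorphic to a maximal subfield of `D'`. -/
def SameMaximalSubfields (K : Type*) [Field K] (D : Type*) [DivisionRing D] [Algebra K D]
    (D' : Type*) [DivisionRing D'] [Algebra K D'] : Prop :=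
  (∀ M : Subalgebra K D, IsMaximalSubfield K D M →
    ∃ M' : Subalgebra K D', IsMaximalSubfield K D' M' ∧ Nonempty (M ≃ₐ[K] M')) ∧
  (∀ M' : Subalgebra K D', IsMaximalSubfield K D' M' →
    ∃ M : Subalgebra K D, IsMaximalSubfield K D M ∧ Nonempty (M ≃ₐ[K] M'))

/-- `D` has exponent `2` in the Brauer group of `K`: `D` is not (split) isomorphic
to `K`, but the class of `D ⊗[K] D` in `Br K` is trivial, i.e. `D ⊗[K] D` is a
matrix algebra over `K`. -/
def HasExponentTwo (K : Type*) [Field K] (D : Type*) [Ring D] [Algebra K D] : Prop :=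
  (¬ Nonempty (D ≃ₐ[K] K)) ∧
  ∃ n : ℕ, 0 < n ∧ Nonempty ((D ⊗[K] D) ≃ₐ[K] Matrix (Fin n) (Fin n) K)

/-- `|gen(D)| = 1`: every finite-dimensional central division `K`-algebra having the
same (isomorphism classes of) maximal subfields as `D` is `K`-isomorphic to `D`. -/
def GenusOne (K : Type u) [Field K] (D : Type u) [DivisionRing D] [Algebra K D] : Prop :=
  ∀ (D' : Type u) [DivisionRing D'] [Algebra K D'],
    FiniteDimensional K D' → Algebra.IsCentral K D' →
    SameMaximalSubfields K D D' → Nonempty (D' ≃ₐ[K] D)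


set_option linter.all false
open MulOpposite

set_option linter.deprecated false

section CSA
variable {F : Type*} [Field F] {D : Type*} [DivisionRing D] [Algebra F D]

theorem sandwich [Algebra.IsCentral F D] {ι : Type*} (b : ι → D) (n : ℕ) :
    ∀ (s : Finset ι) (a : ι → D), s.card = n → LinearIndepOn F b (s : Set ι) →
    (∀ x, ∑ i ∈ s, a i * x * b i = 0) → ∀ i ∈ s, a i = 0 := by
  classical
  induction n with
  | zero => intro s a hs _ _ i hi; simp_all
  | succ n ih =>
    intro s a hs hb h i₀ hi₀
    by_contra hne
    have hcen : ∀ i ∈ s, (a i₀)⁻¹ * a i ∈ Subalgebra.center F D := by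
      intro i hi
      rw [Subalgebra.mem_center_iff]
      intro y
      by_cases hii : i = i₀
      · subst hii; simp [inv_mul_cancel₀ hne]
      have := ih (s.erase i₀) (fun i => y * ((a i₀)⁻¹ * a i) - ((a i₀)⁻¹ * a i) * y)
        (by rw [Finset.card_erase_of_mem hi₀, hs]; rfl)
        (hb.mono (by simp)) (fun x => by
          have e1 : ∑ i ∈ s, (y * ((a i₀)⁻¹ * a i) - ((a i₀)⁻¹ * a i) * y) * x * b i = 0 := by
            have e2 : ∀ i ∈ s, (y * ((a i₀)⁻¹ * a i) - ((a i₀)⁻¹ * a i) * y) * x * b i =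
              y * (a i₀)⁻¹ * (a i * x * b i) - (a i₀)⁻¹ * (a i * (y * x) * b i) := by
              intro i _; simp only [sub_mul, mul_assoc]
            rw [Finset.sum_congr rfl e2, Finset.sum_sub_distrib, ← Finset.mul_sum, ← Finset.mul_sum,
              h, h]; simp
          rw [← Finset.add_sum_erase s _ hi₀, inv_mul_cancel₀ hne] at e1
          simpa using e1) i (by simp [hii, hi])
      exact sub_eq_zero.1 this
    have hc : ∀ i ∈ s, ∃ c : F, algebraMap F D c = (a i₀)⁻¹ * a i := by
      intro i hi
      have := hcen i hi
      rw [Algebra.IsCentral.center_eq_bot, Algebra.mem_bot] at this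
      exact this
    choose! c hc using hc
    have h0 : ∑ i ∈ s, c i • b i = 0 := by
      have := congrArg ((a i₀)⁻¹ * ·) (h 1)
      simp only [mul_one, Finset.mul_sum, mul_zero] at this
      rw [← this]
      refine Finset.sum_congr rfl fun i hi => ?_
      rw [Algebra.smul_def, hc i hi, mul_assoc]
    have := (linearIndepOn_finset_iff.1 hb) c h0 i₀ hi₀
    have h2 := hc i₀ hi₀
    rw [this, inv_mul_cancel₀ hne] at h2
    simp at h2

variable [FiniteDimensional F D] [Algebra.IsCentral F D]

theorem sandwich_basis {ι : Type*} [Fintype ι] (β : Module.Basis ι F D) (a : ι → D)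
    (h : ∀ x, ∑ i, a i * x * β i = 0) : ∀ i, a i = 0 := fun i =>
  sandwich (F := F) β _ Finset.univ a rfl (by
    rw [Finset.coe_univ]; exact linearIndepOn_univ_iff.2 β.linearIndependent)
    h i (Finset.mem_univ i)

theorem sandwich_span {ι : Type*} [Fintype ι] (β : Module.Basis ι F D) (f : D →ₗ[F] D) :
    ∃ t : ι → ι → F, ∀ x, f x = ∑ i, ∑ l, t i l • (β i * x * β l) := by
  classical
  let v : ι × ι → (D →ₗ[F] D) := fun p => LinearMap.mulLeft F (β p.1) ∘ₗ LinearMap.mulRight F (β p.2)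
  have hv : LinearIndependent F v := by
    rw [Fintype.linearIndependent_iff]
    intro g hg p
    have h1 : ∀ x, ∑ l, (∑ i, g (i, l) • β i) * x * β l = 0 := by
      intro x
      have := LinearMap.congr_fun hg x
      simp only [LinearMap.sum_apply, v, LinearMap.smul_apply, LinearMap.comp_apply,
        LinearMap.mulLeft_apply, LinearMap.mulRight_apply, Fintype.sum_prod_type_right] at this
      simpa [Finset.sum_mul, mul_assoc] using this
    have h2 := sandwich_basis β _ h1 p.2
    exact (Fintype.linearIndependent_iff.1 β.linearIndependent) (fun i => g (i, p.2)) h2 p.1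
  have hs := hv.span_eq_top_of_card_eq_finrank' (by
    rw [Module.finrank_linearMap, Module.finrank_eq_card_basis β]; simp)
  have hf : f ∈ Submodule.span F (Set.range v) := by rw [hs]; trivial
  obtain ⟨c, hc⟩ := (Submodule.mem_span_range_iff_exists_fun F).1 hf
  refine ⟨fun i l => c (i, l), fun x => ?_⟩
  rw [← hc]
  simp [v, Fintype.sum_prod_type, mul_assoc]

end CSA

/-- bimodule data: commuting left action `l` and right action `r` of `D` on an `R`-module `M`. -/
structure DBimod (F : Type*) [Field F] (D : Type*) [DivisionRing D] [Algebra F D]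
    (R : Type*) [Field R] [Algebra F R] (M : Type*) [AddCommGroup M] [Module R M] where
  l : D →+* Module.End R M
  r : Dᵐᵒᵖ →+* Module.End R M
  hl : ∀ c m, l (algebraMap F D c) m = algebraMap F R c • m
  hr : ∀ c m, r (MulOpposite.op (algebraMap F D c)) m = algebraMap F R c • m
  comm : ∀ x y m, l x (r y m) = r y (l x m)

namespace DBimod
variable {F : Type*} [Field F] {D : Type*} [DivisionRing D] [Algebra F D]
    {R : Type*} [Field R] [Algebra F R] {M : Type*} [AddCommGroup M] [Module R M]
    (B : DBimod F D R M)

/-- invariants of a bimodule -/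
def inv : Submodule R M where
  carrier := {m | ∀ x, B.l x m = B.r (op x) m}
  add_mem' ha hb x := by rw [map_add, map_add, ha x, hb x]
  zero_mem' x := by simp
  smul_mem' c m hm x := by rw [map_smul, map_smul, hm x]

theorem mem_inv {m : M} : m ∈ B.inv ↔ ∀ x, B.l x m = B.r (op x) m := Iff.rfl

variable [FiniteDimensional F D] [Algebra.IsCentral F D]

theorem uprin {κ : Type*} (s : Finset κ) (a b : κ → D) (h : ∀ x, ∑ k ∈ s, a k * x * b k = 0) (m : M) :
    ∑ k ∈ s, B.l (a k) (B.r (op (b k)) m) = 0 := by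
  let β := Module.finBasis F D
  have hb : ∀ k, b k = ∑ i, algebraMap F D (β.repr (b k) i) * β i := fun k => by
    conv_lhs => rw [← β.sum_repr (b k)]
    simp [Algebra.smul_def]
  have h1 : ∀ x, ∑ i, (∑ k ∈ s, a k * algebraMap F D (β.repr (b k) i)) * x * β i = 0 := by
    intro x
    rw [← h x]
    simp only [Finset.sum_mul]
    rw [Finset.sum_comm]
    refine Finset.sum_congr rfl fun k _ => ?_
    conv_rhs => rw [hb k, Finset.mul_sum]
    refine Finset.sum_congr rfl fun i _ => ?_
    simp only [mul_assoc]; rw [← mul_assoc (algebraMap F D _), Algebra.commutes, mul_assoc]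
  have h2 := sandwich_basis β _ h1
  have : ∀ k, B.r (op (b k)) m = ∑ i, B.l (algebraMap F D (β.repr (b k) i)) (B.r (op (β i)) m) := by
    intro k
    conv_lhs => rw [hb k]
    rw [show op (∑ i, algebraMap F D (β.repr (b k) i) * β i) = ∑ i, op (algebraMap F D (β.repr (b k) i) * β i) from
      Finset.op_sum _ _]
    simp only [op_mul, map_sum, map_mul, LinearMap.sum_apply, Module.End.mul_apply, B.hl, B.hr, map_smul]
  simp only [this, map_sum]
  rw [Finset.sum_comm]
  refine Finset.sum_eq_zero fun i _ => ?_
  have := congrArg (fun d => B.l d (B.r (op (β i)) m)) (h2 i)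
  simpa [map_sum, LinearMap.sum_apply, map_mul] using this

theorem decomp : ∃ (n : ℕ) (x : Module.Basis (Fin n) F D) (τ : Fin n → M →ₗ[R] M),
    (∀ j m, τ j m ∈ B.inv) ∧ (∀ m, m = ∑ j, B.l (x j) (τ j m)) ∧
    ∀ j k, ∀ m ∈ B.inv, τ k (B.l (x j) m) = if j = k then m else 0 := by
  classical
  let β := Module.finBasis F D
  have hex := fun j => sandwich_span β (Algebra.linearMap F D ∘ₗ β.coord j)
  choose t ht using hex
  refine ⟨_, β, fun j => ∑ i, ∑ l, algebraMap F R (t j i l) • (B.l (β i) * B.r (op (β l))), ?_, ?_, ?_⟩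
  · intro j m y
    have := B.uprin (s := (Finset.univ : Finset ((Fin _ × Fin _) ⊕ (Fin _ × Fin _))))
      (Sum.elim (fun p => y * algebraMap F D (t j p.1 p.2) * β p.1) (fun p => -algebraMap F D (t j p.1 p.2) * β p.1))
      (Sum.elim (fun p => β p.2) (fun p => β p.2 * y)) (fun x => by
        have h1 := congrArg (y * ·) (ht j x)
        have h2 := congrArg (· * y) (ht j x)
        simp only [Finset.mul_sum, Finset.sum_mul, LinearMap.comp_apply, Algebra.linearMap_apply] at h1 h2
        rw [← Algebra.commutes, h2] at h1
        simp only [Fintype.sum_sum_type, Sum.elim_inl, Sum.elim_inr, Fintype.sum_prod_type, neg_mul, Finset.sum_neg_distrib]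
        rw [add_neg_eq_zero]
        simpa [Algebra.smul_def, mul_assoc] using h1.symm) m
    simp only [Fintype.sum_sum_type, Sum.elim_inl, Sum.elim_inr, Fintype.sum_prod_type, neg_mul, map_neg, LinearMap.neg_apply,
      Finset.sum_neg_distrib, add_neg_eq_zero, map_mul, op_mul, Module.End.mul_apply, B.hl, map_smul] at this
    simp only [LinearMap.sum_apply, LinearMap.smul_apply, map_sum, map_smul, Module.End.mul_apply, this]
    simp only [B.comm]
  · intro m
    have := B.uprin (s := (Finset.univ : Finset (Option (Fin _ × Fin _ × Fin _))))
      (fun o => o.elim (-1) (fun p => β p.1 * (algebraMap F D (t p.1 p.2.1 p.2.2) * β p.2.1)))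
      (fun o => o.elim 1 (fun p => β p.2.2)) (fun x => by
        have h1 : x = ∑ j, β j * (algebraMap F D (β.coord j x)) := by
          conv_lhs => rw [← β.sum_repr x]
          simp [Algebra.smul_def, Algebra.commutes]
        have h2 : x = ∑ j, β j * ∑ i, ∑ l, t j i l • (β i * x * β l) := by
          conv_lhs => rw [h1]
          exact Finset.sum_congr rfl fun j _ => by rw [← ht j x]; rfl
        rw [Fintype.sum_option]
        simp only [Option.elim, neg_mul, one_mul, mul_one, Fintype.sum_prod_type]
        rw [neg_add_eq_zero]
        conv_lhs => rw [h2]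
        simp only [Finset.mul_sum, Algebra.smul_def, mul_assoc]) m
    rw [Fintype.sum_option] at this
    simp only [Option.elim, map_neg, map_one, op_one, Fintype.sum_prod_type, LinearMap.neg_apply, Module.End.one_apply,
      map_mul, Module.End.mul_apply, B.hl, map_smul] at this
    rw [neg_add_eq_zero] at this
    simpa [LinearMap.sum_apply, map_sum] using this
  · intro j k m hm
    have h1 := ht k (β j)
    simp only [LinearMap.comp_apply, Algebra.linearMap_apply, Module.Basis.coord_apply, Module.Basis.repr_self] at h1
    have h2 := congrArg (fun d => B.l d m) h1
    simp only [B.hl, map_sum, LinearMap.sum_apply, Algebra.smul_def, map_mul, Module.End.mul_apply] at h2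
    simp only [LinearMap.sum_apply, LinearMap.smul_apply, Module.End.mul_apply]
    rw [Finsupp.single_apply] at h2
    have h3 : (algebraMap F R (if j = k then 1 else 0)) • m = if j = k then m else 0 := by split_ifs <;> simp
    rw [← h3, h2]
    refine Finset.sum_congr rfl fun i _ => Finset.sum_congr rfl fun l _ => ?_
    rw [← B.comm, ← hm]

/-- key structure theorem for bimodules over a central division algebra -/
theorem equiv : ∃ n : ℕ, n = Module.finrank F D ∧ Nonempty ((Fin n → B.inv) ≃ₗ[R] M) := by
  classical
  obtain ⟨n, x, τ, h1, h2, h3⟩ := B.decomp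
  refine ⟨n, by rw [Module.finrank_eq_card_basis x]; simp, ⟨LinearEquiv.ofLinearMap
    (∑ j, B.l (x j) ∘ₗ B.inv.subtype ∘ₗ LinearMap.proj j)
    (LinearMap.pi fun j => LinearMap.codRestrict B.inv (τ j) (h1 j)) ?_ ?_⟩⟩
  · ext m; simpa [LinearMap.sum_apply] using (h2 m).symm
  · refine LinearMap.ext fun f => funext fun k => Subtype.ext ?_
    simp [LinearMap.sum_apply, h3 _ _ _ (f _).2]

theorem finrank_eq : Module.finrank R M = Module.finrank F D * Module.finrank R B.inv := by
  obtain ⟨n, hn, ⟨e⟩⟩ := B.equiv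
  rw [← hn, ← e.finrank_eq]
  by_cases h : Module.Finite R B.inv
  · rw [Module.finrank_pi_fintype]; simp
  · rw [Module.finrank_of_infinite_dimensional h]
    by_cases hn0 : n = 0
    · subst hn0; rw [zero_mul]; exact Module.finrank_zero_of_subsingleton
    refine Module.finrank_of_infinite_dimensional fun h' => h ?_
    exact Module.Finite.of_surjective (LinearMap.proj (⟨0, Nat.pos_of_ne_zero hn0⟩ : Fin n) : (Fin n → B.inv) →ₗ[R] B.inv)
      (LinearMap.proj_surjective _)

theorem inv_ne_bot [Nontrivial M] : B.inv ≠ ⊥ := by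
  intro h
  obtain ⟨n, hn, ⟨e⟩⟩ := B.equiv
  have : Subsingleton B.inv := by rw [h]; infer_instance
  have := e.symm.injective.subsingleton
  exact not_subsingleton M this
end DBimod

/-- an action of the `F`-algebra `D` on an `R`-space -/
structure DAct (F : Type*) [Field F] (D : Type*) [DivisionRing D] [Algebra F D]
    (R : Type*) [Field R] [Algebra F R] (X : Type*) [AddCommGroup X] [Module R X] where
  a : D →+* Module.End R X
  ha : ∀ c m, a (algebraMap F D c) m = algebraMap F R c • m

namespace DAct
variable {F : Type*} [Field F] {D : Type*} [DivisionRing D] [Algebra F D]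
    {R : Type*} [Field R] [Algebra F R] {X : Type*} [AddCommGroup X] [Module R X]
    {Y : Type*} [AddCommGroup Y] [Module R Y]
    (A : DAct F D R X) (B : DAct F D R Y)

/-- the bimodule of linear maps -/
def hb : DBimod F D R (X →ₗ[R] Y) where
  l := { toFun := fun d => LinearMap.lcomp R Y LinearMap.id |>.comp (LinearMap.llcomp R X Y Y (B.a d))
         map_one' := by ext; simp
         map_mul' := fun x y => by ext; simp
         map_zero' := by ext; simp
         map_add' := fun x y => by ext; simp }
  r := { toFun := fun d => LinearMap.lcomp R Y (A.a d.unop)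
         map_one' := by ext; simp
         map_mul' := fun x y => by ext; simp
         map_zero' := by ext; simp
         map_add' := fun x y => by ext; simp }
  hl c m := by ext x; simp [B.ha]
  hr c m := by ext x; simp [A.ha]
  comm x y m := by ext; simp

/-- equivariant maps -/
def hom : Submodule R (X →ₗ[R] Y) := (hb A B).inv

theorem mem_hom {f : X →ₗ[R] Y} : f ∈ hom A B ↔ ∀ d x, f (A.a d x) = B.a d (f x) := by
  refine ⟨fun h d x => (LinearMap.congr_fun (h d) x).symm, fun h d => LinearMap.ext fun x => (h d x).symm⟩

variable [FiniteDimensional F D] [Algebra.IsCentral F D]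

theorem finrank_hom [FiniteDimensional R X] [FiniteDimensional R Y] :
    Module.finrank R X * Module.finrank R Y = Module.finrank F D * Module.finrank R (hom A B) := by
  rw [← Module.finrank_linearMap, (hb A B).finrank_eq]; rfl

theorem exists_hom [Nontrivial X] [Nontrivial Y] : ∃ f ∈ hom A B, f ≠ 0 := by
  have : Nontrivial (X →ₗ[R] Y) := by
    obtain ⟨x, hx⟩ := exists_ne (0 : X)
    obtain ⟨y, hy⟩ := exists_ne (0 : Y)
    have : ∃ f : Module.Dual R X, f x ≠ 0 := by
      by_contra! h
      exact hx ((Module.forall_dual_apply_eq_zero_iff R x).1 h)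
    obtain ⟨f, hf⟩ := this
    refine ⟨f.smulRight y, 0, fun h => ?_⟩
    have := LinearMap.congr_fun h x
    simp [hf, hy] at this
  exact Submodule.exists_mem_ne_zero_of_ne_bot (hb A B).inv_ne_bot

theorem le_sq (A : DAct F D R X) [FiniteDimensional R X] [Nontrivial X] : Module.finrank F D ≤ Module.finrank R X ^ 2 := by
  rw [pow_two, finrank_hom A A]
  obtain ⟨f, hf, h0⟩ := exists_hom A A
  have : Nontrivial (hom A A) := ⟨⟨f, hf⟩, 0, by simpa using h0⟩
  exact Nat.le_mul_of_pos_right _ Module.finrank_pos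
end DAct

section SN
variable {F : Type*} [Field F] {D : Type*} [DivisionRing D] [Algebra F D] [FiniteDimensional F D] [Algebra.IsCentral F D]

theorem skolem_noether (φ : D →ₐ[F] D) : ∃ u : D, u ≠ 0 ∧ ∀ x, φ x * u = u * x := by
  let B : DBimod F D F D :=
    { l := { toFun := fun d => LinearMap.mulLeft F (φ d)
             map_one' := by ext; simp
             map_mul' := fun x y => by ext; simp [mul_assoc]
             map_zero' := by ext; simp
             map_add' := fun x y => by ext; simp [add_mul] }
      r := { toFun := fun d => LinearMap.mulRight F d.unop
             map_one' := by ext; simp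
             map_mul' := fun x y => by ext; simp [mul_assoc]
             map_zero' := by ext; simp
             map_add' := fun x y => by ext; simp [mul_add] }
      hl := fun c m => by simp [Algebra.smul_def]
      hr := fun c m => by simp [Algebra.smul_def, Algebra.commutes]
      comm := fun x y m => by simp [mul_assoc] }
  obtain ⟨u, hu, h0⟩ := Submodule.exists_mem_ne_zero_of_ne_bot B.inv_ne_bot
  exact ⟨u, h0, fun x => hu x⟩

variable {D' : Type*} [DivisionRing D'] [Algebra F D'] {V : Type*} [AddCommGroup V] [Module F V] [Nontrivial V]

theorem anti_hom (A : DAct F D F V) (A' : DAct F D' F V) (hc : ∀ x y v, A.a x (A'.a y v) = A'.a y (A.a x v))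
    (hV : Module.finrank F V = Module.finrank F D) : Nonempty (D' →ₐ[F] Dᵐᵒᵖ) := by
  obtain ⟨v, hv⟩ := exists_ne (0 : V)
  let ψ : D →ₗ[F] V :=
    { toFun := fun d => A.a d v, map_add' := by simp, map_smul' := fun c d => by simp [Algebra.smul_def, A.ha] }
  have hinj : Function.Injective ψ := by
    rw [← LinearMap.ker_eq_bot, LinearMap.ker_eq_bot']
    intro d hd
    by_contra hd0
    apply hv
    have : A.a (d⁻¹ * d) v = 0 := by rw [map_mul]; change A.a d⁻¹ (ψ d) = 0; simp [hd]
    simpa [inv_mul_cancel₀ hd0] using this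
  have : FiniteDimensional F V := Module.finite_of_finrank_pos (by rw [hV]; exact Module.finrank_pos)
  have hsurj := (LinearMap.injective_iff_surjective_of_finrank_eq_finrank hV.symm).1 hinj
  choose θ hθ using fun b : D' => hsurj (A'.a b v)
  have key : ∀ b, A.a (θ b) v = A'.a b v := hθ
  have uniq : ∀ d b, A.a d v = A'.a b v → d = θ b := fun d b h => hinj (h.trans (key b).symm)
  exact ⟨{ toFun := fun b => op (θ b)
           map_one' := by rw [← uniq 1 1 (by simp)]; rfl
           map_mul' := fun x y => by
             rw [← op_mul, ← uniq (θ y * θ x) (x * y) (by simp only [map_mul, Module.End.mul_apply, key, hc])]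
           map_zero' := by rw [← uniq 0 0 (by simp)]; rfl
           map_add' := fun x y => by
             rw [← op_add, ← uniq (θ x + θ y) (x + y) (by simp only [map_add, LinearMap.add_apply, key])]
           commutes' := fun c => by
             rw [← uniq (algebraMap F D c) (algebraMap F D' c) (by rw [A.ha, A'.ha])]; rfl }⟩
end SN

section Irr
variable {R : Type*} [Field R] {X : Type*} [AddCommGroup X] [Module R X] {I : Type*} (s : I → Module.End R X)

/-- irreducibility of a family of endomorphisms -/
def Irr : Prop := Nontrivial X ∧ ∀ p : Submodule R X, (∀ i, ∀ x ∈ p, s i x ∈ p) → p = ⊥ ∨ p = ⊤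

/-- commutant -/
abbrev Com : Subalgebra R (Module.End R X) := Subalgebra.centralizer R (Set.range s)

theorem mem_Com {f : Module.End R X} : f ∈ Com s ↔ ∀ i x, s i (f x) = f (s i x) := by
  rw [Subalgebra.mem_centralizer_iff]
  simp only [Set.forall_mem_range, LinearMap.ext_iff, Module.End.mul_apply]

theorem exists_irr [FiniteDimensional R X] [Nontrivial X] : ∃ (p : Submodule R X) (h : ∀ i, ∀ x ∈ p, s i x ∈ p),
    Irr (fun i => (s i).restrict (h i)) := by
  classical
  let P : ℕ → Prop := fun n => ∃ p : Submodule R X, p ≠ ⊥ ∧ (∀ i, ∀ x ∈ p, s i x ∈ p) ∧ Module.finrank R p = n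
  have hP : ∃ n, P n := ⟨_, ⊤, by simp, by simp, rfl⟩
  obtain ⟨p, hp0, hp, hn⟩ := Nat.find_spec hP
  refine ⟨p, hp, ⟨(Submodule.nontrivial_iff_ne_bot).2 hp0, fun q hq => ?_⟩⟩
  by_cases h0 : q = ⊥
  · exact Or.inl h0
  right
  have h1 : Nat.find hP ≤ Module.finrank R (q.map p.subtype) := Nat.find_min' hP ⟨_, by
    intro h; exact h0 (Submodule.map_injective_of_injective p.subtype_injective (h.trans (Submodule.map_bot _).symm)), by
    rintro i x ⟨y, hy, rfl⟩
    exact ⟨_, hq i y hy, rfl⟩, rfl⟩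
  rw [← hn, LinearEquiv.finrank_eq (Submodule.equivMapOfInjective _ p.subtype_injective q).symm] at h1
  exact Submodule.eq_top_of_finrank_eq (le_antisymm (Submodule.finrank_le q) h1)

variable {s}
theorem Irr.isUnit [FiniteDimensional R X] (h : Irr s) (f : Com s) : IsUnit f ∨ f = 0 := by
  obtain ⟨f, hf⟩ := f
  rw [mem_Com] at hf
  rcases h.2 (LinearMap.ker f) (fun i x hx => by
    rw [LinearMap.mem_ker] at hx ⊢; rw [← hf, hx, map_zero]) with h1 | h1
  · left
    let e := LinearEquiv.ofInjectiveEndo f (LinearMap.ker_eq_bot.1 h1)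
    have he : ∀ x, f (e.symm x) = x := fun x => e.apply_symm_apply x
    have he' : ∀ x, e.symm (f x) = x := fun x => e.symm_apply_apply x
    refine ⟨⟨⟨f, (mem_Com s).2 hf⟩, ⟨e.symm.toLinearMap, (mem_Com s).2 fun i x => ?_⟩, ?_, ?_⟩, rfl⟩
    · change s i (e.symm x) = e.symm (s i x)
      apply LinearMap.ker_eq_bot.1 h1
      rw [← hf, he, he]
    · ext x; exact he x
    · ext x; exact he' x
  · right
    ext x
    have : x ∈ LinearMap.ker f := by rw [h1]; trivial
    simpa using this

/-- commutant as division ring -/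
noncomputable abbrev Irr.div [FiniteDimensional R X] (h : Irr s) : DivisionRing (Com s) :=
  letI := h.1
  DivisionRing.ofIsUnitOrEqZero h.isUnit

theorem Irr.finrank_bicom [FiniteDimensional R X] (h : Irr s) :
    Module.finrank R (Com (fun f : Com s => f.1)) * Module.finrank R (Com s) = Module.finrank R X ^ 2 := by
  letI := h.div
  let b := Module.Free.chooseBasis (Com s) X
  have hfin : Module.Finite (Com s) X := Module.Finite.of_restrictScalars_finite R _ _
  let e : Com (fun f : Com s => f.1) ≃ₗ[R] (X →ₗ[Com s] X) :=
    { toFun := fun g => { toFun := g.1, map_add' := by simp, map_smul' := fun c x => ((mem_Com _).1 g.2 c x).symm }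
      map_add' := fun x y => rfl
      map_smul' := fun x y => rfl
      invFun := fun g => ⟨g.restrictScalars R, (mem_Com _).2 fun f x => (g.map_smul f x).symm⟩
      left_inv := fun x => rfl
      right_inv := fun x => rfl }
  rw [e.finrank_eq, ← (b.constr R (M' := X)).finrank_eq, Module.finrank_pi_fintype, Finset.sum_const, Finset.card_univ,
    ← Module.finrank_eq_card_basis b, pow_two, ← Module.finrank_mul_finrank R (Com s) X]
  simp only [smul_eq_mul]; ring
end Irr

section MS
variable {F : Type*} [Field F] {D : Type*} [DivisionRing D] [Algebra F D]

theorem adjoin_comm_insert (M : Subalgebra F D) (hM : ∀ x ∈ M, ∀ y ∈ M, x * y = y * x) (x : D)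
    (hx : ∀ y ∈ M, x * y = y * x) : ∃ N : Subalgebra F D, M ≤ N ∧ x ∈ N ∧ ∀ x ∈ N, ∀ y ∈ N, x * y = y * x := by
  refine ⟨Algebra.adjoin F (insert x (M : Set D)), fun y hy => Algebra.subset_adjoin (Or.inr hy),
    Algebra.subset_adjoin (Or.inl rfl), ?_⟩
  letI := Algebra.adjoinCommRingOfComm F (s := insert x (M : Set D)) (by
    rintro a (rfl | ha) b (rfl | hb)
    · rfl
    · exact hx _ hb
    · exact (hx _ ha).symm
    · exact hM _ ha _ hb)
  intro a ha b hb
  have := mul_comm (⟨a, ha⟩ : Algebra.adjoin F (insert x (M : Set D))) ⟨b, hb⟩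
  exact congrArg Subtype.val this

theorem IsMaximalSubfield.mem {M : Subalgebra F D} (h : IsMaximalSubfield F D M) (x : D)
    (hx : ∀ y ∈ M, x * y = y * x) : x ∈ M := by
  obtain ⟨N, h1, h2, h3⟩ := adjoin_comm_insert M h.1 x hx
  rw [← h.2.2 N h3 h1]; exact h2

theorem exists_maximalSubfield [FiniteDimensional F D] (N : Subalgebra F D) (hN : ∀ x ∈ N, ∀ y ∈ N, x * y = y * x) :
    ∃ M, N ≤ M ∧ IsMaximalSubfield F D M := by
  classical
  let S : Set (Submodule F D) := {p | ∃ M : Subalgebra F D, Subalgebra.toSubmodule M = p ∧ N ≤ M ∧ ∀ x ∈ M, ∀ y ∈ M, x * y = y * x}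
  obtain ⟨p, ⟨M, rfl, h1, h2⟩, hmax⟩ := (wellFounded_gt (α := Submodule F D)).has_min S ⟨_, N, rfl, le_rfl, hN⟩
  have hmax' : ∀ N' : Subalgebra F D, (∀ x ∈ N', ∀ y ∈ N', x * y = y * x) → M ≤ N' → N' = M := by
    intro N' hN' hle
    by_contra hne
    exact hmax _ ⟨N', rfl, h1.trans hle, hN'⟩ (lt_of_le_of_ne hle (fun h => hne (Subalgebra.toSubmodule_injective h.symm)))
  refine ⟨M, h1, h2, fun x hx => ?_, hmax'⟩
  obtain ⟨N', h3, h4, h5⟩ := adjoin_comm_insert M h2 x⁻¹ (fun y hy => by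
    have : Commute x y := h2 x hx y hy
    exact this.inv_left₀)
  rw [← hmax' N' h5 h3]; exact h4

instance isCentral_mop [Algebra.IsCentral F D] : Algebra.IsCentral F Dᵐᵒᵖ := ⟨fun x hx => by
  rw [Subalgebra.mem_center_iff] at hx
  have : x.unop ∈ Subalgebra.center F D := by
    rw [Subalgebra.mem_center_iff]
    intro b
    exact (congrArg unop (hx (op b))).symm
  rw [Algebra.IsCentral.center_eq_bot, Algebra.mem_bot] at this
  obtain ⟨c, hc⟩ := this
  exact Algebra.mem_bot.2 ⟨c, by rw [MulOpposite.algebraMap_apply, hc]; rfl⟩⟩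

/-- field structure on an inverse closed commutative subalgebra -/
noncomputable abbrev subField (M : Subalgebra F D) (h1 : ∀ x ∈ M, ∀ y ∈ M, x * y = y * x)
    (h2 : ∀ x ∈ M, x⁻¹ ∈ M) : Field M :=
  letI : CommRing M := { (inferInstance : Ring M) with mul_comm := fun a b => Subtype.ext (h1 _ a.2 _ b.2) }
  Field.ofIsUnitOrEqZero (R := M) fun a => by
    by_cases h : a = 0
    · exact Or.inr h
    · have h' : (a : D) ≠ 0 := fun h' => h (Subtype.ext h')
      exact Or.inl ⟨⟨a, ⟨_, h2 _ a.2⟩, Subtype.ext (mul_inv_cancel₀ h'), Subtype.ext (inv_mul_cancel₀ h')⟩, rfl⟩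

section
variable (M : Subalgebra F D)

/-- right multiplication on `D` as an `M`-space -/
noncomputable def mopAct (h1 : ∀ x ∈ M, ∀ y ∈ M, x * y = y * x) (h2 : ∀ x ∈ M, x⁻¹ ∈ M) : letI := subField M h1 h2; DAct F Dᵐᵒᵖ M D :=
  letI := subField M h1 h2
  { a := { toFun := fun d => { toFun := fun x => x * d.unop, map_add' := fun x y => add_mul _ _ _,
                               map_smul' := fun c x => mul_assoc (c : D) _ _ }
           map_one' := by ext; simp
           map_mul' := fun x y => by ext z; exact (mul_assoc _ _ _).symm
           map_zero' := by ext; simp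
           map_add' := fun x y => by ext z; exact mul_add _ _ _ }
    ha := fun c m => (Algebra.commutes c m).symm }

variable [FiniteDimensional F D] [Algebra.IsCentral F D]

theorem finrank_eq_sq (h1 : ∀ x ∈ M, ∀ y ∈ M, x * y = y * x) (h2 : ∀ x ∈ M, x⁻¹ ∈ M)
    (h3 : ∀ x, (∀ y ∈ M, x * y = y * x) → x ∈ M) :
    Module.finrank F D = Module.finrank F M ^ 2 ∧
    (letI := subField M h1 h2; Module.finrank M D = Module.finrank F M) := by
  letI := subField M h1 h2
  have : FiniteDimensional M D := Module.Finite.of_restrictScalars_finite F M D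
  have hA := DAct.finrank_hom (mopAct M h1 h2) (mopAct M h1 h2)
  have h1' : Module.finrank M (DAct.hom (mopAct M h1 h2) (mopAct M h1 h2)) = 1 := by
    refine finrank_eq_one (⟨LinearMap.id, ?_⟩) ?_ ?_
    · rw [DAct.mem_hom]; intro d x; rfl
    · intro h
      have := LinearMap.congr_fun (congrArg Subtype.val h) (1 : D)
      exact one_ne_zero this
    · rintro ⟨f, hf⟩
      rw [DAct.mem_hom] at hf
      have hf1 : ∀ x, f x = f 1 * x := fun x => by
        have := hf (op x) 1
        change f (1 * x) = f 1 * x at this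
        rwa [one_mul] at this
      have hm : f 1 ∈ M := h3 _ fun y hy => by
        rw [← hf1 y]
        have := f.map_smul ⟨y, hy⟩ 1
        rw [show ((⟨y, hy⟩ : M) • (1 : D)) = y from mul_one y] at this
        exact this
      refine ⟨⟨f 1, hm⟩, Subtype.ext (LinearMap.ext fun x => (hf1 x).symm)⟩
  rw [h1', mul_one, LinearEquiv.finrank_eq (MulOpposite.opLinearEquiv F (M := D)).symm] at hA
  have ht := Module.finrank_mul_finrank F M D
  have hpos : 0 < Module.finrank M D := Module.finrank_pos
  have e : Module.finrank M D = Module.finrank F M := by nlinarith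
  exact ⟨by rw [← ht, e, pow_two], e⟩

theorem double_centralizer (h1 : ∀ x ∈ M, ∀ y ∈ M, x * y = y * x) (h2 : ∀ x ∈ M, x⁻¹ ∈ M)
    (z : D) (hz : ∀ x, (∀ y ∈ M, x * y = y * x) → z * x = x * z)
    (hz' : ∀ y ∈ M, z * y = y * z) : z ∈ M := by
  letI := subField M h1 h2
  have : FiniteDimensional M D := Module.Finite.of_restrictScalars_finite F M D
  let g : Module.End M D := { toFun := fun x => z * x, map_add' := mul_add _, map_smul' := fun c x => by {
    change z * (c * x) = c * (z * x); rw [← mul_assoc, hz' _ c.2, mul_assoc] } }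
  have hg : g ∈ Subalgebra.center M (Module.End M D) := by
    rw [Subalgebra.mem_center_iff]
    intro f
    obtain ⟨n, x, τ, t1, t2, t3⟩ := (DAct.hb (mopAct M h1 h2) (mopAct M h1 h2)).decomp
    rw [t2 f]
    simp only [Finset.sum_mul, Finset.mul_sum]
    refine Finset.sum_congr rfl fun j _ => ?_
    have hf := (DAct.mem_hom _ _).1 (t1 j f)
    set f' := τ j f
    have hf1 : ∀ x, f' x = f' 1 * x := fun x => by
      have := hf (op x) 1
      change f' (1 * x) = f' 1 * x at this
      rwa [one_mul] at this
    have hm : z * f' 1 = f' 1 * z := hz _ fun y hy => by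
        rw [← hf1 y]
        have := f'.map_smul ⟨y, hy⟩ 1
        rw [show ((⟨y, hy⟩ : M) • (1 : D)) = y from mul_one y] at this
        exact this
    ext y
    change f' (z * y) * (x j).unop = z * (f' y * (x j).unop)
    rw [hf1, hf1 y, ← mul_assoc, ← mul_assoc, ← mul_assoc z, hm]
  rw [Algebra.IsCentral.center_eq_bot, Algebra.mem_bot] at hg
  obtain ⟨c, hc⟩ := hg
  have := LinearMap.congr_fun hc 1
  have h3 : (c : D) * 1 = z * 1 := this
  rw [mul_one, mul_one] at h3
  rw [← h3]; exact c.2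
end

theorem subalg_inv [FiniteDimensional F D] (M : Subalgebra F D) (x : D) (hx : x ∈ M) : x⁻¹ ∈ M := by
  by_cases h0 : x = 0
  · subst h0; simp
  let f : M →ₗ[F] M := LinearMap.mulLeft F ⟨x, hx⟩
  have hf : Function.Injective f := fun a b h => Subtype.ext (mul_left_cancel₀ h0 (congrArg Subtype.val h))
  obtain ⟨y, hy⟩ := (LinearMap.injective_iff_surjective.1 hf) 1
  have : x * y = 1 := congrArg Subtype.val hy
  rw [inv_eq_of_mul_eq_one_right this]; exact y.2

theorem exists_sep_maximalSubfield [FiniteDimensional F D] [Algebra.IsCentral F D] :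
    ∃ M : Subalgebra F D, IsMaximalSubfield F D M ∧ ∀ x ∈ M, IsSeparable F x := by
  classical
  let S : Set (Submodule F D) := {p | ∃ M : Subalgebra F D, Subalgebra.toSubmodule M = p ∧
    (∀ x ∈ M, ∀ y ∈ M, x * y = y * x) ∧ ∀ x ∈ M, IsSeparable F x}
  obtain ⟨p, ⟨M, rfl, h1, h2⟩, hmax⟩ := (wellFounded_gt (α := Submodule F D)).has_min S ⟨_, ⊥, rfl, by
    intro x hx y hy
    obtain ⟨c, rfl⟩ := Algebra.mem_bot.1 hx
    exact Algebra.commutes _ _, by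
    intro x hx
    obtain ⟨c, rfl⟩ := Algebra.mem_bot.1 hx
    exact isSeparable_algebraMap _⟩
  have hmax' : ∀ N' : Subalgebra F D, (∀ x ∈ N', ∀ y ∈ N', x * y = y * x) → (∀ x ∈ N', IsSeparable F x) →
      M ≤ N' → N' = M := by
    intro N' hN' hs hle
    by_contra hne
    exact hmax _ ⟨N', rfl, hN', hs⟩ (lt_of_le_of_ne hle (fun h => hne (Subalgebra.toSubmodule_injective h.symm)))
  refine ⟨M, ⟨h1, subalg_inv M, ?_⟩, h2⟩
  let C := Subalgebra.centralizer F (M : Set D)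
  have hMC : M ≤ C := fun x hx => (Subalgebra.mem_centralizer_iff F).2 fun y hy => h1 y hy x hx
  letI : Field M := subField M h1 (subalg_inv M)
  letI : DivisionRing C := DivisionRing.ofIsUnitOrEqZero fun a => by
    by_cases h : a = 0
    · exact Or.inr h
    · have h' : (a : D) ≠ 0 := fun h' => h (Subtype.ext h')
      exact Or.inl ⟨⟨a, ⟨_, subalg_inv C _ a.2⟩, Subtype.ext (mul_inv_cancel₀ h'), Subtype.ext (inv_mul_cancel₀ h')⟩, rfl⟩
  letI : Algebra M C := RingHom.toAlgebra' (Subalgebra.inclusion hMC).toRingHom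
    (fun c x => Subtype.ext ((Subalgebra.mem_centralizer_iff F).1 x.2 c c.2))
  have : IsScalarTower F M C := IsScalarTower.of_algebraMap_eq fun x => rfl
  have : FiniteDimensional M C := Module.Finite.of_restrictScalars_finite F M C
  have hcen : Algebra.IsCentral M C := ⟨fun z hz => by
    rw [Subalgebra.mem_center_iff] at hz
    have := double_centralizer M h1 (subalg_inv M) z.1 (fun x hx => by
      have := hz ⟨x, (Subalgebra.mem_centralizer_iff F).2 fun y hy => (hx y hy).symm⟩
      exact (congrArg Subtype.val this).symm) (fun y hy => ((Subalgebra.mem_centralizer_iff F).1 z.2 y hy).symm)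
    exact Algebra.mem_bot.2 ⟨⟨z, this⟩, rfl⟩⟩
  by_cases hb : (⊥ : Subalgebra M C) = ⊤
  · intro N hN hMN
    refine le_antisymm (fun x hx => ?_) hMN
    have : (⟨x, (Subalgebra.mem_centralizer_iff F).2 fun y hy => hN y (hMN hy) x hx⟩ : C) ∈ (⊥ : Subalgebra M C) := by
      rw [hb]; trivial
    obtain ⟨c, hc⟩ := Algebra.mem_bot.1 this
    have : (c : D) = x := congrArg Subtype.val hc
    rw [← this]; exact c.2
  exfalso
  obtain ⟨x, hx1, hx2⟩ := JacobsonNoether.exists_separable_and_not_isCentral' hb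
  let N := Algebra.adjoin F (insert x.1 (M : Set D))
  have hN : ∀ x ∈ N, ∀ y ∈ N, x * y = y * x := by
    letI := Algebra.adjoinCommRingOfComm F (s := insert x.1 (M : Set D)) (by
      have := (Subalgebra.mem_centralizer_iff F).1 x.2
      rintro a (rfl | ha) b (rfl | hb)
      · rfl
      · exact (this _ hb).symm
      · exact (this _ ha)
      · exact h1 _ ha _ hb)
    intro a ha b hb
    exact congrArg Subtype.val (mul_comm (⟨a, ha⟩ : Algebra.adjoin F (insert x.1 (M : Set D))) ⟨b, hb⟩)
  have hMN : M ≤ N := fun y hy => Algebra.subset_adjoin (Or.inr hy)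
  have hxN : x.1 ∈ N := Algebra.subset_adjoin (Or.inl rfl)
  letI : Field N := subField N hN (subalg_inv N)
  letI : Algebra M N := RingHom.toAlgebra (Subalgebra.inclusion hMN).toRingHom
  have : IsScalarTower F M N := IsScalarTower.of_algebraMap_eq fun x => rfl
  have : FiniteDimensional M N := Module.Finite.of_restrictScalars_finite F M N
  have hNC : N ≤ C := fun y hy => (Subalgebra.mem_centralizer_iff F).2 fun z hz => hN z (hMN hz) y hy
  let ι : N →ₐ[M] C := { Subalgebra.inclusion hNC with commutes' := fun c => rfl }
  have hι : Function.Injective ι := Subalgebra.inclusion_injective hNC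
  have hxs : IsSeparable M (⟨x.1, hxN⟩ : N) := by
    unfold IsSeparable at hx2 ⊢
    rwa [← minpoly.algHom_eq ι hι]
  have hsep : Algebra.IsSeparable M N := by
    have htop : IntermediateField.adjoin M {(⟨x.1, hxN⟩ : N)} = ⊤ := by
      rw [eq_top_iff]
      rintro ⟨y, hy⟩ -
      refine Algebra.adjoin_induction (p := fun y hy => (⟨y, hy⟩ : N) ∈ IntermediateField.adjoin M {(⟨x.1, hxN⟩ : N)})
        ?_ ?_ ?_ ?_ hy
      · rintro z (rfl | hz)
        · exact IntermediateField.mem_adjoin_simple_self M _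
        · exact (IntermediateField.adjoin M {(⟨x.1, hxN⟩ : N)}).algebraMap_mem ⟨z, hz⟩
      · intro c
        exact (IntermediateField.adjoin M {(⟨x.1, hxN⟩ : N)}).algebraMap_mem (algebraMap F M c)
      · intro a b ha hb h h'; exact add_mem h h'
      · intro a b ha hb h h'; exact mul_mem h h'
    have := (IntermediateField.isSeparable_adjoin_simple_iff_isSeparable (F := M) (E := N)).2 hxs
    rw [htop] at this
    exact (AlgEquiv.Algebra.isSeparable (IntermediateField.topEquiv : (⊤ : IntermediateField M N) ≃ₐ[M] N))
  have hsepM : Algebra.IsSeparable F M := ⟨fun y => by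
    have := h2 y.1 y.2
    unfold IsSeparable at this ⊢
    rwa [← minpoly.algHom_eq M.val Subtype.val_injective]⟩
  have hsepN : Algebra.IsSeparable F N := Algebra.IsSeparable.trans F M N
  have := hmax' N hN (fun y hy => by
    have := hsepN.isSeparable' ⟨y, hy⟩
    unfold IsSeparable at this ⊢
    rwa [← minpoly.algHom_eq N.val Subtype.val_injective] at this) hMN
  rw [this] at hxN
  exact hx1 (Algebra.mem_bot.2 ⟨⟨x.1, hxN⟩, rfl⟩)

end MS

section Split
variable {F : Type*} [Field F] {D : Type*} [DivisionRing D] [Algebra F D] [FiniteDimensional F D]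

theorem dvd_of_split {Q : Type*} [Field Q] [Algebra F Q] [FiniteDimensional F Q] {X : Type*} [AddCommGroup X] [Module Q X]
    [FiniteDimensional Q X]
    (A : DAct F D Q X) (n : ℕ) (hn0 : 0 < n) (hD : Module.finrank F D = n ^ 2) (hX : Module.finrank Q X = n) :
    n ∣ Module.finrank F Q := by
  letI : Module F X := Module.compHom X (algebraMap F Q)
  have : IsScalarTower F Q X := ⟨fun a b x => by
    change (a • b) • x = algebraMap F Q a • b • x
    rw [smul_smul, Algebra.smul_def]⟩
  letI : Module D X := Module.compHom X A.a
  have : IsScalarTower F D X := ⟨fun a b x => by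
    change A.a (a • b) x = algebraMap F Q a • A.a b x
    rw [Algebra.smul_def, map_mul, Module.End.mul_apply, A.ha]⟩
  have h1 := Module.finrank_mul_finrank F Q X
  have h2 := Module.finrank_mul_finrank F D X
  rw [hX] at h1
  rw [hD, ← h1] at h2
  refine ⟨Module.finrank D X, Nat.eq_of_mul_eq_mul_right hn0 ?_⟩
  rw [← h2]; ring

/-- base change of actions -/
noncomputable def DAct.baseChange {M : Type*} [Field M] [Algebra F M] {X : Type*} [AddCommGroup X] [Module M X]
    (A : DAct F D M X) (N : Type*) [Field N] [Algebra F N] [Algebra M N] [IsScalarTower F M N] :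
    DAct F D N (TensorProduct M N X) where
  a := (Module.End.baseChangeHom M N X).toRingHom.comp A.a
  ha c m := by
    have : A.a (algebraMap F D c) = algebraMap F M c • LinearMap.id := by ext x; simp [A.ha]
    change (LinearMap.baseChange N (A.a (algebraMap F D c))) m = _
    rw [this, LinearMap.baseChange_smul]
    simp [IsScalarTower.algebraMap_apply F M N]

variable [Algebra.IsCentral F D] {N : Type*} [Field N] [Algebra F N] [FiniteDimensional F N] {X : Type*} [AddCommGroup X]
  [Module N X] [Module F X] [IsScalarTower F N X] [FiniteDimensional N X] (A : DAct F D N X)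
  {n : ℕ}

theorem split_ker (A : DAct F D N X) (hD : Module.finrank F D = n ^ 2) (hX : Module.finrank N X = n) (p : Submodule N X)
    (hp : ∀ d, ∀ x ∈ p, A.a d x ∈ p) : p = ⊥ ∨ p = ⊤ := by
  by_cases h : p = ⊥
  · exact Or.inl h
  right
  have : Nontrivial p := (Submodule.nontrivial_iff_ne_bot).2 h
  let A' : DAct F D N p :=
    { a := { toFun := fun d => (A.a d).restrict (hp d)
             map_one' := by ext; simp
             map_mul' := fun x y => by ext; simp
             map_zero' := by ext; simp
             map_add' := fun x y => by ext; simp }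
      ha := fun c m => by ext; simp [A.ha] }
  have := A'.le_sq
  rw [hD] at this
  have h2 := Submodule.finrank_le p
  refine Submodule.eq_top_of_finrank_eq (le_antisymm h2 ?_)
  rw [hX]; exact (Nat.pow_le_pow_iff_left two_ne_zero).1 this

theorem split_scalar (A : DAct F D N X) {Y : Type*} [AddCommGroup Y] [Module N Y] [FiniteDimensional N Y] (B : DAct F D N Y)
    (hD : Module.finrank F D = n ^ 2) (hn0 : 0 < n) (hX : Module.finrank N X = n)
    (hY : Module.finrank N Y = n) (f g : X →ₗ[N] Y) (hf : f ∈ DAct.hom A B) (hf0 : f ≠ 0) (hg : g ∈ DAct.hom A B) :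
    ∃ c : N, g = c • f := by
  have h := DAct.finrank_hom A B
  rw [hX, hY, hD, ← pow_two] at h
  have h1 : Module.finrank N (DAct.hom A B) = 1 := by
    have : 0 < n ^ 2 := by positivity
    nlinarith
  obtain ⟨c, hc⟩ := (finrank_eq_one_iff_of_nonzero' (⟨f, hf⟩ : DAct.hom A B) (by simpa using hf0)).1 h1 ⟨g, hg⟩
  exact ⟨c, (congrArg Subtype.val hc).symm⟩

theorem split_semilin (A : DAct F D N X) (hD : Module.finrank F D = n ^ 2) (hn0 : 0 < n) (hX : Module.finrank N X = n)
    (σ : N ≃ₐ[F] N) :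
    ∃ y : X ≃ₗ[F] X, (∀ c x, y (c • x) = σ c • y x) ∧ ∀ d x, y (A.a d x) = A.a d (y x) := by
  have : Nontrivial X := Module.nontrivial_of_finrank_pos (R := N) (by omega)
  let s : N →+* N := (σ : N →+* N)
  let B : DBimod F D N (X →ₛₗ[s] X) :=
    { l := { toFun := fun d => { toFun := fun f => (A.a d).comp f, map_add' := fun f g => by ext; simp,
                                 map_smul' := fun c f => by ext; simp }
             map_one' := by ext; simp
             map_mul' := fun x y => by ext; simp
             map_zero' := by ext; simp
             map_add' := fun x y => by ext; simp }
      r := { toFun := fun d => { toFun := fun f => f.comp (A.a d.unop), map_add' := fun f g => by ext; simp,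
                                 map_smul' := fun c f => by ext; simp }
             map_one' := by ext; simp
             map_mul' := fun x y => by ext; simp
             map_zero' := by ext; simp
             map_add' := fun x y => by ext; simp }
      hl := fun c m => by ext; simp [A.ha]
      hr := fun c m => by ext x; change m (A.a (algebraMap F D c) x) = _; rw [A.ha, LinearMap.map_smulₛₗ]; simp [s]
      comm := fun x y m => by ext; simp }
  have : Nontrivial (X →ₛₗ[s] X) := by
    obtain ⟨x, hx⟩ := exists_ne (0 : X)
    have : ∃ f : Module.Dual N X, f x ≠ 0 := by
      by_contra! h
      exact hx ((Module.forall_dual_apply_eq_zero_iff N x).1 h)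
    obtain ⟨f, hf⟩ := this
    refine ⟨{ toFun := fun z => s (f z) • x, map_add' := fun a b => by simp [add_smul],
              map_smul' := fun a b => by simp [mul_smul] }, 0, fun h => ?_⟩
    have := LinearMap.congr_fun h x
    simp [hf, hx] at this
  obtain ⟨f, hf, hf0⟩ := Submodule.exists_mem_ne_zero_of_ne_bot B.inv_ne_bot
  have hfd : ∀ d x, f (A.a d x) = A.a d (f x) := fun d x => (LinearMap.congr_fun (hf d) x).symm
  let p : Submodule N X :=
    { carrier := {x | f x = 0}, add_mem' := fun {a b} ha hb => by simp_all, zero_mem' := by simp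
      smul_mem' := fun c x hx => by
        change f (c • x) = 0
        rw [LinearMap.map_smulₛₗ, show f x = 0 from hx, smul_zero] }
  have hp : p = ⊥ := by
    rcases split_ker A hD hX p (fun d x hx => by change f _ = 0; rw [hfd, show f x = 0 from hx, map_zero]) with h | h
    · exact h
    · exfalso; apply hf0; ext x
      have : x ∈ p := by rw [h]; trivial
      exact this
  have : FiniteDimensional F X := FiniteDimensional.trans F N X
  let f' : X →ₗ[F] X := { toFun := f, map_add' := map_add f, map_smul' := fun c x => by
                            rw [← algebraMap_smul N c x, LinearMap.map_smulₛₗ]; simp [s] }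
  have hinj : Function.Injective f' := by
    rw [← LinearMap.ker_eq_bot, LinearMap.ker_eq_bot']
    intro x hx
    have : x ∈ p := hx
    rw [hp] at this; exact this
  exact ⟨LinearEquiv.ofInjectiveEndo f' hinj, fun c x => LinearMap.map_smulₛₗ f c x, fun d x => hfd d x⟩

theorem split_trivialize (A : DAct F D N X) (θ : D →ₐ[F] Dᵐᵒᵖ) (hD : Module.finrank F D = n ^ 2) (hn0 : 0 < n)
    (hX : Module.finrank N X = n) (P : Subgroup (N ≃ₐ[F] N)) (hodd : Odd (Nat.card P)) :
    ∃ Y : P → (X →+ X), (∀ g c x, Y g (c • x) = g.1 c • Y g x) ∧ (∀ g d x, Y g (A.a d x) = A.a d (Y g x)) ∧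
      (∀ g h x, Y g (Y h x) = Y (g * h) x) ∧ ∀ x, Y 1 x = x := by
  classical
  have : Finite (N ≃ₐ[F] N) := inferInstance
  letI : Fintype P := Fintype.ofFinite P
  have hXn : Nontrivial X := Module.nontrivial_of_finrank_pos (R := N) (by omega)
  choose y hy1 hy2 using fun g : P => split_semilin A hD hn0 hX g.1
  have hid : LinearMap.id ∈ DAct.hom A A := (DAct.mem_hom A A).2 fun d x => rfl
  have hid0 : (LinearMap.id : X →ₗ[N] X) ≠ 0 := by
    intro h
    obtain ⟨x, hx⟩ := exists_ne (0 : X)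
    exact hx (LinearMap.congr_fun h x)
  have ha : ∀ g h : P, ∃ a : N, ∀ x, y g (y h x) = a • y (g * h) x := by
    intro g h
    let f : X →ₗ[N] X := { toFun := fun x => y g (y h ((y (g * h)).symm x)), map_add' := by simp
                           map_smul' := fun c x => by
                            have : (y (g * h)).symm (c • x) = (g * h).1.symm c • (y (g * h)).symm x := by
                              rw [LinearEquiv.symm_apply_eq, hy1]; simp
                            rw [this, hy1, hy1]
                            congr 1
                            exact AlgEquiv.apply_symm_apply (g * h).1 c }
    obtain ⟨c, hc⟩ := split_scalar A A hD hn0 hX hX _ f hid hid0 ((DAct.mem_hom A A).2 fun d x => by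
      have : (y (g * h)).symm (A.a d x) = A.a d ((y (g * h)).symm x) := by
        rw [LinearEquiv.symm_apply_eq, hy2]; simp
      change y g (y h ((y (g * h)).symm (A.a d x))) = A.a d (y g (y h ((y (g * h)).symm x)))
      rw [this, hy2, hy2])
    refine ⟨c, fun x => ?_⟩
    have := LinearMap.congr_fun hc (y (g * h) x)
    simpa [f] using this
  choose a ha using ha
  obtain ⟨x₀, hx₀⟩ := exists_ne (0 : X)
  have ha0 : ∀ g h, a g h ≠ 0 := by
    intro g h h0
    have := ha g h x₀
    rw [h0, zero_smul] at this
    simp [hx₀] at this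
  have hcoc : ∀ g h k, a g h * a (g * h) k = g.1 (a h k) * a g (h * k) := by
    intro g h k
    have e1 : y g (y h (y k x₀)) = (a g h * a (g * h) k) • y (g * h * k) x₀ := by rw [ha, ha, smul_smul]
    have e2 : y g (y h (y k x₀)) = (g.1 (a h k) * a g (h * k)) • y (g * h * k) x₀ := by
      rw [ha h k, hy1, ha, smul_smul, mul_assoc]
    have h0 : y (g * h * k) x₀ ≠ 0 := by simpa using hx₀
    exact smul_left_injective N h0 (e1.symm.trans e2)
  -- the form
  let Bd : DAct F D N (Module.Dual N X) :=
    { a := { toFun := fun d => (A.a (θ d).unop).dualMap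
             map_one' := by ext; simp
             map_mul' := fun x y => by ext; simp
             map_zero' := by ext; simp
             map_add' := fun x y => by ext; simp }
      ha := fun c m => by ext x; simp [A.ha] }
  have hDual : Module.finrank N (Module.Dual N X) = n := by rw [Subspace.dual_finrank_eq, hX]
  have : Nontrivial (Module.Dual N X) := Module.nontrivial_of_finrank_pos (R := N) (by omega)
  obtain ⟨ψ, hψ, hψ0⟩ := DAct.exists_hom A Bd
  have hψd : ∀ d x z, ψ (A.a d x) z = ψ x (A.a (θ d).unop z) := fun d x z =>
    LinearMap.congr_fun ((DAct.mem_hom A Bd).1 hψ d x) z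
  have hb : ∀ g : P, ∃ b : N, ∀ x z, ψ (y g x) (y g z) = b * g.1 (ψ x z) := by
    intro g
    let f : X →ₗ[N] Module.Dual N X := LinearMap.mk₂ N (fun x z => g.1.symm (ψ (y g x) (y g z)))
      (by simp) (by intros; simp [hy1]) (by simp) (by intros; simp [hy1])
    obtain ⟨c, hc⟩ := split_scalar A Bd hD hn0 hX hDual ψ f hψ hψ0 ((DAct.mem_hom A Bd).2 fun d x => by
      ext z
      change g.1.symm (ψ (y g (A.a d x)) (y g z)) = g.1.symm (ψ (y g x) (y g (A.a (θ d).unop z)))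
      rw [hy2, hy2, hψd])
    refine ⟨g.1 c, fun x z => ?_⟩
    have := LinearMap.congr_fun (LinearMap.congr_fun hc x) z
    have h2 := congrArg g.1 this
    simpa [f] using h2
  choose b hb using hb
  obtain ⟨x₁, z₁, h11⟩ : ∃ x z, ψ x z ≠ 0 := by
    by_contra! h
    exact hψ0 (by ext x z; exact h x z)
  have hb0 : ∀ g, b g ≠ 0 := by
    intro g h0
    have := hb g ((y g).symm x₁) ((y g).symm z₁)
    simp [h0, h11] at this
  have hab : ∀ g h, a g h ^ 2 * b (g * h) = b g * g.1 (b h) := by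
    intro g h
    have e1 : ψ (y g (y h x₁)) (y g (y h z₁)) = b g * g.1 (b h) * g.1 (h.1 (ψ x₁ z₁)) := by
      rw [hb, hb, map_mul, mul_assoc]
    rw [ha, ha] at e1
    simp only [map_smul, LinearMap.smul_apply, smul_eq_mul, hb] at e1
    have h0 : g.1 (h.1 (ψ x₁ z₁)) ≠ 0 := by simpa using h11
    refine mul_right_cancel₀ h0 ?_
    rw [← e1]
    change _ = a g h * (a g h * (b (g * h) * g.1 (h.1 (ψ x₁ z₁))))
    ring
  let c : P → N := fun g => ∏ k, a g k
  have hc0 : ∀ g, c g ≠ 0 := fun g => Finset.prod_ne_zero_iff.2 fun k _ => ha0 g k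
  have hac : ∀ g h, a g h ^ (Nat.card P) * c (g * h) = g.1 (c h) * c g := by
    intro g h
    have := Finset.prod_congr (rfl : (Finset.univ : Finset P) = Finset.univ) (fun k _ => hcoc g h k)
    rw [Finset.prod_mul_distrib, Finset.prod_mul_distrib, Finset.prod_const, Finset.card_univ, ← map_prod,
      Fintype.card_eq_nat_card] at this
    rw [this]
    congr 1
    exact Fintype.prod_equiv (Equiv.mulLeft h) _ _ (fun k => rfl)
  obtain ⟨j, hj⟩ := hodd
  let e : P → N := fun g => c g * (b g ^ j)⁻¹
  have he0 : ∀ g, e g ≠ 0 := fun g => mul_ne_zero (hc0 g) (inv_ne_zero (pow_ne_zero _ (hb0 g)))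
  have hae : ∀ g h, a g h * e (g * h) = e g * g.1 (e h) := by
    intro g h
    have h1 := hac g h
    have h2 := congrArg (· ^ j) (hab g h)
    simp only [mul_pow, ← pow_mul] at h2
    rw [hj, pow_succ] at h1
    have p1 := pow_ne_zero j (hb0 (g * h))
    have p2 := pow_ne_zero j (hb0 g)
    have p3 : g.1 (b h) ^ j ≠ 0 := pow_ne_zero j (by simpa using hb0 h)
    simp only [e, map_mul, map_inv₀, map_pow]
    have p4 := pow_ne_zero (2 * j) (ha0 g h)
    field_simp
    refine mul_left_cancel₀ p4 ?_
    linear_combination (b g ^ j * g.1 (b h) ^ j) * h1 - (g.1 (c h) * c g) * h2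
  let Y : P → (X →+ X) := fun g =>
    { toFun := fun x => (e g)⁻¹ • y g x, map_zero' := by simp, map_add' := by simp }
  have hY : ∀ g x, Y g x = (e g)⁻¹ • y g x := fun g x => rfl
  have hYY : ∀ g h x, Y g (Y h x) = Y (g * h) x := fun g h x => by
      rw [hY, hY, hY, hy1, ha, smul_smul, smul_smul]
      congr 1
      have h1 := hae g h
      have h2 := he0 g
      have h3 := he0 (g * h)
      have h4 : g.1 (e h) ≠ 0 := by simpa using he0 h
      rw [map_inv₀]
      field_simp
      linear_combination h1
  refine ⟨Y, fun g c x => ?_, fun g d x => ?_, hYY, fun x => ?_⟩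
  · rw [hY, hY, hy1, smul_comm]
  · rw [hY, hY, hy2, map_smul]
  · have := hYY 1 1 x
    rw [mul_one, hY 1 (Y 1 x), hY 1 x] at this
    exact (y 1).injective (smul_right_injective X (inv_ne_zero (he0 1)) this)

theorem split_descent (A : DAct F D N X) (θ : D →ₐ[F] Dᵐᵒᵖ) (hD : Module.finrank F D = n ^ 2) (hn0 : 0 < n)
    (hX : Module.finrank N X = n) (P : Subgroup (N ≃ₐ[F] N)) (hodd : Odd (Nat.card P)) :
    n ∣ Module.finrank F (IntermediateField.fixedField P) := by
  classical
  letI : Fintype P := Fintype.ofFinite P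
  obtain ⟨Y, hY1, hY2, hY3, hY4⟩ := split_trivialize A θ hD hn0 hX P hodd
  set Q := IntermediateField.fixedField P with hQ
  have hQf : ∀ (q : Q) (g : P), g.1 (q : N) = q := fun q g =>
    (IntermediateField.mem_fixedField_iff P q.1).1 q.2 g.1 g.2
  have : IsScalarTower Q N X := inferInstance
  have : FiniteDimensional Q X := FiniteDimensional.trans Q N X
  let X0 : Submodule Q X :=
    { carrier := {x | ∀ g, Y g x = x}, add_mem' := fun {a b} ha hb g => by rw [map_add, ha g, hb g]
      zero_mem' := fun g => map_zero _
      smul_mem' := fun c x hx g => by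
        change Y g ((c : N) • x) = (c : N) • x
        rw [hY1, hx g, hQf] }
  have hXn : Nontrivial X := Module.nontrivial_of_finrank_pos (R := N) (by omega)
  have hX0 : Nontrivial X0 := by
    by_contra hne
    obtain ⟨x, hx⟩ := exists_ne (0 : X)
    have hz : ∀ c : N, ∑ g : P, g.1 c • Y g x = 0 := by
      intro c
      have : ∑ g : P, g.1 c • Y g x ∈ X0 := by
        intro h
        rw [map_sum]
        simp only [hY1, hY3]
        exact Fintype.sum_equiv (Equiv.mulLeft h) _ _ (fun g => rfl)
      by_contra h0
      exact hne ⟨⟨_, this⟩, 0, fun h => h0 (congrArg Subtype.val h)⟩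
    have : ∃ f : Module.Dual N X, f x ≠ 0 := by
      by_contra! h
      exact hx ((Module.forall_dual_apply_eq_zero_iff N x).1 h)
    obtain ⟨f, hf⟩ := this
    have hli := linearIndependent_monoidHom N N
    let m : P → (N →* N) := fun g => (g.1 : N →* N)
    have hm : Function.Injective m := fun g h e => Subtype.ext (AlgEquiv.ext fun c => DFunLike.congr_fun e c)
    have hli2 := hli.comp m hm
    rw [Fintype.linearIndependent_iff] at hli2
    have := hli2 (fun g => f (Y g x)) (by
      ext c
      have := congrArg f (hz c)
      simp only [map_sum, map_smul, smul_eq_mul, map_zero] at this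
      simp only [Finset.sum_apply, Pi.smul_apply, Function.comp_apply, smul_eq_mul, Pi.zero_apply]
      rw [← this]
      exact Finset.sum_congr rfl fun g _ => mul_comm _ _) 1
    rw [hY4] at this
    exact hf this
  let A0 : DAct F D Q X0 :=
    { a := { toFun := fun d =>
              { toFun := fun x => ⟨A.a d x.1, fun g => by rw [hY2, x.2 g]⟩
                map_add' := fun x y => by ext; simp
                map_smul' := fun c x => by ext; exact (A.a d).map_smul (c : N) x.1 }
             map_one' := by ext; simp
             map_mul' := fun x y => by ext; simp
             map_zero' := by ext; simp
             map_add' := fun x y => by ext; simp }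
      ha := fun c m => by ext; exact A.ha c m.1 }
  have hge : n ≤ Module.finrank Q X0 := by
    have := A0.le_sq
    rw [hD] at this
    exact (Nat.pow_le_pow_iff_left two_ne_zero).1 this
  have hle : Module.finrank Q X0 ≤ n := by
    let v := Module.finBasis Q X0
    have key : ∀ (m : ℕ) (s : Finset (Fin (Module.finrank Q X0))) (c : Fin (Module.finrank Q X0) → N), s.card = m →
        ∑ i ∈ s, c i • (v i : X) = 0 → ∀ i ∈ s, c i = 0 := by
      intro m
      induction m with
      | zero => intro s c hs _ i hi; simp_all
      | succ m ih =>
        intro s c hs h i₀ hi₀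
        by_contra hne
        let c' := fun i => (c i₀)⁻¹ * c i
        have hc'1 : c' i₀ = 1 := inv_mul_cancel₀ hne
        have h' : ∑ i ∈ s, c' i • (v i : X) = 0 := by
          simp only [c', mul_smul]; rw [← Finset.smul_sum, h, smul_zero]
        have hfix : ∀ i ∈ s, ∀ g : P, g.1 (c' i) = c' i := by
          intro i hi g
          by_cases hii : i = i₀
          · rw [hii, hc'1, map_one]
          have hg : ∑ i ∈ s, g.1 (c' i) • (v i : X) = 0 := by
            have := congrArg (Y g) h'
            rw [map_sum, map_zero] at this
            rw [← this]
            exact Finset.sum_congr rfl fun i _ => by rw [hY1, (v i).2 g]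
          have := ih (s.erase i₀) (fun i => g.1 (c' i) - c' i) (by rw [Finset.card_erase_of_mem hi₀, hs]; rfl) (by
            have e : ∑ i ∈ s, (g.1 (c' i) - c' i) • (v i : X) = 0 := by
              simp only [sub_smul, Finset.sum_sub_distrib, hg, h', sub_zero]
            rw [← Finset.add_sum_erase s _ hi₀, hc'1] at e
            simpa using e) i (by simp [hii, hi])
          exact sub_eq_zero.1 this
        have hmem : ∀ i ∈ s, ∃ q : Q, (q : N) = c' i := fun i hi =>
          ⟨⟨c' i, (IntermediateField.mem_fixedField_iff P _).2 fun g hg => hfix i hi ⟨g, hg⟩⟩, rfl⟩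
        choose! q hq using hmem
        have := (linearIndependent_iff'.1 v.linearIndependent) s q (by
          apply Subtype.ext
          rw [← X0.subtype_apply, map_sum]
          change ∑ i ∈ s, (q i : N) • (v i : X) = 0
          rw [← h']
          exact Finset.sum_congr rfl fun i hi => by rw [hq i hi]) i₀ hi₀
        have h2 := hq i₀ hi₀
        rw [this, hc'1] at h2
        simp at h2
    have hv : LinearIndependent N (fun i => (v i : X)) := by
      rw [Fintype.linearIndependent_iff]
      intro c hc i
      exact key _ Finset.univ c rfl hc i (Finset.mem_univ i)
    have := hv.fintype_card_le_finrank
    rwa [Fintype.card_fin, hX] at this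
  exact dvd_of_split A0 n hn0 hD (le_antisymm hle hge)
end Split

theorem two_power_aux {F : Type u} [Field F] {D : Type u} [DivisionRing D] [Algebra F D] [FiniteDimensional F D]
    [Algebra.IsCentral F D] (θ : D →ₐ[F] Dᵐᵒᵖ) {M : Type u} [Field M] [Algebra F M] {X0 : Type u} [AddCommGroup X0]
    [Module M X0] [FiniteDimensional M X0] (A0 : DAct F D M X0)
    {N : Type u} [Field N] [Algebra F N] [Algebra M N] [IsScalarTower F M N] [IsGalois F N] [FiniteDimensional F N]
    {n : ℕ} (hn : Module.finrank F D = n ^ 2) (hn0 : 0 < n) (hn' : Module.finrank M X0 = n) :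
    ∃ a : ℕ, n = 2 ^ a := by
  let A := A0.baseChange N
  have hX : Module.finrank N (TensorProduct M N X0) = n := by rw [Module.finrank_baseChange, hn']
  have : IsScalarTower F N (TensorProduct M N X0) := inferInstance
  have hp : ∀ p : ℕ, p.Prime → p ≠ 2 → ¬ p ∣ n := by
    intro p hp hp2 hpn
    haveI : Fact p.Prime := ⟨hp⟩
    obtain ⟨P⟩ : Nonempty (Sylow p (N ≃ₐ[F] N)) := inferInstance
    have hodd : Odd (Nat.card P) := by
      obtain ⟨k, hk⟩ := IsPGroup.iff_card.1 P.2
      have : Nat.card P = p ^ k := hk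
      rw [this]
      exact (hp.odd_of_ne_two hp2).pow
    have h1 := split_descent A θ hn hn0 hX P.1 hodd
    have h2 : Module.finrank F (IntermediateField.fixedField P.1) * Nat.card P = Nat.card (N ≃ₐ[F] N) := by
      rw [IsGalois.card_aut_eq_finrank, ← Module.finrank_mul_finrank F (IntermediateField.fixedField P.1) N,
        IntermediateField.finrank_fixedField_eq_card]
    have h3 : P.1.index = Module.finrank F (IntermediateField.fixedField P.1) := by
      have := P.1.index_mul_card
      rw [← h2] at this
      exact Nat.eq_of_mul_eq_mul_right Nat.card_pos this
    exact P.not_dvd_index (h3 ▸ hpn.trans h1)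
  exact ⟨_, Nat.eq_prime_pow_of_unique_prime_dvd hn0.ne' (fun {d} hd hdn => by
    by_contra h; exact hp d hd h hdn)⟩

theorem exists_gal_closure (F M : Type u) [Field F] [Field M] [Algebra F M] [FiniteDimensional F M]
    [Algebra.IsSeparable F M] : ∃ (N : Type u) (_ : Field N) (_ : Algebra F N) (_ : Algebra M N),
      IsScalarTower F M N ∧ IsGalois F N ∧ FiniteDimensional F N := by
  have : Algebra.IsSeparable F (SeparableClosure M) := Algebra.IsSeparable.trans F M _
  have : IsSepClosure F (SeparableClosure M) := ⟨inferInstance, inferInstance⟩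
  have : IsGalois F (SeparableClosure M) := inferInstance
  exact ⟨IntermediateField.normalClosure F M (SeparableClosure M), inferInstance, inferInstance,
    normalClosure.algebra F M (SeparableClosure M), inferInstance, IsGalois.normalClosure F M _, inferInstance⟩

theorem two_power {F : Type u} [Field F] {D : Type u} [DivisionRing D] [Algebra F D] [FiniteDimensional F D]
    [Algebra.IsCentral F D] (θ : D →ₐ[F] Dᵐᵒᵖ) : ∃ a : ℕ, Module.finrank F D = (2 ^ a) ^ 2 := by
  classical
  obtain ⟨M, hM, hsep⟩ := exists_sep_maximalSubfield (F := F) (D := D)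
  letI : Field M := subField M hM.1 hM.2.1
  obtain ⟨hn, hn'⟩ := finrank_eq_sq M hM.1 hM.2.1 hM.mem
  have hn0 : 0 < Module.finrank F M := Module.finrank_pos
  have hsepM : Algebra.IsSeparable F M := ⟨fun y => by
    have := hsep y.1 y.2
    unfold IsSeparable at this ⊢
    rwa [← minpoly.algHom_eq M.val Subtype.val_injective]⟩
  have : FiniteDimensional M D := Module.Finite.of_restrictScalars_finite F M D
  let A0 : DAct F D M D := ⟨(mopAct M hM.1 hM.2.1).a.comp θ.toRingHom, fun c m => by
    change (mopAct M hM.1 hM.2.1).a (θ (algebraMap F D c)) m = _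
    rw [θ.commutes, (mopAct M hM.1 hM.2.1).ha]⟩
  obtain ⟨N, _, _, _, _, _, _⟩ := exists_gal_closure F M
  obtain ⟨a, ha⟩ := two_power_aux θ A0 (N := N) hn hn0 hn'
  exact ⟨a, by rw [hn, ha]⟩

section SubBimod
variable {F : Type*} [Field F] {D : Type*} [DivisionRing D] [Algebra F D]
    {R : Type*} [Field R] [Algebra F R] {X : Type*} [AddCommGroup X] [Module R X]

/-- submodules of endomorphisms as bimodules -/
def DAct.sb (A : DAct F D R X) (S : Submodule R (Module.End R X)) (hl : ∀ d, ∀ f ∈ S, A.a d * f ∈ S)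
    (hr : ∀ d, ∀ f ∈ S, f * A.a d ∈ S) : DBimod F D R S where
  l := { toFun := fun d => { toFun := fun f => ⟨A.a d * f.1, hl d _ f.2⟩, map_add' := fun f g => by ext; simp, map_smul' := fun c f => by ext; simp }
         map_one' := by ext; simp
         map_mul' := fun x y => by ext; simp
         map_zero' := by ext; simp
         map_add' := fun x y => by ext; simp }
  r := { toFun := fun d => { toFun := fun f => ⟨f.1 * A.a d.unop, hr _ _ f.2⟩, map_add' := fun f g => by ext; simp, map_smul' := fun c f => by ext; simp }
         map_one' := by ext; simp
         map_mul' := fun x y => by ext; simp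
         map_zero' := by ext; simp
         map_add' := fun x y => by ext; simp }
  hl c m := by ext x; simp [A.ha]
  hr c m := by ext x; simp [A.ha]
  comm x y m := by ext; simp

theorem DAct.sub_bimod [FiniteDimensional F D] [Algebra.IsCentral F D]
    (A : DAct F D R X) (S : Submodule R (Module.End R X)) (hl : ∀ d, ∀ f ∈ S, A.a d * f ∈ S)
    (hr : ∀ d, ∀ f ∈ S, f * A.a d ∈ S) :
    Module.finrank R S = Module.finrank F D * Module.finrank R (S ⊓ Subalgebra.toSubmodule (Com A.a) : Submodule R (Module.End R X)) ∧
    ∃ (n : ℕ) (x : Fin n → D), ∀ f ∈ S, ∃ t : Fin n → Module.End R X,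
      (∀ j, t j ∈ S ∧ t j ∈ Com A.a) ∧ f = ∑ j, A.a (x j) * t j := by
  have hinv : ∀ m : S, m ∈ (A.sb S hl hr).inv ↔ m.1 ∈ Com A.a := by
    intro m
    rw [mem_Com]
    constructor
    · intro h d x
      exact LinearMap.congr_fun (congrArg Subtype.val (h d)) x
    · intro h d
      exact Subtype.ext (LinearMap.ext fun x => h d x)
  constructor
  · rw [(A.sb S hl hr).finrank_eq]
    congr 1
    have : (A.sb S hl hr).inv = (Subalgebra.toSubmodule (Com A.a)).comap S.subtype := by
      ext m; exact hinv m
    rw [this, inf_comm, ← LinearEquiv.finrank_eq (Submodule.comapSubtypeEquivOfLe (inf_le_right :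
      Subalgebra.toSubmodule (Com A.a) ⊓ S ≤ S)), Submodule.comap_inf, Submodule.comap_subtype_self, inf_top_eq]
  · obtain ⟨n, x, τ, h1, h2, -⟩ := (A.sb S hl hr).decomp
    refine ⟨n, x, fun f hf => ⟨fun j => (τ j ⟨f, hf⟩).1, fun j => ⟨(τ j ⟨f, hf⟩).2, (hinv _).1 (h1 j _)⟩, ?_⟩⟩
    have := congrArg Subtype.val (h2 ⟨f, hf⟩)
    simp only [AddSubmonoidClass.coe_finset_sum] at this
    exact this

theorem Irr.central_of {I : Type*} {s : I → Module.End R X} [FiniteDimensional R X] (h : Irr s)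
    (h1 : Module.finrank R (Subalgebra.toSubmodule (Com (fun f : Com s => f.1)) ⊓ Subalgebra.toSubmodule (Com s) :
      Submodule R (Module.End R X)) = 1) : letI := h.div; Algebra.IsCentral R (Com s) := by
  letI := h.div
  refine ⟨fun z hz => ?_⟩
  rw [Subalgebra.mem_center_iff] at hz
  have hone : (1 : Module.End R X) ∈ (Subalgebra.toSubmodule (Com (fun f : Com s => f.1)) ⊓ Subalgebra.toSubmodule (Com s) :
      Submodule R (Module.End R X)) := ⟨Subalgebra.one_mem _, Subalgebra.one_mem _⟩
  have hne : (⟨1, hone⟩ : (Subalgebra.toSubmodule (Com (fun f : Com s => f.1)) ⊓ Subalgebra.toSubmodule (Com s) :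
      Submodule R (Module.End R X))) ≠ 0 := by
    have := h.1
    intro h0
    exact one_ne_zero (congrArg Subtype.val h0)
  obtain ⟨c, hc⟩ := exists_smul_eq_of_finrank_eq_one h1 hne ⟨z.1, (mem_Com _).2 fun f x =>
    LinearMap.congr_fun (congrArg Subtype.val (hz f)) x, z.2⟩
  rw [Algebra.mem_bot]
  refine ⟨c, Subtype.ext ?_⟩
  have := congrArg Subtype.val hc
  simp only at this
  rw [← this]
  rfl
end SubBimod

/-- local module data -/
structure LocMod (F D L X Δ : Type*) [Field F] [DivisionRing D] [Algebra F D] [Field L] [Algebra F L]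
    [AddCommGroup X] [Module L X] [DivisionRing Δ] [Algebra L Δ] where
  A : DAct F D L X
  B : DAct L Δ L X
  comm : ∀ d g x, A.a d (B.a g x) = B.a g (A.a d x)
  full : ∀ f : Module.End L X, (∀ d x, A.a d (f x) = f (A.a d x)) → ∃ g, B.a g = f
  span : ∀ f : Module.End L X, (∀ g x, B.a g (f x) = f (B.a g x)) → f ∈ Submodule.span L (Set.range A.a)
  fin : FiniteDimensional L X
  finΔ : FiniteDimensional L Δ
  nt : Nontrivial X
  central : Algebra.IsCentral L Δ
  irr : Irr A.a

theorem exists_locMod (F D L : Type u) [Field F] [DivisionRing D] [Algebra F D] [FiniteDimensional F D] [Algebra.IsCentral F D]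
    [Field L] [Algebra F L] : ∃ (X Δ : Type u) (_ : AddCommGroup X) (_ : Module L X) (_ : DivisionRing Δ) (_ : Algebra L Δ),
      Nonempty (LocMod F D L X Δ) := by
  let A0 : DAct F D F D := ⟨Module.toModuleEnd F D |>.comp (RingHom.id D), fun c m => by simp [Algebra.smul_def]⟩
  let A1 := A0.baseChange L
  have hfin : FiniteDimensional L (TensorProduct F L D) := inferInstance
  have hnt : Nontrivial (TensorProduct F L D) := Module.nontrivial_of_finrank_pos (R := L) (by
    rw [Module.finrank_baseChange]; exact Module.finrank_pos)
  obtain ⟨X, hX, hirr⟩ := exists_irr (fun d => A1.a d)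
  let A : DAct F D L X :=
    { a := { toFun := fun d => (A1.a d).restrict (hX d)
             map_one' := by ext; simp
             map_mul' := fun x y => by ext; simp
             map_zero' := by ext; simp
             map_add' := fun x y => by ext; simp }
      ha := fun c m => by ext; simp [A1.ha] }
  have hA : Irr A.a := hirr
  letI := hA.div
  have e1 := (A.sub_bimod ⊤ (by simp) (by simp)).1
  obtain ⟨e2, n, x, e3⟩ := (A.sub_bimod (Subalgebra.toSubmodule (Com (fun f : Com A.a => f.1)))
    (fun d f hf => Subalgebra.mul_mem _ ((mem_Com _).2 fun g x => ((mem_Com _).1 g.2 d x).symm) hf)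
    (fun d f hf => Subalgebra.mul_mem _ hf ((mem_Com _).2 fun g x => ((mem_Com _).1 g.2 d x).symm)))
  have e4 := hA.finrank_bicom
  rw [finrank_top, Module.finrank_linearMap, top_inf_eq] at e1
  have hDp : 0 < Module.finrank F D := Module.finrank_pos
  have hXn := hA.1
  haveI hCfin : FiniteDimensional L (Com A.a) := inferInstanceAs (FiniteDimensional L (Subalgebra.toSubmodule (Com A.a)))
  have hCp : 0 < Module.finrank L (Com A.a) := Module.finrank_pos
  have e5 := e2
  rw [Subalgebra.finrank_toSubmodule] at e2 e1
  have hone : Module.finrank L (Subalgebra.toSubmodule (Com (fun f : Com A.a => f.1)) ⊓ Subalgebra.toSubmodule (Com A.a) :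
      Submodule L (Module.End L X)) = 1 := by
    rw [e2, pow_two, e1] at e4
    have := Nat.eq_of_mul_eq_mul_right hCp e4
    exact Nat.eq_of_mul_eq_mul_left hDp (this.trans (mul_one _).symm)
  have hc := hA.central_of hone
  refine ⟨X, Com A.a, inferInstance, inferInstance, inferInstance, inferInstance, ⟨{
    A := A, B := ⟨(Com A.a).val.toRingHom, fun c m => rfl⟩, comm := fun d g x => (mem_Com _).1 g.2 d x,
    full := fun f hf => ⟨⟨f, (mem_Com _).2 hf⟩, rfl⟩, span := ?_, fin := inferInstance, finΔ := inferInstance,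
    nt := hA.1, central := hc, irr := hA }⟩⟩
  intro f hf
  obtain ⟨t, ht, rfl⟩ := e3 f ((mem_Com _).2 hf)
  refine Submodule.sum_mem _ fun j _ => ?_
  have hz : (⟨t j, (ht j).2⟩ : Com A.a) ∈ Subalgebra.center L (Com A.a) := by
    rw [Subalgebra.mem_center_iff]
    intro g
    exact Subtype.ext (LinearMap.ext fun x => (mem_Com _).1 (ht j).1 g x)
  obtain ⟨c, hc⟩ := Algebra.mem_bot.1 (hc.out hz)
  have h2 := congrArg Subtype.val hc
  have h3 : t j = c • 1 := by rw [← Algebra.algebraMap_eq_smul_one]; exact h2.symm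
  rw [h3, mul_smul_comm, mul_one]
  exact Submodule.smul_mem _ _ (Submodule.subset_span ⟨_, rfl⟩)

namespace LocMod
variable {F D L X Δ : Type*} [Field F] [DivisionRing D] [Algebra F D] [Field L] [Algebra F L]
    [AddCommGroup X] [Module L X] [DivisionRing Δ] [Algebra L Δ]

theorem B_inj (Q : LocMod F D L X Δ) : Function.Injective Q.B.a := by
  have := Q.nt
  exact RingHom.injective _

theorem finrank_eq [FiniteDimensional F D] [Algebra.IsCentral F D] (Q : LocMod F D L X Δ) :
    Module.finrank L X ^ 2 = Module.finrank F D * Module.finrank L Δ := by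
  have := Q.fin
  rw [pow_two, Q.A.finrank_hom Q.A]
  congr 1
  symm
  exact LinearEquiv.finrank_eq (LinearEquiv.ofBijective
    { toFun := fun g => ⟨Q.B.a g, (DAct.mem_hom _ _).2 fun d x => (Q.comm d g x).symm⟩
      map_add' := fun x y => by ext; simp
      map_smul' := fun c x => by ext; simp [Algebra.smul_def, Q.B.ha] }
    ⟨fun x y h => Q.B_inj (congrArg Subtype.val h), fun f => by
      obtain ⟨g, hg⟩ := Q.full f.1 (fun d x => ((DAct.mem_hom _ _).1 f.2 d x).symm)
      exact ⟨g, Subtype.ext hg⟩⟩)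

/-- adjoint involution -/
theorem anti [FiniteDimensional F D] [Algebra.IsCentral F D] (Q : LocMod F D L X Δ) (θ : D →ₐ[F] Dᵐᵒᵖ) :
    Nonempty (Δ →ₐ[L] Δᵐᵒᵖ) := by
  have := Q.fin
  have := Q.nt
  let A' : DAct F D L (Module.Dual L X) :=
    { a := { toFun := fun d => (Q.A.a (θ d).unop).dualMap
             map_one' := by ext; simp
             map_mul' := fun x y => by ext; simp
             map_zero' := by ext; simp
             map_add' := fun x y => by ext; simp }
      ha := fun c m => by ext x; simp [Q.A.ha, Algebra.smul_def] }
  have hnt : Nontrivial (Module.Dual L X) := Module.nontrivial_of_finrank_pos (R := L) (by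
    rw [Subspace.dual_finrank_eq]; exact Module.finrank_pos)
  obtain ⟨ψ, hψ, h0⟩ := Q.A.exists_hom A'
  rw [DAct.mem_hom] at hψ
  have hψ' : ∀ d x y, ψ (Q.A.a d x) y = ψ x (Q.A.a (θ d).unop y) := fun d x y => by rw [hψ]; rfl
  have hinj : Function.Injective ψ := by
    rw [← LinearMap.ker_eq_bot]
    refine (Q.irr.2 (LinearMap.ker ψ) (fun d x hx => ?_)).resolve_right fun h => h0 (LinearMap.ker_eq_top.1 h)
    rw [LinearMap.mem_ker] at hx ⊢
    rw [hψ, hx, map_zero]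
  let e := LinearEquiv.ofInjectiveOfFinrankEq ψ hinj (Subspace.dual_finrank_eq).symm
  have he : ∀ x, e x = ψ x := fun x => rfl
  have hex : ∀ g : Δ, ∃ g' : Δ, ∀ x y, ψ (Q.B.a g' x) y = ψ x (Q.B.a g y) := by
    intro g
    let f : Module.End L X := e.symm.toLinearMap ∘ₗ (Q.B.a g).dualMap ∘ₗ ψ
    have hf : ∀ x y, ψ (f x) y = ψ x (Q.B.a g y) := by
      intro x y
      rw [← he]
      simp [f]
    obtain ⟨g', hg'⟩ := Q.full f (fun d x => hinj (LinearMap.ext fun y => by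
      rw [hψ', hf, hf, hψ', Q.comm]))
    exact ⟨g', fun x y => by rw [hg', hf]⟩
  choose t ht using hex
  have uniq : ∀ a b : Δ, (∀ x y, ψ (Q.B.a a x) y = ψ (Q.B.a b x) y) → a = b := fun a b h =>
    Q.B_inj (LinearMap.ext fun x => hinj (LinearMap.ext fun y => h x y))
  exact ⟨{ toFun := fun g => op (t g)
           map_one' := by rw [uniq (t 1) 1 fun x y => by simp [ht]]; rfl
           map_mul' := fun a b => by rw [← op_mul, uniq (t (a * b)) (t b * t a) fun x y => by simp [ht]]
           map_zero' := by rw [uniq (t 0) 0 fun x y => by simp [ht]]; rfl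
           map_add' := fun a b => by rw [← op_add, uniq (t (a + b)) (t a + t b) fun x y => by simp [ht]]
           commutes' := fun c => by
             rw [uniq (t (algebraMap L Δ c)) (algebraMap L Δ c) fun x y => by simp [ht, Q.B.ha]]; rfl }⟩
end LocMod

/-- ultrametric norms on vector spaces -/
structure VNorm (L : Type*) [NontriviallyNormedField L] (W : Type*) [AddCommGroup W] [Module L W] where
  v : W → ℝ
  nonneg : ∀ x, 0 ≤ v x
  eq_zero : ∀ x, v x = 0 → x = 0
  add_le : ∀ x y, v (x + y) ≤ max (v x) (v y)
  smul : ∀ (c : L) x, v (c • x) = ‖c‖ * v x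

namespace VNorm
variable {L : Type*} [NontriviallyNormedField L] {W : Type*} [AddCommGroup W] [Module L W] (ν : VNorm L W)
  {W' : Type*} [AddCommGroup W'] [Module L W'] (ν' : VNorm L W')

theorem v_zero : ν.v 0 = 0 := by
  have := ν.smul 0 0
  simpa using this

theorem v_neg (x : W) : ν.v (-x) = ν.v x := by
  have := ν.smul (-1) x
  simpa using this

theorem sub_le (x y : W) : ν.v (x - y) ≤ max (ν.v x) (ν.v y) := by
  have := ν.add_le x (-y)
  rwa [v_neg, ← sub_eq_add_neg] at this

theorem sub_comm (x y : W) : ν.v (x - y) = ν.v (y - x) := by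
  rw [← v_neg, neg_sub]

theorem pos {x : W} (h : x ≠ 0) : 0 < ν.v x := lt_of_le_of_ne (ν.nonneg x) fun h' => h (ν.eq_zero x h'.symm)

theorem sum_le {ι : Type*} (s : Finset ι) (f : ι → W) (C : ℝ) (hC : 0 ≤ C) (h : ∀ i ∈ s, ν.v (f i) ≤ C) :
    ν.v (∑ i ∈ s, f i) ≤ C := by
  classical
  induction s using Finset.induction_on with
  | empty => simpa [v_zero] using hC
  | insert a s ha ih =>
    rw [Finset.sum_insert ha]
    exact (ν.add_le _ _).trans (max_le (h a (by simp)) (ih fun i hi => h i (by simp [hi])))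

theorem eq_of_lt {x y : W} (h : ν.v (x - y) < ν.v x) : ν.v y = ν.v x := by
  apply le_antisymm
  · have := ν.sub_le x (x - y)
    rw [sub_sub_cancel] at this
    exact this.trans (max_le le_rfl h.le)
  · have := ν.add_le (x - y) y
    rw [sub_add_cancel] at this
    rcases le_max_iff.1 this with h1 | h1
    · exact absurd h1 (not_le.2 h)
    · exact h1

/-- normed group structure -/
abbrev nacg : NormedAddCommGroup W :=
  AddGroupNorm.toNormedAddCommGroup
    { toFun := ν.v, map_zero' := ν.v_zero, neg' := ν.v_neg, eq_zero_of_map_eq_zero' := ν.eq_zero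
      add_le' := fun x y => (ν.add_le x y).trans (max_le_add_of_nonneg (ν.nonneg x) (ν.nonneg y)) }

/-- normed space structure -/
abbrev ns : letI := ν.nacg; NormedSpace L W :=
  letI := ν.nacg
  { norm_smul_le := fun c x => (ν.smul c x).le }

theorem bound [CompleteSpace L] [FiniteDimensional L W] (f : W →ₗ[L] W') : ∃ C, 0 < C ∧ ∀ x, ν'.v (f x) ≤ C * ν.v x := by
  letI := ν.nacg; letI := ν.ns; letI := ν'.nacg; letI := ν'.ns
  let g : W →L[L] W' := ⟨f, LinearMap.continuous_of_finiteDimensional f⟩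
  exact g.bound

theorem boundL [CompleteSpace L] [FiniteDimensional L W] (f : W →ₗ[L] L) : ∃ C, 0 < C ∧ ∀ x, ‖f x‖ ≤ C * ν.v x := by
  letI := ν.nacg; letI := ν.ns
  let g : W →L[L] L := ⟨f, LinearMap.continuous_of_finiteDimensional f⟩
  exact g.bound

/-- discreteness of the values -/
def Disc (q : ℝ) (K : ℕ) : Prop := ∀ x ≠ 0, ∃ m : ℤ, ν.v x ^ K = q ^ m

/-- orthogonality of a basis -/
def Orth {ι : Type*} (b : Module.Basis ι L W) : Prop := ∀ x i, ‖b.repr x i‖ * ν.v (b i) ≤ ν.v x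

theorem exists_min {q : ℝ} {K : ℕ} (hq0 : 0 < q) (hq1 : q < 1) (hK : K ≠ 0) (h : ν.Disc q K) (S : Set W) (hS : S.Nonempty)
    (C : ℝ) (hC : 0 < C) (hb : ∀ x ∈ S, C ≤ ν.v x) : ∃ x ∈ S, ∀ y ∈ S, ν.v x ≤ ν.v y := by
  have hne : ∀ x ∈ S, x ≠ 0 := fun x hx h0 => by
    have := hb x hx; rw [h0, ν.v_zero] at this; linarith
  obtain ⟨x0, hx0⟩ := hS
  have hbd : ∃ B : ℤ, ∀ m : ℤ, (∃ x ∈ S, ν.v x ^ K = q ^ m) → m ≤ B := by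
    obtain ⟨B, hB⟩ := exists_pow_lt_of_lt_one (pow_pos hC K) hq1
    refine ⟨B, ?_⟩
    rintro m ⟨x, hx, hm⟩
    by_contra hlt
    push Not at hlt
    have h1 : C ^ K ≤ ν.v x ^ K := pow_le_pow_left₀ hC.le (hb x hx) K
    rw [hm] at h1
    have h2 : q ^ m ≤ q ^ (B : ℤ) := zpow_le_zpow_right_of_le_one₀ hq0 hq1.le hlt.le
    rw [zpow_natCast] at h2
    linarith
  obtain ⟨m0, hm0⟩ := h x0 (hne _ hx0)
  obtain ⟨m, ⟨x, hx, hm⟩, hmax⟩ := Int.exists_greatest_of_bdd hbd ⟨m0, x0, hx0, hm0⟩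
  refine ⟨x, hx, fun y hy => ?_⟩
  obtain ⟨m', hm'⟩ := h y (hne _ hy)
  have := hmax m' ⟨y, hy, hm'⟩
  refine le_of_pow_le_pow_left₀ hK (ν.nonneg y) ?_
  rw [hm, hm']
  exact zpow_le_zpow_right_of_le_one₀ hq0 hq1.le this

/-- restriction to a subspace -/
def restrict (p : Submodule L W) : VNorm L p where
  v x := ν.v x.1
  nonneg x := ν.nonneg _
  eq_zero x h := Subtype.ext (ν.eq_zero _ h)
  add_le x y := ν.add_le _ _
  smul c x := ν.smul _ _

theorem exists_orth_aux [CompleteSpace L] {q : ℝ} {K : ℕ} (hq0 : 0 < q) (hq1 : q < 1) (hK : K ≠ 0) (n : ℕ) :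
    ∀ (p : Submodule L W) [FiniteDimensional L p], Module.finrank L p = n → ∀ (ν : VNorm L p), ν.Disc q K →
      ∃ b : Module.Basis (Fin n) L p, ν.Orth b := by
  induction n with
  | zero =>
    intro p _ hp ν _
    have := Module.finBasis L p
    rw [hp] at this
    exact ⟨this, fun x i => i.elim0⟩
  | succ n ih =>
    intro p _ hp ν hν
    have : Nontrivial p := Module.nontrivial_of_finrank_pos (R := L) (by omega)
    obtain ⟨x, hx⟩ := exists_ne (0 : p)
    have : ∃ f : Module.Dual L p, f x ≠ 0 := by
      by_contra! h
      exact hx ((Module.forall_dual_apply_eq_zero_iff L x).1 h)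
    obtain ⟨f, hf⟩ := this
    obtain ⟨C, hC0, hC⟩ := ν.boundL f
    obtain ⟨w, hw, hmin⟩ := ν.exists_min hq0 hq1 hK hν {w | f w = 1} ⟨(f x)⁻¹ • x, by simp [hf]⟩ (C⁻¹) (by positivity)
      (fun w hw => by
        have := hC w
        rw [show f w = 1 from hw, norm_one] at this
        rw [inv_le_iff_one_le_mul₀ hC0]; linarith)
    have hw : f w = 1 := hw
    have hker : Module.finrank L (LinearMap.ker f) = n := by
      have h1 := LinearMap.finrank_range_add_finrank_ker f
      rw [LinearMap.range_eq_top.2 (LinearMap.surjective (by rintro rfl; simp at hf)), finrank_top, Module.finrank_self] at h1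
      omega
    let e : LinearMap.ker f ≃ₗ[L] (LinearMap.ker f).map p.subtype :=
      Submodule.equivMapOfInjective _ p.subtype_injective _
    let ν1 : VNorm L ((LinearMap.ker f).map p.subtype) :=
      { v := fun x => ν.v (e.symm x).1
        nonneg := fun x => ν.nonneg _
        eq_zero := fun x h => by
          have := ν.eq_zero _ h
          exact e.symm.injective (by rw [map_zero]; exact Subtype.ext this)
        add_le := fun x y => by rw [map_add]; exact ν.add_le _ _
        smul := fun c x => by rw [map_smul]; exact ν.smul _ _ }
    have : FiniteDimensional L ((LinearMap.ker f).map p.subtype) := e.finiteDimensional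
    obtain ⟨b1, hb1⟩ := ih ((LinearMap.ker f).map p.subtype) (by rw [← e.finrank_eq, hker]) ν1 (fun x hx => hν _ (by
      intro h0
      exact hx (e.symm.injective (by rw [map_zero]; exact Subtype.ext h0))))
    let b0 := b1.map e.symm
    have hb0 : ∀ (x : LinearMap.ker f) i, ‖b0.repr x i‖ * ν.v (b0 i).1 ≤ ν.v x.1 := by
      intro x i
      have := hb1 (e x) i
      simp only [ν1, e.symm_apply_apply] at this
      simpa [b0] using this
    have hli : ∀ (c : L), ∀ x ∈ LinearMap.ker f, c • w + x = 0 → c = 0 := fun c x hx h => by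
      have := congrArg f h
      simpa [hw, LinearMap.mem_ker.1 hx] using this
    have hsp : ∀ z, ∃ c : L, z + c • w ∈ LinearMap.ker f := fun z => ⟨-f z, by simp [hw]⟩
    refine ⟨Module.Basis.mkFinCons w b0 hli hsp, ?_⟩
    intro z i
    set b := Module.Basis.mkFinCons w b0 hli hsp with hb
    let h : LinearMap.ker f := ⟨z - f z • w, by simp [hw]⟩
    have hz : z = f z • w + h.1 := by simp [h]
    have hb0' : b 0 = w := by simp [hb]
    have hbs : ∀ j : Fin n, b j.succ = (b0 j).1 := fun j => by simp [hb]
    have hz2 : z = ∑ j, (Fin.cons (f z) (fun j => b0.repr h j) : Fin (n+1) → L) j • b j := by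
      rw [Fin.sum_univ_succ]
      simp only [Fin.cons_zero, Fin.cons_succ, hb0', hbs]
      have := congrArg Subtype.val (b0.sum_repr h)
      simp only [AddSubmonoidClass.coe_finset_sum, Submodule.coe_smul] at this
      rw [this]; exact hz
    have hrep : ⇑(b.repr z) = (Fin.cons (f z) (fun j => b0.repr h j) : Fin (n+1) → L) := by
      conv_lhs => rw [hz2]
      exact b.repr_sum_self _
    have hc : ‖f z‖ * ν.v w ≤ ν.v z := by
      by_cases h0 : f z = 0
      · rw [h0]; simpa using ν.nonneg z
      · have := hmin ((f z)⁻¹ • z) (by simp [h0])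
        rw [ν.smul, norm_inv] at this
        have hp : 0 < ‖f z‖ := norm_pos_iff.2 h0
        calc ‖f z‖ * ν.v w ≤ ‖f z‖ * (‖f z‖⁻¹ * ν.v z) := by gcongr
          _ = ν.v z := by field_simp
    rw [hrep]
    refine Fin.cases ?_ (fun j => ?_) i
    · rw [Fin.cons_zero, hb0']; exact hc
    · rw [Fin.cons_succ, hbs]
      refine (hb0 h j).trans ?_
      refine (ν.sub_le z (f z • w)).trans (max_le le_rfl ?_)
      rw [ν.smul]; exact hc

theorem exists_orth [CompleteSpace L] [FiniteDimensional L W] {q : ℝ} {K : ℕ} (hq0 : 0 < q) (hq1 : q < 1) (hK : K ≠ 0)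
    (h : ν.Disc q K) : ∃ b : Module.Basis (Fin (Module.finrank L W)) L W, ν.Orth b := by
  obtain ⟨b, hb⟩ := exists_orth_aux (W := W) hq0 hq1 hK _ ⊤ (finrank_top L W) (ν.restrict ⊤) (fun x hx => h _ fun h0 => hx (Subtype.ext h0))
  let e : (⊤ : Submodule L W) ≃ₗ[L] W := Submodule.topEquiv
  refine ⟨b.map e, fun x i => ?_⟩
  have := hb (e.symm x) i
  simp only [Module.Basis.map_repr, Module.Basis.map_apply, LinearEquiv.trans_apply]
  exact this

theorem Orth.le {ι : Type*} [Fintype ι] {b : Module.Basis ι L W} (hb : ν.Orth b) (x : W) (C : ℝ) (hC : 0 ≤ C) :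
    ν.v x ≤ C ↔ ∀ i, ‖b.repr x i‖ * ν.v (b i) ≤ C := by
  refine ⟨fun h i => (hb x i).trans h, fun h => ?_⟩
  rw [← b.sum_repr x]
  exact ν.sum_le _ _ _ hC fun i _ => by rw [ν.smul]; exact h i

/-- norm from a basis -/
noncomputable def ofBasis [IsUltrametricDist L] {ι : Type*} [Fintype ι] (b : Module.Basis ι L W) : VNorm L W where
  v x := ‖b.equivFun x‖
  nonneg x := norm_nonneg _
  eq_zero x h := by simpa using h
  add_le x y := by
    rw [map_add, pi_norm_le_iff_of_nonneg (le_max_of_le_left (norm_nonneg _))]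
    intro i
    refine (IsUltrametricDist.norm_add_le_max _ _).trans (max_le_max (norm_le_pi_norm _ i) (norm_le_pi_norm _ i))
  smul c x := by rw [map_smul, norm_smul]

end VNorm

theorem newton {L : Type*} [NontriviallyNormedField L] [CompleteSpace L] {R : Type*} [CommRing R] [Algebra L R] [FiniteDimensional L R]
    (ν : VNorm L R) (hmul : ∀ x y, ν.v (x * y) ≤ ν.v x * ν.v y) (h1 : ν.v 1 ≤ 1) (f : Polynomial R)
    (hf : ∀ i, ν.v (f.coeff i) ≤ 1) (a : R) (ha : ν.v a ≤ 1) (u : R) (hu : u * f.derivative.eval a = 1)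
    (C : ℝ) (hC : 1 ≤ C) (huC : ν.v u ≤ C) (hs : C * (C * ν.v (f.eval a)) < 1) :
    ∃ s, f.eval s = 0 ∧ ν.v (s - a) ≤ C * ν.v (f.eval a) := by
  let R0 : Subring R :=
    { carrier := {x | ν.v x ≤ 1}
      mul_mem' := fun {x y} hx hy => (hmul x y).trans (mul_le_one₀ hx (ν.nonneg y) hy)
      one_mem' := h1
      add_mem' := fun {x y} hx hy => (ν.add_le x y).trans (max_le hx hy)
      zero_mem' := by change ν.v 0 ≤ 1; rw [ν.v_zero]; exact zero_le_one
      neg_mem' := fun {x} hx => by change ν.v (-x) ≤ 1; rw [ν.v_neg]; exact hx }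
  have hcoef : (f.coeffs : Set R) ⊆ R0 := fun c hc => by
    obtain ⟨i, -, rfl⟩ := Polynomial.mem_coeffs_iff.1 hc
    exact hf i
  let f0 := f.toSubring R0 hcoef
  have hf0 : f0.map R0.subtype = f := Polynomial.map_toSubring _ _ _
  have hev : ∀ x : R0, f.eval x.1 = (f0.eval x).1 := fun x => by
    rw [← hf0]; exact Polynomial.eval_map_apply R0.subtype x
  have hev' : ∀ x : R0, f.derivative.eval x.1 = (f0.derivative.eval x).1 := fun x => by
    rw [← hf0, Polynomial.derivative_map]; exact Polynomial.eval_map_apply R0.subtype x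
  set ρ := C * ν.v (f.eval a) with hρ
  have hρ0 : 0 ≤ ρ := mul_nonneg (by linarith) (ν.nonneg _)
  have hρ1 : ρ < 1 := by nlinarith
  let a0 : R0 := ⟨a, ha⟩
  have hball : ∀ s, ν.v (s - a) ≤ ρ → ν.v s ≤ 1 := fun s hs => by
    have := ν.add_le (s - a) a
    rw [sub_add_cancel] at this
    exact this.trans (max_le (hs.trans hρ1.le) ha)
  have key : ∀ s t, ν.v (s - a) ≤ ρ → ν.v (t - a) ≤ ρ →
      ν.v ((s - u * f.eval s) - (t - u * f.eval t)) ≤ (C * ρ) * ν.v (s - t) := by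
    intro s t hs ht
    let s0 : R0 := ⟨s, hball s hs⟩
    let t0 : R0 := ⟨t, hball t ht⟩
    obtain ⟨k, hk⟩ := f0.binomExpansion t0 (s0 - t0)
    obtain ⟨k', hk'⟩ := f0.derivative.evalSubFactor t0 a0
    rw [add_sub_cancel] at hk
    have e1 : f.eval s - f.eval t = (s - t) * (f.derivative.eval a + (k'.1 * (t - a) + k.1 * (s - t))) := by
      rw [hev s0, hev t0, hev' a0, hk]
      have := congrArg Subtype.val hk'
      simp only [AddSubgroupClass.coe_sub, Subring.coe_mul, Subring.coe_add, Subring.coe_pow] at this ⊢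
      change _ = k'.1 * (t - a) at this
      rw [← this]
      ring
    have e2 : (s - u * f.eval s) - (t - u * f.eval t) = -(u * (s - t) * (k'.1 * (t - a) + k.1 * (s - t))) := by
      linear_combination (-u) * e1 - (s - t) * hu
    rw [e2, ν.v_neg]
    have hst : ν.v (s - t) ≤ ρ := by
      have := ν.sub_le (s - a) (t - a)
      rw [sub_sub_sub_cancel_right] at this
      exact this.trans (max_le hs ht)
    have e3 : ν.v (k'.1 * (t - a) + k.1 * (s - t)) ≤ ρ := by
      refine (ν.add_le _ _).trans (max_le ((hmul _ _).trans ?_) ((hmul _ _).trans ?_))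
      · exact (mul_le_of_le_one_left (ν.nonneg _) k'.2).trans ht
      · exact (mul_le_of_le_one_left (ν.nonneg _) k.2).trans hst
    calc _ ≤ ν.v (u * (s - t)) * ν.v (k'.1 * (t - a) + k.1 * (s - t)) := hmul _ _
      _ ≤ (ν.v u * ν.v (s - t)) * ρ := mul_le_mul (hmul _ _) e3 (ν.nonneg _) (mul_nonneg (ν.nonneg _) (ν.nonneg _))
      _ ≤ (C * ν.v (s - t)) * ρ := by gcongr; exact ν.nonneg _
      _ = _ := by ring
  letI := ν.nacg; letI := ν.ns
  have : CompleteSpace R := FiniteDimensional.complete L R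
  have hdist : ∀ x y : R, dist x y = ν.v (x - y) := fun x y => dist_eq_norm x y
  let T : R → R := fun s => s - u * f.eval s
  have hmaps : Set.MapsTo T (Metric.closedBall a ρ) (Metric.closedBall a ρ) := by
    intro s hs
    rw [Metric.mem_closedBall, hdist] at hs ⊢
    have e := key s a hs (by rw [sub_self, ν.v_zero]; exact hρ0)
    have e2 : T s - a = (T s - (a - u * f.eval a)) - u * f.eval a := by ring
    rw [e2]
    refine (ν.sub_le _ _).trans (max_le (e.trans ?_) ((hmul _ _).trans ?_))
    · calc _ ≤ 1 * ν.v (s - a) := by gcongr; exact ν.nonneg _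
        _ ≤ ρ := by rw [one_mul]; exact hs
    · rw [hρ]; gcongr; exact ν.nonneg _
  have hcon : ContractingWith ⟨C * ρ, mul_nonneg (by linarith) hρ0⟩ (hmaps.restrict T _ _) := by
    refine ⟨?_, LipschitzWith.of_dist_le_mul fun s t => ?_⟩
    · exact hs
    · have := key s.1 t.1 (by have := s.2; rwa [Metric.mem_closedBall, hdist] at this)
        (by have := t.2; rwa [Metric.mem_closedBall, hdist] at this)
      rw [Subtype.dist_eq, Subtype.dist_eq, hdist, hdist]
      exact this
  obtain ⟨s, hs1, hs2, -⟩ := hcon.exists_fixedPoint' (Metric.isClosed_closedBall.isComplete) hmaps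
    (Metric.mem_closedBall_self hρ0) (edist_ne_top _ _)
  refine ⟨s, ?_, by rwa [Metric.mem_closedBall, hdist] at hs1⟩
  have : u * f.eval s = 0 := by
    have : s - u * f.eval s = s := hs2
    simpa using this
  calc f.eval s = (u * f.derivative.eval a) * f.eval s := by rw [hu, one_mul]
    _ = f.derivative.eval a * (u * f.eval s) := by ring
    _ = 0 := by rw [this, mul_zero]

/-- local field data -/
structure Loc (L : Type*) [NontriviallyNormedField L] (q : ℝ) : Prop where
  q0 : 0 < q
  q1 : q < 1
  ex : ∃ p : L, ‖p‖ = q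
  disc : ∀ x : L, x ≠ 0 → ∃ m : ℤ, ‖x‖ = q ^ m
  two : ‖(2 : L)‖ = 1

section nm
variable {L : Type*} [NontriviallyNormedField L] {Δ : Type*} [DivisionRing Δ] [Algebra L Δ]

variable (L) in
/-- the norm on a division algebra -/
noncomputable def nm (x : Δ) : ℝ := spectralValue (minpoly L x)

theorem adjoin_comm {L : Type*} [Field L] {Δ : Type*} [DivisionRing Δ] [Algebra L Δ] (y : Δ) : ∀ a ∈ Algebra.adjoin L {y}, ∀ b ∈ Algebra.adjoin L {y}, a * b = b * a := fun a ha b hb => by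
  have := Algebra.commute_of_mem_adjoin_of_forall_mem_commute (R := L) (s := {y}) (a := a) (b := b) hb (fun c hc => by
    rw [Set.mem_singleton_iff.1 hc]
    exact (Algebra.commute_of_mem_adjoin_self ha).symm)
  exact this

theorem nm_nonneg (x : Δ) : 0 ≤ nm L x := spectralValue_nonneg _

variable [FiniteDimensional L Δ]

theorem nm_sub (M : Subalgebra L Δ) (h1 : ∀ x ∈ M, ∀ y ∈ M, x * y = y * x) (x : M) :
    letI := subField M h1 (subalg_inv M); nm L (x : Δ) = spectralNorm L M x := by
  letI := subField M h1 (subalg_inv M)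
  change spectralValue _ = spectralValue _
  congr 1
  exact minpoly.algHom_eq M.val Subtype.val_injective x

variable [CompleteSpace L] [IsUltrametricDist L]

theorem nm_pow (x : Δ) : nm L x ^ Module.finrank L Δ = ‖Algebra.norm L x‖ := by
  let M := Algebra.adjoin L {x}
  letI := subField M (adjoin_comm x) (subalg_inv M)
  let y : M := ⟨x, Algebra.self_mem_adjoin_singleton L x⟩
  have e1 : nm L x = spectralNorm L M y := nm_sub M (adjoin_comm x) y
  have hfin : Module.Finite M Δ := Module.Finite.of_restrictScalars_finite L M Δ
  have hy : Algebra.adjoin L {y} = ⊤ := by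
    rw [eq_top_iff]
    rintro ⟨z, hz⟩ -
    induction hz using Algebra.adjoin_induction with
    | mem w hw =>
      rw [Set.mem_singleton_iff] at hw; subst hw
      exact Algebra.self_mem_adjoin_singleton L y
    | algebraMap r => exact Subalgebra.algebraMap_mem _ r
    | add a b ha hb h1 h2 => exact add_mem h1 h2
    | mul a b ha hb h1 h2 => exact mul_mem h1 h2
  let pb := PowerBasis.ofAdjoinEqTop' (Algebra.IsIntegral.isIntegral (R := L) y) hy
  have hpb : pb.gen = y := PowerBasis.ofAdjoinEqTop'_gen _ _
  have e2 : ‖Algebra.norm L y‖ = ‖(minpoly L y).coeff 0‖ := by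
    rw [← hpb, Algebra.PowerBasis.norm_gen_eq_coeff_zero_minpoly]
    simp
  have e3 : Module.finrank L M = (minpoly L y).natDegree := by
    rw [pb.finrank, PowerBasis.ofAdjoinEqTop'_dim]
  have e4 : nm L x ^ Module.finrank L M = ‖Algebra.norm L y‖ := by
    rw [e1, spectralNorm.spectralNorm_eq_norm_coeff_zero_rpow, e2, e3, one_div, Real.rpow_inv_natCast_pow (norm_nonneg _)]
    exact (minpoly.natDegree_pos (Algebra.IsIntegral.isIntegral y)).ne'
  have e5 : Algebra.norm L x = Algebra.norm L y ^ Module.finrank M Δ := by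
    have : (Algebra.lmul L Δ x) = ((y • LinearMap.id : Δ →ₗ[M] Δ)).restrictScalars L := by
      ext z; rfl
    rw [Algebra.norm_apply]
    change LinearMap.det (Algebra.lmul L Δ x) = _
    rw [this, LinearMap.det_restrictScalars, LinearMap.det_smul, LinearMap.det_id, mul_one, map_pow]
  rw [e5, norm_pow, ← e4, ← pow_mul, Module.finrank_mul_finrank]

theorem nm_mul (x y : Δ) : nm L (x * y) = nm L x * nm L y := by
  have h : Module.finrank L Δ ≠ 0 := Module.finrank_pos.ne'
  refine (pow_left_inj₀ (nm_nonneg _) (mul_nonneg (nm_nonneg _) (nm_nonneg _)) h).1 ?_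
  rw [mul_pow, nm_pow, nm_pow, nm_pow, map_mul, norm_mul]

theorem nm_algebraMap (c : L) : nm L (algebraMap L Δ c) = ‖c‖ := by
  rw [nm, minpoly.eq_X_sub_C_of_algebraMap_inj _ (algebraMap L Δ).injective]
  exact spectralValue_X_sub_C c

theorem nm_one : nm L (1 : Δ) = 1 := by
  have := nm_algebraMap (L := L) (Δ := Δ) 1
  simpa using this

theorem nm_zero : nm L (0 : Δ) = 0 := by
  have := nm_algebraMap (L := L) (Δ := Δ) 0
  simpa using this

theorem nm_eq_zero (x : Δ) (h : nm L x = 0) : x = 0 := by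
  by_contra hx
  have := nm_mul (L := L) x x⁻¹
  rw [mul_inv_cancel₀ hx, nm_one, h, zero_mul] at this
  exact one_ne_zero this

theorem nm_pos {x : Δ} (h : x ≠ 0) : 0 < nm L x := lt_of_le_of_ne (nm_nonneg x) fun h' => h (nm_eq_zero x h'.symm)

theorem nm_inv (x : Δ) : nm L x⁻¹ = (nm L x)⁻¹ := by
  by_cases hx : x = 0
  · simp [hx, nm_zero]
  have := nm_mul (L := L) x x⁻¹
  rw [mul_inv_cancel₀ hx, nm_one] at this
  exact eq_inv_of_mul_eq_one_right this.symm

theorem nm_add_le (x y : Δ) : nm L (x + y) ≤ max (nm L x) (nm L y) := by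
  by_cases hx : x = 0
  · rw [hx, zero_add]; exact le_max_right _ _
  have key : ∀ z : Δ, nm L (1 + z) ≤ max 1 (nm L z) := fun z => by
    let M := Algebra.adjoin L {z}
    letI := subField M (adjoin_comm z) (subalg_inv M)
    have h := isNonarchimedean_spectralNorm (K := L) (L := M) 1 ⟨z, Algebra.self_mem_adjoin_singleton L z⟩
    rw [← nm_sub M (adjoin_comm z), ← nm_sub M (adjoin_comm z), ← nm_sub M (adjoin_comm z)] at h
    have e : nm L ((1 : M) : Δ) = 1 := nm_one
    rw [e] at h
    exact h
  have e : x + y = x * (1 + x⁻¹ * y) := by rw [mul_add, mul_one, mul_inv_cancel_left₀ hx]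
  rw [e, nm_mul]
  calc nm L x * nm L (1 + x⁻¹ * y) ≤ nm L x * max 1 (nm L (x⁻¹ * y)) := mul_le_mul_of_nonneg_left (key _) (nm_nonneg x)
    _ = _ := by
      rw [mul_max_of_nonneg _ _ (nm_nonneg x), mul_one, ← nm_mul, mul_inv_cancel_left₀ hx]

theorem nm_smul (c : L) (x : Δ) : nm L (c • x) = ‖c‖ * nm L x := by
  rw [Algebra.smul_def, nm_mul, nm_algebraMap]

variable (L Δ) in
/-- the norm as VNorm -/
noncomputable def nmV : VNorm L Δ := ⟨nm L, nm_nonneg, nm_eq_zero, nm_add_le, nm_smul⟩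

theorem nmV_disc {q : ℝ} (hL : Loc L q) : (nmV L Δ).Disc q (Module.finrank L Δ) := fun x hx => by
  have h : Algebra.norm L x ≠ 0 := fun h => by
    have h2 := nm_pow (L := L) x
    rw [h, norm_zero] at h2
    exact hx (nm_eq_zero x (pow_eq_zero_iff (Module.finrank_pos.ne') |>.1 h2))
  obtain ⟨m, hm⟩ := hL.disc _ h
  exact ⟨m, (nm_pow x).trans hm⟩

theorem nm_of_minpoly {Δ' : Type*} [DivisionRing Δ'] [Algebra L Δ'] {x : Δ} {y : Δ'} (h : minpoly L x = minpoly L y) :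
    nm L x = nm L y := by rw [nm, nm, h]

theorem nm_hensel (f : Polynomial L) (hf : ∀ i, ‖f.coeff i‖ ≤ 1) (x : Δ) (hx : nm L x ≤ 1)
    (h1 : nm L (Polynomial.aeval x f.derivative) = 1) (h2 : nm L (Polynomial.aeval x f) < 1) :
    ∃ s ∈ Algebra.adjoin L {x}, Polynomial.aeval s f = 0 ∧ nm L (s - x) < 1 := by
  let M := Algebra.adjoin L {x}
  letI := subField M (adjoin_comm x) (subalg_inv M)
  let y : M := ⟨x, Algebra.self_mem_adjoin_singleton L x⟩
  let ν : VNorm L M := (nmV L Δ).restrict (Subalgebra.toSubmodule M)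
  have hev : ∀ (g : Polynomial L) (z : M), ((Polynomial.aeval z g : M) : Δ) = Polynomial.aeval (z : Δ) g := fun g z =>
    (Polynomial.aeval_algHom_apply M.val z g).symm
  have hmap : ∀ (g : Polynomial L) (z : M), (g.map (algebraMap L M)).eval z = Polynomial.aeval z g := fun g z => by
    rw [Polynomial.eval_map_algebraMap]
  have hy0 : Polynomial.aeval y f.derivative ≠ 0 := fun h => by
    have := hev f.derivative y
    rw [h] at this
    rw [show Polynomial.aeval x f.derivative = 0 from this.symm, nm_zero] at h1
    exact zero_ne_one h1
  have hu : ν.v (Polynomial.aeval y f.derivative)⁻¹ ≤ 1 := by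
    have h3 : nm L (((Polynomial.aeval y f.derivative)⁻¹ * Polynomial.aeval y f.derivative : M) : Δ) = 1 := by
      rw [inv_mul_cancel₀ hy0]; exact nm_one
    have h4 : ((((Polynomial.aeval y f.derivative)⁻¹ * Polynomial.aeval y f.derivative : M)) : Δ) = 
      (((Polynomial.aeval y f.derivative)⁻¹ : M) : Δ) * Polynomial.aeval x f.derivative := by
      rw [← hev f.derivative y]; rfl
    rw [h4, nm_mul, h1, mul_one] at h3
    exact h3.le
  have e2 : ν.v ((f.map (algebraMap L M)).eval y) = nm L (Polynomial.aeval x f) := by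
    rw [hmap]; exact congrArg (nm L) (hev f y)
  obtain ⟨s, hs1, hs2⟩ := newton ν (fun a b => (nm_mul a.1 b.1).le) (nm_one (L := L) (Δ := Δ)).le (f.map (algebraMap L M))
    (fun i => by
      rw [Polynomial.coeff_map]
      exact (nm_algebraMap (Δ := Δ) _).le.trans (hf i)) y hx (Polynomial.aeval y f.derivative)⁻¹ (by
      rw [Polynomial.derivative_map, hmap, inv_mul_cancel₀ hy0]) 1 le_rfl hu (by rw [one_mul, one_mul, e2]; exact h2)
  refine ⟨s.1, s.2, ?_, ?_⟩
  · rw [← hev, ← hmap, hs1]; rfl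
  · rw [one_mul, e2] at hs2
    exact lt_of_le_of_lt hs2 h2

end nm

section cas
variable (F : Type*) [Field F] (D : Type*) [DivisionRing D] [Algebra F D] 

/-- regular trace -/
noncomputable def rtr : D →ₗ[F] F := LinearMap.trace F D ∘ₗ (Algebra.lmul F D).toLinearMap

theorem rtr_comm (x y : D) : rtr F D (x * y) = rtr F D (y * x) := by
  change LinearMap.trace F D (Algebra.lmul F D (x * y)) = LinearMap.trace F D (Algebra.lmul F D (y * x))
  rw [map_mul (Algebra.lmul F D), map_mul (Algebra.lmul F D), LinearMap.trace_mul_comm]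

theorem rtr_algebraMap [FiniteDimensional F D] (c : F) : rtr F D (algebraMap F D c) = c * Module.finrank F D := by
  rw [Algebra.algebraMap_eq_smul_one, map_smul]
  change c • LinearMap.trace F D (Algebra.lmul F D 1) = _
  rw [map_one, LinearMap.trace_one, smul_eq_mul]

/-- dual families -/
structure DualFam {ι : Type*} [Fintype ι] [DecidableEq ι] (b c : ι → D) : Prop where
  d : ∀ i j, rtr F D (c i * b j) = if i = j then 1 else 0
  hc : ∀ x, x = ∑ i, rtr F D (x * b i) • c i
  hb : ∀ x, x = ∑ i, rtr F D (x * c i) • b i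
end cas

namespace DualFam
variable {F : Type*} [Field F] {D : Type*} [DivisionRing D] [Algebra F D] [FiniteDimensional F D]
  {ι : Type*} [Fintype ι] [DecidableEq ι] {b c : ι → D}

theorem symm (h : DualFam F D b c) : DualFam F D c b :=
  ⟨fun i j => by rw [rtr_comm, h.d]; simp [eq_comm], h.hb, h.hc⟩

theorem nondeg (h0 : (Module.finrank F D : F) ≠ 0) (x : D) (hx : ∀ y, rtr F D (x * y) = 0) : x = 0 := by
  by_contra hne
  have := hx x⁻¹
  rw [mul_inv_cancel₀ hne, ← map_one (algebraMap F D), rtr_algebraMap, one_mul] at this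
  exact h0 this

theorem exists_dual (h0 : (Module.finrank F D : F) ≠ 0) (b : Module.Basis ι F D) : ∃ c : ι → D, DualFam F D b c := by
  let φ : D →ₗ[F] (ι → F) := LinearMap.pi fun i => rtr F D ∘ₗ (LinearMap.mulRight F (b i))
  have hφ : Function.Injective φ := by
    rw [← LinearMap.ker_eq_bot, LinearMap.ker_eq_bot']
    intro x hx
    refine nondeg h0 x fun y => ?_
    rw [← b.sum_repr y, Finset.mul_sum, map_sum]
    refine Finset.sum_eq_zero fun i _ => ?_
    rw [mul_smul_comm, map_smul]
    have : rtr F D (x * b i) = 0 := congrFun hx i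
    rw [this, smul_zero]
  have hs : Function.Surjective φ := (LinearMap.injective_iff_surjective_of_finrank_eq_finrank (by
    rw [Module.finrank_fintype_fun_eq_card, Module.finrank_eq_card_basis b])).1 hφ
  choose c hc using fun i : ι => hs (Pi.single i 1)
  have hd : ∀ i j, rtr F D (c i * b j) = if i = j then 1 else 0 := fun i j => by
    have := congrFun (hc i) j
    rw [Pi.single_apply] at this
    simp only [@eq_comm _ i j]; exact this
  have h1 : ∀ x, x = ∑ i, rtr F D (x * b i) • c i := fun x => hφ (by
    ext j
    change rtr F D (x * b j) = rtr F D (_ * b j)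
    rw [Finset.sum_mul, map_sum]
    simp [smul_mul_assoc, hd])
  refine ⟨c, hd, h1, fun x => ?_⟩
  have h2 : ∀ j, rtr F D ((x - ∑ i, rtr F D (x * c i) • b i) * c j) = 0 := fun j => by
    rw [sub_mul, map_sub, Finset.sum_mul, map_sum]
    simp [smul_mul_assoc, rtr_comm F D (b _), hd]
  refine sub_eq_zero.1 (nondeg h0 _ fun y => ?_)
  rw [h1 y, Finset.mul_sum, map_sum]
  exact Finset.sum_eq_zero fun i _ => by rw [mul_smul_comm, map_smul, h2, smul_zero]

/-- Casimir operator commutes -/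
theorem comm (h : DualFam F D b c) {A : Type*} [Ring A] [Algebra F A] (ρ : D →ₐ[F] A) (f : A) (y : D) :
    ρ y * ∑ i, ρ (b i) * f * ρ (c i) = (∑ i, ρ (b i) * f * ρ (c i)) * ρ y := by
  have e1 : ∀ i, y * b i = ∑ j, rtr F D (c j * y * b i) • b j := fun i => by
    conv_lhs => rw [h.hb (y * b i)]
    exact Finset.sum_congr rfl fun j _ => by rw [rtr_comm F D (y * b i), mul_assoc]
  have e2 : ∀ j, c j * y = ∑ i, rtr F D (c j * y * b i) • c i := fun j => h.hc _
  rw [Finset.mul_sum, Finset.sum_mul]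
  calc _ = ∑ i, ∑ j, rtr F D (c j * y * b i) • (ρ (b j) * f * ρ (c i)) := by
        refine Finset.sum_congr rfl fun i _ => ?_
        rw [← mul_assoc, ← mul_assoc, ← map_mul, e1, map_sum, Finset.sum_mul, Finset.sum_mul]
        exact Finset.sum_congr rfl fun j _ => by rw [map_smul, smul_mul_assoc, smul_mul_assoc]
    _ = ∑ j, ∑ i, rtr F D (c j * y * b i) • (ρ (b j) * f * ρ (c i)) := Finset.sum_comm
    _ = _ := by
        refine Finset.sum_congr rfl fun j _ => ?_
        rw [mul_assoc, ← map_mul]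
        conv_rhs => rw [e2, map_sum, Finset.mul_sum]
        exact Finset.sum_congr rfl fun i _ => by rw [map_smul, mul_smul_comm]

theorem scalar [Algebra.IsCentral F D] (h : DualFam F D b c) (y : D) : ∃ l : F, ∑ i, b i * y * c i = algebraMap F D l := by
  have : ∑ i, b i * y * c i ∈ Subalgebra.center F D := by
    rw [Subalgebra.mem_center_iff]
    exact fun z => h.comm (AlgHom.id F D) y z
  obtain ⟨l, hl⟩ := Algebra.IsCentral.out this
  exact ⟨l, hl.symm⟩

theorem sum_one [Algebra.IsCentral F D] (h0 : (Module.finrank F D : F) ≠ 0) (hcard : Fintype.card ι = Module.finrank F D)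
    (h : DualFam F D b c) : ∑ i, b i * c i = 1 := by
  obtain ⟨l, hl⟩ := h.scalar 1
  simp only [mul_one] at hl
  have e := congrArg (rtr F D) hl
  rw [rtr_algebraMap, map_sum] at e
  have : ∀ i, rtr F D (b i * c i) = 1 := fun i => by rw [rtr_comm, h.d, if_pos rfl]
  simp only [this, Finset.sum_const, Finset.card_univ, nsmul_eq_mul, mul_one, hcard] at e
  rw [hl, mul_right_cancel₀ h0 (e.symm.trans (one_mul _).symm), map_one]

theorem sum_eq [Algebra.IsCentral F D] (h0 : (Module.finrank F D : F) ≠ 0) (hcard : Fintype.card ι = Module.finrank F D)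
    (h : DualFam F D b c) (y : D) : (Module.finrank F D : F) • ∑ i, b i * y * c i = algebraMap F D (rtr F D y) := by
  obtain ⟨l, hl⟩ := h.scalar y
  have e := congrArg (rtr F D) hl
  rw [rtr_algebraMap, map_sum] at e
  have e2 : ∑ i, rtr F D (b i * y * c i) = rtr F D ((∑ i, c i * b i) * y) := by
    rw [Finset.sum_mul, map_sum]
    exact Finset.sum_congr rfl fun i _ => by rw [rtr_comm, mul_assoc]
  rw [e2, h.symm.sum_one h0 hcard, one_mul] at e
  rw [hl, e, mul_comm, map_mul, Algebra.smul_def]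
end DualFam

/-- trace of an action -/
theorem trace_action {F : Type*} [Field F] {D : Type*} [DivisionRing D] [Algebra F D] [FiniteDimensional F D] [Algebra.IsCentral F D]
    (h0 : (Module.finrank F D : F) ≠ 0) {R : Type*} [Field R] [Algebra F R] {X : Type*} [AddCommGroup X] [Module R X]
    [FiniteDimensional R X] (A : DAct F D R X) (x : D) :
    (Module.finrank F D : R) * LinearMap.trace R X (A.a x) = Module.finrank R X * algebraMap F R (rtr F D x) := by
  obtain ⟨c, h⟩ := DualFam.exists_dual h0 (Module.finBasis F D)
  have e := congrArg (fun z => LinearMap.trace R X (A.a z)) (h.sum_eq h0 (by simp) x)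
  have ha : ∀ (r : F) (z : D), A.a (r • z) = algebraMap F R r • A.a z := fun r z => by
    ext m; rw [Algebra.smul_def, map_mul]; exact A.ha r _
  have ha2 : ∀ (r : F), A.a (algebraMap F D r) = algebraMap F R r • 1 := fun r => by
    ext m; exact A.ha r m
  simp only [ha, ha2, map_smul, LinearMap.trace_one, map_natCast, smul_eq_mul, map_sum, map_mul] at e
  rw [mul_comm (Module.finrank R X : R), ← e]
  congr 1
  have : ∀ i, LinearMap.trace R X (A.a ((Module.finBasis F D) i) * A.a x * A.a (c i)) = 
    LinearMap.trace R X (A.a (c i * (Module.finBasis F D) i) * A.a x) := fun i => by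
    rw [LinearMap.trace_mul_comm, ← mul_assoc, map_mul A.a]
  simp only [this]
  rw [← map_sum, ← Finset.sum_mul, ← map_sum, h.symm.sum_one h0 (by simp), map_one, one_mul]

section nmcas
variable {L : Type*} [NontriviallyNormedField L] [CompleteSpace L] [IsUltrametricDist L] {Δ : Type*} [DivisionRing Δ] [Algebra L Δ]
  [FiniteDimensional L Δ]

theorem norm_rtr_le {ι : Type*} [Fintype ι] [DecidableEq ι] {b : Module.Basis ι L Δ} (hb : (nmV L Δ).Orth b) (x : Δ) : ‖rtr L Δ x‖ ≤ nm L x := by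
  have : rtr L Δ x = ∑ i, b.repr (x * b i) i := by
    change LinearMap.trace L Δ (Algebra.lmul L Δ x) = _
    rw [LinearMap.trace_eq_matrix_trace L b, Matrix.trace]
    exact Finset.sum_congr rfl fun i _ => by rw [Matrix.diag_apply, LinearMap.toMatrix_apply]; rfl
  rw [this]
  refine IsUltrametricDist.norm_sum_le_of_forall_le_of_nonneg (nm_nonneg x) fun i _ => ?_
  have h := hb (x * b i) i
  change _ * nm L (b i) ≤ nm L (x * b i) at h
  rw [nm_mul] at h
  exact le_of_mul_le_mul_right h (nm_pos (b.ne_zero i))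

theorem nm_dual_le {ι : Type*} [Fintype ι] [DecidableEq ι] {b : Module.Basis ι L Δ} (hb : (nmV L Δ).Orth b) {c : ι → Δ}
    (h : DualFam L Δ b c) (hN : ‖(Module.finrank L Δ : L)‖ = 1) (i : ι) : nm L (b i) * nm L (c i) ≤ 1 := by
  have hc : c i ≠ 0 := fun h0 => by
    have := h.d i i
    rw [h0, zero_mul, map_zero, if_pos rfl] at this
    exact zero_ne_one this
  have h1 := hb (c i)⁻¹ i
  have h2 : b.repr (c i)⁻¹ i = rtr L Δ ((c i)⁻¹ * c i) := by
    conv_lhs => rw [h.hb (c i)⁻¹]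
    rw [b.repr_sum_self]
  rw [h2, inv_mul_cancel₀ hc] at h1
  have h3 : rtr L Δ (1 : Δ) = Module.finrank L Δ := by
    have := rtr_algebraMap L Δ 1
    rwa [map_one, one_mul] at this
  rw [h3, hN, one_mul] at h1
  change nm L (b i) ≤ nm L (c i)⁻¹ at h1
  rw [nm_inv] at h1
  have := nm_pos (L := L) hc
  calc _ ≤ (nm L (c i))⁻¹ * nm L (c i) := by gcongr
    _ = 1 := inv_mul_cancel₀ this.ne'

theorem VNorm.sum_lt {W : Type*} [AddCommGroup W] [Module L W] (ν : VNorm L W) {ι : Type*} (s : Finset ι) (f : ι → W) (C : ℝ) (hC : 0 < C)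
    (h : ∀ i ∈ s, ν.v (f i) < C) : ν.v (∑ i ∈ s, f i) < C := by
  classical
  induction s using Finset.induction_on with
  | empty => simpa [VNorm.v_zero] using hC
  | insert a s ha ih =>
    rw [Finset.sum_insert ha]
    exact lt_of_le_of_lt (ν.add_le _ _) (max_lt (h a (by simp)) (ih fun i hi => h i (by simp [hi])))

theorem exists_nm_dual [Algebra.IsCentral L Δ] {q : ℝ} (hL : Loc L q) (hN : ‖(Module.finrank L Δ : L)‖ = 1) :
    ∃ (b c : Fin (Module.finrank L Δ) → Δ), DualFam L Δ b c ∧ (∀ i, nm L (b i) * nm L (c i) ≤ 1) ∧ ∑ i, b i * c i = 1 ∧ ∑ i, c i * b i = 1 := by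
  have h0 : (Module.finrank L Δ : L) ≠ 0 := fun h => by rw [h, norm_zero] at hN; exact zero_ne_one hN
  obtain ⟨b, hb⟩ := (nmV L Δ).exists_orth hL.q0 hL.q1 (Module.finrank_pos (R := L) (M := Δ)).ne' (nmV_disc hL)
  obtain ⟨c, h⟩ := DualFam.exists_dual h0 b
  exact ⟨b, c, h, nm_dual_le hb h hN, h.sum_one h0 (by simp), h.symm.sum_one h0 (by simp)⟩

theorem gr_central [Algebra.IsCentral L Δ] {q : ℝ} (hL : Loc L q) (hN : ‖(Module.finrank L Δ : L)‖ = 1) (r : Δ)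
    (hr : r ≠ 0) (h : ∀ x ≠ 0, nm L (x * r - r * x) < nm L x * nm L r) : ∃ l : L, nm L (r - algebraMap L Δ l) < nm L r := by
  obtain ⟨b, c, hd, hbc, h1, -⟩ := exists_nm_dual (Δ := Δ) hL hN
  obtain ⟨l, hl⟩ := hd.scalar r
  refine ⟨l, ?_⟩
  have e : r - algebraMap L Δ l = ∑ i, -((b i * r - r * b i) * c i) := by
    rw [← hl]
    have e0 : r = ∑ i, r * (b i * c i) := by rw [← Finset.mul_sum, h1, mul_one]
    rw [sub_eq_iff_eq_add, ← Finset.sum_add_distrib]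
    refine e0.trans ?_
    exact Finset.sum_congr rfl fun i _ => by rw [sub_mul, neg_sub, mul_assoc r, sub_add_cancel]
  rw [e]
  refine (nmV L Δ).sum_lt _ _ _ (nm_pos hr) fun i _ => ?_
  rw [VNorm.v_neg]
  change nm L _ < _
  by_cases hb : b i = 0
  · simp [hb, nm_zero, nm_pos hr]
  by_cases hc : c i = 0
  · simp [hc, nm_zero, nm_pos hr]
  rw [nm_mul]
  calc _ < nm L (b i) * nm L r * nm L (c i) := mul_lt_mul_of_pos_right (h _ hb) (nm_pos hc)
    _ = nm L (b i) * nm L (c i) * nm L r := by ring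
    _ ≤ _ := mul_le_of_le_one_left (nm_nonneg r) (hbc i)

end nmcas

section resid
variable (L : Type*) [NontriviallyNormedField L] [CompleteSpace L] [IsUltrametricDist L] (Δ : Type*) [DivisionRing Δ] [Algebra L Δ]
  [FiniteDimensional L Δ]

/-- integers of a division algebra -/
def OO : Subring Δ where
  carrier := {x | nm L x ≤ 1}
  mul_mem' := fun {x y} hx hy => by
    change nm L (x * y) ≤ 1; rw [nm_mul]; exact mul_le_one₀ hx (nm_nonneg y) hy
  one_mem' := nm_one.le
  add_mem' := fun {x y} hx hy => (nm_add_le x y).trans (max_le hx hy)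
  zero_mem' := by change nm L 0 ≤ 1; rw [nm_zero]; exact zero_le_one
  neg_mem' := fun {x} hx => by
    change (nmV L Δ).v (-x) ≤ 1; rw [VNorm.v_neg]; exact hx

/-- residue data -/
structure Resid (R : Type*) [DivisionRing R] where
  ψ : OO L Δ →+* R
  surj : Function.Surjective ψ
  ker : ∀ x, ψ x = 0 ↔ nm L x.1 < 1

/-- the maximal ideal -/
def MM : Ideal (OO L Δ) where
  carrier := {x | nm L x.1 < 1}
  add_mem' := fun {x y} hx hy => lt_of_le_of_lt (nm_add_le x.1 y.1) (max_lt hx hy)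
  zero_mem' := by change nm L 0 < 1; rw [nm_zero]; exact zero_lt_one
  smul_mem' := fun c x hx => by
    change nm L (c.1 * x.1) < 1; rw [nm_mul]; exact mul_lt_one_of_nonneg_of_lt_one_right c.2 (nm_nonneg _) hx
end resid

theorem exists_resid (L : Type*) [NontriviallyNormedField L] [CompleteSpace L] [IsUltrametricDist L] (Δ : Type u) [DivisionRing Δ] [Algebra L Δ]
  [FiniteDimensional L Δ] : ∃ (R : Type u) (_ : DivisionRing R), Nonempty (Resid L Δ R) := by
  have h2 : (MM L Δ).IsTwoSided := ⟨fun {a} b ha => by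
    change nm L (a.1 * b.1) < 1; rw [nm_mul]; exact mul_lt_one_of_nonneg_of_lt_one_left (nm_nonneg _) ha b.2⟩
  have hnt : Nontrivial (OO L Δ ⧸ MM L Δ) := Ideal.Quotient.nontrivial_iff.2 (by
    rw [Ideal.ne_top_iff_one]; intro h; change nm L (1 : Δ) < 1 at h; rw [nm_one] at h; exact lt_irrefl _ h)
  have hu : ∀ a : OO L Δ ⧸ MM L Δ, IsUnit a ∨ a = 0 := by
    intro a
    obtain ⟨x, rfl⟩ := Ideal.Quotient.mk_surjective a
    by_cases h : nm L x.1 < 1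
    · right; exact Ideal.Quotient.eq_zero_iff_mem.2 h
    · left
      have h1 : nm L x.1 = 1 := le_antisymm x.2 (not_lt.1 h)
      have h0 : x.1 ≠ 0 := fun h0 => by rw [h0, nm_zero] at h1; exact zero_ne_one h1
      let y : OO L Δ := ⟨x.1⁻¹, by change nm L _ ≤ 1; rw [nm_inv, h1, inv_one]⟩
      have e1 : x * y = 1 := Subtype.ext (mul_inv_cancel₀ h0)
      have e2 : y * x = 1 := Subtype.ext (inv_mul_cancel₀ h0)
      exact ⟨⟨Ideal.Quotient.mk _ x, Ideal.Quotient.mk _ y, by rw [← map_mul, e1, map_one], by rw [← map_mul, e2, map_one]⟩, rfl⟩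
  letI dr : DivisionRing (OO L Δ ⧸ MM L Δ) := DivisionRing.ofIsUnitOrEqZero hu
  exact ⟨_, dr, ⟨⟨Ideal.Quotient.mk _, Ideal.Quotient.mk_surjective, fun x => Ideal.Quotient.eq_zero_iff_mem⟩⟩⟩

namespace Resid
variable {L : Type*} [NontriviallyNormedField L] [CompleteSpace L] [IsUltrametricDist L] {Δ : Type*} [DivisionRing Δ] [Algebra L Δ]
  [FiniteDimensional L Δ] {R : Type*} [DivisionRing R] (ρ : Resid L Δ R)

open Classical in
/-- residue as a total function -/
noncomputable def r (x : Δ) : R := if h : nm L x ≤ 1 then ρ.ψ ⟨x, h⟩ else 0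

theorem r_def {x : Δ} (h : nm L x ≤ 1) : ρ.r x = ρ.ψ ⟨x, h⟩ := dif_pos h

theorem r_mul {x y : Δ} (hx : nm L x ≤ 1) (hy : nm L y ≤ 1) : ρ.r (x * y) = ρ.r x * ρ.r y := by
  rw [r_def ρ hx, r_def ρ hy, ← map_mul]; exact r_def ρ ((OO L Δ).mul_mem hx hy)

theorem r_add {x y : Δ} (hx : nm L x ≤ 1) (hy : nm L y ≤ 1) : ρ.r (x + y) = ρ.r x + ρ.r y := by
  rw [r_def ρ hx, r_def ρ hy, ← map_add]; exact r_def ρ ((OO L Δ).add_mem hx hy)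

theorem r_sub {x y : Δ} (hx : nm L x ≤ 1) (hy : nm L y ≤ 1) : ρ.r (x - y) = ρ.r x - ρ.r y := by
  rw [r_def ρ hx, r_def ρ hy, ← map_sub]; exact r_def ρ ((OO L Δ).sub_mem hx hy)

theorem r_one : ρ.r 1 = 1 := by rw [r_def ρ nm_one.le]; exact map_one ρ.ψ

theorem r_zero_iff {x : Δ} (hx : nm L x ≤ 1) : ρ.r x = 0 ↔ nm L x < 1 := by rw [r_def ρ hx]; exact ρ.ker _

theorem r_eq {x y : Δ} (hx : nm L x ≤ 1) (hy : nm L y ≤ 1) : ρ.r x = ρ.r y ↔ nm L (x - y) < 1 := by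
  rw [← sub_eq_zero, ← r_sub ρ hx hy]; exact r_zero_iff ρ ((OO L Δ).sub_mem hx hy)

theorem ex (t : R) : ∃ x, nm L x ≤ 1 ∧ ρ.r x = t := by
  obtain ⟨x, rfl⟩ := ρ.surj t
  exact ⟨x.1, x.2, r_def ρ x.2⟩

theorem ex1 (t : R) (ht : t ≠ 0) : ∃ x, nm L x = 1 ∧ ρ.r x = t := by
  obtain ⟨x, hx, rfl⟩ := ρ.ex t
  exact ⟨x, le_antisymm hx (not_lt.1 fun h => ht ((ρ.r_zero_iff hx).2 h)), rfl⟩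

theorem exists_lift {S : Type*} [Ring S] (g : OO L Δ →+* S) (hg : ∀ x, nm L x.1 < 1 → g x = 0) :
    ∃ e : R →+* S, ∀ x : OO L Δ, e (ρ.r x.1) = g x := by
  let e := RingHom.liftOfSurjective ρ.ψ ρ.surj ⟨g, fun x hx => hg x ((ρ.ker x).1 hx)⟩
  refine ⟨e, fun x => ?_⟩
  rw [r_def ρ x.2]
  exact RingHom.liftOfRightInverse_comp_apply ρ.ψ _ _ ⟨g, _⟩ x

theorem nm_conj {y : Δ} (hy : y ≠ 0) (x : Δ) : nm L (y * x * y⁻¹) = nm L x := by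
  rw [nm_mul, nm_mul, nm_inv, mul_comm (nm L y), mul_assoc, mul_inv_cancel₀ (nm_pos hy).ne', mul_one]

theorem exists_cj0 {y : Δ} (hy : y ≠ 0) : ∃ e : R →+* R, ∀ x, nm L x ≤ 1 → e (ρ.r x) = ρ.r (y * x * y⁻¹) := by
  have hm : ∀ x, nm L x ≤ 1 → nm L (y * x * y⁻¹) ≤ 1 := fun x hx => by rw [nm_conj hy]; exact hx
  let g : OO L Δ →+* R :=
    { toFun := fun x => ρ.r (y * x.1 * y⁻¹)
      map_one' := by
        change ρ.r (y * 1 * y⁻¹) = 1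
        rw [mul_one, mul_inv_cancel₀ hy, r_one]
      map_mul' := fun a b => by
        rw [← r_mul ρ (hm _ a.2) (hm _ b.2)]
        congr 1
        change y * (a.1 * b.1) * y⁻¹ = _
        simp only [mul_assoc, inv_mul_cancel_left₀ hy]
      map_zero' := by
        change ρ.r (y * 0 * y⁻¹) = 0
        rw [mul_zero, zero_mul, r_zero_iff ρ (by rw [nm_zero]; exact zero_le_one), nm_zero]; exact zero_lt_one
      map_add' := fun a b => by
        rw [← r_add ρ (hm _ a.2) (hm _ b.2)]
        congr 1
        change y * (a.1 + b.1) * y⁻¹ = _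
        rw [mul_add, add_mul] }
  obtain ⟨e, he⟩ := ρ.exists_lift g (fun x hx => (r_zero_iff ρ (hm _ x.2)).2 (by rw [nm_conj hy]; exact hx))
  exact ⟨e, fun x hx => he ⟨x, hx⟩⟩

theorem exists_cj {y : Δ} (hy : y ≠ 0) : ∃ e : R ≃+* R, ∀ x, nm L x ≤ 1 → e (ρ.r x) = ρ.r (y * x * y⁻¹) := by
  obtain ⟨e, he⟩ := ρ.exists_cj0 hy
  obtain ⟨e', he'⟩ := ρ.exists_cj0 (inv_ne_zero hy)
  refine ⟨RingEquiv.ofRingHom e e' ?_ ?_, he⟩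
  · ext t
    obtain ⟨x, hx, rfl⟩ := ρ.ex t
    rw [RingHom.comp_apply, he' x hx, he _ (by rw [nm_conj (inv_ne_zero hy)]; exact hx)]
    simp [mul_assoc, hy]
  · ext t
    obtain ⟨x, hx, rfl⟩ := ρ.ex t
    rw [RingHom.comp_apply, he x hx, he' _ (by rw [nm_conj hy]; exact hx)]
    simp [mul_assoc, hy]

open Classical in
/-- conjugation on the residue ring -/
noncomputable def cj (y : Δ) : R ≃+* R := if hy : y ≠ 0 then Classical.choose (ρ.exists_cj hy) else RingEquiv.refl R

theorem cj_r {y : Δ} (hy : y ≠ 0) {x : Δ} (hx : nm L x ≤ 1) : ρ.cj y (ρ.r x) = ρ.r (y * x * y⁻¹) := by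
  rw [cj, dif_pos hy]; exact Classical.choose_spec (ρ.exists_cj hy) x hx

theorem cj_mul {y z : Δ} (hy : y ≠ 0) (hz : z ≠ 0) (t : R) : ρ.cj (y * z) t = ρ.cj y (ρ.cj z t) := by
  obtain ⟨x, hx, rfl⟩ := ρ.ex t
  rw [cj_r ρ (mul_ne_zero hy hz) hx, cj_r ρ hz hx, cj_r ρ hy (by rw [nm_conj hz]; exact hx)]
  simp [mul_assoc]

theorem cj_unit {y : Δ} (hy : nm L y = 1) (t : R) : ρ.cj y t = ρ.r y * t * (ρ.r y)⁻¹ := by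
  have h0 : y ≠ 0 := fun h0 => by rw [h0, nm_zero] at hy; exact zero_ne_one hy
  have hi : nm L y⁻¹ = 1 := by rw [nm_inv, hy, inv_one]
  obtain ⟨x, hx, rfl⟩ := ρ.ex t
  have e : (ρ.r y)⁻¹ = ρ.r y⁻¹ := by
    refine inv_eq_of_mul_eq_one_right ?_
    rw [← r_mul ρ hy.le hi.le, mul_inv_cancel₀ h0, r_one]
  rw [cj_r ρ h0 hx, e, ← r_mul ρ hy.le hx, ← r_mul ρ _ hi.le]
  rw [nm_mul, hy, one_mul]; exact hx

theorem cj_unit_center {y : Δ} (hy : nm L y = 1) (t : R) (ht : t ∈ Subring.center R) : ρ.cj y t = t := by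
  have h1 : ρ.r y ≠ 0 := fun h => by
    rw [r_zero_iff ρ hy.le, hy] at h; exact lt_irrefl _ h
  rw [cj_unit ρ hy, Subring.mem_center_iff.1 ht, mul_assoc, mul_inv_cancel₀ h1, mul_one]

theorem cj_algebraMap {c : L} (hc : c ≠ 0) (t : R) : ρ.cj (algebraMap L Δ c) t = t := by
  have h0 : algebraMap L Δ c ≠ 0 := by simpa using hc
  obtain ⟨x, hx, rfl⟩ := ρ.ex t
  rw [cj_r ρ h0 hx, Algebra.commutes, mul_assoc, mul_inv_cancel₀ h0, mul_one]

theorem cj_eq_iff {y x : Δ} (hy : y ≠ 0) (hx : nm L x ≤ 1) : ρ.cj y (ρ.r x) = ρ.r x ↔ nm L (y * x - x * y) < nm L y := by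
  rw [cj_r ρ hy hx, r_eq ρ (by rw [nm_conj hy]; exact hx) hx]
  have : y * x - x * y = (y * x * y⁻¹ - x) * y := by rw [sub_mul, mul_assoc (y * x), inv_mul_cancel₀ hy, mul_one]
  rw [this, nm_mul]
  exact (mul_lt_iff_lt_one_left (nm_pos hy)).symm

theorem r_alg_center {c : L} (hc : ‖c‖ ≤ 1) : ρ.r (algebraMap L Δ c) ∈ Subring.center R := by
  rw [Subring.mem_center_iff]
  intro t
  obtain ⟨x, hx, rfl⟩ := ρ.ex t
  have h : nm L (algebraMap L Δ c) ≤ 1 := by rwa [nm_algebraMap]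
  rw [← r_mul ρ hx h, ← r_mul ρ h hx, Algebra.commutes]

theorem isCentral (R : Type*) [DivisionRing R] : Algebra.IsCentral (Subring.center R) R := ⟨fun x hx => by
  rw [Subalgebra.mem_center_iff] at hx
  exact ⟨⟨x, Subring.mem_center_iff.2 hx⟩, rfl⟩⟩

/-- the residue ring is spanned by finitely many elements over the image of the base -/
theorem exists_span {q : ℝ} (hL : Loc L q) : ∃ g : Fin (Module.finrank L Δ) → R, ∀ t : R, ∃ c : Fin (Module.finrank L Δ) → L,
    (∀ i, ‖c i‖ ≤ 1) ∧ t = ∑ i, ρ.r (algebraMap L Δ (c i)) * g i := by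
  obtain ⟨b, hb⟩ := (nmV L Δ).exists_orth hL.q0 hL.q1 (Module.finrank_pos (R := L) (M := Δ)).ne' (nmV_disc hL)
  obtain ⟨p, hp⟩ := hL.ex
  have hp0 : p ≠ 0 := fun h => by rw [h, norm_zero] at hp; exact hL.q0.ne hp
  have : ∀ i, ∃ m : ℤ, nm L (b i) * q ^ m ≤ 1 ∧ 1 < nm L (b i) * q ^ (m - 1) := fun i => by
    have h0 := nm_pos (L := L) (b.ne_zero i)
    obtain ⟨m, hm1, hm2⟩ := exists_mem_Ioc_zpow h0 (one_lt_inv₀ hL.q0 |>.2 hL.q1)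
    rw [inv_zpow'] at hm1 hm2
    refine ⟨m + 1, ?_, ?_⟩
    · calc _ ≤ q ^ (-(m + 1)) * q ^ (m + 1) := by gcongr; exact zpow_nonneg hL.q0.le _
        _ = 1 := by rw [← zpow_add₀ hL.q0.ne']; simp
    · rw [add_sub_cancel_right]
      calc (1 : ℝ) = q ^ (-m) * q ^ m := by rw [← zpow_add₀ hL.q0.ne']; simp
        _ < _ := mul_lt_mul_of_pos_right hm1 (zpow_pos hL.q0 _)
  choose m hm1 hm2 using this
  have hn : ∀ i, nm L (algebraMap L Δ (p ^ m i) * b i) ≤ 1 := fun i => by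
    rw [nm_mul, nm_algebraMap, norm_zpow, hp, mul_comm]; exact hm1 i
  refine ⟨fun i => ρ.r (algebraMap L Δ (p ^ m i) * b i), fun t => ?_⟩
  obtain ⟨x, hx, rfl⟩ := ρ.ex t
  have hc : ∀ i, ‖b.repr x i * (p ^ m i)⁻¹‖ ≤ 1 := fun i => by
    by_cases h0 : b.repr x i = 0
    · simp [h0]
    obtain ⟨k, hk⟩ := hL.disc _ (mul_ne_zero h0 (inv_ne_zero (zpow_ne_zero (m i) hp0)))
    rw [hk]
    by_contra hlt
    push Not at hlt
    have hk0 : k ≤ -1 := by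
      by_contra h
      have : q ^ k ≤ 1 := zpow_le_one₀ hL.q0 hL.q1.le (by omega)
      linarith
    have h1 : ‖b.repr x i‖ = q ^ k * q ^ m i := by
      rw [← hk, norm_mul, norm_inv, norm_zpow, hp, mul_assoc, inv_mul_cancel₀ (zpow_pos hL.q0 _).ne', mul_one]
    have h2 : ‖b.repr x i‖ * nm L (b i) ≤ nm L x := hb x i
    have h3 : q ^ (m i - 1) ≤ ‖b.repr x i‖ := by
      rw [h1, ← zpow_add₀ hL.q0.ne']
      exact zpow_le_zpow_right_of_le_one₀ hL.q0 hL.q1.le (by omega)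
    have h4 := mul_le_mul_of_nonneg_right h3 (nm_nonneg (L := L) (b i))
    have h5 := hm2 i
    rw [mul_comm] at h5
    linarith
  refine ⟨fun i => b.repr x i * (p ^ m i)⁻¹, hc, ?_⟩
  have e : x = ∑ i, algebraMap L Δ (b.repr x i * (p ^ m i)⁻¹) * (algebraMap L Δ (p ^ m i) * b i) := by
    conv_lhs => rw [← b.sum_repr x]
    refine Finset.sum_congr rfl fun i _ => ?_
    rw [← mul_assoc, ← map_mul, mul_assoc, inv_mul_cancel₀ (zpow_ne_zero _ hp0), mul_one, Algebra.smul_def]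
  have hs : ∀ (s : Finset (Fin (Module.finrank L Δ))) (f : Fin (Module.finrank L Δ) → Δ), (∀ i, nm L (f i) ≤ 1) →
      ρ.r (∑ i ∈ s, f i) = ∑ i ∈ s, ρ.r (f i) := fun s f hf => by
    have : ∑ i ∈ s, f i = ((∑ i ∈ s, (⟨f i, hf i⟩ : OO L Δ) : OO L Δ) : Δ) := by
      rw [AddSubmonoidClass.coe_finset_sum]
    rw [this, r_def ρ (∑ i ∈ s, (⟨f i, hf i⟩ : OO L Δ) : OO L Δ).2, Subtype.coe_eta, map_sum]
    exact Finset.sum_congr rfl fun i _ => (r_def ρ (hf i)).symm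
  conv_lhs => rw [e]
  rw [hs _ _ (fun i => by
    rw [nm_mul, nm_algebraMap]; exact mul_le_one₀ (hc i) (nm_nonneg _) (hn i))]
  exact Finset.sum_congr rfl fun i _ => r_mul ρ (by rw [nm_algebraMap]; exact hc i) (hn i)

theorem finite_center (ρ : Resid L Δ R) {q : ℝ} (hL : Loc L q) : FiniteDimensional (Subring.center R) R := by
  obtain ⟨g, hg⟩ := ρ.exists_span hL
  refine Module.Finite.of_surjective (Fintype.linearCombination (Subring.center R) g) fun t => ?_
  obtain ⟨c, hc, ht⟩ := hg t
  refine ⟨fun i => ⟨ρ.r (algebraMap L Δ (c i)), ρ.r_alg_center (hc i)⟩, ?_⟩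
  rw [ht, Fintype.linearCombination_apply]; rfl

end Resid

section E
variable {L : Type*} [NontriviallyNormedField L] [CompleteSpace L] [IsUltrametricDist L] {Δ : Type*} [DivisionRing Δ] [Algebra L Δ]
  [FiniteDimensional L Δ] {R : Type*} [DivisionRing R]

theorem nm_neg (x : Δ) : nm L (-x) = nm L x := (nmV L Δ).v_neg x

theorem nm_ne_zero {x : Δ} (h : nm L x = 1) : x ≠ 0 := fun h0 => by rw [h0, nm_zero] at h; exact zero_ne_one h

theorem nm_zpow (x : Δ) (i : ℤ) : nm L (x ^ i) = nm L x ^ i := by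
  have hp : ∀ n : ℕ, nm L (x ^ n) = nm L x ^ n := fun n => by
    induction n with
    | zero => simp [nm_one]
    | succ n ih => rw [pow_succ, nm_mul, ih, pow_succ]
  cases i with
  | ofNat n => simpa using hp n
  | negSucc n => rw [zpow_negSucc, zpow_negSucc, nm_inv, hp]

theorem nm_npow (x : Δ) (n : ℕ) : nm L (x ^ n) = nm L x ^ n := by simpa using nm_zpow (L := L) x n

theorem nm_close {x y : Δ} (h : nm L (x - y) < nm L x) : nm L y = nm L x := by
  have h2 : nm L (y - x) < nm L x := by rw [← neg_sub, nm_neg]; exact h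
  refine le_antisymm ?_ ?_
  · have := nm_add_le (L := L) (y - x) x
    rw [sub_add_cancel] at this
    exact this.trans (max_le h2.le le_rfl)
  · by_contra hlt
    push Not at hlt
    have := nm_add_le (L := L) (x - y) y
    rw [sub_add_cancel] at this
    exact absurd (this.trans_lt (max_lt h hlt)) (lt_irrefl _)

theorem exists_unif {q : ℝ} (hL : Loc L q) : ∃ P : Δ, 1 < nm L P ∧ ∀ y : Δ, y ≠ 0 → ∃ i : ℤ, nm L y = nm L P ^ i := by
  obtain ⟨p, hp⟩ := hL.ex
  obtain ⟨P, hP, hmin⟩ := (nmV L Δ).exists_min hL.q0 hL.q1 (Module.finrank_pos (R := L) (M := Δ)).ne' (nmV_disc hL)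
    {x | 1 < nm L x} ⟨algebraMap L Δ p⁻¹, by
      change 1 < nm L _
      rw [nm_algebraMap, norm_inv, hp]; exact (one_lt_inv₀ hL.q0).2 hL.q1⟩ 1 one_pos (fun x hx => le_of_lt hx)
  have hP : 1 < nm L P := hP
  refine ⟨P, hP, fun y hy => ?_⟩
  have hP0 : (0 : ℝ) < nm L P := one_pos.trans hP
  obtain ⟨i, h1, h2⟩ := exists_mem_Ico_zpow (nm_pos (L := L) hy) hP
  refine ⟨i, le_antisymm (not_lt.1 fun hlt => ?_) h1⟩
  have h3 : 1 < nm L (y * P ^ (-i)) := by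
    rw [nm_mul, nm_zpow, zpow_neg, ← div_eq_mul_inv, one_lt_div (zpow_pos hP0 _)]; exact hlt
  have h4 : nm L P ≤ nm L (y * P ^ (-i)) := hmin _ h3
  rw [nm_mul, nm_zpow, zpow_neg, ← div_eq_mul_inv, le_div_iff₀ (zpow_pos hP0 _), ← zpow_one_add₀ hP0.ne', add_comm] at h4
  linarith

/-- `x` and `r` commute in the graded ring -/
def GC (L : Type*) [NontriviallyNormedField L] {Δ : Type*} [DivisionRing Δ] [Algebra L Δ] (r x : Δ) : Prop :=
  nm L (x * r - r * x) < nm L x * nm L r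

theorem GC.mul {r x y : Δ} (hr : r ≠ 0) (hx0 : x ≠ 0) (hy0 : y ≠ 0) (hx : GC L r x) (hy : GC L r y) : GC L r (x * y) := by
  have e : x * y * r - r * (x * y) = x * (y * r - r * y) + (x * r - r * x) * y := by noncomm_ring
  have h1 := nm_pos (L := L) hx0
  have h2 := nm_pos (L := L) hy0
  unfold GC at *
  rw [e, nm_mul x y]
  refine (nm_add_le _ _).trans_lt (max_lt ?_ ?_)
  · rw [nm_mul, mul_assoc]; gcongr
  · rw [nm_mul, mul_right_comm]; gcongr

theorem GC.inv {r x : Δ} (hx0 : x ≠ 0) (hx : GC L r x) : GC L r x⁻¹ := by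
  have e : x⁻¹ * r - r * x⁻¹ = -(x⁻¹ * (x * r - r * x) * x⁻¹) := by
    rw [mul_sub, sub_mul, inv_mul_cancel_left₀ hx0, mul_assoc, mul_assoc r, mul_inv_cancel₀ hx0, mul_one, neg_sub]
  have h1 := nm_pos (L := L) hx0
  unfold GC at *
  rw [e, nm_neg, nm_mul, nm_mul, nm_inv]
  calc (nm L x)⁻¹ * nm L (x * r - r * x) * (nm L x)⁻¹ < (nm L x)⁻¹ * (nm L x * nm L r) * (nm L x)⁻¹ := by gcongr
    _ = _ := by field_simp

theorem GC.symm {r x : Δ} (h : GC L r x) : GC L x r := by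
  unfold GC at *; rw [← neg_sub, nm_neg, mul_comm]; exact h

theorem GC.zpow {r x : Δ} (hr : r ≠ 0) (hx0 : x ≠ 0) (hx : GC L r x) (i : ℤ) : GC L r (x ^ i) := by
  have hp : ∀ n : ℕ, GC L r (x ^ n) := fun n => by
    induction n with
    | zero => unfold GC; simp [nm_one, nm_zero]; exact nm_pos hr
    | succ n ih => rw [pow_succ]; exact GC.mul hr (pow_ne_zero _ hx0) hx0 ih hx
  cases i with
  | ofNat n => simpa using hp n
  | negSucc n => rw [zpow_negSucc]; exact GC.inv (pow_ne_zero _ hx0) (hp _)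

theorem GC.all {P : Δ} (hP0 : P ≠ 0) (hP : ∀ y : Δ, y ≠ 0 → ∃ i : ℤ, nm L y = nm L P ^ i) {r : Δ} (hr : r ≠ 0)
    (h1 : ∀ x, nm L x = 1 → GC L r x) (h2 : GC L r P) (x : Δ) (hx : x ≠ 0) : GC L r x := by
  obtain ⟨i, hi⟩ := hP x hx
  have e : x = (x * P ^ (-i)) * P ^ i := by rw [mul_assoc, ← zpow_add₀ hP0]; simp
  rw [e]
  refine GC.mul hr (mul_ne_zero hx (zpow_ne_zero _ hP0)) (zpow_ne_zero _ hP0) (h1 _ ?_) (h2.zpow hr hP0 i)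
  rw [nm_mul, nm_zpow, hi, ← zpow_add₀ (nm_pos hP0).ne']; simp

theorem GC.val [Algebra.IsCentral L Δ] {q : ℝ} (hL : Loc L q) (hN : ‖(Module.finrank L Δ : L)‖ = 1)
    {P : Δ} (hP0 : P ≠ 0) (hP : ∀ y : Δ, y ≠ 0 → ∃ i : ℤ, nm L y = nm L P ^ i) {r : Δ} (hr : r ≠ 0)
    (h1 : ∀ x, nm L x = 1 → GC L r x) (h2 : GC L r P) : ∃ l : L, nm L (r - algebraMap L Δ l) < nm L r ∧ ‖l‖ = nm L r := by
  obtain ⟨l, hl⟩ := gr_central hL hN r hr (GC.all hP0 hP hr h1 h2)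
  exact ⟨l, hl, by rw [← nm_algebraMap (Δ := Δ), nm_close hl]⟩

variable (ρ : Resid L Δ R)

theorem Resid.gc_iff {y x : Δ} (hy : y ≠ 0) (hx : nm L x = 1) : ρ.cj y (ρ.r x) = ρ.r x ↔ GC L x y := by
  rw [ρ.cj_eq_iff hy hx.le, GC, hx, mul_one]

theorem Resid.center_gc {x : Δ} (hx : nm L x = 1) (h : ρ.r x ∈ Subring.center R) (y : Δ) (hy : nm L y = 1) : GC L x y :=
  (ρ.gc_iff (nm_ne_zero hy) hx).1 (ρ.cj_unit_center hy _ h)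

theorem Resid.r_ne {x : Δ} (hx : nm L x = 1) : ρ.r x ≠ 0 := fun h => by
  rw [ρ.r_zero_iff hx.le, hx] at h; exact lt_irrefl _ h

theorem Resid.fixed [Algebra.IsCentral L Δ] {q : ℝ} (hL : Loc L q) (hN : ‖(Module.finrank L Δ : L)‖ = 1)
    {P : Δ} (hP0 : P ≠ 0) (hP : ∀ y : Δ, y ≠ 0 → ∃ i : ℤ, nm L y = nm L P ^ i) (t : R) (ht : t ∈ Subring.center R)
    (ht0 : t ≠ 0) (h : ρ.cj P t = t) : ∃ l : L, ‖l‖ = 1 ∧ ρ.r (algebraMap L Δ l) = t := by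
  obtain ⟨x, hx, rfl⟩ := ρ.ex1 t ht0
  obtain ⟨l, h1, h2⟩ := GC.val hL hN hP0 hP (nm_ne_zero hx) (ρ.center_gc hx ht) ((ρ.gc_iff hP0 hx).1 h)
  refine ⟨l, h2.trans hx, ?_⟩
  rw [eq_comm, ρ.r_eq hx.le (by rw [nm_algebraMap, h2, hx]), ← hx]; exact h1

/-- inner correction -/
theorem Resid.exists_inner {q : ℝ} (hL : Loc L q) {y : Δ} (hy : y ≠ 0) (h : ∀ t ∈ Subring.center R, ρ.cj y t = t) :
    ∃ u : Δ, nm L u = 1 ∧ ∀ t, ρ.cj (u⁻¹ * y) t = t := by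
  haveI := ρ.finite_center hL
  haveI := Resid.isCentral R
  let φ : R →ₐ[Subring.center R] R := { (ρ.cj y : R →+* R) with commutes' := fun t => h t.1 t.2 }
  obtain ⟨v, hv0, hv⟩ := skolem_noether φ
  obtain ⟨u, hu, rfl⟩ := ρ.ex1 v hv0
  have hi : nm L u⁻¹ = 1 := by rw [nm_inv, hu, inv_one]
  refine ⟨u, hu, fun t => ?_⟩
  have e : ρ.r u⁻¹ = (ρ.r u)⁻¹ := by
    refine (inv_eq_of_mul_eq_one_right ?_).symm
    rw [← Resid.r_mul ρ hu.le hi.le, mul_inv_cancel₀ (nm_ne_zero hu), Resid.r_one]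
  rw [ρ.cj_mul (nm_ne_zero hi) hy, ρ.cj_unit hi, e, inv_inv, mul_assoc]
  have h3 : ρ.cj y t * ρ.r u = ρ.r u * t := hv t
  rw [h3, inv_mul_cancel_left₀ hv0]

end E

section E2
variable {L : Type*} [NontriviallyNormedField L] [CompleteSpace L] [IsUltrametricDist L] {Δ : Type*} [DivisionRing Δ] [Algebra L Δ]
  [FiniteDimensional L Δ] {R : Type*} [DivisionRing R]

theorem nm_op (x : Δᵐᵒᵖ) : nm L (unop x) = nm L x := by
  refine nm_of_minpoly (Δ' := Δᵐᵒᵖ) ?_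
  have hop : ∀ (p : Polynomial L) (y : Δ), Polynomial.aeval (op y) p = op (Polynomial.aeval y p) := fun p y => by
    rw [Polynomial.aeval_eq_sum_range, Polynomial.aeval_eq_sum_range]
    simp
  haveI : FiniteDimensional L Δᵐᵒᵖ := Module.Finite.equiv (MulOpposite.opLinearEquiv L : Δ ≃ₗ[L] Δᵐᵒᵖ)
  have hx : IsIntegral L (unop x) := IsIntegral.of_finite _ _
  have hx' : IsIntegral L x := IsIntegral.of_finite _ _
  refine Polynomial.eq_of_monic_of_associated (minpoly.monic hx) (minpoly.monic hx') (associated_of_dvd_dvd ?_ ?_)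
  · refine minpoly.dvd _ _ ?_
    apply op_injective
    rw [← hop, op_unop, minpoly.aeval, op_zero]
  · refine minpoly.dvd _ _ ?_
    rw [← op_unop x, hop, op_unop, minpoly.aeval, op_zero]

theorem nm_anti (θ : Δ →ₐ[L] Δᵐᵒᵖ) (x : Δ) : nm L (unop (θ x)) = nm L x := by
  rw [nm_op]
  exact nm_of_minpoly (Δ' := Δ) (minpoly.algHom_eq θ θ.injective x)

variable (ρ : Resid L Δ R)

theorem Resid.mem_center_iff {x : Δ} (hx : nm L x = 1) : ρ.r x ∈ Subring.center R ↔ ∀ y, nm L y = 1 → nm L (y * x - x * y) < 1 := by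
  constructor
  · intro h y hy
    have := ρ.center_gc hx h y hy
    rwa [GC, hx, hy, one_mul] at this
  · intro h
    rw [Subring.mem_center_iff]
    intro t
    by_cases ht : t = 0
    · rw [ht, zero_mul, mul_zero]
    obtain ⟨y, hy, rfl⟩ := ρ.ex1 t ht
    rw [← Resid.r_mul ρ hx.le hy.le, ← Resid.r_mul ρ hy.le hx.le, ρ.r_eq (by rw [nm_mul, hx, hy, one_mul]) (by rw [nm_mul, hx, hy, one_mul])]
    exact h y hy

theorem Resid.exists_op (θ : Δ →ₐ[L] Δᵐᵒᵖ) : ∃ e : R →+* Rᵐᵒᵖ, ∀ x : OO L Δ, e (ρ.r x.1) = op (ρ.r (unop (θ x.1))) := by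
  have hθ : ∀ x : Δ, nm L x ≤ 1 → nm L (unop (θ x)) ≤ 1 := fun x hx => by rw [nm_anti]; exact hx
  let g : OO L Δ →+* Rᵐᵒᵖ :=
    { toFun := fun x => op (ρ.r (unop (θ x.1)))
      map_one' := by change op (ρ.r (unop (θ 1))) = 1; rw [map_one, unop_one, Resid.r_one]; rfl
      map_zero' := by
        change op (ρ.r (unop (θ 0))) = 0
        rw [map_zero, unop_zero, (ρ.r_zero_iff (by rw [nm_zero]; exact zero_le_one)).2 (by rw [nm_zero]; exact zero_lt_one)]; rfl
      map_add' := fun a b => by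
        rw [← op_add, ← Resid.r_add ρ (hθ _ a.2) (hθ _ b.2), ← unop_add, ← map_add]; rfl
      map_mul' := fun a b => by
        rw [← op_mul, ← Resid.r_mul ρ (hθ _ b.2) (hθ _ a.2), ← unop_mul, ← map_mul]; rfl }
  exact ρ.exists_lift g (fun x hx => by
    change op (ρ.r (unop (θ x.1))) = 0
    rw [(ρ.r_zero_iff (hθ _ x.2)).2 (by rw [nm_anti]; exact hx)]; rfl)

theorem Resid.exists_tau (θ : Δ →ₐ[L] Δᵐᵒᵖ) : ∃ τ : Subring.center R →+* Subring.center R,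
    ∀ (x : Δ) (hx : nm L x ≤ 1) (h : ρ.r x ∈ Subring.center R), (τ ⟨ρ.r x, h⟩).1 = ρ.r (unop (θ x)) := by
  obtain ⟨e, he⟩ := ρ.exists_op θ
  have hsurj : ∀ y : Δ, ∃ x, unop (θ x) = y := fun y => by
    haveI : FiniteDimensional L Δᵐᵒᵖ := Module.Finite.equiv (MulOpposite.opLinearEquiv L : Δ ≃ₗ[L] Δᵐᵒᵖ)
    have h1 : Module.finrank L Δ = Module.finrank L Δᵐᵒᵖ := (MulOpposite.opLinearEquiv L : Δ ≃ₗ[L] Δᵐᵒᵖ).finrank_eq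
    obtain ⟨x, hx⟩ := (LinearMap.injective_iff_surjective_of_finrank_eq_finrank (f := θ.toLinearMap) h1).1 θ.injective (op y)
    exact ⟨x, by
      have : θ x = op y := hx
      rw [this, unop_op]⟩
  have hc : ∀ t : Subring.center R, unop (e t.1) ∈ Subring.center R := fun t => by
    rcases eq_or_ne t.1 0 with h0 | h0
    · rw [h0, map_zero, unop_zero]; exact Subring.zero_mem _
    obtain ⟨x, hx, hxt⟩ := ρ.ex1 t.1 h0
    have h1 := he ⟨x, hx.le⟩
    change e (ρ.r x) = op (ρ.r (unop (θ x))) at h1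
    rw [← hxt, h1, unop_op, ρ.mem_center_iff (by rw [nm_anti, hx])]
    intro y hy
    obtain ⟨y, rfl⟩ := hsurj y
    rw [nm_anti] at hy
    rw [← unop_mul, ← unop_mul, ← map_mul, ← map_mul, ← unop_sub, ← map_sub, nm_anti, ← neg_sub, nm_neg]
    exact (ρ.mem_center_iff hx).1 (hxt ▸ t.2) y hy
  refine ⟨{ toFun := fun t => ⟨unop (e t.1), hc t⟩, map_one' := ?_, map_mul' := ?_, map_zero' := ?_, map_add' := ?_ }, fun x hx h => ?_⟩
  · apply Subtype.ext; simp
  · intro a b; apply Subtype.ext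
    change unop (e (a.1 * b.1)) = unop (e a.1) * unop (e b.1)
    rw [map_mul, unop_mul]; exact (Subring.mem_center_iff.1 (hc a) _)
  · apply Subtype.ext; simp
  · intro a b; apply Subtype.ext; simp
  · have h1 := he ⟨x, hx⟩
    change e (ρ.r x) = op (ρ.r (unop (θ x))) at h1
    change unop (e (ρ.r x)) = _
    rw [h1, unop_op]

/-- conjugation by an element of the value group of the base acts trivially on the center -/
theorem Resid.cj_even {q : ℝ} (hL : Loc L q) {y : Δ} (hy : y ≠ 0) {m : ℤ} (h : nm L y = q ^ m) (t : R) (ht : t ∈ Subring.center R) :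
    ρ.cj y t = t := by
  obtain ⟨p, hp⟩ := hL.ex
  have hp0 : p ≠ 0 := fun h => by rw [h, norm_zero] at hp; exact hL.q0.ne hp
  have hc : algebraMap L Δ (p ^ m) ≠ 0 := fun h => zpow_ne_zero m hp0 ((map_eq_zero _).1 h)
  have e : y = algebraMap L Δ (p ^ m) * ((algebraMap L Δ (p ^ m))⁻¹ * y) := by rw [mul_inv_cancel_left₀ hc]
  rw [e, ρ.cj_mul hc (mul_ne_zero (inv_ne_zero hc) hy), ρ.cj_algebraMap (zpow_ne_zero m hp0)]
  refine ρ.cj_unit_center ?_ t ht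
  rw [nm_mul, nm_inv, nm_algebraMap, norm_zpow, hp, h, inv_mul_cancel₀ (zpow_pos hL.q0 _).ne']

theorem Resid.cj_same {y z : Δ} (hy : y ≠ 0) (hz : z ≠ 0) (h : nm L y = nm L z) (t : R) (ht : t ∈ Subring.center R) :
    ρ.cj y t = ρ.cj z t := by
  have e : y = z * (z⁻¹ * y) := by rw [mul_inv_cancel_left₀ hz]
  rw [e, ρ.cj_mul hz (mul_ne_zero (inv_ne_zero hz) hy), ρ.cj_unit_center (y := z⁻¹ * y) ?_ t ht]
  rw [nm_mul, nm_inv, h, inv_mul_cancel₀ (nm_pos hz).ne']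

theorem Resid.cj_center (y : Δ) (t : R) (ht : t ∈ Subring.center R) : ρ.cj y t ∈ Subring.center R :=
  (Subring.centerCongr (ρ.cj y) ⟨t, ht⟩).2

theorem Resid.sq_one [Algebra.IsCentral L Δ] {q : ℝ} (hL : Loc L q) (hN : ‖(Module.finrank L Δ : L)‖ = 1)
    {P : Δ} (hP0 : P ≠ 0) (hP : ∀ y : Δ, y ≠ 0 → ∃ i : ℤ, nm L y = nm L P ^ i) (θ : Δ →ₐ[L] Δᵐᵒᵖ)
    (t : R) (ht : t ∈ Subring.center R) : ρ.cj P (ρ.cj P t) = t := by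
  obtain ⟨τ, hτ⟩ := ρ.exists_tau θ
  let σ : RingAut (Subring.center R) := Subring.centerCongr (ρ.cj P)
  have hσ : ∀ s : Subring.center R, (σ s).1 = ρ.cj P s.1 := fun s => rfl
  have hσn : ∀ (n : ℕ) (s : Subring.center R), ((σ ^ n) s).1 = ρ.cj (P ^ n) s.1 := fun n => by
    induction n with
    | zero => intro s; rw [pow_zero, pow_zero, ρ.cj_unit_center nm_one _ s.2]; rfl
    | succ n ih =>
      intro s
      rw [pow_succ, pow_succ, ρ.cj_mul (pow_ne_zero _ hP0) hP0]
      change ((σ ^ n) (σ s)).1 = _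
      rw [ih, hσ]
  have hfin : σ ^ Module.finrank L Δ = 1 := by
    refine RingEquiv.ext fun s => Subtype.ext ?_
    rw [hσn]
    obtain ⟨m, hm⟩ := nmV_disc (Δ := Δ) hL P hP0
    rw [ρ.cj_even hL (pow_ne_zero _ hP0) (m := m) (by rw [nm_npow]; exact hm) _ s.2]; rfl
  let G := Subgroup.zpowers σ
  haveI : Finite G := by
    have : IsOfFinOrder σ := isOfFinOrder_iff_pow_eq_one.2 ⟨_, Module.finrank_pos (R := L) (M := Δ), hfin⟩
    exact (finite_zpowers.2 this).to_subtype
  have hτfix : ∀ s : Subring.center R, σ s = s → τ s = s := fun s hs => by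
    rcases eq_or_ne s 0 with h0 | h0
    · rw [h0, map_zero]
    obtain ⟨l, hl, h⟩ := ρ.fixed hL hN hP0 hP s.1 s.2 (fun h => h0 (Subtype.ext h)) (by rw [← hσ, hs])
    have h1 : s = ⟨ρ.r (algebraMap L Δ l), h ▸ s.2⟩ := Subtype.ext h.symm
    apply Subtype.ext
    conv_lhs => rw [h1]
    rw [hτ _ (by rw [nm_algebraMap, hl]), AlgHom.commutes, MulOpposite.algebraMap_apply, unop_op, h]
  let τ' : Subring.center R →ₐ[FixedPoints.subfield G (Subring.center R)] Subring.center R :=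
    { τ with commutes' := fun s => hτfix s.1 (s.2 ⟨σ, Subgroup.mem_zpowers σ⟩) }
  obtain ⟨g, hg⟩ := (FixedPoints.toAlgHom_bijective G (Subring.center R)).2 τ'
  have hg' : ∀ s, τ s = g.1 s := fun s => by
    have : τ' s = g.1 s := by rw [← hg]; rfl
    exact this
  obtain ⟨i, hi⟩ := Subgroup.mem_zpowers_iff.1 g.2
  have hcomm : ∀ s, g.1 (σ s) = σ (g.1 s) := fun s => by
    rw [← hi]
    change (σ ^ i * σ) s = (σ * σ ^ i) s
    rw [(Commute.zpow_self σ i).eq]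
  have hts : ∀ s : Subring.center R, σ (τ (σ s)) = τ s := fun s => by
    rcases eq_or_ne s 0 with h0 | h0
    · rw [h0]; simp
    obtain ⟨x, hx, hxs⟩ := ρ.ex1 s.1 (fun h => h0 (Subtype.ext h))
    have hP' : unop (θ P) ≠ 0 := fun h => by
      have := nm_anti θ P
      rw [h, nm_zero] at this; exact (nm_pos (L := L) hP0).ne this
    have h1 : s = ⟨ρ.r x, hxs ▸ s.2⟩ := Subtype.ext hxs.symm
    have h2 : σ s = ⟨ρ.r (P * x * P⁻¹), by rw [← ρ.cj_r hP0 hx.le, hxs]; exact ρ.cj_center _ _ s.2⟩ := Subtype.ext (by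
      rw [hσ]; exact (congrArg (ρ.cj P) hxs.symm).trans (ρ.cj_r hP0 hx.le))
    apply Subtype.ext
    rw [hσ, h2, hτ _ (by rw [Resid.nm_conj hP0, hx])]
    conv_rhs => rw [h1]
    rw [hτ _ hx.le, ← ρ.cj_same hP' hP0 (nm_anti θ P), ρ.cj_r hP' (by rw [nm_anti, Resid.nm_conj hP0, hx])]
    · rw [map_mul, map_mul, unop_mul, unop_mul, map_inv₀, unop_inv]
      simp only [mul_assoc, mul_inv_cancel_left₀ hP', mul_inv_cancel₀ hP', mul_one]
    · rw [← hτ (P * x * P⁻¹) (by rw [Resid.nm_conj hP0, hx]) (by rw [← ρ.cj_r hP0 hx.le, hxs]; exact ρ.cj_center _ _ s.2)]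
      exact Subtype.prop _
  have hfinal : ∀ s, σ (σ s) = s := fun s => by
    have h1 := hts (g.1⁻¹ s)
    rw [hg', hg', hcomm] at h1
    have h2 : g.1 (g.1⁻¹ s) = s := by
      change (g.1 * g.1⁻¹) s = s
      rw [mul_inv_cancel]; rfl
    rwa [h2] at h1
  exact congrArg Subtype.val (hfinal ⟨t, ht⟩)

end E2

/-- the structure of a local division algebra with an anti-automorphism -/
theorem local_structure {L : Type*} [NontriviallyNormedField L] [CompleteSpace L] [IsUltrametricDist L] {Δ : Type u} [DivisionRing Δ]
    [Algebra L Δ] [FiniteDimensional L Δ] [Algebra.IsCentral L Δ] {q : ℝ} (hL : Loc L q) (hN : ‖(Module.finrank L Δ : L)‖ = 1)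
    (θ : Δ →ₐ[L] Δᵐᵒᵖ) :
    (∀ x : Δ, x ≠ 0 → ∃ m : ℤ, nm L x = q ^ m) ∨
    ∃ (z : Δ) (c : L), z * z = algebraMap L Δ c ∧ ‖c‖ = 1 ∧ (∀ x : Δ, x ≠ 0 → ∃ m : ℤ, nm L x ^ 2 = q ^ m) ∧
      (∃ x : Δ, x ≠ 0 ∧ ∀ m : ℤ, nm L x ≠ q ^ m) ∧
      (∀ y : Δ, y ≠ 0 → (∃ m : ℤ, nm L y = q ^ m) → nm L (y * z - z * y) < nm L y) ∧
      (∀ y : Δ, y ≠ 0 → (∀ m : ℤ, nm L y ≠ q ^ m) → nm L (y * z + z * y) < nm L y) := by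
  obtain ⟨R, _, ⟨ρ⟩⟩ := exists_resid L Δ
  obtain ⟨P, hP1, hP⟩ := exists_unif (Δ := Δ) hL
  have hP0 : P ≠ 0 := fun h => by rw [h, nm_zero] at hP1; linarith
  have hPP : P * P ≠ 0 := mul_ne_zero hP0 hP0
  have hsq := ρ.sq_one hL hN hP0 hP θ
  have hval : ∀ l : L, ∀ r : Δ, r ≠ 0 → ‖l‖ = nm L r → ∃ m : ℤ, nm L r = q ^ m := fun l r hr h => by
    have : l ≠ 0 := fun h0 => by rw [h0, norm_zero] at h; exact (nm_pos (L := L) hr).ne h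
    obtain ⟨m, hm⟩ := hL.disc l this
    exact ⟨m, by rw [← h, hm]⟩
  by_cases hσ : ∀ t ∈ Subring.center R, ρ.cj P t = t
  · left
    obtain ⟨u, hu, hui⟩ := ρ.exists_inner hL hP0 hσ
    have hu0 := nm_ne_zero hu
    have hr : u⁻¹ * P ≠ 0 := mul_ne_zero (inv_ne_zero hu0) hP0
    have h1 : ∀ x, nm L x = 1 → GC L (u⁻¹ * P) x := fun x hx => ((ρ.gc_iff hr hx).1 (hui _)).symm
    have h2 : GC L (u⁻¹ * P) P := by
      have h := GC.mul hr hu0 hr (h1 u hu) (show GC L (u⁻¹ * P) (u⁻¹ * P) by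
        unfold GC; rw [sub_self, nm_zero]; exact mul_pos (nm_pos hr) (nm_pos hr))
      rwa [mul_inv_cancel_left₀ hu0] at h
    obtain ⟨l, -, hl⟩ := GC.val hL hN hP0 hP hr h1 h2
    obtain ⟨m, hm⟩ := hval l _ hr hl
    rw [nm_mul, nm_inv, hu, inv_one, one_mul] at hm
    intro x hx
    obtain ⟨i, hi⟩ := hP x hx
    exact ⟨m * i, by rw [hi, hm, zpow_mul]⟩
  · right
    push Not at hσ
    obtain ⟨t, ht, hts⟩ := hσ
    have hcj2 : ∀ s ∈ Subring.center R, ρ.cj (P * P) s = s := fun s hs => by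
      rw [ρ.cj_mul hP0 hP0]; exact hsq s hs
    obtain ⟨u, hu, hui⟩ := ρ.exists_inner hL hPP hcj2
    have hu0 := nm_ne_zero hu
    obtain ⟨r, hrdef⟩ : ∃ r, r = u⁻¹ * (P * P) := ⟨_, rfl⟩
    rw [← hrdef] at hui
    have hr : r ≠ 0 := hrdef ▸ mul_ne_zero (inv_ne_zero hu0) hPP
    have hur : u * r = P * P := by rw [hrdef, mul_inv_cancel_left₀ hu0]
    have h1 : ∀ x, nm L x = 1 → GC L r x := fun x hx => ((ρ.gc_iff hr hx).1 (hui _)).symm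
    -- w
    obtain ⟨w, hwdef⟩ : ∃ w, w = P * r * P⁻¹ * r⁻¹ := ⟨_, rfl⟩
    have hw : nm L w = 1 := by
      rw [hwdef, nm_mul, Resid.nm_conj hP0, nm_inv, mul_inv_cancel₀ (nm_pos hr).ne']
    have hwr : w * r = P * r * P⁻¹ := by rw [hwdef, mul_assoc, inv_mul_cancel₀ hr, mul_one]
    have hcji : ∀ s, ρ.cj P (ρ.cj P⁻¹ s) = s := fun s => by
      rw [← ρ.cj_mul hP0 (inv_ne_zero hP0), mul_inv_cancel₀ hP0, ρ.cj_unit nm_one, Resid.r_one]; simp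
    have hcw : ∀ s, ρ.cj w s = s := fun s => by
      have h := ρ.cj_mul (nm_ne_zero hw) hr s
      rw [hui, hwr, mul_assoc, ρ.cj_mul hP0 (mul_ne_zero hr (inv_ne_zero hP0)), ρ.cj_mul hr (inv_ne_zero hP0), hui, hcji] at h
      exact h.symm
    have hwr0 := ρ.r_ne hw
    have hwc : ρ.r w ∈ Subring.center R := by
      rw [Subring.mem_center_iff]
      intro s
      have h := hcw s
      rw [ρ.cj_unit hw] at h
      conv_lhs => rw [← h]
      rw [mul_assoc, inv_mul_cancel₀ hwr0, mul_one]
    have hcom : ∀ s, s * ρ.r w = ρ.r w * s := fun s => Subring.mem_center_iff.1 hwc s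
    have hu1 : ρ.cj P (ρ.r u) * ρ.r w = ρ.r u := by
      rw [ρ.cj_r hP0 hu.le, ← Resid.r_mul ρ (by rw [Resid.nm_conj hP0, hu]) hw.le]
      congr 1
      have : P * u * P⁻¹ * w * r = u * r := by
        rw [mul_assoc _ w, hwr]
        calc P * u * P⁻¹ * (P * r * P⁻¹) = P * u * (P⁻¹ * P) * r * P⁻¹ := by noncomm_ring
          _ = P * (u * r) * P⁻¹ := by rw [inv_mul_cancel₀ hP0]; noncomm_ring
          _ = _ := by rw [hur, mul_assoc, mul_assoc, mul_inv_cancel₀ hP0, mul_one]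
      exact mul_right_cancel₀ hr this
    have hu2 : ρ.cj P (ρ.cj P (ρ.r u)) = ρ.r u := by
      rw [← ρ.cj_mul hP0 hP0, ← hur, ρ.cj_mul hu0 hr, hui, ρ.cj_unit hu, mul_assoc, mul_inv_cancel₀ (ρ.r_ne hu), mul_one]
    have hwσ : ρ.r w * ρ.cj P (ρ.r w) = 1 := by
      have h3 : ρ.cj P (ρ.cj P (ρ.r u) * ρ.r w) = ρ.cj P (ρ.r u) := congrArg _ hu1
      rw [map_mul, hu2] at h3
      rw [← h3, mul_assoc] at hu1
      have h5 := ρ.r_ne hu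
      have h4 : ρ.cj P (ρ.r w) * ρ.r w = 1 := mul_left_cancel₀ h5 (by rw [hu1, mul_one])
      rw [← hcom, h4]
    -- y
    obtain ⟨s, hsc, hs0⟩ : ∃ s ∈ Subring.center R, s + ρ.r w * ρ.cj P s ≠ 0 := by
      by_cases hw1 : ρ.r w = -1
      · exact ⟨t, ht, by rw [hw1, neg_one_mul, ← sub_eq_add_neg]; exact sub_ne_zero.2 (Ne.symm hts)⟩
      · refine ⟨1, Subring.one_mem _, ?_⟩
        rw [map_one, mul_one]
        intro h
        exact hw1 (eq_neg_of_add_eq_zero_right h)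
    obtain ⟨y, hy, hys⟩ := ρ.ex1 _ hs0
    have hyc : ρ.r y ∈ Subring.center R := by
      rw [hys]; exact Subring.add_mem _ hsc (Subring.mul_mem _ hwc (ρ.cj_center _ _ hsc))
    have hyσ : ρ.cj P (ρ.r y) * ρ.r w = ρ.r y := by
      rw [hys, map_add, map_mul, hsq s hsc, add_mul, hcom, hcom, ← mul_assoc, hwσ, one_mul, add_comm]
    have hyr : y * r ≠ 0 := mul_ne_zero (nm_ne_zero hy) hr
    have g1 : ∀ x, nm L x = 1 → GC L (y * r) x := fun x hx =>
      (GC.mul (nm_ne_zero hx) (nm_ne_zero hy) hr (ρ.center_gc hy hyc x hx).symm (h1 x hx).symm).symm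
    have g2 : GC L (y * r) P := by
      have h3 : nm L (P * y * P⁻¹ * w - y) < 1 := by
        rw [← ρ.r_eq (by rw [nm_mul, Resid.nm_conj hP0, hy, hw, one_mul]) hy.le, Resid.r_mul ρ (by rw [Resid.nm_conj hP0, hy]) hw.le,
          ← ρ.cj_r hP0 hy.le, hyσ]
      have e : P * (y * r) - y * r * P = (P * y * P⁻¹ * w - y) * (r * P) := by
        have : P * y * P⁻¹ * w * (r * P) = P * (y * r) := by
          calc P * y * P⁻¹ * w * (r * P) = P * y * P⁻¹ * (w * r) * P := by noncomm_ring
            _ = P * y * (P⁻¹ * P) * r * (P⁻¹ * P) := by rw [hwr]; noncomm_ring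
            _ = _ := by rw [inv_mul_cancel₀ hP0]; noncomm_ring
        rw [sub_mul, this, mul_assoc]
      unfold GC
      rw [e, nm_mul, nm_mul, nm_mul y, hy, one_mul, mul_comm (nm L P)]
      exact mul_lt_of_lt_one_left (mul_pos (nm_pos hr) (nm_pos hP0)) h3
    obtain ⟨l, -, hl⟩ := GC.val hL hN hP0 hP hyr g1 g2
    obtain ⟨m, hm⟩ := hval l _ hyr hl
    rw [nm_mul, hy, one_mul, hrdef, nm_mul, nm_inv, hu, inv_one, one_mul, nm_mul, ← sq] at hm
    -- z
    obtain ⟨z0, hz0, hz0t⟩ := ρ.ex1 (t - ρ.cj P t) (sub_ne_zero.2 (Ne.symm hts))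
    have hz0c : ρ.r z0 ∈ Subring.center R := by rw [hz0t]; exact Subring.sub_mem _ ht (ρ.cj_center _ _ ht)
    have hσz0 : ρ.cj P (ρ.r z0) = -ρ.r z0 := by rw [hz0t, map_sub, hsq t ht, neg_sub]
    have hz2 : nm L (z0 * z0) = 1 := by rw [nm_mul, hz0, one_mul]
    obtain ⟨c, hc, hcz⟩ := ρ.fixed hL hN hP0 hP (ρ.r (z0 * z0))
      (by rw [Resid.r_mul ρ hz0.le hz0.le]; exact Subring.mul_mem _ hz0c hz0c) (ρ.r_ne hz2)
      (by rw [Resid.r_mul ρ hz0.le hz0.le, map_mul, hσz0, neg_mul_neg])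
    obtain ⟨z, -, hz, hzz⟩ := nm_hensel (Polynomial.X ^ 2 - Polynomial.C c) (fun i => by
        rw [Polynomial.coeff_sub, Polynomial.coeff_X_pow, Polynomial.coeff_C]
        rw [sub_eq_add_neg]
        refine (IsUltrametricDist.norm_add_le_max _ _).trans (max_le ?_ ?_)
        rotate_left
        · rw [norm_neg]; split_ifs <;> simp [hc]
        · split_ifs <;> simp) z0 hz0.le (by
        simp only [Polynomial.derivative_sub, Polynomial.derivative_X_pow, Polynomial.derivative_C, sub_zero, map_mul, Polynomial.aeval_X,
          Polynomial.aeval_C, map_pow]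
        rw [nm_mul, nm_algebraMap]
        simp [hL.two, hz0]) (by
        rw [map_sub, map_pow, Polynomial.aeval_X, Polynomial.aeval_C, sq, ← ρ.r_eq hz2.le (by rw [nm_algebraMap, hc]), hcz])
    rw [map_sub, map_pow, Polynomial.aeval_X, Polynomial.aeval_C, sub_eq_zero, sq] at hz
    have hzn : nm L z = 1 := by
      rw [← hz0]; apply nm_close; rw [hz0, ← neg_sub, nm_neg]; exact hzz
    have hrz : ρ.r z = ρ.r z0 := (ρ.r_eq hzn.le hz0.le).2 hzz
    have heven : ∀ y : Δ, y ≠ 0 → (∃ m : ℤ, nm L y = q ^ m) → nm L (y * z - z * y) < nm L y := fun y hy ⟨m, hm⟩ =>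
      (ρ.cj_eq_iff hy hzn.le).1 (ρ.cj_even hL hy hm _ (hrz ▸ hz0c))
    refine ⟨z, c, hz, hc, fun x hx => ?_, ⟨P, hP0, fun m hm => hts (ρ.cj_even hL hP0 hm t ht)⟩, heven, fun y hy hodd => ?_⟩
    · obtain ⟨i, hi⟩ := hP x hx
      exact ⟨m * i, by rw [hi, ← zpow_natCast, ← zpow_mul, mul_comm, zpow_mul, zpow_natCast, hm, zpow_mul]⟩
    · obtain ⟨i, hi⟩ := hP y hy
      rcases Int.even_or_odd' i with ⟨j, rfl | rfl⟩
      · exact absurd (by rw [hi, zpow_mul, zpow_ofNat, hm, zpow_mul]) (hodd (m * j))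
      have hyp : ∃ v : Δ, v ≠ 0 ∧ y = P * v ∧ nm L v = q ^ (m * j) := by
        refine ⟨P⁻¹ * y, mul_ne_zero (inv_ne_zero hP0) hy, by rw [mul_inv_cancel_left₀ hP0], ?_⟩
        rw [nm_mul, nm_inv, hi, zpow_add_one₀ (nm_pos hP0).ne', zpow_mul, zpow_ofNat, hm, mul_comm, mul_assoc,
          mul_inv_cancel₀ (nm_pos hP0).ne', mul_one, zpow_mul]
      obtain ⟨v, hv0, hyv, hv⟩ := hyp
      have h3 : ρ.cj y (ρ.r z) = -ρ.r z := by
        rw [hyv, ρ.cj_mul hP0 hv0, ρ.cj_even hL hv0 hv _ (hrz ▸ hz0c), hrz, hσz0]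
      have hzc : nm L (y * z * y⁻¹) ≤ 1 := by rw [Resid.nm_conj hy, hzn]
      rw [ρ.cj_r hy hzn.le, eq_neg_iff_add_eq_zero, ← Resid.r_add ρ hzc hzn.le,
        ρ.r_zero_iff ((nm_add_le _ _).trans (max_le hzc hzn.le))] at h3
      have e : y * z + z * y = (y * z * y⁻¹ + z) * y := by
        rw [add_mul, mul_assoc (y * z), inv_mul_cancel₀ hy, mul_one]
      rw [e, nm_mul]
      exact mul_lt_of_lt_one_left (nm_pos hy) h3
open Topology

section linind
variable {F : Type*} [Field F] {D : Type*} [DivisionRing D] [Algebra F D] {R : Type*} [Field R] [Algebra F R] {X : Type*} [AddCommGroup X]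
  [Module R X]

theorem DAct.map_algebraMap (A : DAct F D R X) (c : F) : A.a (algebraMap F D c) = algebraMap F R c • (1 : Module.End R X) :=
  LinearMap.ext fun x => A.ha c x

theorem DAct.map_smul (A : DAct F D R X) (c : F) (d : D) : A.a (c • d) = algebraMap F R c • A.a d := by
  rw [Algebra.smul_def, map_mul, A.map_algebraMap, smul_mul_assoc, one_mul]

theorem DAct.linInd_basis [FiniteDimensional F D] [Algebra.IsCentral F D] [Nontrivial X] (A : DAct F D R X) {ι : Type*} [Fintype ι]
    (β : Module.Basis ι F D) : LinearIndependent R (fun i => A.a (β i)) := by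
  classical
  rw [Fintype.linearIndependent_iff]
  intro g hg k
  obtain ⟨t, ht⟩ := sandwich_span β ((Algebra.linearMap F D) ∘ₗ β.coord k)
  have h1 : ∀ d, ∑ i, ∑ l, algebraMap F R (t i l) • (A.a (β i) * A.a d * A.a (β l)) = algebraMap F R (β.coord k d) • (1 : Module.End R X) := fun d => by
    rw [← A.map_algebraMap, show algebraMap F D (β.coord k d) = ∑ i, ∑ l, t i l • (β i * d * β l) from ht d, map_sum]
    refine Finset.sum_congr rfl fun i _ => ?_
    rw [map_sum]
    exact Finset.sum_congr rfl fun l _ => by rw [A.map_smul, map_mul, map_mul]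
  have h2 : ∑ j, g j • (∑ i, ∑ l, algebraMap F R (t i l) • (A.a (β i) * A.a (β j) * A.a (β l))) = 0 := by
    have : ∑ j, g j • (∑ i, ∑ l, algebraMap F R (t i l) • (A.a (β i) * A.a (β j) * A.a (β l))) =
        ∑ i, ∑ l, algebraMap F R (t i l) • (A.a (β i) * (∑ j, g j • A.a (β j)) * A.a (β l)) := by
      simp only [Finset.smul_sum, Finset.mul_sum, Finset.sum_mul, mul_smul_comm, smul_mul_assoc]
      rw [Finset.sum_comm]
      refine Finset.sum_congr rfl fun i _ => ?_
      rw [Finset.sum_comm]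
      refine Finset.sum_congr rfl fun l _ => Finset.sum_congr rfl fun j _ => ?_
      rw [smul_comm]
    rw [this, hg]; simp
  simp only [h1] at h2
  rw [Finset.sum_eq_single k] at h2
  · simpa using h2
  · intro j _ hj
    simp [Finsupp.single_eq_of_ne hj, Module.Basis.coord_apply, Finsupp.single_apply, hj]
  · simp

theorem DAct.linInd [FiniteDimensional F D] [Algebra.IsCentral F D] [Nontrivial X] (A : DAct F D R X) {ι : Type*} {v : ι → D}
    (hv : LinearIndependent F v) : LinearIndependent R (fun i => A.a (v i)) := by
  let β := Module.Basis.sumExtend hv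
  haveI := FiniteDimensional.fintypeBasisIndex β
  have h := (A.linInd_basis β).comp Sum.inl Sum.inl_injective
  have e : (fun i => A.a (v i)) = (fun i => A.a (β i)) ∘ Sum.inl := by
    funext i
    simp [β, Module.Basis.sumExtend]
    rfl
  rw [e]; exact h

theorem DAct.aeval (A : DAct F D R X) (d : D) (g : Polynomial F) :
    Polynomial.aeval (A.a d) (g.map (algebraMap F R)) = A.a (Polynomial.aeval d g) := by
  induction g using Polynomial.induction_on' with
  | add p q hp hq => simp [hp, hq]
  | monomial n c =>
    rw [Polynomial.map_monomial, Polynomial.aeval_monomial, Polynomial.aeval_monomial, map_mul, A.map_algebraMap, map_pow,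
      Algebra.algebraMap_eq_smul_one]

theorem DAct.aeval_eq_zero_iff [FiniteDimensional F D] [Algebra.IsCentral F D] [Nontrivial X] (A : DAct F D R X) (d : D) (g : Polynomial R) :
    Polynomial.aeval (A.a d) g = 0 ↔ (minpoly F d).map (algebraMap F R) ∣ g := by
  have hm : (minpoly F d).Monic := minpoly.monic (IsIntegral.of_finite F d)
  have hm' := hm.map (algebraMap F R)
  have h0 : Polynomial.aeval (A.a d) ((minpoly F d).map (algebraMap F R)) = 0 := by rw [A.aeval, minpoly.aeval, map_zero]
  constructor
  · intro h
    rw [← Polynomial.modByMonic_eq_zero_iff_dvd hm']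
    set r := g %ₘ (minpoly F d).map (algebraMap F R) with hr
    have hr0 : Polynomial.aeval (A.a d) r = 0 := by
      rw [hr, Polynomial.modByMonic_eq_sub_mul_div, map_sub, map_mul, h0, h]; simp
    have hdeg : r.degree < (minpoly F d).natDegree := by
      rw [← Polynomial.degree_eq_natDegree hm.ne_zero, ← Polynomial.degree_map (minpoly F d) (algebraMap F R)]
      exact Polynomial.degree_modByMonic_lt _ hm'
    have hli : LinearIndependent R fun i : Fin (minpoly F d).natDegree => A.a (d ^ (i : ℕ)) := A.linInd (linearIndependent_pow d)
    rw [Fintype.linearIndependent_iff] at hli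
    have hnd : r.natDegree < (minpoly F d).natDegree := by
      by_cases hr1 : r = 0
      · rw [hr1, Polynomial.natDegree_zero]; exact minpoly.natDegree_pos (IsIntegral.of_finite F d)
      · exact (Polynomial.natDegree_lt_iff_degree_lt hr1).2 hdeg
    have h2 := hli (fun i => r.coeff i) (by
      rw [Polynomial.aeval_def, Polynomial.eval₂_eq_sum_range' _ hnd] at hr0
      rw [Finset.sum_range] at hr0
      rw [← hr0]
      exact Finset.sum_congr rfl fun i _ => by rw [map_pow, Algebra.smul_def])
    ext i
    rw [Polynomial.coeff_zero]
    by_cases hi : i < (minpoly F d).natDegree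
    · exact h2 ⟨i, hi⟩
    · exact Polynomial.coeff_eq_zero_of_degree_lt (lt_of_lt_of_le hdeg (by exact_mod_cast not_lt.1 hi))
  · rintro ⟨k, rfl⟩
    rw [map_mul, h0, zero_mul]

end linind

theorem newton_op {L : Type*} [NontriviallyNormedField L] [CompleteSpace L] {A : Type*} [NormedRing A] [NormedAlgebra L A] [FiniteDimensional L A]
    (hu : ∀ x y : A, ‖x + y‖ ≤ max ‖x‖ ‖y‖) (h1 : ‖(1 : A)‖ ≤ 1) (P : Polynomial L) (hP : ∀ i, ‖P.coeff i‖ ≤ 1) (hsep : P.Separable) (a : A)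
    (ha : ‖a‖ ≤ 1) (haP : Polynomial.aeval a P = 0) (n : ℕ) (hli : LinearIndependent L (fun i : Fin n => a ^ (i : ℕ))) :
    ∀ᶠ b in 𝓝 a, LinearIndependent L (fun i : Fin n => b ^ (i : ℕ)) ∧ ∃ p : Polynomial L, Polynomial.aeval (Polynomial.aeval b p) P = 0 ∧
      LinearIndependent L (fun i : Fin n => (Polynomial.aeval b p) ^ (i : ℕ)) := by
  haveI : CompleteSpace A := FiniteDimensional.complete L A
  have hopen : ∀ᶠ b in 𝓝 a, LinearIndependent L (fun i : Fin n => b ^ (i : ℕ)) := by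
    have h : IsOpen {f : Fin n → A | LinearIndependent L f} := isOpen_setOfPred_linearIndependent
    have hc : Continuous fun b : A => fun i : Fin n => b ^ (i : ℕ) := by fun_prop
    exact (h.preimage hc).mem_nhds hli
  obtain ⟨ε, hε, hball⟩ := Metric.eventually_nhds_iff.1 hopen
  obtain ⟨u, v, huv⟩ := hsep
  set C := ‖Polynomial.aeval a v‖ + 1 with hC
  have hC1 : 1 ≤ C := by have := norm_nonneg (Polynomial.aeval a v); linarith
  have hcont : ∀ g : Polynomial L, Continuous fun b : A => Polynomial.aeval b g := fun g => Polynomial.continuous_aeval g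
  have ev1 : ∀ᶠ b in 𝓝 a, ‖Polynomial.aeval b v‖ < C := by
    refine ((hcont v).norm.tendsto a).eventually_lt_const ?_
    rw [hC]; linarith
  have ev2 : ∀ᶠ b in 𝓝 a, ‖Polynomial.aeval b (u * P)‖ < 1 := by
    refine ((hcont (u * P)).norm.tendsto a).eventually_lt_const ?_
    rw [map_mul, haP, mul_zero, norm_zero]; exact one_pos
  have ev3 : ∀ᶠ b in 𝓝 a, C * (C * ‖Polynomial.aeval b P‖) < 1 := by
    refine ((continuous_const.mul (continuous_const.mul (hcont P).norm)).tendsto a).eventually_lt_const ?_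
    simp [haP]
  have ev4 : ∀ᶠ b in 𝓝 a, C * ‖Polynomial.aeval b P‖ < ε := by
    refine ((continuous_const.mul (hcont P).norm).tendsto a).eventually_lt_const ?_
    simpa [haP] using hε
  have ev5 : ∀ᶠ b in 𝓝 a, ‖b - a‖ < 1 := by
    have := Metric.ball_mem_nhds a (one_pos : (0 : ℝ) < 1)
    filter_upwards [this] with b hb
    rwa [Metric.mem_ball, dist_eq_norm] at hb
  have ev6 : ∀ᶠ b in 𝓝 a, ‖b - a‖ < ε := by
    have := Metric.ball_mem_nhds a hε
    filter_upwards [this] with b hb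
    rwa [Metric.mem_ball, dist_eq_norm] at hb
  filter_upwards [hopen, ev1, ev2, ev3, ev4, ev5, ev6] with b hb0 hb1 hb2 hb3 hb4 hb5 hb6
  refine ⟨hb0, ?_⟩
  have hbn : ‖b‖ ≤ 1 := by
    have := hu (b - a) a
    rw [sub_add_cancel] at this
    exact this.trans (max_le hb5.le ha)
  let S := Algebra.adjoin L {b}
  letI : CommRing S := Algebra.adjoinCommRingOfComm L (s := {b}) (by rintro x rfl y rfl; rfl)
  haveI : FiniteDimensional L S := inferInstanceAs (FiniteDimensional L (Subalgebra.toSubmodule S))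
  let y : S := ⟨b, Algebra.self_mem_adjoin_singleton L b⟩
  let ν : VNorm L S := ⟨fun x => ‖(x : A)‖, fun x => norm_nonneg _, fun x hx => Subtype.ext (norm_eq_zero.1 hx), fun x y => hu _ _, fun c x => norm_smul c (x : A)⟩
  have hev : ∀ (g : Polynomial L) (z : S), ((Polynomial.aeval z g : S) : A) = Polynomial.aeval (z : A) g := fun g z =>
    (Polynomial.aeval_algHom_apply S.val z g).symm
  have hmap : ∀ (g : Polynomial L) (z : S), (g.map (algebraMap L S)).eval z = Polynomial.aeval z g := fun g z => by
    rw [Polynomial.eval_map_algebraMap]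
  set t : A := Polynomial.aeval b (u * P) with ht
  have hw : Polynomial.aeval b (v * P.derivative) = 1 - t := by
    rw [eq_sub_iff_add_eq, ht, ← map_add, add_comm, huv, map_one]
  let U : Aˣ := Units.oneSub t hb2
  have hU : (U : A) = 1 - t := rfl
  have hUi : ‖((U⁻¹ : Aˣ) : A)‖ ≤ 1 := by
    have e : ((U⁻¹ : Aˣ) : A) = 1 + t * ((U⁻¹ : Aˣ) : A) := by
      have := U.mul_inv
      rw [hU, sub_mul, one_mul] at this
      rw [← this]; abel
    have h3 := hu 1 (t * ((U⁻¹ : Aˣ) : A))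
    rw [← e] at h3
    rcases le_max_iff.1 h3 with h | h
    · exact h.trans h1
    · have h4 := h.trans (norm_mul_le _ _)
      by_contra hlt
      push Not at hlt
      nlinarith [norm_nonneg t]
  have hmem : ((U⁻¹ : Aˣ) : A) ∈ S := by
    have hUS : (U : A) ∈ S := by
      rw [hU, ← hw, ← hev _ y]; exact Subtype.prop _
    let f : S →ₗ[L] S := LinearMap.mulLeft L ⟨U, hUS⟩
    have hf : Function.Injective f := fun a b h => Subtype.ext (U.isUnit.mul_left_cancel (congrArg Subtype.val h))
    obtain ⟨z, hz⟩ := (LinearMap.injective_iff_surjective.1 hf) 1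
    have : (U : A) * z = 1 := congrArg Subtype.val hz
    rw [Units.inv_eq_of_mul_eq_one_right this]; exact z.2
  let w : S := ⟨((U⁻¹ : Aˣ) : A), hmem⟩
  obtain ⟨s, hs1, hs2⟩ := newton ν (fun a b => norm_mul_le _ _) h1 (P.map (algebraMap L S)) (fun i => by
      rw [Polynomial.coeff_map]
      change ‖algebraMap L A _‖ ≤ 1
      rw [norm_algebraMap]
      exact mul_le_one₀ (hP i) (norm_nonneg _) h1) y hbn (w * Polynomial.aeval y v) (by
      rw [Polynomial.derivative_map, hmap, mul_assoc, ← map_mul]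
      apply Subtype.ext
      change ((U⁻¹ : Aˣ) : A) * ((Polynomial.aeval y (v * P.derivative) : S) : A) = 1
      rw [hev]
      change ((U⁻¹ : Aˣ) : A) * (Polynomial.aeval b (v * P.derivative)) = 1
      rw [hw, ← hU, Units.inv_mul]) C hC1 (by
      change ‖((U⁻¹ : Aˣ) : A) * ((Polynomial.aeval y v : S) : A)‖ ≤ C
      rw [hev]
      refine (norm_mul_le _ _).trans ?_
      change _ * ‖Polynomial.aeval b v‖ ≤ C
      nlinarith [norm_nonneg (Polynomial.aeval b v), norm_nonneg (((U⁻¹ : Aˣ) : A))]) (by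
      rw [hmap]
      change C * (C * ‖((Polynomial.aeval y P : S) : A)‖) < 1
      rw [hev]; exact hb3)
  obtain ⟨p, hp⟩ : ∃ p : Polynomial L, Polynomial.aeval b p = s.1 := by
    have : s.1 ∈ Algebra.adjoin L {b} := s.2
    rw [Algebra.adjoin_singleton_eq_range_aeval] at this
    exact this
  refine ⟨p, ?_, ?_⟩
  · rw [hp, ← hev, ← hmap, hs1]; rfl
  · rw [hp]
    apply hball
    rw [dist_eq_norm]
    have h3 : ‖s.1 - b‖ < ε := by
      rw [hmap] at hs2
      change ‖s.1 - b‖ ≤ C * ‖((Polynomial.aeval y P : S) : A)‖ at hs2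
      rw [hev] at hs2
      exact hs2.trans_lt hb4
    have h4 := hu (s.1 - b) (b - a)
    rw [sub_add_sub_cancel] at h4
    exact h4.trans_lt (max_lt h3 hb6)

theorem le_natDegree_of_linInd {L A : Type*} [Field L] [Ring A] [Algebra L A] [FiniteDimensional L A] (s : A) (n : ℕ)
    (h : LinearIndependent L (fun i : Fin n => s ^ (i : ℕ))) : n ≤ (minpoly L s).natDegree := by
  by_contra hlt
  push Not at hlt
  have h1 := minpoly.aeval L s
  rw [Polynomial.aeval_eq_sum_range' hlt, Finset.sum_range] at h1
  have h2 := Fintype.linearIndependent_iff.1 h (fun i => (minpoly L s).coeff i) h1 ⟨_, hlt⟩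
  have h3 := minpoly.monic (IsIntegral.of_finite L s)
  rw [Polynomial.Monic, Polynomial.leadingCoeff] at h3
  exact one_ne_zero (h3.symm.trans h2)

theorem minpoly_of_linInd {L A : Type*} [Field L] [Ring A] [Algebra L A] [FiniteDimensional L A] (s : A) (P : Polynomial L)
    (hP : P.Monic) (h0 : Polynomial.aeval s P = 0)
    (h : LinearIndependent L (fun i : Fin P.natDegree => s ^ (i : ℕ))) : minpoly L s = P :=
  (Polynomial.eq_of_monic_of_dvd_of_natDegree_le (minpoly.monic (IsIntegral.of_finite L s)) hP (minpoly.dvd L s h0)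
    (le_natDegree_of_linInd s _ h)).symm

theorem linInd_smul_pow {L A : Type*} [Field L] [Ring A] [Algebra L A] (s : A) (t : L) (ht : t ≠ 0) (n : ℕ)
    (h : LinearIndependent L (fun i : Fin n => s ^ (i : ℕ))) : LinearIndependent L (fun i : Fin n => (t • s) ^ (i : ℕ)) := by
  have := h.units_smul (fun i => (Units.mk0 t ht) ^ (i : ℕ))
  convert this using 2 with i
  rw [smul_pow]; rfl

theorem newton_op' {L : Type*} [NontriviallyNormedField L] [CompleteSpace L] {A : Type*} [NormedRing A] [NormedAlgebra L A] [FiniteDimensional L A]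
    (hu : ∀ x y : A, ‖x + y‖ ≤ max ‖x‖ ‖y‖) (h1 : ‖(1 : A)‖ ≤ 1) (P : Polynomial L) (hsep : P.Separable) (a : A)
    (haP : Polynomial.aeval a P = 0) (n : ℕ) (hli : LinearIndependent L (fun i : Fin n => a ^ (i : ℕ))) :
    ∀ᶠ b in 𝓝 a, LinearIndependent L (fun i : Fin n => b ^ (i : ℕ)) ∧ ∃ p : Polynomial L, Polynomial.aeval (Polynomial.aeval b p) P = 0 ∧
      LinearIndependent L (fun i : Fin n => (Polynomial.aeval b p) ^ (i : ℕ)) := by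
  have small : ∀ C : ℝ, ∃ t : L, t ≠ 0 ∧ ‖t‖ * C ≤ 1 := fun C => by
    obtain ⟨t, ht0, ht⟩ := NormedField.exists_norm_lt L (inv_pos.2 (by positivity : 0 < |C| + 1))
    refine ⟨t, norm_pos_iff.1 ht0, ?_⟩
    rw [lt_inv_comm₀ ht0 (by positivity)] at ht
    have h5 : C < ‖t‖⁻¹ := lt_of_le_of_lt (le_abs_self C) (by linarith)
    calc ‖t‖ * C ≤ ‖t‖ * ‖t‖⁻¹ := by gcongr
      _ = 1 := mul_inv_cancel₀ ht0.ne'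
  obtain ⟨s, hs0, hs⟩ := small ‖a‖
  let l : L → Polynomial L := fun r => Polynomial.C r * Polynomial.X
  have hl : ∀ r (x : A), Polynomial.aeval x (l r) = r • x := fun r x => by simp [l, Algebra.smul_def]
  obtain ⟨t, ht0, ht⟩ := small (∑ i ∈ (P.comp (l s⁻¹)).support, ‖(P.comp (l s⁻¹)).coeff i‖)
  let P2 := Polynomial.C t * P.comp (l s⁻¹)
  have hev : ∀ x : A, Polynomial.aeval (s • x) P2 = t • Polynomial.aeval x P := fun x => by
    simp only [P2, map_mul, Polynomial.aeval_comp, Polynomial.aeval_C, hl, Algebra.smul_def t]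
    rw [smul_smul, inv_mul_cancel₀ hs0, one_smul]
  have hcoef : ∀ i, ‖P2.coeff i‖ ≤ 1 := fun i => by
    rw [Polynomial.coeff_C_mul, norm_mul]
    by_cases hi : i ∈ (P.comp (l s⁻¹)).support
    · refine le_trans ?_ ht
      gcongr
      exact Finset.single_le_sum (f := fun i => ‖(P.comp (l s⁻¹)).coeff i‖) (fun j _ => norm_nonneg _) hi
    · rw [Polynomial.notMem_support_iff.1 hi]; simp
  have hsep2 : P2.Separable := by
    obtain ⟨u, v, huv⟩ := hsep
    refine ⟨Polynomial.C t⁻¹ * u.comp (l s⁻¹), Polynomial.C (t⁻¹ * s) * v.comp (l s⁻¹), ?_⟩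
    have h2 : P2.derivative = Polynomial.C t * (Polynomial.C s⁻¹ * P.derivative.comp (l s⁻¹)) := by
      simp [P2, l, Polynomial.derivative_comp]
    have h3 : Polynomial.C t⁻¹ * Polynomial.C t = 1 := by rw [← Polynomial.C_mul, inv_mul_cancel₀ ht0, Polynomial.C_1]
    have h4 : Polynomial.C s * Polynomial.C s⁻¹ = 1 := by rw [← Polynomial.C_mul, mul_inv_cancel₀ hs0, Polynomial.C_1]
    have h5 := congrArg (fun g => g.comp (l s⁻¹)) huv
    simp only [Polynomial.add_comp, Polynomial.mul_comp, Polynomial.one_comp] at h5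
    rw [h2, Polynomial.C_mul]
    simp only [P2]
    linear_combination (u.comp (l s⁻¹) * P.comp (l s⁻¹) + (Polynomial.C s * Polynomial.C s⁻¹) * v.comp (l s⁻¹) * P.derivative.comp (l s⁻¹)) * h3 +
      v.comp (l s⁻¹) * P.derivative.comp (l s⁻¹) * h4 + h5
  have key := newton_op hu h1 P2 hcoef hsep2 (s • a) (by rw [norm_smul]; exact hs) (by rw [hev, haP, smul_zero]) n (linInd_smul_pow a s hs0 n hli)
  have hc : Filter.Tendsto (fun b : A => s • b) (𝓝 a) (𝓝 (s • a)) := (continuous_const_smul s).tendsto a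
  filter_upwards [hc.eventually key] with b ⟨hb1, p, hb2, hb3⟩
  refine ⟨?_, Polynomial.C s⁻¹ * p.comp (l s), ?_⟩
  · have := linInd_smul_pow _ s⁻¹ (inv_ne_zero hs0) n hb1
    rwa [smul_smul, inv_mul_cancel₀ hs0, one_smul] at this
  have e : Polynomial.aeval b (Polynomial.C s⁻¹ * p.comp (l s)) = s⁻¹ • Polynomial.aeval (s • b) p := by
    rw [map_mul, Polynomial.aeval_comp, Polynomial.aeval_C, hl, Algebra.smul_def s⁻¹]
  rw [e]
  refine ⟨?_, linInd_smul_pow _ s⁻¹ (inv_ne_zero hs0) n hb3⟩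
  have h7 := hev (s⁻¹ • Polynomial.aeval (s • b) p)
  rw [smul_smul, mul_inv_cancel₀ hs0, one_smul, hb2] at h7
  exact (smul_eq_zero.1 h7.symm).resolve_left ht0

theorem DAct.exists_basis {L Δ X : Type*} [Field L] [DivisionRing Δ] [Algebra L Δ] [FiniteDimensional L Δ] [AddCommGroup X] [Module L X]
    [FiniteDimensional L X] (B : DAct L Δ L X) : ∃ (r : ℕ) (e : Fin r → X), Module.finrank L X = r * Module.finrank L Δ ∧
      (∀ a : Module.End L X, (∀ g x, a (B.a g x) = B.a g (a x)) → (∀ i, a (e i) = 0) → a = 0) ∧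
      ∀ y : Fin r → X, ∃ a : Module.End L X, (∀ g x, a (B.a g x) = B.a g (a x)) ∧ ∀ i, a (e i) = y i := by
  letI : Module Δ X := Module.compHom X B.a
  have hs : ∀ (g : Δ) x, g • x = B.a g x := fun g x => rfl
  haveI : IsScalarTower L Δ X := ⟨fun c g x => by
    rw [hs, hs, B.map_smul]; rfl⟩
  haveI : Module.Finite Δ X := Module.Finite.of_restrictScalars_finite L Δ X
  let e := Module.finBasis Δ X
  refine ⟨_, e, ?_, ?_, ?_⟩
  · rw [← Module.finrank_mul_finrank L Δ X, mul_comm]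
  · intro a ha h
    have : ({ toFun := a, map_add' := a.map_add, map_smul' := ha } : X →ₗ[Δ] X) = 0 := e.ext h
    exact LinearMap.ext fun x => LinearMap.congr_fun this x
  · intro y
    refine ⟨(e.constr ℕ y).restrictScalars L, fun g x => (e.constr ℕ y).map_smul g x, fun i => e.constr_basis ℕ y i⟩

theorem DAct.approx {F D L X : Type*} [Field F] [DivisionRing D] [Algebra F D] [FiniteDimensional F D]
    [NontriviallyNormedField L] [CompleteSpace L] [Algebra F L] (hd : DenseRange (algebraMap F L)) [AddCommGroup X] [Module L X]
    [FiniteDimensional L X] [Nontrivial X] (ν : VNorm L X) (A : DAct F D L X) (a : Module.End L X) (ha : a ∈ Submodule.span L (Set.range A.a))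
    (P : Polynomial L) (hP : P.Monic) (hsep : P.Separable) (haP : minpoly L a = P) :
    ∃ (d : D) (p : Polynomial L), P.natDegree ≤ (minpoly L (A.a d)).natDegree ∧ minpoly L (Polynomial.aeval (A.a d) p) = P := by
  classical
  letI := ν.nacg; letI := ν.ns
  let e : Module.End L X ≃ₐ[L] (X →L[L] X) := Module.End.toContinuousLinearMap X
  have hmin : ∀ f, minpoly L (e f) = minpoly L f := fun f => minpoly.algEquiv_eq e f
  have hu : ∀ x y : X →L[L] X, ‖x + y‖ ≤ max ‖x‖ ‖y‖ := fun x y =>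
    ContinuousLinearMap.opNorm_le_bound _ (le_max_of_le_left (norm_nonneg _)) fun w => by
      refine (ν.add_le (x w) (y w)).trans ?_
      have hw := ν.nonneg w
      rw [max_mul_of_nonneg _ _ (norm_nonneg w)]
      exact max_le_max (x.le_opNorm w) (y.le_opNorm w)
  have hfd : FiniteDimensional L (X →L[L] X) := e.toLinearEquiv.finiteDimensional
  have h1 : ‖(1 : X →L[L] X)‖ ≤ 1 := ContinuousLinearMap.norm_id_le
  have key := newton_op' hu h1 P hsep (e a) (by rw [← haP, ← hmin]; exact minpoly.aeval _ _) P.natDegree (by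
    rw [← haP, ← hmin]; exact linearIndependent_pow (e a))
  let β := Module.finBasis F D
  have hspan : a ∈ Submodule.span L (Set.range fun i => A.a (β i)) := by
    refine Submodule.span_le.2 ?_ ha
    rintro _ ⟨d, rfl⟩
    rw [← β.sum_repr d, map_sum]
    exact Submodule.sum_mem _ fun i _ => by
      rw [A.map_smul]; exact Submodule.smul_mem _ _ (Submodule.subset_span ⟨i, rfl⟩)
  obtain ⟨c, hc⟩ := (Submodule.mem_span_range_iff_exists_fun L).1 hspan
  let Φ : (Fin (Module.finrank F D) → L) → (X →L[L] X) := fun c => ∑ i, c i • e (A.a (β i))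
  have hΦ : Continuous Φ := by fun_prop
  have hΦc : Φ c = e a := by rw [← hc, map_sum]; simp [Φ]
  have key2 : ∀ᶠ t in 𝓝 c, _ := (hΦ.tendsto c).eventually (hΦc ▸ key)
  have hdense : DenseRange (fun (t : Fin (Module.finrank F D) → F) i => algebraMap F L (t i)) := DenseRange.piMap fun _ => hd
  obtain ⟨U, hU, hUo, hcU⟩ := eventually_nhds_iff.1 key2
  obtain ⟨t, ht⟩ := hdense.exists_mem_open hUo ⟨c, hcU⟩
  have h2 := hU _ ht
  have h3 : Φ (fun i => algebraMap F L (t i)) = e (A.a (∑ i, t i • β i)) := by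
    rw [map_sum, map_sum]
    exact Finset.sum_congr rfl fun i _ => by rw [A.map_smul, _root_.map_smul]
  rw [h3] at h2
  obtain ⟨h4, p, h5, h6⟩ := h2
  refine ⟨∑ i, t i • β i, p, ?_, ?_⟩
  · rw [← hmin]; exact le_natDegree_of_linInd _ _ h4
  · have e2 : Polynomial.aeval (e (A.a (∑ i, t i • β i))) p = e (Polynomial.aeval (A.a (∑ i, t i • β i)) p) :=
      Polynomial.aeval_algHom_apply e.toAlgHom _ p
    rw [e2] at h5 h6
    rw [← hmin]; exact minpoly_of_linInd _ P hP h5 h6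
open Polynomial

theorem aeval_comm {L X : Type*} [Field L] [AddCommGroup X] [Module L X] {a b : Module.End L X} (h : ∀ x, a (b x) = b (a x)) (g : L[X]) (x : X) :
    aeval a g (b x) = b (aeval a g x) := by
  have h1 : aeval a g ∈ Com (fun _ : Unit => b) := by
    refine Algebra.adjoin_le (S := Com (fun _ : Unit => b)) (s := {a}) ?_ (aeval_mem_adjoin_singleton L a)
    rintro _ rfl
    exact (mem_Com _).2 fun _ x => (h x).symm
  exact ((mem_Com _).1 h1 () x).symm

theorem DAct.aeval_act {L X Δ : Type*} [Field L] [AddCommGroup X] [Module L X] [DivisionRing Δ] [Algebra L Δ] (B : DAct L Δ L X)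
    {a : Module.End L X} (h : ∀ g x, a (B.a g x) = B.a g (a x)) {η : Δ} {x : X} (hx : a x = B.a η x) (g : L[X]) :
    Polynomial.aeval a g x = B.a (Polynomial.aeval η g) x := by
  have hp : ∀ n : ℕ, (a ^ n) x = B.a (η ^ n) x := fun n => by
    induction n with
    | zero => simp
    | succ n ih => rw [pow_succ', pow_succ, Module.End.mul_apply, ih, h, hx, map_mul, Module.End.mul_apply]
  induction g using Polynomial.induction_on' with
  | add p q hp hq => simp [hp, hq]
  | monomial n c => simp [Polynomial.aeval_monomial, hp, B.map_algebraMap, map_mul, map_pow]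

theorem DAct.act_eq_zero {F D R X : Type*} [Field F] [DivisionRing D] [Algebra F D] [Field R] [Algebra F R] [AddCommGroup X] [Module R X]
    (B : DAct F D R X) {d : D} {x : X} (hx : x ≠ 0) (h : B.a d x = 0) : d = 0 := by
  by_contra hd
  apply hx
  have : B.a (d⁻¹ * d) x = 0 := by rw [map_mul, Module.End.mul_apply, h, map_zero]
  rwa [inv_mul_cancel₀ hd, map_one] at this

theorem DAct.minpoly_eq {F D R X : Type*} [Field F] [DivisionRing D] [Algebra F D] [Field R] [Algebra F R] [AddCommGroup X] [Module R X]
    [FiniteDimensional R X] [FiniteDimensional F D] [Algebra.IsCentral F D] [Nontrivial X] (A : DAct F D R X) (d : D) :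
    minpoly R (A.a d) = (minpoly F d).map (algebraMap F R) := by
  have h1 := (minpoly.monic (IsIntegral.of_finite F d)).map (algebraMap F R)
  refine eq_of_monic_of_associated (minpoly.monic (IsIntegral.of_finite R _)) h1 (associated_of_dvd_dvd ?_ ?_)
  · exact minpoly.dvd _ _ ((A.aeval_eq_zero_iff d _).2 dvd_rfl)
  · exact (A.aeval_eq_zero_iff d _).1 (minpoly.aeval _ _)

theorem natDegree_minpoly_le {F D : Type*} [Field F] [DivisionRing D] [Algebra F D] [FiniteDimensional F D] [Algebra.IsCentral F D] {n : ℕ}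
    (hn : Module.finrank F D = n ^ 2) (d : D) : (minpoly F d).natDegree ≤ n := by
  obtain ⟨M, hM, hm⟩ := exists_maximalSubfield (Algebra.adjoin F {d}) (adjoin_comm d)
  obtain ⟨h1, -⟩ := finrank_eq_sq M hm.1 hm.2.1 hm.mem
  have h2 : Module.finrank F M = n := Nat.pow_left_injective (n := 2) two_ne_zero (h1.symm.trans hn)
  rw [← h2]
  have h3 := (linearIndependent_pow (K := F) (⟨d, hM (Algebra.self_mem_adjoin_singleton F d)⟩ : M)).fintype_card_le_finrank
  have h4 : minpoly F (⟨d, hM (Algebra.self_mem_adjoin_singleton F d)⟩ : M) = minpoly F d :=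
    (minpoly.algHom_eq M.val Subtype.val_injective _).symm
  rwa [h4, Fintype.card_fin] at h3

theorem exists_scalars {L E : Type*} [NontriviallyNormedField L] [CompleteSpace L] [IsUltrametricDist L] [Field E] [Algebra L E]
    [FiniteDimensional L E] (α : E) (r : ℕ) : ∃ c : Fin r → L, Function.Injective fun i => minpoly L (α + algebraMap L E (c i)) := by
  obtain ⟨p, hp⟩ := NormedField.exists_one_lt_norm L
  obtain ⟨m, hm⟩ := pow_unbounded_of_one_lt (nm L α) hp
  refine ⟨fun i => p ^ (m + i : ℕ), fun i j h => ?_⟩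
  have h1 : ∀ i : ℕ, nm L (α + algebraMap L E (p ^ (m + i))) = ‖p‖ ^ (m + i) := fun i => by
    have h2 : nm L (algebraMap L E (p ^ (m + i))) = ‖p‖ ^ (m + i) := by rw [nm_algebraMap, norm_pow]
    rw [← h2]
    refine (nmV L E).eq_of_lt ?_
    change nm L _ < nm L _
    rw [sub_add_cancel_right, h2]
    have h3 := (nmV L E).v_neg α
    change nm L (-α) = nm L α at h3
    rw [h3]
    exact hm.trans_le (pow_le_pow_right₀ hp.le (Nat.le_add_right _ _))
  have h4 : nm L (α + algebraMap L E (p ^ (m + (i : ℕ)))) = nm L (α + algebraMap L E (p ^ (m + (j : ℕ)))) := congrArg spectralValue h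
  rw [h1, h1] at h4
  have := pow_right_injective₀ (one_pos.trans hp) hp.ne' h4
  exact Fin.ext (by omega)

theorem local_core {F D D' L X X' Δ Δ' E : Type*} [Field F] [DivisionRing D] [Algebra F D] [FiniteDimensional F D] [Algebra.IsCentral F D]
    [DivisionRing D'] [Algebra F D'] [FiniteDimensional F D'] [Algebra.IsCentral F D']
    [NontriviallyNormedField L] [CompleteSpace L] [IsUltrametricDist L] [Algebra F L] (hd : DenseRange (algebraMap F L))
    [AddCommGroup X] [Module L X] [DivisionRing Δ] [Algebra L Δ] [AddCommGroup X'] [Module L X'] [DivisionRing Δ'] [Algebra L Δ']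
    (Q : LocMod F D L X Δ) (Q' : LocMod F D' L X' Δ') {n : ℕ} (hn : Module.finrank F D = n ^ 2) (hn' : Module.finrank F D' = n ^ 2)
    (hs : ∀ a : D', (minpoly F a).natDegree = n → ∃ b : D, minpoly F b = minpoly F a)
    [Field E] [Algebra L E] [FiniteDimensional L E] [Algebra.IsSeparable L E] (φ : E →ₐ[L] Δ') (hE : Module.finrank L Δ' = Module.finrank L E ^ 2) :
    Module.finrank L Δ ≤ Module.finrank L Δ' ∧ (Module.finrank L Δ = Module.finrank L Δ' → Nonempty (E →ₐ[L] Δ)) := by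
  classical
  haveI := Q.fin; haveI := Q.finΔ; haveI := Q.nt; haveI := Q'.fin; haveI := Q'.finΔ; haveI := Q'.nt
  obtain ⟨r, e, hr, he0, hey⟩ := Q'.B.exists_basis
  have hrd : r * Module.finrank L E = n := by
    have h1 := Q'.finrank_eq
    rw [hr, hE, hn'] at h1
    have h2 : 0 < Module.finrank L E := Module.finrank_pos
    refine Nat.pow_left_injective (n := 2) two_ne_zero (Nat.eq_of_mul_eq_mul_right (pow_pos h2 2) ?_)
    calc _ = (r * Module.finrank L E ^ 2) ^ 2 := by ring
      _ = _ := h1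
  let pb := Field.powerBasisOfFiniteOfSeparable L E
  obtain ⟨c, hc⟩ := exists_scalars (L := L) pb.gen r
  set ξ : Fin r → E := fun i => pb.gen + algebraMap L E (c i) with hξ
  set f : Fin r → L[X] := fun i => minpoly L (ξ i) with hf
  have hfc : ∀ i, f i = (minpoly L pb.gen).comp (Polynomial.X - C (c i)) := fun i => minpoly.add_algebraMap _ _
  have hfm : ∀ i, (f i).Monic := fun i => minpoly.monic (IsIntegral.of_finite L _)
  have hfd : ∀ i, (f i).natDegree = Module.finrank L E := fun i => by
    rw [hfc, natDegree_comp, natDegree_X_sub_C, mul_one, pb.natDegree_minpoly, pb.finrank]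
  have hfi : ∀ i, Irreducible (f i) := fun i => minpoly.irreducible (IsIntegral.of_finite L _)
  have hco : Pairwise (Function.onFun IsCoprime f) := fun i j hij => by
    rcases (hfi i).isCoprime_or_dvd (f j) with h | h
    · exact h
    · exact absurd (hc (eq_of_monic_of_associated (hfm i) (hfm j) (((hfi i).dvd_irreducible_iff_associated (hfi j)).1 h))) hij
  set P := ∏ i, f i with hP
  have hPm : P.Monic := monic_prod_of_monic _ _ fun i _ => hfm i
  have hPd : P.natDegree = n := by
    rw [hP, natDegree_prod_of_monic _ _ fun i _ => hfm i, Finset.sum_congr rfl fun i _ => hfd i]; simpa using hrd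
  have hPs : P.Separable := separable_prod hco fun i => Algebra.IsSeparable.isSeparable L (ξ i)
  obtain ⟨a, ha, hae⟩ := hey fun i => Q'.B.a (φ (ξ i)) (e i)
  have hag : ∀ (g : L[X]) i, aeval a g (e i) = Q'.B.a (φ (aeval (ξ i) g)) (e i) := fun g i => by
    rw [Q'.B.aeval_act ha (hae i), aeval_algHom_apply]
  have hen : ∀ i, e i ≠ 0 := fun i h => by
    obtain ⟨x, hx⟩ := exists_ne (0 : X')
    obtain ⟨b, -, hb⟩ := hey fun _ => x
    exact hx (by rw [← hb i, h, map_zero])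
  have hmin : minpoly L a = P := by
    refine eq_of_monic_of_associated (minpoly.monic (IsIntegral.of_finite L _)) hPm (associated_of_dvd_dvd ?_ ?_)
    · refine minpoly.dvd _ _ (he0 _ (fun g x => aeval_comm (ha g) P x) fun i => ?_)
      rw [hag, (minpoly.dvd_iff).1 (Finset.dvd_prod_of_mem f (Finset.mem_univ i)), map_zero, map_zero]; rfl
    · refine Fintype.prod_dvd_of_coprime hco fun i => minpoly.dvd _ _ ?_
      have h := hag (minpoly L a) i
      rw [minpoly.aeval] at h
      exact (map_eq_zero φ).1 (Q'.B.act_eq_zero (hen i) h.symm)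
  obtain ⟨d0, p, h1, h2⟩ := Q'.A.approx hd (VNorm.ofBasis (Module.finBasis L X')) a (Q'.span a fun g x => (ha g x).symm) P hPm hPs hmin
  rw [Q'.A.minpoly_eq, natDegree_map, hPd] at h1
  obtain ⟨b0, hb0⟩ := hs d0 (le_antisymm (natDegree_minpoly_le hn' d0) h1)
  set s := aeval (Q.A.a b0) p with hs'
  have hsz : ∀ g : L[X], aeval s g = 0 ↔ P ∣ g := fun g => by
    rw [← h2, minpoly.dvd_iff, hs', ← aeval_comp, ← aeval_comp, ← minpoly.dvd_iff, ← minpoly.dvd_iff, Q.A.minpoly_eq, Q'.A.minpoly_eq, hb0]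
  have hsB : ∀ g x, s (Q.B.a g x) = Q.B.a g (s x) := fun g x => aeval_comm (fun x => Q.comm b0 g x) p x
  have hx : ∀ i, ∃ x : X, x ≠ 0 ∧ aeval s (f i) x = 0 := fun i => by
    by_contra hcon
    push Not at hcon
    have hinj : Function.Injective (aeval s (f i)) := (injective_iff_map_eq_zero _).2 fun x hx => by
      by_contra h0; exact hcon x h0 hx
    have h3 : aeval s (∏ j ∈ Finset.univ.erase i, f j) = 0 := LinearMap.ext fun x => hinj (by
      rw [← Module.End.mul_apply, ← map_mul, Finset.mul_prod_erase _ _ (Finset.mem_univ i), (hsz _).2 dvd_rfl]; simp)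
    have h4 := (hsz _).1 h3
    rw [hP, ← Finset.mul_prod_erase _ _ (Finset.mem_univ i)] at h4
    have h5 : (∏ j ∈ Finset.univ.erase i, f j) ≠ 0 := (monic_prod_of_monic _ _ fun i _ => hfm i).ne_zero
    exact (hfi i).not_isUnit (isUnit_of_dvd_one ((mul_dvd_mul_iff_right h5).1 (by rwa [one_mul])))
  choose x hx0 hxf using hx
  have hind : ∀ y : Fin r → X, (∀ i, aeval s (f i) (y i) = 0) → ∑ i, y i = 0 → ∀ i, y i = 0 := fun y hy h j => by
    have hcop : IsCoprime (f j) (∏ i ∈ Finset.univ.erase j, f i) := IsCoprime.prod_right fun i hi => hco (Finset.ne_of_mem_erase hi).symm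
    obtain ⟨u, v, huv⟩ := hcop
    have h3 : aeval s (∏ i ∈ Finset.univ.erase j, f i) (y j) = 0 := by
      have h4 : ∀ i ∈ Finset.univ.erase j, aeval s (∏ i ∈ Finset.univ.erase j, f i) (y i) = 0 := fun i hi => by
        rw [← Finset.prod_erase_mul _ _ hi, map_mul, Module.End.mul_apply, hy, map_zero]
      have h5 := congrArg (aeval s (∏ i ∈ Finset.univ.erase j, f i)) h
      rw [← Finset.add_sum_erase _ _ (Finset.mem_univ j), map_add, map_sum, Finset.sum_eq_zero h4, add_zero, map_zero] at h5
      exact h5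
    have h6 := LinearMap.congr_fun (congrArg (aeval s) huv) (y j)
    simpa [hy j, h3] using h6.symm
  let Ψ : (Fin r → Δ) →ₗ[L] X :=
    { toFun := fun δ => ∑ i, Q.B.a (δ i) (x i)
      map_add' := fun δ δ' => by simp [Finset.sum_add_distrib]
      map_smul' := fun c δ => by simp [Finset.smul_sum, Q.B.map_smul] }
  have hker : ∀ i δ, aeval s (f i) (Q.B.a δ (x i)) = 0 := fun i δ => by rw [aeval_comm (hsB δ), hxf, map_zero]
  have hΨ : Function.Injective Ψ := (injective_iff_map_eq_zero _).2 fun δ h => funext fun i =>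
    Q.B.act_eq_zero (hx0 i) (hind (fun i => Q.B.a (δ i) (x i)) (fun i => hker i _) h i)
  have hle := LinearMap.finrank_le_finrank_of_injective hΨ
  rw [Module.finrank_pi_fintype] at hle
  simp only [Finset.sum_const, Finset.card_univ, Fintype.card_fin, smul_eq_mul] at hle
  have hN : 0 < Module.finrank L Δ := Module.finrank_pos
  have hE0 : 0 < Module.finrank L E := Module.finrank_pos
  have h7 := Q.finrank_eq
  rw [hn, ← hrd] at h7
  have hr0 : 0 < r := by
    rcases Nat.eq_zero_or_pos r with h | h
    · have := Module.finrank_pos (R := L) (M := X'); rw [hr, h, zero_mul] at this; omega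
    · exact h
  refine ⟨?_, fun hNN => ?_⟩
  · rw [hE]
    have h8 : (r * Module.finrank L Δ) ^ 2 ≤ (r * Module.finrank L E) ^ 2 * Module.finrank L Δ := h7 ▸ Nat.pow_le_pow_left hle 2
    have h9 : (r ^ 2 * Module.finrank L Δ) * Module.finrank L Δ ≤ (r ^ 2 * Module.finrank L Δ) * Module.finrank L E ^ 2 := by nlinarith
    exact Nat.le_of_mul_le_mul_left h9 (by positivity)
  · have h8 : Module.finrank L X = r * Module.finrank L Δ := by
      refine Nat.pow_left_injective (n := 2) two_ne_zero ?_
      change Module.finrank L X ^ 2 = (r * Module.finrank L Δ) ^ 2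
      rw [h7, hNN, hE]; ring
    have hsur : Function.Surjective Ψ := by
      rw [← LinearMap.range_eq_top]
      apply Submodule.eq_top_of_finrank_eq
      rw [LinearMap.finrank_range_of_inj hΨ, h8, Module.finrank_pi_fintype]; simp
    let i0 : Fin r := ⟨0, hr0⟩
    obtain ⟨δ, hδ⟩ := hsur (s (x i0))
    have h9 := hind (fun i => Q.B.a (δ i) (x i) - if i = i0 then s (x i0) else 0) (fun i => by
      split_ifs with h
      · subst h; rw [map_sub, hker, aeval_comm (a := s) (b := s) (fun x => rfl) (f i0), hxf]; simp
      · rw [sub_zero, hker]) (by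
      rw [Finset.sum_sub_distrib]
      change Ψ δ - _ = 0
      rw [hδ]; simp) i0
    rw [if_pos rfl, sub_eq_zero] at h9
    have h10 : aeval (δ i0) (f i0) = 0 := by
      refine Q.B.act_eq_zero (hx0 i0) ?_
      rw [← Q.B.aeval_act hsB h9.symm, hxf]
    refine ⟨pb.lift (δ i0 - algebraMap L Δ (c i0)) ?_⟩
    rw [hfc, aeval_comp] at h10
    simpa using h10

theorem finrank_same {F D D' : Type*} [Field F] [DivisionRing D] [Algebra F D] [FiniteDimensional F D] [Algebra.IsCentral F D]
    [DivisionRing D'] [Algebra F D'] [FiniteDimensional F D'] [Algebra.IsCentral F D'] (h : SameMaximalSubfields F D D') :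
    Module.finrank F D = Module.finrank F D' := by
  obtain ⟨M, -, hm⟩ := exists_maximalSubfield (Algebra.adjoin F {(1 : D)}) (adjoin_comm 1)
  obtain ⟨M', hm', ⟨e⟩⟩ := h.1 M hm
  rw [(finrank_eq_sq M hm.1 hm.2.1 hm.mem).1, (finrank_eq_sq M' hm'.1 hm'.2.1 hm'.mem).1, e.toLinearEquiv.finrank_eq]

theorem max_of_natDegree {F D' : Type*} [Field F] [DivisionRing D'] [Algebra F D'] [FiniteDimensional F D'] [Algebra.IsCentral F D'] {n : ℕ}
    (hn : Module.finrank F D' = n ^ 2) (a : D') (ha : (minpoly F a).natDegree = n) : IsMaximalSubfield F D' (Algebra.adjoin F {a}) := by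
  obtain ⟨M, hM, hm⟩ := exists_maximalSubfield (Algebra.adjoin F {a}) (adjoin_comm a)
  obtain ⟨h1, -⟩ := finrank_eq_sq M hm.1 hm.2.1 hm.mem
  have h2 : Module.finrank F M = n := Nat.pow_left_injective (n := 2) two_ne_zero (h1.symm.trans hn)
  let x : Algebra.adjoin F {a} := ⟨a, Algebra.self_mem_adjoin_singleton F a⟩
  haveI : FiniteDimensional F (Algebra.adjoin F {a}) := inferInstanceAs (FiniteDimensional F (Subalgebra.toSubmodule (Algebra.adjoin F {a})))
  have h3 := (linearIndependent_pow (K := F) x).fintype_card_le_finrank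
  have h4 : minpoly F x = minpoly F a := (minpoly.algHom_eq (Algebra.adjoin F {a}).val Subtype.val_injective _).symm
  rw [h4, Fintype.card_fin, ha] at h3
  have h5 : Algebra.adjoin F {a} = M := Subalgebra.toSubmodule_injective
    (Submodule.eq_of_le_of_finrank_le (S₁ := Subalgebra.toSubmodule _) (S₂ := Subalgebra.toSubmodule M) hM (h2.le.trans h3))
  rwa [h5]

theorem same_minpoly {F D D' : Type*} [Field F] [DivisionRing D] [Algebra F D]
    [DivisionRing D'] [Algebra F D'] [FiniteDimensional F D'] [Algebra.IsCentral F D']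
    (h : ∀ M' : Subalgebra F D', IsMaximalSubfield F D' M' → ∃ M : Subalgebra F D, IsMaximalSubfield F D M ∧ Nonempty (M ≃ₐ[F] M')) {n : ℕ}
    (hn : Module.finrank F D' = n ^ 2) (a : D') (ha : (minpoly F a).natDegree = n) : ∃ b : D, minpoly F b = minpoly F a := by
  obtain ⟨M, -, ⟨e⟩⟩ := h _ (max_of_natDegree hn a ha)
  let x : Algebra.adjoin F {a} := ⟨a, Algebra.self_mem_adjoin_singleton F a⟩
  refine ⟨e.symm x, ?_⟩
  have h1 : minpoly F ((e.symm x : M) : D) = minpoly F (e.symm x) := minpoly.algHom_eq M.val Subtype.val_injective _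
  rw [h1, minpoly.algEquiv_eq e.symm x]
  exact (minpoly.algHom_eq (Algebra.adjoin F {a}).val Subtype.val_injective x).symm

theorem LocMod.twoPow {F D L X Δ : Type*} [Field F] [DivisionRing D] [Algebra F D] [FiniteDimensional F D] [Algebra.IsCentral F D]
    [Field L] [Algebra F L] [AddCommGroup X] [Module L X] [DivisionRing Δ] [Algebra L Δ] (Q : LocMod F D L X Δ) {a : ℕ}
    (hn : Module.finrank F D = (2 ^ a) ^ 2) : ∃ b, Module.finrank L Δ = (2 ^ b) ^ 2 := by
  haveI := Q.fin; haveI := Q.finΔ; haveI := Q.nt; haveI := Q.central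
  obtain ⟨M, -, hm⟩ := exists_maximalSubfield (Algebra.adjoin L {(1 : Δ)}) (adjoin_comm 1)
  have h1 := (finrank_eq_sq M hm.1 hm.2.1 hm.mem).1
  obtain ⟨r, e, hr, -, -⟩ := Q.B.exists_basis
  have h2 := Q.finrank_eq
  rw [hr, h1, hn] at h2
  have h0 : 0 < Module.finrank L M := Nat.pos_of_ne_zero fun h => by
    rw [h] at h1; have := Module.finrank_pos (R := L) (M := Δ); rw [h1] at this; simp at this
  have h3 : r * Module.finrank L M = 2 ^ a := by
    refine Nat.pow_left_injective (n := 2) two_ne_zero (Nat.eq_of_mul_eq_mul_right (pow_pos h0 2) ?_)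
    calc _ = (r * Module.finrank L M ^ 2) ^ 2 := by ring
      _ = _ := h2
  obtain ⟨b, -, hb⟩ := (Nat.dvd_prime_pow Nat.prime_two).1 (Dvd.intro_left _ h3)
  exact ⟨b, by rw [h1, hb]⟩

theorem sep_of_two {L E : Type*} [Field L] [Field E] [Algebra L E] (h2 : (2 : L) ≠ 0) {b : ℕ} (h : Module.finrank L E = 2 ^ b) :
    Algebra.IsSeparable L E := by
  haveI : FiniteDimensional L E := Module.finite_of_finrank_pos (by rw [h]; positivity)
  refine ⟨fun x => ?_⟩
  have hi := IsIntegral.of_finite L x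
  rw [IsSeparable, separable_iff_derivative_ne_zero (minpoly.irreducible hi)]
  intro h0
  obtain ⟨c, -, hc⟩ := (Nat.dvd_prime_pow Nat.prime_two).1 (h ▸ minpoly.degree_dvd hi)
  have h1 := congrArg (fun g => g.coeff ((minpoly L x).natDegree - 1)) h0
  have hp := minpoly.natDegree_pos hi
  simp only [coeff_derivative, coeff_zero, Nat.sub_add_cancel hp] at h1
  have h3 : (minpoly L x).coeff (minpoly L x).natDegree = 1 := minpoly.monic hi
  rw [h3, one_mul] at h1
  have h4 : (((minpoly L x).natDegree : ℕ) : L) = 0 := by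
    rw [← h1, ← Nat.cast_one (R := L), ← Nat.cast_add, Nat.sub_add_cancel hp]
  rw [hc, Nat.cast_pow] at h4
  exact pow_ne_zero c h2 (by exact_mod_cast h4)

/-- the two algebras have the same commutative subalgebras -/
structure SameLoc (L Δ Δ' : Type*) [Field L] [DivisionRing Δ] [Algebra L Δ] [DivisionRing Δ'] [Algebra L Δ'] : Prop where
  dim : Module.finrank L Δ = Module.finrank L Δ'
  f : ∀ M : Subalgebra L Δ', (∀ x ∈ M, ∀ y ∈ M, x * y = y * x) → Nonempty (M →ₐ[L] Δ)
  g : ∀ M : Subalgebra L Δ, (∀ x ∈ M, ∀ y ∈ M, x * y = y * x) → Nonempty (M →ₐ[L] Δ')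

theorem local_emb_aux {F D D' L X X' Δ Δ' : Type*} [Field F] [DivisionRing D] [Algebra F D] [FiniteDimensional F D] [Algebra.IsCentral F D]
    [DivisionRing D'] [Algebra F D'] [FiniteDimensional F D'] [Algebra.IsCentral F D']
    [NontriviallyNormedField L] [CompleteSpace L] [IsUltrametricDist L] [Algebra F L] (hd : DenseRange (algebraMap F L))
    [AddCommGroup X] [Module L X] [DivisionRing Δ] [Algebra L Δ] [AddCommGroup X'] [Module L X'] [DivisionRing Δ'] [Algebra L Δ']
    (Q : LocMod F D L X Δ) (Q' : LocMod F D' L X' Δ') (h2 : (2 : L) ≠ 0) {a : ℕ}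
    (hn : Module.finrank F D = (2 ^ a) ^ 2) (hn' : Module.finrank F D' = (2 ^ a) ^ 2)
    (h : ∀ M' : Subalgebra F D', IsMaximalSubfield F D' M' → ∃ M : Subalgebra F D, IsMaximalSubfield F D M ∧ Nonempty (M ≃ₐ[F] M'))
    (M : Subalgebra L Δ') (hM : ∀ x ∈ M, ∀ y ∈ M, x * y = y * x) : Module.finrank L Δ ≤ Module.finrank L Δ' ∧
        (Module.finrank L Δ = Module.finrank L Δ' → Nonempty (M →ₐ[L] Δ)) := by
  haveI := Q'.finΔ; haveI := Q'.central
  obtain ⟨N, hMN, hN⟩ := exists_maximalSubfield M hM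
  have h3 := (finrank_eq_sq N hN.1 hN.2.1 hN.mem).1
  obtain ⟨b, hb⟩ := Q'.twoPow hn'
  letI := subField N hN.1 hN.2.1
  haveI : FiniteDimensional L N := inferInstanceAs (FiniteDimensional L (Subalgebra.toSubmodule N))
  haveI : Algebra.IsSeparable L N := sep_of_two h2 (Nat.pow_left_injective (n := 2) two_ne_zero (h3.symm.trans hb))
  obtain ⟨h4, h5⟩ := local_core (E := N) hd Q Q' hn hn' (same_minpoly h hn') N.val h3
  exact ⟨h4, fun h6 => (h5 h6).map fun φ => φ.comp (Subalgebra.inclusion hMN)⟩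

theorem local_emb {F D D' L X X' Δ Δ' : Type*} [Field F] [DivisionRing D] [Algebra F D] [FiniteDimensional F D] [Algebra.IsCentral F D]
    [DivisionRing D'] [Algebra F D'] [FiniteDimensional F D'] [Algebra.IsCentral F D']
    [NontriviallyNormedField L] [CompleteSpace L] [IsUltrametricDist L] [Algebra F L] (hd : DenseRange (algebraMap F L))
    [AddCommGroup X] [Module L X] [DivisionRing Δ] [Algebra L Δ] [AddCommGroup X'] [Module L X'] [DivisionRing Δ'] [Algebra L Δ']
    (Q : LocMod F D L X Δ) (Q' : LocMod F D' L X' Δ') (h2 : (2 : L) ≠ 0) {a : ℕ} (hn : Module.finrank F D = (2 ^ a) ^ 2)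
    (h : SameMaximalSubfields F D D') : SameLoc L Δ Δ' := by
  have hn' : Module.finrank F D' = (2 ^ a) ^ 2 := (finrank_same h).symm.trans hn
  have h' : ∀ M : Subalgebra F D, IsMaximalSubfield F D M → ∃ M' : Subalgebra F D', IsMaximalSubfield F D' M' ∧ Nonempty (M' ≃ₐ[F] M) :=
    fun M hM => by
      obtain ⟨M', h1, ⟨e⟩⟩ := h.1 M hM
      exact ⟨M', h1, ⟨e.symm⟩⟩
  have hdim := le_antisymm (local_emb_aux hd Q Q' h2 hn hn' h.2 (Algebra.adjoin L {1}) (adjoin_comm 1)).1 (local_emb_aux hd Q' Q h2 hn' hn h' (Algebra.adjoin L {1}) (adjoin_comm 1)).1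
  exact ⟨hdim, fun M hM => (local_emb_aux hd Q Q' h2 hn hn' h.2 M hM).2 hdim, fun M hM => (local_emb_aux hd Q' Q h2 hn' hn h' M hM).2 hdim.symm⟩

/-- grading data -/
structure ZData (L Δ : Type*) [NontriviallyNormedField L] [DivisionRing Δ] [Algebra L Δ] (q s : ℝ) (c : L) (z : Δ) : Prop where
  sq : z * z = algebraMap L Δ c
  ev : ∀ y, y ≠ 0 → y * z = z * y → ∃ m : ℤ, nm L y = q ^ m
  od : ∀ y, y ≠ 0 → y * z = -(z * y) → ∃ m : ℤ, nm L y = s * q ^ m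

theorem emb_minpoly {L Δ Δ' : Type*} [Field L] [DivisionRing Δ] [Algebra L Δ] [DivisionRing Δ'] [Algebra L Δ'] [FiniteDimensional L Δ']
    {M : Subalgebra L Δ'} (φ : M →ₐ[L] Δ) (x : M) : minpoly L (φ x) = minpoly L (x : Δ') := by
  rw [minpoly.algHom_eq φ, ← minpoly.algHom_eq M.val Subtype.val_injective]; · rfl
  refine (injective_iff_map_eq_zero φ).2 fun y hy => ?_
  by_contra h0
  have h1 : y * ⟨(y : Δ')⁻¹, subalg_inv M _ y.2⟩ = 1 := Subtype.ext (mul_inv_cancel₀ fun h => h0 (Subtype.ext h))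
  have := congrArg φ h1
  rw [map_mul, hy, zero_mul, map_one] at this
  exact zero_ne_one this

section zdata
variable {L Δ Δ' : Type*} [NontriviallyNormedField L] [CompleteSpace L] [IsUltrametricDist L] [DivisionRing Δ] [Algebra L Δ]
  [FiniteDimensional L Δ] [DivisionRing Δ'] [Algebra L Δ'] [FiniteDimensional L Δ']

theorem nm_two_mul {q : ℝ} (hL : Loc L q) (x : Δ) : nm L (2 * x) = nm L x := by
  have : (2 : Δ) = algebraMap L Δ 2 := (map_ofNat (algebraMap L Δ) 2).symm
  rw [nm_mul, this, nm_algebraMap, hL.two, one_mul]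

theorem not_both {q : ℝ} (hL : Loc L q) {y z : Δ} (hz : nm L z = 1) (h1 : nm L (y * z + z * y) < nm L y)
    (h2 : nm L (y * z - z * y) < nm L y) : False := by
  have h3 : 2 * (y * z) = (y * z + z * y) + (y * z - z * y) := by rw [two_mul]; abel
  have h4 := nm_add_le (L := L) (y * z + z * y) (y * z - z * y)
  rw [← h3, nm_two_mul hL, nm_mul, hz, mul_one] at h4
  exact absurd h4 (not_le.2 (max_lt h1 h2))

theorem nm_of_sq {c : L} (hc : ‖c‖ = 1) {z : Δ} (hz : z * z = algebraMap L Δ c) : nm L z = 1 := by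
  have h := congrArg (nm L) hz
  rw [nm_mul, nm_algebraMap, hc] at h
  nlinarith [nm_nonneg (L := L) z]

theorem eq_zero_of_anti {q : ℝ} (hL : Loc L q) (y : Δ) (h : y * 1 = -(1 * y)) : y = 0 := by
  refine nm_eq_zero (L := L) _ ?_
  have h3 : (2 : Δ) * y = 0 := by rw [two_mul]; nth_rewrite 1 [← mul_one y]; rw [h]; simp
  rw [← nm_two_mul hL, h3, nm_zero]

theorem exists_zdata {Δ : Type u} [DivisionRing Δ] [Algebra L Δ] [FiniteDimensional L Δ] [Algebra.IsCentral L Δ] {q : ℝ} (hL : Loc L q)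
    (hN : ‖(Module.finrank L Δ : L)‖ = 1) (θ : Δ →ₐ[L] Δᵐᵒᵖ) (S : SameLoc L Δ Δ') :
    ∃ (s : ℝ) (c : L) (z : Δ) (z' : Δ'), 0 < s ∧ (∃ j : ℤ, s ^ 2 = q ^ j) ∧ ‖c‖ = 1 ∧ ZData L Δ q s c z ∧ ZData L Δ' q s c z' := by
  have emb : ∀ y : Δ', ∃ x : Δ, minpoly L x = minpoly L y := fun y => by
    obtain ⟨φ⟩ := S.f (Algebra.adjoin L {y}) (adjoin_comm y)
    exact ⟨_, emb_minpoly φ ⟨y, Algebra.self_mem_adjoin_singleton L y⟩⟩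
  have emb' : ∀ y : Δ, ∃ x : Δ', minpoly L x = minpoly L y := fun y => by
    obtain ⟨φ⟩ := S.g (Algebra.adjoin L {y}) (adjoin_comm y)
    exact ⟨_, emb_minpoly φ ⟨y, Algebra.self_mem_adjoin_singleton L y⟩⟩
  rcases local_structure hL hN θ with h1 | ⟨z, c, hz, hc, hsq, ⟨ϖ, hϖ0, hϖ⟩, hev, hod⟩
  · refine ⟨1, 1, 1, 1, one_pos, ⟨0, by simp⟩, norm_one, ⟨by simp, fun y hy _ => h1 y hy, fun y hy h => absurd (eq_zero_of_anti hL y h) hy⟩,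
      ⟨by simp, fun y hy _ => ?_, fun y hy h => absurd (eq_zero_of_anti hL y h) hy⟩⟩
    obtain ⟨x, hx⟩ := emb y
    rw [← nm_of_minpoly hx]
    refine h1 x fun h => ?_
    have := nm_of_minpoly hx
    rw [h, nm_zero] at this
    exact hy (nm_eq_zero _ this.symm)
  have hq := hL.q0
  have hϖp := nm_pos (L := L) hϖ0
  have hnz := nm_of_sq hc hz
  -- parity
  have hpar : ∀ x : ℝ, 0 < x → (∃ m : ℤ, x ^ 2 = q ^ m) → (∀ m : ℤ, x ≠ q ^ m) → ∃ m : ℤ, x = nm L ϖ * q ^ m := by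
    intro x hx ⟨m, hm⟩ hxm
    have hodd : ∀ (x : ℝ), 0 < x → (∀ m : ℤ, x ≠ q ^ m) → ∀ m : ℤ, x ^ 2 = q ^ m → ¬ Even m := fun x hx h m hm ⟨k, hk⟩ => by
      refine h k ((pow_left_inj₀ hx.le (zpow_pos hq k).le two_ne_zero).1 ?_)
      rw [hm, hk, zpow_add₀ hq.ne', pow_two]
    obtain ⟨m', hm'⟩ := hsq ϖ hϖ0
    obtain ⟨k, hk⟩ := (Int.not_even_iff_odd.1 (hodd x hx hxm m hm)).sub_odd (Int.not_even_iff_odd.1 (hodd _ hϖp hϖ m' hm'))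
    refine ⟨k, (pow_left_inj₀ hx.le (mul_pos hϖp (zpow_pos hq k)).le two_ne_zero).1 ?_⟩
    rw [mul_pow, hm, hm', ← zpow_natCast, ← zpow_mul, ← zpow_add₀ hq.ne']
    congr 1; push_cast; omega
  have hcl : ∀ w y : Δ, w * w = z * z → y ≠ 0 → y * w = w * y → ∃ m : ℤ, nm L y = q ^ m := by
    intro w y hw hy hyw
    by_contra hno
    push Not at hno
    have hnw : nm L w = 1 := nm_of_sq hc (hw.trans hz)
    have h1 := hev w (nm_ne_zero hnw) ⟨0, by simpa using hnw⟩
    have h2 : (w - z) * (w + z) = w * z - z * w := by noncomm_ring; rw [hw]; abel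
    rw [hnw, ← h2, nm_mul] at h1
    have h3 : ∀ ε : Δ, nm L ε < 1 → nm L (y * ε - ε * y) < nm L y := fun ε hε => by
      have h4 := (nmV L Δ).sub_le (y * ε) (ε * y)
      change nm L _ ≤ max (nm L _) (nm L _) at h4
      rw [nm_mul, nm_mul, mul_comm (nm L ε), max_self] at h4
      nlinarith [nm_pos (L := L) hy]
    have h5 : nm L (y * z - z * y) < nm L y := by
      by_cases h6 : nm L (w - z) < 1
      · have h7 := h3 _ h6
        rwa [show y * (w - z) - (w - z) * y = -(y * z - z * y) by noncomm_ring; rw [hyw]; abel, nm_neg] at h7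
      · have h8 : nm L (w + z) < 1 := by
          by_contra h8; push Not at h6 h8; nlinarith
        have h7 := h3 _ h8
        rwa [show y * (w + z) - (w + z) * y = y * z - z * y by noncomm_ring; rw [hyw]; abel] at h7
    exact not_both hL hnz (hod y hy hno) h5
  obtain ⟨z', hz'⟩ : ∃ z' : Δ', z' * z' = algebraMap L Δ' c := by
    obtain ⟨z', h⟩ := emb' z
    have h1 : minpoly L z ∣ Polynomial.X ^ 2 - C c := minpoly.dvd _ _ (by simp [pow_two, hz])
    rw [← h, minpoly.dvd_iff] at h1
    exact ⟨z', by simpa [pow_two, sub_eq_zero] using h1⟩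
  have hnz' := nm_of_sq hc hz'
  have hz0' := nm_ne_zero hnz'
  have hev' : ∀ y : Δ', y ≠ 0 → y * z' = z' * y → ∃ m : ℤ, nm L y = q ^ m := by
    intro y hy hyz
    obtain ⟨N, hN1, hN2, hN3⟩ := adjoin_comm_insert (Algebra.adjoin L {z'}) (adjoin_comm z') y (fun w hw => by
      exact (Algebra.commute_of_mem_adjoin_of_forall_mem_commute (R := L) (s := {z'}) hw (fun c hc => by
        rw [Set.mem_singleton_iff.1 hc]; exact hyz) : Commute y w))
    obtain ⟨φ⟩ := S.f N hN3
    let zN : N := ⟨z', hN1 (Algebra.self_mem_adjoin_singleton L z')⟩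
    let yN : N := ⟨y, hN2⟩
    have h1 : nm L (φ yN) = nm L y := nm_of_minpoly (emb_minpoly φ yN)
    rw [← h1]
    refine hcl (φ zN) (φ yN) ?_ (fun h => ?_) ?_
    · rw [← map_mul, show zN * zN = algebraMap L N c from Subtype.ext hz', AlgHom.commutes, hz]
    · rw [h, nm_zero] at h1; exact hy (nm_eq_zero _ h1.symm)
    · rw [← map_mul, ← map_mul]; exact congrArg φ (Subtype.ext hyz)
  obtain ⟨ϖ', hϖ'⟩ := emb' ϖ
  have hϖn := nm_of_minpoly hϖ'
  have hzz : z'⁻¹ * z' = 1 := inv_mul_cancel₀ hz0'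
  have hzz' : z' * z'⁻¹ = 1 := mul_inv_cancel₀ hz0'
  have hcc : ∀ y : Δ', z' * z' * y = y * (z' * z') := fun y => by rw [hz']; exact Algebra.commutes c y
  have hconj : ∀ y : Δ', z' * (z' * y * z'⁻¹) = y * z' := fun y => by
    rw [← mul_assoc, ← mul_assoc, hcc, mul_assoc, mul_assoc, hzz', mul_one]
  have hconj' : ∀ y : Δ', (z' * y * z'⁻¹) * z' = z' * y := fun y => by rw [mul_assoc, hzz, mul_one]
  set E := ϖ' - z' * ϖ' * z'⁻¹ with hE
  set G := ϖ' + z' * ϖ' * z'⁻¹ with hG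
  have hEz : E * z' = -(z' * E) := by rw [hE, sub_mul, mul_sub, hconj, hconj']; abel
  have hGz : G * z' = z' * G := by rw [hG, add_mul, mul_add, hconj, hconj']; abel
  have hEn : nm L E = nm L ϖ := by
    have hEle : nm L E ≤ nm L ϖ := by
      have := (nmV L Δ').sub_le ϖ' (z' * ϖ' * z'⁻¹)
      change nm L E ≤ max (nm L ϖ') (nm L _) at this
      rwa [nm_mul, nm_mul, nm_inv, hnz', inv_one, mul_one, one_mul, max_self, hϖn] at this
    refine le_antisymm hEle (not_lt.1 fun hlt => ?_)
    have h2 : nm L (2 * ϖ') = nm L ϖ := by rw [nm_two_mul hL, hϖn]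
    have h3 : 2 * ϖ' - G = E := by rw [hE, hG, two_mul]; abel
    have h4 := nm_close (L := L) (x := 2 * ϖ') (y := G) (by rw [h3, h2]; exact hlt)
    obtain ⟨m, hm⟩ := hev' G (fun h => by rw [h, nm_zero, h2] at h4; linarith) hGz
    exact hϖ m (by rw [← h2, ← h4, hm])
  have hE0 : E ≠ 0 := fun h => by rw [h, nm_zero] at hEn; linarith
  obtain ⟨j, hj⟩ := hsq ϖ hϖ0
  refine ⟨nm L ϖ, c, z, z', hϖp, ⟨j, hj⟩, hc, ⟨hz, fun y hy h => hcl z y rfl hy h, fun y hy h => ?_⟩, ⟨hz', hev', fun y hy h => ?_⟩⟩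
  · refine hpar _ (nm_pos hy) (hsq y hy) fun m hm => ?_
    have h1 := hev y hy ⟨m, hm⟩
    exact not_both hL hnz (by rw [h, neg_add_cancel, nm_zero]; exact nm_pos hy) h1
  · obtain ⟨m, hm⟩ := hev' (y * E) (mul_ne_zero hy hE0) (by rw [mul_assoc, hEz, mul_neg, ← mul_assoc, h, neg_mul, neg_neg, mul_assoc])
    rw [nm_mul, hEn] at hm
    refine ⟨m - j, ?_⟩
    rw [zpow_sub₀ hq.ne', ← hj, ← hm]
    field_simp

end zdata

theorem DAct.sub2 {F F' D D' R X : Type*} [Field F] [Field F'] [DivisionRing D] [Algebra F D] [DivisionRing D'] [Algebra F' D'] [Field R] [Algebra F R]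
    [Algebra F' R] [AddCommGroup X] [Module R X] [FiniteDimensional F D] [Algebra.IsCentral F D] [FiniteDimensional F' D'] [Algebra.IsCentral F' D']
    [FiniteDimensional R X] (A : DAct F D R X) (A' : DAct F' D' R X) (hc : ∀ x y v, A.a x (A'.a y v) = A'.a y (A.a x v))
    (S : Subalgebra R (Module.End R X)) (h : ∀ d, A.a d ∈ S) (h' : ∀ d, A'.a d ∈ S) :
    Module.finrank R S = Module.finrank F D * Module.finrank F' D' *
      Module.finrank R (Subalgebra.toSubmodule S ⊓ Subalgebra.toSubmodule (Com (Sum.elim A.a A'.a)) : Submodule R (Module.End R X)) := by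
  have e1 := (A.sub_bimod (Subalgebra.toSubmodule S) (fun d f hf => S.mul_mem (h d) hf) (fun d f hf => S.mul_mem hf (h d))).1
  have hC : ∀ d, A'.a d ∈ Com A.a := fun d => (mem_Com _).2 fun i x => hc i d x
  have e2 := (A'.sub_bimod (Subalgebra.toSubmodule S ⊓ Subalgebra.toSubmodule (Com A.a))
    (fun d f hf => ⟨S.mul_mem (h' d) hf.1, (Com A.a).mul_mem (hC d) hf.2⟩) (fun d f hf => ⟨S.mul_mem hf.1 (h' d), (Com A.a).mul_mem hf.2 (hC d)⟩)).1
  have e3 : Subalgebra.toSubmodule S ⊓ Subalgebra.toSubmodule (Com A.a) ⊓ Subalgebra.toSubmodule (Com A'.a) =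
      Subalgebra.toSubmodule S ⊓ Subalgebra.toSubmodule (Com (Sum.elim A.a A'.a)) := by
    ext f
    simp only [Submodule.mem_inf, Subalgebra.mem_toSubmodule, mem_Com, Sum.forall, Sum.elim_inl, Sum.elim_inr, and_assoc]
  rw [← Subalgebra.finrank_toSubmodule, e1, e2, mul_assoc, e3]

/-- a space with three commuting actions -/
structure Tri (F D F' D' G E R X : Type*) [Field F] [Field F'] [Field G] [DivisionRing D] [Algebra F D] [DivisionRing D'] [Algebra F' D']
    [DivisionRing E] [Algebra G E] [Field R] [Algebra F R] [Algebra F' R] [Algebra G R] [AddCommGroup X] [Module R X] where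
  A : DAct F D R X
  A' : DAct F' D' R X
  B : DAct G E R X
  c : ∀ x y v, A.a x (A'.a y v) = A'.a y (A.a x v)
  cA : ∀ x y v, A.a x (B.a y v) = B.a y (A.a x v)
  cA' : ∀ x y v, A'.a x (B.a y v) = B.a y (A'.a x v)
  fin : FiniteDimensional R X
  dim : Module.finrank R X ^ 2 = Module.finrank F D * Module.finrank F' D' * Module.finrank G E

theorem exists_pair (F D D' : Type u) [Field F] [DivisionRing D] [Algebra F D] [FiniteDimensional F D] [Algebra.IsCentral F D]
    [DivisionRing D'] [Algebra F D'] [FiniteDimensional F D'] [Algebra.IsCentral F D'] :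
    ∃ (V E : Type u) (_ : AddCommGroup V) (_ : Module F V) (_ : DivisionRing E) (_ : Algebra F E),
      Nonempty (Tri F D F D' F E F V) ∧ FiniteDimensional F E ∧ Algebra.IsCentral F E := by
  let T := TensorProduct F D D'
  let s0 : D ⊕ D' → Module.End F T := Sum.elim (fun d => Algebra.lmul F T (d ⊗ₜ 1)) (fun d => Algebra.lmul F T (1 ⊗ₜ d))
  haveI : Nontrivial T := Module.nontrivial_of_finrank_pos (R := F) (by
    rw [Module.finrank_tensorProduct]; exact Nat.mul_pos Module.finrank_pos Module.finrank_pos)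
  obtain ⟨V, hV, hirr⟩ := exists_irr s0
  have m1 : ∀ (x : D) (y : T), s0 (Sum.inl x) y = (x ⊗ₜ 1) * y := fun x y => rfl
  have m2 : ∀ (x : D') (y : T), s0 (Sum.inr x) y = (1 ⊗ₜ x) * y := fun x y => rfl
  let A : DAct F D F V :=
    { a := { toFun := fun d => (s0 (Sum.inl d)).restrict (hV (Sum.inl d))
             map_one' := by ext v; simp [m1, ← Algebra.TensorProduct.one_def]
             map_mul' := fun x y => by ext v; simp [m1, ← mul_assoc]
             map_zero' := by ext v; simp [m1]
             map_add' := fun x y => by ext v; simp [m1, TensorProduct.add_tmul, add_mul] }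
      ha := fun c m => by
        ext; change (algebraMap F D c ⊗ₜ 1) * m.1 = c • m.1
        rw [Algebra.algebraMap_eq_smul_one, ← TensorProduct.smul_tmul', ← Algebra.TensorProduct.one_def, smul_mul_assoc, one_mul] }
  let A' : DAct F D' F V :=
    { a := { toFun := fun d => (s0 (Sum.inr d)).restrict (hV (Sum.inr d))
             map_one' := by ext v; simp [m2, ← Algebra.TensorProduct.one_def]
             map_mul' := fun x y => by ext v; simp [m2, ← mul_assoc]
             map_zero' := by ext v; simp [m2]
             map_add' := fun x y => by ext v; simp [m2, TensorProduct.tmul_add, add_mul] }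
      ha := fun c m => by
        ext; change (1 ⊗ₜ algebraMap F D' c) * m.1 = c • m.1
        rw [Algebra.algebraMap_eq_smul_one, TensorProduct.tmul_smul, ← Algebra.TensorProduct.one_def, smul_mul_assoc, one_mul] }
  have hc : ∀ x y v, A.a x (A'.a y v) = A'.a y (A.a x v) := fun x y v => by
    ext; change (x ⊗ₜ 1) * ((1 ⊗ₜ y) * v.1) = (1 ⊗ₜ y) * ((x ⊗ₜ 1) * v.1)
    rw [← mul_assoc, ← mul_assoc]; simp
  let s := Sum.elim A.a A'.a
  have hA : Irr s := by
    convert hirr using 1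
    funext i; cases i <;> rfl
  letI := hA.div
  have hXn := hA.1
  haveI hCfin : FiniteDimensional F (Com s) := inferInstanceAs (FiniteDimensional F (Subalgebra.toSubmodule (Com s)))
  have e1 := A.sub2 A' hc ⊤ (fun _ => trivial) (fun _ => trivial)
  have e2 := A.sub2 A' hc (Com (fun f : Com s => f.1)) (fun d => (mem_Com _).2 fun g x => ((mem_Com _).1 g.2 (Sum.inl d) x).symm)
    (fun d => (mem_Com _).2 fun g x => ((mem_Com _).1 g.2 (Sum.inr d) x).symm)
  have e4 := hA.finrank_bicom
  rw [← Subalgebra.finrank_toSubmodule, Algebra.top_toSubmodule, finrank_top, Module.finrank_linearMap, top_inf_eq, Subalgebra.finrank_toSubmodule] at e1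
  have hDp : 0 < Module.finrank F D * Module.finrank F D' := Nat.mul_pos Module.finrank_pos Module.finrank_pos
  have hCp : 0 < Module.finrank F (Com s) := Module.finrank_pos
  have hc1 := hA.central_of (by
    rw [e2, pow_two, e1] at e4
    exact Nat.eq_of_mul_eq_mul_left hDp ((Nat.eq_of_mul_eq_mul_right hCp e4).trans (mul_one _).symm))
  exact ⟨V, Com s, inferInstance, inferInstance, inferInstance, inferInstance, ⟨{
    A := A, A' := A', B := ⟨(Com s).val.toRingHom, fun c m => rfl⟩, c := hc, cA := fun d g x => (mem_Com _).1 g.2 (Sum.inl d) x,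
    cA' := fun d g x => (mem_Com _).1 g.2 (Sum.inr d) x, fin := inferInstance, dim := by rw [pow_two]; exact e1 }⟩, hCfin, hc1⟩

section
variable {F D L X Y Δ G M : Type*} [Field F] [DivisionRing D] [Algebra F D] [Field L] [Algebra F L]
    [AddCommGroup X] [Module L X] [AddCommGroup Y] [Module L Y] [DivisionRing Δ] [Algebra L Δ] [Field G] [DivisionRing M] [Algebra G M] [Algebra G L]

/-- precomposition -/
def DAct.pre (A : DAct F D L X) (C : DAct F D L Y) (B : DAct L Δ L X) (h : ∀ x y v, A.a x (B.a y v) = B.a y (A.a x v)) :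
    DAct L Δᵐᵒᵖ L (DAct.hom A C) where
  a := { toFun := fun d => (LinearMap.lcomp L Y (B.a d.unop)).restrict fun f hf => (DAct.mem_hom _ _).2 fun x v => by
           simp only [LinearMap.lcomp_apply]; rw [← h, (DAct.mem_hom _ _).1 hf]
         map_one' := by ext; simp
         map_mul' := fun x y => by ext; simp
         map_zero' := by ext; simp
         map_add' := fun x y => by ext; simp }
  ha c m := by ext v; simp [B.ha]

/-- postcomposition -/
def DAct.post (A : DAct F D L X) (C : DAct F D L Y) (B : DAct G M L Y) (h : ∀ x y v, C.a x (B.a y v) = B.a y (C.a x v)) :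
    DAct G M L (DAct.hom A C) where
  a := { toFun := fun d => (LinearMap.llcomp L X Y Y (B.a d)).restrict fun f hf => (DAct.mem_hom _ _).2 fun x v => by
           simp only [LinearMap.llcomp_apply]; rw [h, (DAct.mem_hom _ _).1 hf]
         map_one' := by ext; simp
         map_mul' := fun x y => by ext; simp
         map_zero' := by ext; simp
         map_add' := fun x y => by ext; simp }
  ha c m := by ext v; simp [B.ha]
end

noncomputable def Tri.baseChange {F D D' E V : Type*} [Field F] [DivisionRing D] [Algebra F D] [DivisionRing D'] [Algebra F D']
    [AddCommGroup V] [Module F V] [DivisionRing E] [Algebra F E] (T : Tri F D F D' F E F V) (L : Type*) [Field L] [Algebra F L] :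
    Tri F D F D' F E L (TensorProduct F L V) :=
  have bc : ∀ f g : Module.End F V, (∀ v, f (g v) = g (f v)) → ∀ v, Module.End.baseChangeHom F L V f (Module.End.baseChangeHom F L V g v) =
      Module.End.baseChangeHom F L V g (Module.End.baseChangeHom F L V f v) := fun f g h => by
    have h2 := congrArg (Module.End.baseChangeHom F L V) (LinearMap.ext h : f * g = g * f)
    rw [map_mul, map_mul] at h2
    exact LinearMap.congr_fun h2
  { A := T.A.baseChange L, A' := T.A'.baseChange L, B := T.B.baseChange L, c := fun x y => bc _ _ (T.c x y), cA := fun x y => bc _ _ (T.cA x y),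
    cA' := fun x y => bc _ _ (T.cA' x y), fin := by have := T.fin; infer_instance, dim := by rw [Module.finrank_baseChange]; exact T.dim }

theorem hom_step {F D G M G' E Y X Δ L : Type u} [Field F] [DivisionRing D] [Algebra F D] [FiniteDimensional F D] [Algebra.IsCentral F D]
    [Field G] [DivisionRing M] [Algebra G M] [Field L] [Algebra F L] [Algebra G L] [Field G'] [Algebra G' L]
    [AddCommGroup Y] [Module L Y] [DivisionRing E] [Algebra G' E] [AddCommGroup X] [Module L X] [DivisionRing Δ] [Algebra L Δ]
    (T : Tri F D G M G' E L Y) (Q : LocMod F D L X Δ) :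
    ∃ (W : Type u) (_ : AddCommGroup W) (_ : Module L W), Nonempty (Tri G M L Δᵐᵒᵖ G' E L W) := by
  haveI := T.fin; haveI := Q.fin; haveI := Q.finΔ
  refine ⟨DAct.hom Q.A T.A, inferInstance, inferInstance, ⟨⟨Q.A.post T.A T.A' T.c, Q.A.pre T.A Q.B Q.comm, Q.A.post T.A T.B T.cA, fun x y v => rfl,
    fun x y v => by ext w; exact T.cA' x y _, fun x y v => rfl, inferInstance, ?_⟩⟩⟩
  have d1 := Q.A.finrank_hom T.A
  have e1 : Module.finrank L Δᵐᵒᵖ = Module.finrank L Δ := (opLinearEquiv L).finrank_eq.symm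
  rw [e1]
  refine Nat.eq_of_mul_eq_mul_left (pow_pos (Module.finrank_pos (R := F) (M := D)) 2) ?_
  rw [← mul_pow, ← d1, mul_pow, Q.finrank_eq, T.dim]; ring

theorem exists_wmod {F D D' E V X X' Δ Δ' L : Type u} [Field F] [DivisionRing D] [Algebra F D] [FiniteDimensional F D] [Algebra.IsCentral F D]
    [DivisionRing D'] [Algebra F D'] [FiniteDimensional F D'] [Algebra.IsCentral F D'] [Field L] [Algebra F L]
    [AddCommGroup V] [Module F V] [DivisionRing E] [Algebra F E]
    [AddCommGroup X] [Module L X] [DivisionRing Δ] [Algebra L Δ] [AddCommGroup X'] [Module L X'] [DivisionRing Δ'] [Algebra L Δ']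
    (T : Tri F D F D' F E F V) (Q : LocMod F D L X Δ) (Q' : LocMod F D' L X' Δ') :
    ∃ (W : Type u) (_ : AddCommGroup W) (_ : Module L W), Nonempty (Tri L Δᵐᵒᵖ L Δ'ᵐᵒᵖ F E L W) := by
  obtain ⟨W, _, _, ⟨T1⟩⟩ := hom_step (T.baseChange L) Q
  exact hom_step T1 Q'

section inv
variable {L W : Type*} [NontriviallyNormedField L] [AddCommGroup W] [Module L W]

theorem VNorm.bdd_span [CompleteSpace L] [FiniteDimensional L W] (β : VNorm L W) {ι : Type*} [Fintype ι] (T : ι → Module.End L W) :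
    ∃ C, 0 < C ∧ ∀ (r : ι → L) (t : ℝ), 0 ≤ t → (∀ i, ‖r i‖ ≤ t) → ∀ w, β.v ((∑ i, r i • T i) w) ≤ C * t * β.v w := by
  choose C hC0 hC using fun i => β.bound β (T i)
  refine ⟨1 + ∑ i, C i, add_pos_of_pos_of_nonneg one_pos (Finset.sum_nonneg fun i _ => (hC0 i).le), fun r t ht hr w => ?_⟩
  have hC1 : ∀ i, C i ≤ 1 + ∑ i, C i := fun i => by
    have := Finset.single_le_sum (fun i _ => (hC0 i).le) (Finset.mem_univ i); linarith
  have h0 := β.nonneg w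
  rw [LinearMap.sum_apply]
  have hS := Finset.sum_nonneg fun i (_ : i ∈ Finset.univ) => (hC0 i).le
  refine β.sum_le _ _ _ (by positivity) fun i _ => ?_
  rw [LinearMap.smul_apply, β.smul]
  calc ‖r i‖ * β.v (T i w) ≤ t * (C i * β.v w) := mul_le_mul (hr i) (hC i w) (β.nonneg _) ht
    _ ≤ t * ((1 + ∑ i, C i) * β.v w) := by gcongr; exact hC1 i
    _ = _ := by ring

theorem VNorm.exists_inv (β : VNorm L W) {I : Type*} [Monoid I] (T : I →* Module.End L W) (t : I → ℝ) (t1 : t 1 = 1)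
    (tm : ∀ i j, t (i * j) = t i * t j) (ht : ∀ i, 0 ≤ t i) (C : ℝ) (hC : ∀ i w, β.v (T i w) ≤ C * t i * β.v w) :
    ∃ α : VNorm L W, (∀ i w, α.v (T i w) ≤ t i * α.v w) ∧ ∀ g : Module.End L W, (∀ i w, T i (g w) = g (T i w)) → ∀ c, 0 ≤ c →
      (∀ w, β.v (g w) ≤ c * β.v w) → ∀ w, α.v (g w) ≤ c * α.v w := by
  have hz : ∀ i w, t i = 0 → β.v (T i w) = 0 := fun i w h => le_antisymm (by simpa [h] using hC i w) (β.nonneg _)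
  have bd : ∀ w, BddAbove (Set.range fun i => β.v (T i w) / t i) := fun w => ⟨|C * β.v w|, by
    rintro _ ⟨i, rfl⟩
    refine le_trans ?_ (le_abs_self _)
    rcases (ht i).eq_or_lt with h | h
    · have := hC 1 w
      rw [map_one, t1] at this
      simp only [hz i w h.symm, zero_div]
      have h0 := β.nonneg w
      simp at this; linarith
    · rw [div_le_iff₀ h]; linarith [hC i w]⟩
  have nn : ∀ i w, 0 ≤ β.v (T i w) / t i := fun i w => div_nonneg (β.nonneg _) (ht i)
  have le : ∀ w i, β.v (T i w) / t i ≤ ⨆ i, β.v (T i w) / t i := fun w i => le_ciSup (bd w) i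
  let α : VNorm L W :=
    { v := fun w => ⨆ i, β.v (T i w) / t i
      nonneg := fun w => (nn 1 w).trans (le w 1)
      eq_zero := fun w h => by
        have := le w 1
        rw [h, map_one, t1, div_one] at this
        exact β.eq_zero _ (le_antisymm this (β.nonneg _))
      add_le := fun x y => ciSup_le fun i => by
        rw [map_add]
        rcases le_max_iff.1 (β.add_le (T i x) (T i y)) with h | h
        · exact le_max_of_le_left ((div_le_div_of_nonneg_right h (ht i)).trans (le x i))
        · exact le_max_of_le_right ((div_le_div_of_nonneg_right h (ht i)).trans (le y i))
      smul := fun c x => by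
        rw [Real.mul_iSup_of_nonneg (norm_nonneg c)]
        refine iSup_congr fun i => ?_
        rw [map_smul, β.smul, mul_div_assoc] }
  refine ⟨α, fun i w => ciSup_le fun j => ?_, fun g hg c hc h w => ciSup_le fun i => ?_⟩
  · have e : T j (T i w) = T (j * i) w := by rw [map_mul]; rfl
    rw [e]
    rcases (ht i).eq_or_lt with h | h
    · rw [hz (j * i) w (by rw [tm, ← h, mul_zero]), zero_div, ← h, zero_mul]
    · have := le w (j * i)
      rw [tm, ← div_div, div_le_iff₀ h] at this
      rw [mul_comm]; exact this
  · rw [hg]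
    calc _ ≤ c * β.v (T i w) / t i := div_le_div_of_nonneg_right (h _) (ht i)
      _ = c * (β.v (T i w) / t i) := mul_div_assoc _ _ _
      _ ≤ _ := mul_le_mul_of_nonneg_left (le w i) hc

/-- rounding up to powers of `q` -/
noncomputable def cl (q t : ℝ) : ℝ := if t ≤ 0 then 0 else q ^ ⌊Real.logb q t⌋

theorem cl_zero (q : ℝ) : cl q 0 = 0 := by simp [cl]

theorem cl_mem {q t : ℝ} (h : 0 < t) : ∃ m : ℤ, cl q t = q ^ m := ⟨_, by rw [cl, if_neg (not_le.2 h)]⟩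

theorem cl_nonneg {q : ℝ} (hq : 0 < q) (t : ℝ) : 0 ≤ cl q t := by
  unfold cl; split_ifs; exacts [le_rfl, (zpow_pos hq _).le]

theorem cl_pos {q : ℝ} (hq : 0 < q) {t : ℝ} (h : 0 < t) : 0 < cl q t := by rw [cl, if_neg (not_le.2 h)]; exact zpow_pos hq _

theorem cl_mono {q : ℝ} (hq : 0 < q) (h1 : q < 1) {t t' : ℝ} (h : t ≤ t') : cl q t ≤ cl q t' := by
  by_cases h0 : t ≤ 0
  · rw [cl, if_pos h0]; exact cl_nonneg hq _
  rw [cl, cl, if_neg h0, if_neg fun h' => h0 (h.trans h')]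
  exact zpow_le_zpow_right_of_le_one₀ hq h1.le (Int.floor_le_floor ((Real.logb_le_logb_of_base_lt_one hq h1 (by linarith) (by linarith)).2 h))

theorem cl_max {q : ℝ} (hq : 0 < q) (h1 : q < 1) (t t' : ℝ) : cl q (max t t') = max (cl q t) (cl q t') :=
  Monotone.map_max fun _ _ h => cl_mono hq h1 h

theorem cl_mul {q : ℝ} (hq : 0 < q) (h1 : q < 1) (m : ℤ) (t : ℝ) : cl q (q ^ m * t) = q ^ m * cl q t := by
  have hp := zpow_pos hq m
  by_cases h0 : t ≤ 0
  · rw [cl, cl, if_pos h0, if_pos (mul_nonpos_of_nonneg_of_nonpos hp.le h0), mul_zero]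
  rw [cl, cl, if_neg h0, if_neg (not_le.2 (mul_pos hp (not_le.1 h0))), Real.logb_mul hp.ne' (fun h => h0 h.le), ← Real.rpow_intCast q m,
    Real.logb_rpow hq h1.ne, Real.rpow_intCast, Int.floor_intCast_add, zpow_add₀ hq.ne']

theorem cl_norm {q : ℝ} (hL : Loc L q) (c : L) (t : ℝ) : cl q (‖c‖ * t) = ‖c‖ * cl q t := by
  by_cases h : c = 0
  · simp [h, cl_zero]
  · obtain ⟨m, hm⟩ := hL.disc c h
    rw [hm, cl_mul hL.q0 hL.q1]

theorem zpow_lt_imp {q : ℝ} (hq : 0 < q) (h1 : q < 1) {m n : ℤ} (h : q ^ m < q⁻¹ * q ^ n) : q ^ m ≤ q ^ n := by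
  rw [← zpow_neg_one, ← zpow_add₀ hq.ne', zpow_lt_zpow_iff_right_of_lt_one₀ hq h1] at h
  exact zpow_le_zpow_right_of_le_one₀ hq h1.le (by omega)

theorem Loc.le_one {q : ℝ} (hL : Loc L q) {x : L} (h : ‖x‖ < q⁻¹) : ‖x‖ ≤ 1 := by
  by_cases h0 : x = 0
  · simp [h0]
  obtain ⟨m, hm⟩ := hL.disc x h0
  rw [hm] at h ⊢
  have := zpow_lt_imp hL.q0 hL.q1 (m := m) (n := 0) (by simpa using h)
  simpa using this

theorem Loc.exists_norm {q : ℝ} (hL : Loc L q) {t : ℝ} (ht : 0 < t) : ∃ x : L, x ≠ 0 ∧ q * t < ‖x‖ ∧ ‖x‖ ≤ t := by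
  obtain ⟨n, h1, h2⟩ := exists_mem_Ico_zpow ht (one_lt_inv₀ hL.q0 |>.2 hL.q1)
  obtain ⟨p, hp⟩ := hL.ex
  have hq := hL.q0
  have hp0 : p ≠ 0 := fun h => by rw [h, norm_zero] at hp; exact hq.ne hp
  refine ⟨p⁻¹ ^ n, zpow_ne_zero _ (inv_ne_zero hp0), ?_, ?_⟩ <;> rw [norm_zpow, norm_inv, hp]
  · rw [zpow_add₀ (inv_pos.2 hq).ne', zpow_one] at h2
    calc q * t < q * (q⁻¹ ^ n * q⁻¹) := by gcongr
      _ = _ := by field_simp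
  · exact h1

/-- operator norm -/
noncomputable def opV (α : VNorm L W) {n : ℕ} (e : Module.Basis (Fin n) L W) : VNorm L (Module.End L W) :=
  have bd : ∀ f : Module.End L W, BddAbove (Set.range fun j => α.v (f (e j)) / α.v (e j)) := fun f => (Set.finite_range _).bddAbove
  { v := fun f => ⨆ j, α.v (f (e j)) / α.v (e j)
    nonneg := fun f => Real.iSup_nonneg fun j => div_nonneg (α.nonneg _) (α.nonneg _)
    eq_zero := fun f h => e.ext fun j => by
      have h1 := le_ciSup (bd f) j
      rw [h, div_le_iff₀ (α.pos (e.ne_zero j)), zero_mul] at h1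
      exact α.eq_zero _ (le_antisymm h1 (α.nonneg _))
    add_le := fun f g => Real.iSup_le (fun j => by
      rw [LinearMap.add_apply]
      rcases le_max_iff.1 (α.add_le (f (e j)) (g (e j))) with h | h
      · exact le_max_of_le_left ((div_le_div_of_nonneg_right h (α.nonneg _)).trans (le_ciSup (bd f) j))
      · exact le_max_of_le_right ((div_le_div_of_nonneg_right h (α.nonneg _)).trans (le_ciSup (bd g) j)))
      (le_max_of_le_left (Real.iSup_nonneg fun j => div_nonneg (α.nonneg _) (α.nonneg _)))
    smul := fun c f => by
      rw [Real.mul_iSup_of_nonneg (norm_nonneg c)]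
      refine iSup_congr fun i => ?_
      rw [LinearMap.smul_apply, α.smul, mul_div_assoc] }

theorem opV_le_iff (α : VNorm L W) {n : ℕ} {e : Module.Basis (Fin n) L W} (he : α.Orth e) (f : Module.End L W) {t : ℝ} (ht : 0 ≤ t) :
    (opV α e).v f ≤ t ↔ ∀ w, α.v (f w) ≤ t * α.v w := by
  constructor
  · intro h w
    rw [← e.sum_repr w, map_sum, e.sum_repr w]
    refine α.sum_le _ _ _ (mul_nonneg ht (α.nonneg _)) fun j _ => ?_
    have h1 := (le_ciSup (f := fun j => α.v (f (e j)) / α.v (e j)) (Set.finite_range _).bddAbove j).trans h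
    rw [div_le_iff₀ (α.pos (e.ne_zero j))] at h1
    rw [map_smul, α.smul]
    calc _ ≤ ‖e.repr w j‖ * (t * α.v (e j)) := by gcongr
      _ = t * (‖e.repr w j‖ * α.v (e j)) := by ring
      _ ≤ _ := by gcongr; exact he w j
  · exact fun h => Real.iSup_le (fun j => (div_le_iff₀ (α.pos (e.ne_zero j))).2 (h _)) ht

theorem opV_mem (α : VNorm L W) {n : ℕ} (e : Module.Basis (Fin n) L W) {f : Module.End L W} (hf : f ≠ 0) :
    ∃ j, f (e j) ≠ 0 ∧ (opV α e).v f = α.v (f (e j)) / α.v (e j) := by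
  haveI : Nonempty (Fin n) := by
    by_contra h; rw [not_nonempty_iff] at h
    exact hf (e.ext fun j => h.elim j)
  obtain ⟨j, hj⟩ := exists_eq_ciSup_of_finite (f := fun j => α.v (f (e j)) / α.v (e j))
  refine ⟨j, fun h0 => hf ((opV α e).eq_zero f ?_), hj.symm⟩
  refine hj.symm.trans ?_
  rw [h0, α.v_zero, zero_div]

theorem norm_trace_le [IsUltrametricDist L] (α : VNorm L W) {n : ℕ} {e : Module.Basis (Fin n) L W} (he : α.Orth e)
    (f : Module.End L W) {q : ℝ} (hL : Loc L q) (h : ∀ w ≠ 0, α.v (f w) < q⁻¹ * α.v w) : ‖LinearMap.trace L W f‖ ≤ 1 := by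
  rw [LinearMap.trace_eq_matrix_trace L e, Matrix.trace]
  refine IsUltrametricDist.norm_sum_le_of_forall_le_of_nonneg zero_le_one fun j _ => hL.le_one ?_
  rw [Matrix.diag_apply, LinearMap.toMatrix_apply]
  exact lt_of_mul_lt_mul_right ((he _ j).trans_lt (h _ (e.ne_zero j))) (α.nonneg _)

theorem trace_smulRight' [FiniteDimensional L W] (l : W →ₗ[L] L) (w : W) : LinearMap.trace L W (l.smulRight w) = l w := by
  simp
end inv

section round
variable {L W : Type*} [NontriviallyNormedField L] [AddCommGroup W] [Module L W]

theorem exists_round {q s : ℝ} (hL : Loc L q) (hs : 0 < s) (hs2 : ∃ j : ℤ, s ^ 2 = q ^ j) (γ : VNorm L W) (τ : Module.End L W)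
    (h1 : ∀ w, τ (τ w) = w) : ∃ α : VNorm L W, α.Disc q 2 ∧
      (∀ (f : Module.End L W) (m : ℤ), (∀ w, f (τ w) = τ (f w)) → (∀ w, γ.v (f w) = q ^ m * γ.v w) → ∀ w, α.v (f w) = q ^ m * α.v w) ∧
      (∀ (f : Module.End L W) (m : ℤ), (∀ w, f (τ w) = -τ (f w)) → (∀ w, γ.v (f w) = s * q ^ m * γ.v w) → ∀ w, α.v (f w) = s * q ^ m * α.v w) ∧
      (∀ (f : Module.End L W), (∀ w, f (τ w) = τ (f w)) → (∀ w, w ≠ 0 → α.v (f w) < q⁻¹ * α.v w) → ∀ w, α.v (f w) ≤ α.v w) := by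
  have hq := hL.q0
  have hq1 := hL.q1
  obtain ⟨j, hj⟩ := hs2
  have h2 : (2 : L) ≠ 0 := fun h => by have := hL.two; rw [h, norm_zero] at this; exact zero_ne_one this
  let P : Module.End L W := (2 : L)⁻¹ • (1 + τ)
  let M : Module.End L W := (2 : L)⁻¹ • (1 - τ)
  have hP : ∀ w, P w = (2 : L)⁻¹ • (w + τ w) := fun w => rfl
  have hM : ∀ w, M w = (2 : L)⁻¹ • (w - τ w) := fun w => rfl
  have hPM : ∀ w, w = P w + M w := fun w => by
    rw [hP, hM, ← smul_add, add_add_sub_cancel, ← two_smul L, inv_smul_smul₀ h2]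
  have hPP : ∀ w, P (P w) = P w := fun w => by
    rw [hP (P w), hP w, map_smul, map_add, h1, add_comm (τ w), ← two_smul L, inv_smul_smul₀ h2]
  have hMP : ∀ w, M (P w) = 0 := fun w => by
    rw [hM (P w), hP w, map_smul, map_add, h1, add_comm (τ w), sub_self, smul_zero]
  have hPM0 : ∀ w, P (M w) = 0 := fun w => by
    rw [hP (M w), hM w, map_smul, map_sub, h1, ← smul_add, sub_add_sub_cancel, sub_self, smul_zero, smul_zero]
  have hMM : ∀ w, M (M w) = M w := fun w => by have := hPM (M w); rw [hPM0, zero_add] at this; exact this.symm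
  let α : VNorm L W :=
    { v := fun w => max (cl q (γ.v (P w))) (s * cl q (γ.v (M w) / s))
      nonneg := fun w => le_max_of_le_left (cl_nonneg hq _)
      eq_zero := fun w h => by
        have e1 : P w = 0 := by
          by_contra h0; have := le_max_left (cl q (γ.v (P w))) (s * cl q (γ.v (M w) / s))
          rw [h] at this; exact absurd (cl_pos hq (γ.pos h0)) (not_lt.2 this)
        have e2 : M w = 0 := by
          by_contra h0; have := le_max_right (cl q (γ.v (P w))) (s * cl q (γ.v (M w) / s))
          rw [h] at this; exact absurd (mul_pos hs (cl_pos hq (div_pos (γ.pos h0) hs))) (not_lt.2 this)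
        rw [hPM w, e1, e2, add_zero]
      add_le := fun x y => by
        rw [map_add, map_add, max_max_max_comm]
        refine max_le_max ?_ ?_
        · rw [← cl_max hq hq1]; exact cl_mono hq hq1 (γ.add_le _ _)
        · rw [← mul_max_of_nonneg _ _ hs.le, ← cl_max hq hq1, max_div_div_right hs.le]
          exact mul_le_mul_of_nonneg_left (cl_mono hq hq1 (div_le_div_of_nonneg_right (γ.add_le _ _) hs.le)) hs.le
      smul := fun c x => by
        rw [map_smul, map_smul, γ.smul, γ.smul, mul_div_assoc, cl_norm hL, cl_norm hL, mul_left_comm, ← mul_max_of_nonneg _ _ (norm_nonneg c)] }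
  have hα : ∀ w, α.v w = max (cl q (γ.v (P w))) (s * cl q (γ.v (M w) / s)) := fun w => rfl
  have aP : ∀ w, α.v (P w) = cl q (γ.v (P w)) := fun w => by
    rw [hα, hPP, hMP, γ.v_zero, zero_div, cl_zero, mul_zero, max_eq_left (cl_nonneg hq _)]
  have aM : ∀ w, α.v (M w) = s * cl q (γ.v (M w) / s) := fun w => by
    rw [hα, hMM, hPM0, γ.v_zero, cl_zero, max_eq_right (mul_nonneg hs.le (cl_nonneg hq _))]
  have vP : ∀ w, P w ≠ 0 → ∃ m : ℤ, α.v (P w) = q ^ m := fun w h => by rw [aP]; exact cl_mem (γ.pos h)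
  have vM : ∀ w, M w ≠ 0 → ∃ m : ℤ, α.v (M w) = s * q ^ m := fun w h => by
    obtain ⟨m, hm⟩ := cl_mem (q := q) (div_pos (γ.pos h) hs)
    exact ⟨m, by rw [aM, hm]⟩
  have split : ∀ w, α.v w = max (α.v (P w)) (α.v (M w)) := fun w => by rw [aP, aM]
  refine ⟨α, fun w hw => ?_, fun f m hc hf w => ?_, fun f m hc hf w => ?_, fun f hc hf w => ?_⟩
  · have key : α.v w = α.v (P w) ∧ P w ≠ 0 ∨ α.v w = α.v (M w) ∧ M w ≠ 0 := by
      have hw' := (α.pos hw).ne'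
      rcases max_choice (α.v (P w)) (α.v (M w)) with h | h <;> rw [← split] at h
      · exact Or.inl ⟨h, fun h0 => hw' (by rw [h, h0, α.v_zero])⟩
      · exact Or.inr ⟨h, fun h0 => hw' (by rw [h, h0, α.v_zero])⟩
    rcases key with ⟨h, h0⟩ | ⟨h, h0⟩
    · obtain ⟨m, hm⟩ := vP w h0
      exact ⟨m * 2, by rw [h, hm, zpow_mul, zpow_ofNat]⟩
    · obtain ⟨m, hm⟩ := vM w h0
      exact ⟨j + m * 2, by rw [h, hm, mul_pow, hj, zpow_add₀ hq.ne', zpow_mul, zpow_ofNat]⟩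
  · have e1 : P (f w) = f (P w) := by rw [hP, hP, map_smul, map_add, hc]
    have e2 : M (f w) = f (M w) := by rw [hM, hM, map_smul, map_sub, hc]
    rw [hα, hα, e1, e2, hf, hf, cl_mul hq hq1, mul_div_assoc, cl_mul hq hq1, mul_left_comm, ← mul_max_of_nonneg _ _ (zpow_pos hq m).le]
  · have e1 : P (f w) = f (M w) := by rw [hP, hM, map_smul, map_sub, hc, sub_neg_eq_add]
    have e2 : M (f w) = f (P w) := by rw [hP, hM, map_smul, map_add, hc, sub_eq_add_neg]
    have e3 : s * q ^ m * γ.v (M w) = q ^ (j + m) * (γ.v (M w) / s) := by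
      rw [zpow_add₀ hq.ne', ← hj]; field_simp
    have e4 : s * q ^ m * γ.v (P w) / s = q ^ m * γ.v (P w) := by field_simp
    have e5 : ∀ t : ℝ, q ^ (j + m) * t = s * q ^ m * (s * t) := fun t => by rw [zpow_add₀ hq.ne', ← hj]; ring
    rw [hα, hα, e1, e2, hf, hf, e3, e4, cl_mul hq hq1, cl_mul hq hq1, e5, ← mul_assoc s (q ^ m), ← mul_max_of_nonneg _ _ (mul_pos hs (zpow_pos hq m)).le,
      max_comm]
  · have e1 : P (f w) = f (P w) := by rw [hP, hP, map_smul, map_add, hc]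
    have e2 : M (f w) = f (M w) := by rw [hM, hM, map_smul, map_sub, hc]
    rw [split (f w), split w]
    refine max_le_max ?_ ?_
    · by_cases h0 : P w = 0
      · rw [e1, h0, map_zero]
      by_cases h0' : P (f w) = 0
      · rw [h0', α.v_zero]; exact α.nonneg _
      obtain ⟨m, hm⟩ := vP w h0
      obtain ⟨m', hm'⟩ := vP _ h0'
      have := hf _ h0
      rw [← e1, hm, hm'] at this
      rw [hm, hm']; exact zpow_lt_imp hq hq1 this
    · by_cases h0 : M w = 0
      · rw [e2, h0, map_zero]
      by_cases h0' : M (f w) = 0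
      · rw [h0', α.v_zero]; exact α.nonneg _
      obtain ⟨m, hm⟩ := vM w h0
      obtain ⟨m', hm'⟩ := vM _ h0'
      have := hf _ h0
      rw [← e2, hm, hm', mul_left_comm] at this
      rw [hm, hm']; exact mul_le_mul_of_nonneg_left (zpow_lt_imp hq hq1 (lt_of_mul_lt_mul_left this hs.le)) hs.le

variable [CompleteSpace L] [IsUltrametricDist L] {Δ Δ' : Type*} [DivisionRing Δ] [Algebra L Δ] [FiniteDimensional L Δ]
  [DivisionRing Δ'] [Algebra L Δ'] [FiniteDimensional L Δ']

theorem DAct.exists_inv [FiniteDimensional L W] (A : DAct L Δ L W) (β : VNorm L W) : ∃ α : VNorm L W, (∀ y w, α.v (A.a y w) ≤ nm L y * α.v w) ∧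
    ∀ g : Module.End L W, (∀ y w, A.a y (g w) = g (A.a y w)) → ∀ c, 0 ≤ c →
      (∀ w, β.v (g w) ≤ c * β.v w) → ∀ w, α.v (g w) ≤ c * α.v w := by
  let b := Module.finBasis L Δ
  obtain ⟨C, hC0, hC⟩ := β.bdd_span fun i => A.a (b i)
  choose C' hC'0 hC' using fun i => (nmV L Δ).boundL (b.coord i)
  refine β.exists_inv (A.a : Δ →* Module.End L W) (fun y => nm L y) (nm_one) (fun x y => nm_mul x y) (fun y => nm_nonneg y) (C * (1 + ∑ i, C' i)) fun y w => ?_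
  have hS := Finset.sum_nonneg fun i (_ : i ∈ Finset.univ) => (hC'0 i).le
  have hy := nm_nonneg (L := L) y
  have := hC (fun i => b.repr y i) ((1 + ∑ i, C' i) * nm L y) (by positivity) (fun i => (hC' i y).trans (by
    have := Finset.single_le_sum (fun i _ => (hC'0 i).le) (Finset.mem_univ i)
    exact mul_le_mul_of_nonneg_right (by linarith) hy)) w
  have e : ∑ i, b.repr y i • A.a (b i) = A.a y := by
    conv_rhs => rw [← b.sum_repr y]
    rw [map_sum]; exact Finset.sum_congr rfl fun i _ => (A.map_smul _ _).symm
  rw [e] at this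
  exact this.trans (le_of_eq (by ring))

theorem round_act {q s : ℝ} (hL : Loc L q) {c : L} {z : Δ} (hc : ‖c‖ = 1) (Z : ZData L Δ q s c z) (A : DAct L Δ L W) (γ α : VNorm L W) (τ : Module.End L W)
    (hγ : ∀ y w, γ.v (A.a y w) ≤ nm L y * γ.v w) (τ' : Module.End L W) (h' : ∀ y w, A.a y (τ' w) = τ' (A.a y w)) (hτ : ∀ w, τ w = τ' (A.a z w))
    (p2 : ∀ (f : Module.End L W) (m : ℤ), (∀ w, f (τ w) = τ (f w)) → (∀ w, γ.v (f w) = q ^ m * γ.v w) → ∀ w, α.v (f w) = q ^ m * α.v w)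
    (p3 : ∀ (f : Module.End L W) (m : ℤ), (∀ w, f (τ w) = -τ (f w)) → (∀ w, γ.v (f w) = s * q ^ m * γ.v w) → ∀ w, α.v (f w) = s * q ^ m * α.v w)
    (y : Δ) (w : W) : α.v (A.a y w) ≤ nm L y * α.v w := by
  have eq : ∀ y : Δ, y ≠ 0 → ∀ w, γ.v (A.a y w) = nm L y * γ.v w := fun y hy w => by
    refine le_antisymm (hγ y w) ?_
    have := hγ y⁻¹ (A.a y w)
    rw [← Module.End.mul_apply, ← map_mul, inv_mul_cancel₀ hy, map_one, Module.End.one_apply, nm_inv, inv_mul_eq_div, le_div_iff₀' (nm_pos hy)] at this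
    exact this
  have ev : ∀ y : Δ, y * z = z * y → α.v (A.a y w) ≤ nm L y * α.v w := fun y hy => by
    by_cases h0 : y = 0
    · rw [h0, map_zero, LinearMap.zero_apply, α.v_zero, nm_zero, zero_mul]
    obtain ⟨m, hm⟩ := Z.ev y h0 hy
    rw [hm]
    refine (p2 _ m (fun w => ?_) (fun w => by rw [eq y h0, hm]) w).le
    rw [hτ, hτ, h', ← Module.End.mul_apply (A.a y), ← map_mul, hy, map_mul]; rfl
  have od : ∀ y : Δ, y * z = -(z * y) → α.v (A.a y w) ≤ nm L y * α.v w := fun y hy => by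
    by_cases h0 : y = 0
    · rw [h0, map_zero, LinearMap.zero_apply, α.v_zero, nm_zero, zero_mul]
    obtain ⟨m, hm⟩ := Z.od y h0 hy
    rw [hm]
    refine (p3 _ m (fun w => ?_) (fun w => by rw [eq y h0, hm]) w).le
    rw [hτ, hτ, h', ← Module.End.mul_apply (A.a y), ← map_mul, hy, map_neg, map_mul, LinearMap.neg_apply, map_neg]; rfl
  have hz1 := nm_of_sq hc Z.sq
  have hz0 : z ≠ 0 := fun h => by rw [h, nm_zero] at hz1; exact zero_ne_one hz1
  have hz2 : z * z⁻¹ = 1 := mul_inv_cancel₀ hz0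
  have hz3 : z⁻¹ * z = 1 := inv_mul_cancel₀ hz0
  have c1 : ∀ y : Δ, z * z * y = y * (z * z) := fun y => by rw [Z.sq]; exact Algebra.commutes _ _
  have c2 : z⁻¹ * y * z * z = z * y := by
    apply mul_left_cancel₀ hz0
    rw [← mul_assoc, ← mul_assoc, ← mul_assoc, hz2, one_mul, mul_assoc, ← c1, mul_assoc]
  have c3 : z * (z⁻¹ * y * z) = y * z := by rw [← mul_assoc, ← mul_assoc, hz2, one_mul]
  have hn : nm L (z⁻¹ * y * z) = nm L y := by rw [nm_mul, nm_mul, nm_inv, hz1]; simp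
  have h2 := hL.two
  have h20 : (2 : L) ≠ 0 := fun h => by rw [h, norm_zero] at h2; exact zero_ne_one h2
  have n2 : ∀ x : Δ, nm L ((2 : L)⁻¹ • x) = nm L x := fun x => by rw [nm_smul, norm_inv, h2, inv_one, one_mul]
  have hy : y = (2 : L)⁻¹ • (y + z⁻¹ * y * z) + (2 : L)⁻¹ • (y - z⁻¹ * y * z) := by
    rw [← smul_add, add_add_sub_cancel, ← two_smul L, inv_smul_smul₀ h20]
  have a0 := α.nonneg w
  conv_lhs => rw [hy, map_add, LinearMap.add_apply]
  refine (α.add_le _ _).trans (max_le ((ev _ ?_).trans ?_) ((od _ ?_).trans ?_))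
  · rw [smul_mul_assoc, mul_smul_comm, add_mul, mul_add, c2, c3, add_comm]
  · rw [n2]; exact mul_le_mul_of_nonneg_right ((nm_add_le _ _).trans (by rw [hn, max_self])) a0
  · rw [smul_mul_assoc, mul_smul_comm, sub_mul, mul_sub, c2, c3, ← smul_neg, neg_sub]
  · rw [n2, sub_eq_add_neg]; exact mul_le_mul_of_nonneg_right ((nm_add_le _ _).trans (by rw [nm_neg, hn, max_self])) a0

/-- the lattice at a place -/
theorem exists_alpha [FiniteDimensional L W] {q s : ℝ} (hL : Loc L q) (hs : 0 < s) (hs2 : ∃ j : ℤ, s ^ 2 = q ^ j) {c : L} {z : Δ} {z' : Δ'} (hc : ‖c‖ = 1)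
    (Z : ZData L Δ q s c z) (Z' : ZData L Δ' q s c z') (A : DAct L Δ L W) (A' : DAct L Δ' L W) (hAA : ∀ x y v, A.a x (A'.a y v) = A'.a y (A.a x v)) :
    ∃ α : VNorm L W, α.Disc q 2 ∧ (∀ y w, α.v (A.a y w) ≤ nm L y * α.v w) ∧ (∀ y w, α.v (A'.a y w) ≤ nm L y * α.v w) ∧
      ∀ f : Module.End L W, (∀ y w, A.a y (f w) = f (A.a y w)) → (∀ y w, A'.a y (f w) = f (A'.a y w)) →
        (∀ w, w ≠ 0 → α.v (f w) < q⁻¹ * α.v w) → ∀ w, α.v (f w) ≤ α.v w := by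
  obtain ⟨γ1, g1, -⟩ := A.exists_inv (VNorm.ofBasis (Module.finBasis L W))
  obtain ⟨γ, g2, g3⟩ := A'.exists_inv γ1
  have c0 : c ≠ 0 := fun h => by rw [h, norm_zero] at hc; exact zero_ne_one hc
  have sq : ∀ v, A.a z (A.a z v) = c • v := fun v => by
    rw [← Module.End.mul_apply, ← map_mul, Z.sq, A.ha]; rfl
  have sq' : ∀ v, A'.a z' (A'.a z' v) = c • v := fun v => by
    rw [← Module.End.mul_apply, ← map_mul, Z'.sq, A'.ha]; rfl
  obtain ⟨α, a1, a2, a3, a4⟩ := exists_round hL hs hs2 γ (c⁻¹ • (A.a z * A'.a z')) fun w => by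
    simp only [LinearMap.smul_apply, Module.End.mul_apply, map_smul]
    rw [← hAA, sq', map_smul, map_smul, sq, inv_smul_smul₀ c0, inv_smul_smul₀ c0]
  refine ⟨α, a1, round_act hL hc Z A γ α _ (fun y => g3 _ (fun x w => (hAA _ _ _).symm) _ (nm_nonneg y) (g1 y)) (c⁻¹ • A'.a z')
    (fun y w => by simp [hAA]) (fun w => by simp [hAA]) a2 a3, round_act hL hc Z' A' γ α _ g2 (c⁻¹ • A.a z) (fun y w => by simp [hAA]) (fun w => rfl) a2 a3,
    fun f h1 h2 => a4 f fun w => ?_⟩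
  simp [h1, h2]
end round

theorem Tri.nt {F D F' D' G E R X : Type*} [Field F] [Field F'] [Field G] [DivisionRing D] [Algebra F D] [DivisionRing D'] [Algebra F' D']
    [DivisionRing E] [Algebra G E] [Field R] [Algebra F R] [Algebra F' R] [Algebra G R] [AddCommGroup X] [Module R X]
    [FiniteDimensional F D] [FiniteDimensional F' D'] [FiniteDimensional G E] (T : Tri F D F' D' G E R X) : Nontrivial X := by
  haveI := T.fin
  refine Module.nontrivial_of_finrank_pos (R := R) (pos_of_ne_zero fun h => ?_)
  have := T.dim
  rw [h] at this
  have h1 := Nat.mul_pos (Nat.mul_pos (Module.finrank_pos (R := F) (M := D)) (Module.finrank_pos (R := F') (M := D'))) (Module.finrank_pos (R := G) (M := E))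
  omega

theorem Tri.span {F D F' D' G E R X : Type*} [Field F] [Field F'] [Field G] [DivisionRing D] [Algebra F D] [DivisionRing D'] [Algebra F' D']
    [DivisionRing E] [Algebra G E] [Field R] [Algebra F R] [Algebra F' R] [Algebra G R] [AddCommGroup X] [Module R X]
    [FiniteDimensional F D] [FiniteDimensional F' D'] [FiniteDimensional G E] [Algebra.IsCentral F D] [Algebra.IsCentral F' D'] [Algebra.IsCentral G E]
    (T : Tri F D F' D' G E R X) {ι : Type*} [Fintype ι] (g : Module.Basis ι G E) (f : Module.End R X)
    (h1 : ∀ y w, T.A.a y (f w) = f (T.A.a y w)) (h2 : ∀ y w, T.A'.a y (f w) = f (T.A'.a y w)) : ∃ l : ι → R, ∑ i, l i • T.B.a (g i) = f := by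
  haveI := T.fin; haveI := T.nt
  rw [← Submodule.mem_span_range_iff_exists_fun]
  have e1 := T.A.sub2 T.A' T.c ⊤ (fun _ => trivial) (fun _ => trivial)
  rw [← Subalgebra.finrank_toSubmodule, Algebra.top_toSubmodule, finrank_top, Module.finrank_linearMap, top_inf_eq, ← pow_two, T.dim] at e1
  have e2 := Nat.eq_of_mul_eq_mul_left (Nat.mul_pos (Module.finrank_pos (R := F) (M := D)) (Module.finrank_pos (R := F') (M := D'))) e1
  have hle : Submodule.span R (Set.range fun i => T.B.a (g i)) ≤ Subalgebra.toSubmodule (Com (Sum.elim T.A.a T.A'.a)) := by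
    rw [Submodule.span_le]; rintro _ ⟨i, rfl⟩
    refine (mem_Com _).2 ?_
    rintro (x | x) v
    exacts [T.cA x _ v, T.cA' x _ v]
  rw [Submodule.eq_of_le_of_finrank_eq hle (by rw [finrank_span_eq_card (T.B.linInd_basis g), ← Module.finrank_eq_card_basis g, e2])]
  refine (mem_Com _).2 ?_
  rintro (x | x) v
  exacts [h1 x v, h2 x v]

section det
variable {L : Type*} [NontriviallyNormedField L] [IsUltrametricDist L]

theorem norm_det_le {m : ℕ} (T : Matrix (Fin m) (Fin m) L) (h : ∀ i j, ‖T i j‖ ≤ 1) : ‖T.det‖ ≤ 1 := by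
  rw [Matrix.det_apply']
  refine IsUltrametricDist.norm_sum_le_of_forall_le_of_nonneg zero_le_one fun σ _ => ?_
  rw [norm_mul, norm_prod]
  refine mul_le_one₀ ?_ (Finset.prod_nonneg fun _ _ => norm_nonneg _) (Finset.prod_le_one (fun _ _ => norm_nonneg _) fun i _ => h _ _)
  rcases Int.units_eq_one_or (Equiv.Perm.sign σ) with h | h <;> simp [h]

theorem norm_det_eq {m : ℕ} (T : Matrix (Fin m) (Fin m) L) (h : ∀ i j, ‖T i j‖ ≤ 1)
    (h' : ∀ l : Fin m → L, (∀ i, ‖(T.mulVec l) i‖ ≤ 1) → ∀ j, ‖l j‖ ≤ 1) : ‖T.det‖ = 1 := by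
  have hdet : T.det ≠ 0 := fun h0 => by
    obtain ⟨v, hv, hT⟩ := Matrix.exists_mulVec_eq_zero_iff.2 h0
    obtain ⟨j, hj⟩ := Function.ne_iff.1 hv
    obtain ⟨x, hx⟩ := NormedField.exists_one_lt_norm L
    have := h' ((x * (v j)⁻¹) • v) (fun i => by rw [Matrix.mulVec_smul, hT]; simp) j
    rw [Pi.smul_apply, smul_eq_mul, inv_mul_cancel_right₀ hj] at this
    linarith
  have hu := (Matrix.isUnit_iff_isUnit_det T).2 (isUnit_iff_ne_zero.2 hdet)
  have hinv : ∀ i j, ‖T⁻¹ i j‖ ≤ 1 := fun i j => by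
    have := h' (fun i => T⁻¹ i j) (fun k => by
      have e : T.mulVec (fun i => T⁻¹ i j) k = (T * T⁻¹) k j := rfl
      rw [e, Matrix.mul_nonsing_inv _ (isUnit_iff_ne_zero.2 hdet), Matrix.one_apply]; split_ifs <;> simp) i
    exact this
  refine le_antisymm (norm_det_le T h) ?_
  have h1 := norm_det_le _ hinv
  rw [Matrix.det_nonsing_inv, Ring.inverse_eq_inv', norm_inv] at h1
  exact (inv_le_one₀ (norm_pos_iff.2 hdet)).1 h1
end det

section lo
variable {L W F E Δ Δ' : Type*} [NontriviallyNormedField L] [CompleteSpace L] [IsUltrametricDist L] [AddCommGroup W] [Module L W] [Field F] [Algebra F L]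
  [DivisionRing E] [Algebra F E] [FiniteDimensional F E] [Algebra.IsCentral F E] [DivisionRing Δ] [Algebra L Δ] [FiniteDimensional L Δ] [Algebra.IsCentral L Δ]
  [DivisionRing Δ'] [Algebra L Δ'] [FiniteDimensional L Δ'] [Algebra.IsCentral L Δ']

/-- averaging -/
theorem DAct.average {q : ℝ} (hL : Loc L q) (hN : ‖(Module.finrank L Δ : L)‖ = 1) (A : DAct L Δ L W) (α : VNorm L W)
    (hα : ∀ y w, α.v (A.a y w) ≤ nm L y * α.v w) (f : Module.End L W) (hf : ∀ w, α.v (f w) ≤ α.v w) : ∃ f' : Module.End L W,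
      (∀ w, α.v (f' w) ≤ α.v w) ∧ (∀ y w, A.a y (f' w) = f' (A.a y w)) ∧
      (∀ g : Module.End L W, (∀ y, A.a y * g = g * A.a y) → LinearMap.trace L W (g * f') = LinearMap.trace L W (g * f)) ∧
      ∀ g : Module.End L W, (∀ y, A.a y * g = g * A.a y) → g * f = f * g → g * f' = f' * g := by
  obtain ⟨b, c, hd, hbc, -, hcb⟩ := exists_nm_dual hL hN (Δ := Δ)
  let ρ : Δ →ₐ[L] Module.End L W := { A.a with commutes' := fun r => LinearMap.ext fun w => A.ha r w }
  have hρ : ∀ y, ρ y = A.a y := fun y => rfl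
  refine ⟨∑ i, A.a (b i) * f * A.a (c i), fun w => ?_, fun y w => LinearMap.congr_fun (hd.comm ρ f y) w, fun g hg => ?_, fun g hg h => ?_⟩
  · rw [LinearMap.sum_apply]
    refine α.sum_le _ _ _ (α.nonneg w) fun i _ => ?_
    calc _ ≤ nm L (b i) * α.v (f (A.a (c i) w)) := hα _ _
      _ ≤ nm L (b i) * (nm L (c i) * α.v w) := mul_le_mul_of_nonneg_left ((hf _).trans (hα _ _)) (nm_nonneg _)
      _ = nm L (b i) * nm L (c i) * α.v w := by ring
      _ ≤ 1 * α.v w := mul_le_mul_of_nonneg_right (hbc i) (α.nonneg w)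
      _ = _ := one_mul _
  · have e : ∀ i, LinearMap.trace L W (g * (A.a (b i) * f * A.a (c i))) = LinearMap.trace L W (g * A.a (c i * b i) * f) := fun i => by
      rw [← mul_assoc, LinearMap.trace_mul_comm, ← mul_assoc, ← mul_assoc, hg, mul_assoc g, ← map_mul]
    rw [Finset.mul_sum, map_sum, Finset.sum_congr rfl fun i _ => e i, ← map_sum, ← Finset.sum_mul, ← Finset.mul_sum, ← map_sum, hcb, map_one, mul_one]
  · rw [Finset.mul_sum, Finset.sum_mul]
    exact Finset.sum_congr rfl fun i _ => by
      rw [mul_assoc _ _ g, hg, ← mul_assoc, ← mul_assoc, ← hg, mul_assoc _ g f, h]; simp only [mul_assoc]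

theorem self_dual [FiniteDimensional L W] {q : ℝ} (hL : Loc L q) (hN : ‖(Module.finrank L Δ : L)‖ = 1) (hN' : ‖(Module.finrank L Δ' : L)‖ = 1)
    (A : DAct L Δ L W) (A' : DAct L Δ' L W) (hAA : ∀ x y v, A.a x (A'.a y v) = A'.a y (A.a x v)) (α : VNorm L W) (hα : ∀ y w, α.v (A.a y w) ≤ nm L y * α.v w)
    (hα' : ∀ y w, α.v (A'.a y w) ≤ nm L y * α.v w) {n : ℕ} {e : Module.Basis (Fin n) L W} (he : α.Orth e) (g : Module.End L W)
    (hg : ∀ y w, A.a y (g w) = g (A.a y w)) (hg' : ∀ y w, A'.a y (g w) = g (A'.a y w))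
    (H : ∀ f : Module.End L W, (∀ y w, A.a y (f w) = f (A.a y w)) → (∀ y w, A'.a y (f w) = f (A'.a y w)) → (∀ w, α.v (f w) ≤ α.v w) →
      ‖LinearMap.trace L W (g * f)‖ ≤ 1) (w : W) (hw : w ≠ 0) : α.v (g w) < q⁻¹ * α.v w := by
  have H' : ∀ f : Module.End L W, (∀ w, α.v (f w) ≤ α.v w) → ‖LinearMap.trace L W (g * f)‖ ≤ 1 := fun f hf => by
    obtain ⟨f1, p1, p2, p3, -⟩ := A.average hL hN α hα f hf
    obtain ⟨f2, r1, r2, r3, r4⟩ := A'.average hL hN' α hα' f1 p1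
    rw [← p3 g fun y => LinearMap.ext (hg y), ← r3 g fun y => LinearMap.ext (hg' y)]
    exact H f2 (fun y => LinearMap.congr_fun (r4 (A.a y) (fun z => LinearMap.ext fun v => (hAA _ _ _).symm) (LinearMap.ext (p2 y)))) r2 r1
  by_contra hlt
  push Not at hlt
  have hw0 := α.pos hw
  have hq := hL.q0
  have hgw : 0 < α.v (g w) := lt_of_lt_of_le (by positivity) hlt
  have : ∃ i, α.v (g w) ≤ ‖e.repr (g w) i‖ * α.v (e i) := by
    by_contra! h
    have := α.sum_lt Finset.univ (fun i => e.repr (g w) i • e i) _ hgw (fun i _ => by rw [α.smul]; exact h i)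
    rw [e.sum_repr] at this
    exact lt_irrefl _ this
  obtain ⟨i, hi⟩ := this
  have hei := α.pos (e.ne_zero i)
  obtain ⟨x, -, hx1, hx2⟩ := hL.exists_norm (div_pos hei hw0)
  have h1 := H' ((x • e.coord i).smulRight w) (fun v => by
    rw [LinearMap.smulRight_apply, α.smul, LinearMap.smul_apply, norm_smul, Module.Basis.coord_apply]
    calc _ ≤ α.v (e i) / α.v w * ‖e.repr v i‖ * α.v w := by gcongr
      _ = ‖e.repr v i‖ * α.v (e i) := by field_simp
      _ ≤ _ := he v i)
  have e1 : g * (x • e.coord i).smulRight w = (x • e.coord i).smulRight (g w) := by ext v; simp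
  rw [e1, trace_smulRight', LinearMap.smul_apply, norm_smul, Module.Basis.coord_apply] at h1
  have h2 : q * (α.v (e i) / α.v w) * ‖e.repr (g w) i‖ < 1 :=
    lt_of_lt_of_le (mul_lt_mul_of_pos_right hx1 (by by_contra h; push Not at h; nlinarith [mul_nonpos_of_nonpos_of_nonneg h hei.le])) h1
  have h3 : q * (α.v (e i) / α.v w) * ‖e.repr (g w) i‖ = q * (‖e.repr (g w) i‖ * α.v (e i)) / α.v w := by ring
  rw [h3, div_lt_one hw0] at h2
  have h4 : α.v w ≤ q * α.v (g w) := by rwa [inv_mul_le_iff₀ hq] at hlt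
  nlinarith [mul_le_mul_of_nonneg_left hi hq.le]

/-- pulled back norm -/
def VNorm.comap {V : Type*} [AddCommGroup V] [Module L V] (ν : VNorm L W) (f : V →ₗ[L] W) (hf : Function.Injective f) : VNorm L V where
  v x := ν.v (f x)
  nonneg x := ν.nonneg _
  eq_zero x h := hf (by rw [ν.eq_zero _ h, map_zero])
  add_le x y := by rw [map_add]; exact ν.add_le _ _
  smul c x := by rw [map_smul]; exact ν.smul _ _

/-- approximation of an orthogonal basis by rational vectors -/
theorem exists_rat_orth {q : ℝ} {K : ℕ} (hL : Loc L q) (hK : K ≠ 0) (hd : DenseRange (algebraMap F L)) {m : ℕ} (ν : VNorm L (Fin m → L)) (hν : ν.Disc q K) :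
    ∃ f : Fin m → Fin m → F, (∀ i, ν.v (fun j => algebraMap F L (f i j)) ≤ 1) ∧
      ∀ c : Fin m → L, ν.v (∑ i, c i • fun j => algebraMap F L (f i j)) ≤ 1 → ∀ i, ‖c i‖ ≤ 1 := by
  have hq := hL.q0
  obtain ⟨h0, ho⟩ := ν.exists_orth hq hL.q1 hK hν
  let h := h0.reindex (finCongr (Module.finrank_fin_fun L))
  have ho : ν.Orth h := fun x i => by simpa [h] using ho x _
  choose x hx0 hx1 hx2 using fun i => hL.exists_norm (inv_pos.2 (ν.pos (h.ne_zero i)))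
  let C : ℝ := 1 + ∑ j, ν.v (Pi.single j 1)
  have hS : 0 ≤ ∑ j : Fin m, ν.v (Pi.single j 1) := Finset.sum_nonneg fun j _ => ν.nonneg _
  have hC0 : 0 < C := by positivity
  have hC : ∀ (v : Fin m → L) (t : ℝ), 0 ≤ t → (∀ j, ‖v j‖ ≤ t / C) → ν.v v ≤ t := fun v t ht hv => by
    rw [pi_eq_sum_univ' v]
    refine ν.sum_le _ _ _ ht fun j _ => ?_
    rw [ν.smul]
    have h1 := Finset.single_le_sum (fun i _ => ν.nonneg (Pi.single i (1 : L))) (Finset.mem_univ j)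
    calc _ ≤ t / C * C := mul_le_mul (hv j) (by linarith) (ν.nonneg _) (by positivity)
      _ = t := by field_simp
  choose f hf using fun i j => hd.exists_dist_lt ((x i • h i) j) (div_pos hq hC0)
  have hk1 : ∀ i, ν.v (x i • h i) ≤ 1 := fun i => by
    rw [ν.smul]
    have := ν.pos (h.ne_zero i)
    calc _ ≤ (ν.v (h i))⁻¹ * ν.v (h i) := by gcongr; exact hx2 i
      _ = 1 := by field_simp
  have hfk : ∀ i, ν.v (x i • h i - fun j => algebraMap F L (f i j)) ≤ q := fun i => hC _ _ hq.le fun j => by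
    have := hf i j; rw [dist_eq_norm] at this; exact this.le
  refine ⟨f, fun i => ?_, fun c hc => ?_⟩
  · have := ν.sub_le (x i • h i) (x i • h i - fun j => algebraMap F L (f i j))
    rw [sub_sub_cancel] at this
    exact this.trans (max_le (hk1 i) ((hfk i).trans hL.q1.le))
  · by_contra! hM
    obtain ⟨i1, hi1⟩ := hM
    obtain ⟨i, -, hi⟩ := Finset.exists_max_image Finset.univ (fun i => ‖c i‖) ⟨i1, Finset.mem_univ _⟩
    have hci : 1 < ‖c i‖ := hi1.trans_le (hi i1 (Finset.mem_univ _))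
    have hci2 : 1 ≤ ‖c i‖ * q := by
      by_contra h; push Not at h
      exact absurd (hL.le_one (x := c i) (by rwa [lt_inv_comm₀ (by linarith) hq, inv_eq_one_div, lt_div_iff₀ (by linarith), mul_comm])) (not_le.2 hci)
    have e1 : ∑ i, c i • x i • h i = (∑ i, c i • fun j => algebraMap F L (f i j)) + ∑ i, c i • (x i • h i - fun j => algebraMap F L (f i j)) := by
      rw [← Finset.sum_add_distrib]; exact Finset.sum_congr rfl fun i _ => by rw [← smul_add, add_sub_cancel]
    have h1 := ν.add_le (∑ i, c i • fun j => algebraMap F L (f i j)) (∑ i, c i • (x i • h i - fun j => algebraMap F L (f i j)))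
    rw [← e1] at h1
    have h2 : ν.v (∑ i, c i • (x i • h i - fun j => algebraMap F L (f i j))) ≤ ‖c i‖ * q := ν.sum_le _ _ _ (by positivity) fun j _ => by
      rw [ν.smul]; exact mul_le_mul (hi j (Finset.mem_univ _)) (hfk j) (ν.nonneg _) (norm_nonneg _)
    have h3 := ho (∑ i, c i • x i • h i) i
    have e2 : h.repr (∑ i, c i • x i • h i) i = c i * x i := by
      simp_rw [smul_smul]; rw [h.repr_sum_self]
    rw [e2, norm_mul] at h3
    have h4 := hx1 i
    have h5 := ν.pos (h.ne_zero i)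
    rw [← div_eq_mul_inv, div_lt_iff₀ h5] at h4
    have h6 : ‖c i‖ * q < ‖c i‖ * (‖x i‖ * ν.v (h i)) := mul_lt_mul_of_pos_left h4 (by linarith)
    have h7 := h3.trans (h1.trans (max_le (hc.trans hci2) h2))
    linarith [mul_assoc ‖c i‖ ‖x i‖ (ν.v (h i))]

theorem local_order {q s : ℝ} (hL : Loc L q) (hN : ‖(Module.finrank L Δ : L)‖ = 1) (hN' : ‖(Module.finrank L Δ' : L)‖ = 1)
    (hE : ‖(Module.finrank F E : L)‖ = 1) (hd : DenseRange (algebraMap F L)) (hs : 0 < s) (hs2 : ∃ j : ℤ, s ^ 2 = q ^ j) {c : L} {z : Δ} {z' : Δ'} (hc : ‖c‖ = 1)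
    (Z : ZData L Δ q s c z) (Z' : ZData L Δ' q s c z') (T : Tri L Δ L Δ' F E L W) :
    ∃ h : Module.Basis (Fin (Module.finrank F E)) F E, (∀ i j k, ‖algebraMap F L (h.repr (h i * h j) k)‖ ≤ 1) ∧
      ‖algebraMap F L (Matrix.of fun i j => rtr F E (h i * h j)).det‖ = 1 := by
  haveI := T.fin; haveI := T.nt
  obtain ⟨α, a1, a2, a3, a4⟩ := exists_alpha hL hs hs2 hc Z Z' T.A T.A' T.c
  obtain ⟨e, he⟩ := α.exists_orth hL.q0 hL.q1 two_ne_zero a1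
  let g := Module.finBasis F E
  let Φ := Fintype.linearCombination L (fun i => T.B.a (g i))
  have hΦ : ∀ l, Φ l = ∑ i, l i • T.B.a (g i) := fun l => Fintype.linearCombination_apply _ _ _
  have hΦF : ∀ f : Fin (Module.finrank F E) → F, Φ (fun j => algebraMap F L (f j)) = T.B.a (∑ j, f j • g j) := fun f => by
    rw [hΦ, map_sum]; exact Finset.sum_congr rfl fun i _ => (T.B.map_smul _ _).symm
  have hΦi : Function.Injective Φ := (injective_iff_map_eq_zero _).2 fun l h => funext (Fintype.linearIndependent_iff.1 (T.B.linInd_basis g) l ((hΦ l).symm.trans h))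
  obtain ⟨f, f1, f2⟩ := exists_rat_orth hL two_ne_zero hd ((opV α e).comap Φ hΦi) (fun x hx => by
    obtain ⟨j, hj, h⟩ := opV_mem α e (f := Φ x) (fun h => hx (hΦi (by rw [h, map_zero])))
    obtain ⟨m1, h1⟩ := a1 _ hj
    obtain ⟨m2, h2⟩ := a1 _ (e.ne_zero j)
    exact ⟨m1 - m2, by change (opV α e).v (Φ x) ^ 2 = _; rw [h, div_pow, h1, h2, zpow_sub₀ hL.q0.ne']⟩)
  let h : Fin (Module.finrank F E) → E := fun i => ∑ j, f i j • g j
  have h1 : ∀ i w, α.v (T.B.a (h i) w) ≤ α.v w := fun i w => by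
    have := (opV_le_iff α he _ zero_le_one).1 (f1 i) w
    rwa [hΦF, one_mul] at this
  have h2 : ∀ c : Fin (Module.finrank F E) → L, (∀ w, α.v ((∑ i, c i • T.B.a (h i)) w) ≤ α.v w) → ∀ i, ‖c i‖ ≤ 1 := fun c hc => f2 c (by
    refine (opV_le_iff α he _ zero_le_one).2 fun w => ?_
    rw [map_sum, one_mul]
    simp only [map_smul, hΦF]
    exact hc w)
  have hind : LinearIndependent F h := by
    rw [Fintype.linearIndependent_iff]
    intro c hc i
    by_contra h0
    obtain ⟨x, hx⟩ := NormedField.exists_one_lt_norm L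
    have h0' : algebraMap F L (c i) ≠ 0 := (_root_.map_ne_zero _).2 h0
    have := h2 (fun j => x * (algebraMap F L (c i))⁻¹ * algebraMap F L (c j)) (fun w => by
      have : ∑ j, (x * (algebraMap F L (c i))⁻¹ * algebraMap F L (c j)) • T.B.a (h j) = 0 := by
        simp_rw [mul_smul, ← T.B.map_smul, ← Finset.smul_sum, ← map_sum, hc]; simp
      rw [this, LinearMap.zero_apply, α.v_zero]; exact α.nonneg _) i
    rw [inv_mul_cancel_right₀ h0'] at this
    linarith
  let H := basisOfLinearIndependentOfCardEqFinrank' h hind (by simp)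
  have hH : ∀ i, H i = h i := fun i => by simp [H]
  have hHB : ∀ x : E, ∑ i, algebraMap F L (H.repr x i) • T.B.a (h i) = T.B.a x := fun x => by
    conv_rhs => rw [← H.sum_repr x, map_sum]
    exact Finset.sum_congr rfl fun i _ => by rw [T.B.map_smul, hH]
  have hmul : ∀ i j w, α.v (T.B.a (h i * h j) w) ≤ α.v w := fun i j w => by
    rw [map_mul]; exact (h1 _ _).trans (h1 _ _)
  refine ⟨H, fun i j k => h2 (fun k => algebraMap F L (H.repr (H i * H j) k)) (fun w => by rw [hHB, hH, hH]; exact hmul i j w) k, ?_⟩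
  have hW : ‖(Module.finrank L W : L)‖ = 1 := by
    have := congrArg (fun n : ℕ => ‖(n : L)‖) T.dim
    simp only [Nat.cast_pow, Nat.cast_mul, norm_pow, norm_mul, hN, hN', hE, mul_one] at this
    exact (pow_eq_one_iff_of_nonneg (norm_nonneg _) two_ne_zero).1 this
  have hE0 : (Module.finrank F E : F) ≠ 0 := fun h0 => by
    have := congrArg (algebraMap F L) h0
    rw [map_natCast, map_zero] at this
    rw [this, norm_zero] at hE; exact zero_ne_one hE
  have htr : ∀ x, ‖algebraMap F L (rtr F E x)‖ = ‖LinearMap.trace L W (T.B.a x)‖ := fun x => by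
    have := congrArg norm (trace_action hE0 T.B x)
    rw [norm_mul, norm_mul, hE, hW, one_mul, one_mul] at this
    exact this.symm
  have bd : ∀ f : Module.End L W, (∀ w, α.v (f w) ≤ α.v w) → ‖LinearMap.trace L W f‖ ≤ 1 := fun f hf =>
    norm_trace_le α he f hL fun w hw => (hf w).trans_lt (by
      have := α.pos hw; exact lt_mul_of_one_lt_left this ((one_lt_inv₀ hL.q0).2 hL.q1))
  rw [RingHom.map_det]
  refine norm_det_eq _ (fun i j => ?_) fun l hl => ?_
  · rw [RingHom.mapMatrix_apply, Matrix.map_apply, Matrix.of_apply, htr, hH, hH]; exact bd _ (hmul i j)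
  · let G : Module.End L W := ∑ i, l i • T.B.a (h i)
    have cA : ∀ y w, T.A.a y (G w) = G (T.A.a y w) := fun y w => by simp [G, LinearMap.sum_apply, T.cA]
    have cA' : ∀ y w, T.A'.a y (G w) = G (T.A'.a y w) := fun y w => by simp [G, LinearMap.sum_apply, T.cA']
    refine h2 l (a4 G cA cA' fun w hw => self_dual hL hN hN' T.A T.A' T.c α a2 a3 he G cA cA' (fun f k1 k2 k3 => ?_) w hw)
    obtain ⟨d, hd⟩ := T.span H f k1 k2
    have hdi := h2 d (fun w => by simp_rw [← hH]; rw [hd]; exact k3 w)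
    have e1 : ‖LinearMap.trace L W (G * f)‖ = ‖∑ i, d i * ∑ j, LinearMap.trace L W (T.B.a (h i * h j)) * l j‖ := by
      rw [← hd, LinearMap.trace_mul_comm]
      simp only [G, Finset.sum_mul, Finset.mul_sum, map_sum, smul_mul_assoc, mul_smul_comm, hH, map_smul, smul_eq_mul, map_mul]
      rw [Finset.sum_comm]
      congr 1
      exact Finset.sum_congr rfl fun i _ => Finset.sum_congr rfl fun j _ => by ring
    have e2 : ∀ i, (Module.finrank F E : L) * ∑ j, LinearMap.trace L W (T.B.a (h i * h j)) * l j =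
        Module.finrank L W * (((algebraMap F L).mapMatrix (Matrix.of fun i j => rtr F E (H i * H j))).mulVec l) i := fun i => by
      rw [Matrix.mulVec, dotProduct, Finset.mul_sum, Finset.mul_sum]
      refine Finset.sum_congr rfl fun j _ => ?_
      rw [RingHom.mapMatrix_apply, Matrix.map_apply, Matrix.of_apply, hH, hH, ← mul_assoc, ← mul_assoc, trace_action hE0]
    rw [e1]
    refine IsUltrametricDist.norm_sum_le_of_forall_le_of_nonneg zero_le_one fun i _ => ?_
    have e3 := congrArg norm (e2 i)
    rw [norm_mul, norm_mul, hE, hW, one_mul, one_mul] at e3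
    rw [norm_mul, e3]
    exact mul_le_one₀ (hdi i) (norm_nonneg _) (hl i)
end lo

theorem ZData.op' {L Δ : Type*} [NontriviallyNormedField L] [CompleteSpace L] [IsUltrametricDist L] [DivisionRing Δ] [Algebra L Δ] [FiniteDimensional L Δ] {q s : ℝ} {c : L} {z : Δ}
    (Z : ZData L Δ q s c z) : ZData L Δᵐᵒᵖ q s c (op z) where
  sq := by rw [← op_mul, Z.sq]; rfl
  ev y hy h := by
    rw [← nm_op]; exact Z.ev _ (by simpa using hy) (by simpa using (congrArg unop h).symm)
  od y hy h := by
    rw [← nm_op]; exact Z.od _ (by simpa using hy) (by have := congrArg unop h; simp at this; rw [this, neg_neg])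

theorem Loc.two_pow {L : Type*} [NontriviallyNormedField L] {q : ℝ} (hL : Loc L q) {n a : ℕ} (h : n = 2 ^ a) : ‖(n : L)‖ = 1 := by
  rw [h]; push_cast; rw [norm_pow, hL.two, one_pow]

section place
variable {F D D' E V : Type u} [Field F] [DivisionRing D] [Algebra F D] [FiniteDimensional F D] [Algebra.IsCentral F D]
  [DivisionRing D'] [Algebra F D'] [FiniteDimensional F D'] [Algebra.IsCentral F D'] [AddCommGroup V] [Module F V]
  [DivisionRing E] [Algebra F E] [FiniteDimensional F E] [Algebra.IsCentral F E]

theorem Tri.two (T : Tri F D F D' F E F V) {a : ℕ} (h : Module.finrank F D = (2 ^ a) ^ 2) (h' : Module.finrank F D' = (2 ^ a) ^ 2) :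
    ∃ b, Module.finrank F E = 2 ^ b := by
  haveI := T.fin
  obtain ⟨r, -, hr, -⟩ := T.B.exists_basis
  have := T.dim
  rw [hr, h, h'] at this
  have h3 : 2 ^ (4 * a) = Module.finrank F E * r ^ 2 :=
    Nat.eq_of_mul_eq_mul_right (Module.finrank_pos (R := F) (M := E)) (by linear_combination -this)
  obtain ⟨b, -, hb⟩ := (Nat.dvd_prime_pow Nat.prime_two).1 (Dvd.intro _ h3.symm)
  exact ⟨b, hb⟩

theorem place_order (θ : D →ₐ[F] Dᵐᵒᵖ) (T : Tri F D F D' F E F V) (h : SameMaximalSubfields F D D') {L : Type u} [NontriviallyNormedField L] [CompleteSpace L]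
    [IsUltrametricDist L] [Algebra F L] {q : ℝ} (hL : Loc L q) (hd : DenseRange (algebraMap F L)) :
    ∃ h : Module.Basis (Fin (Module.finrank F E)) F E, (∀ i j k, ‖algebraMap F L (h.repr (h i * h j) k)‖ ≤ 1) ∧
      ‖algebraMap F L (Matrix.of fun i j => rtr F E (h i * h j)).det‖ = 1 := by
  obtain ⟨a, ha⟩ := two_power θ
  have ha' := (finrank_same h).symm.trans ha
  obtain ⟨X, Δ, _, _, _, _, ⟨Q⟩⟩ := exists_locMod F D L
  obtain ⟨X', Δ', _, _, _, _, ⟨Q'⟩⟩ := exists_locMod F D' L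
  haveI := Q.finΔ; haveI := Q.central; haveI := Q'.finΔ; haveI := Q'.central; haveI := Q.fin; haveI := Q.nt
  obtain ⟨b, hb⟩ := Q.twoPow ha
  obtain ⟨b', hb'⟩ := Q'.twoPow ha'
  obtain ⟨e, he⟩ := T.two ha ha'
  rw [← pow_mul] at hb hb'
  obtain ⟨t⟩ := Q.anti θ
  have S := local_emb hd Q Q' (fun h0 => by simpa [h0] using hL.two) ha h
  obtain ⟨s, c, z, z', hs, hs2, hc, Z, Z'⟩ := exists_zdata hL (hL.two_pow hb) t S
  obtain ⟨W, _, _, ⟨T'⟩⟩ := exists_wmod T Q Q'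
  exact local_order hL (hL.two_pow ((opLinearEquiv L).finrank_eq.symm.trans hb)) (hL.two_pow ((opLinearEquiv L).finrank_eq.symm.trans hb')) (hL.two_pow he) hd
    hs hs2 hc Z.op' Z'.op' T'
end place

section J
open WithZero WithZeroMulInt

theorem exists_completion {F : Type u} [Field F] (w : Valuation F (WithZero (Multiplicative ℤ))) (hex : ∃ p, w p = exp (-1 : ℤ)) (h2 : w 2 = 1) :
    ∃ (L : Type u) (_ : NontriviallyNormedField L) (_ : CompleteSpace L) (_ : IsUltrametricDist L) (_ : Algebra F L),
      Loc L 2⁻¹ ∧ DenseRange (algebraMap F L) ∧ ∀ x, ‖algebraMap F L x‖ = toNNReal (e := 2) two_ne_zero (w x) := by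
  have hm := (toNNReal_strictMono (e := 2) (by norm_num)).monotone
  let v : AbsoluteValue F ℝ :=
    { toFun x := toNNReal (e := 2) two_ne_zero (w x)
      map_mul' x y := by simp
      nonneg' _ := NNReal.zero_le_coe
      eq_zero' x := by simp
      add_le' x y := by
        rw [← NNReal.coe_add, NNReal.coe_le_coe]
        refine (hm (w.map_add x y)).trans ?_
        rw [hm.map_max]; exact max_le (le_add_of_nonneg_right bot_le) (le_add_of_nonneg_left bot_le) }
  have hv : ∀ x, v x = toNNReal (e := 2) two_ne_zero (w x) := fun x => rfl
  have hna : ∀ x y, v (x + y) ≤ max (v x) (v y) := fun x y => by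
    rw [hv, hv, hv, ← NNReal.coe_max, NNReal.coe_le_coe, ← hm.map_max]; exact hm (w.map_add x y)
  have hdisc : ∀ x, x ≠ 0 → ∃ m : ℤ, v x = 2⁻¹ ^ m := fun x hx => by
    have h0 : w x ≠ 0 := w.ne_zero_iff.2 hx
    refine ⟨-(WithZero.unzero h0).toAdd, ?_⟩
    rw [hv, toNNReal_neg_apply _ h0]; simp
  obtain ⟨p, hp⟩ := hex
  have hp : v p = 2⁻¹ := by
    rw [hv, hp, toNNReal_neg_apply _ exp_ne_zero]
    have : (WithZero.unzero (exp_ne_zero (a := (-1 : ℤ)))).toAdd = -1 := rfl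
    rw [this]; simp
  have h2 : v 2 = 1 := by rw [hv, h2]; simp
  let i : F →+* v.Completion := (UniformSpace.Completion.coeRingHom).comp (WithAbs.equiv v).symm.toRingHom
  have hi : ∀ x, ‖i x‖ = v x := fun x => UniformSpace.Completion.norm_coe _
  have hd : DenseRange i := UniformSpace.Completion.denseRange_coe.comp (WithAbs.equiv v).symm.surjective.denseRange (UniformSpace.Completion.continuous_coe _)
  have ult : IsUltrametricDist v.Completion := by
    refine IsUltrametricDist.isUltrametricDist_of_forall_norm_add_le_max_norm fun x y => ?_
    refine hd.induction_on₂ (p := fun x y => ‖x + y‖ ≤ max ‖x‖ ‖y‖) ?_ (fun a b => ?_) x y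
    · exact isClosed_le (by fun_prop) (by fun_prop)
    · rw [← map_add, hi, hi, hi]; exact hna a b
  letI nn : NontriviallyNormedField v.Completion := { (inferInstance : NormedField v.Completion) with
    non_trivial := ⟨(i p)⁻¹, by rw [norm_inv, hi, hp]; norm_num⟩ }
  refine ⟨v.Completion, nn, inferInstance, ult, i.toAlgebra, ⟨by norm_num, by norm_num, ⟨i p, (hi p).trans hp⟩, fun x hx => ?_, ?_⟩, hd, fun x => hi x⟩
  · obtain ⟨f, hf⟩ := hd.exists_dist_lt x (norm_pos_iff.2 hx)
    rw [dist_eq_norm] at hf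
    have h1 : ‖i f‖ = ‖x‖ := by
      rw [sub_eq_add_neg] at hf
      simpa using (IsUltrametricDist.norm_eq_of_add_norm_lt_max (hf.trans_le (le_max_left _ _))).symm
    obtain ⟨m, hm⟩ := hdisc f (fun h0 => by rw [h0, map_zero, norm_zero] at h1; exact (norm_pos_iff.2 hx).ne h1)
    exact ⟨m, by rw [← h1, hi, hm]⟩
  · have := hi 2
    rw [map_ofNat, h2] at this; exact this

variable {k : Type u} [Field k]

theorem exists_place {p : k[X]} (hp : Irreducible p) (h2 : (2 : k) ≠ 0) :
    ∃ (L : Type u) (_ : NontriviallyNormedField L) (_ : CompleteSpace L) (_ : IsUltrametricDist L) (_ : Algebra (RatFunc k) L),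
      Loc L 2⁻¹ ∧ DenseRange (algebraMap (RatFunc k) L) ∧ (∀ f : k[X], ‖algebraMap (RatFunc k) L (algebraMap k[X] (RatFunc k) f)‖ ≤ 1) ∧
      (∀ f : k[X], ‖algebraMap (RatFunc k) L (algebraMap k[X] (RatFunc k) f)‖ < 1 ↔ p ∣ f) ∧ ‖algebraMap (RatFunc k) L (algebraMap k[X] (RatFunc k) p)‖ = 2⁻¹ := by
  let v : IsDedekindDomain.HeightOneSpectrum k[X] := ⟨Ideal.span {p}, (Ideal.span_singleton_prime hp.ne_zero).2 hp.prime, by simpa using hp.ne_zero⟩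
  have hpv : v.valuation (RatFunc k) (algebraMap k[X] (RatFunc k) p) = exp (-1 : ℤ) := by
    rw [v.valuation_of_algebraMap]; exact v.intValuation_singleton hp.ne_zero rfl
  have h2' : v.valuation (RatFunc k) 2 = 1 := by
    have : (2 : RatFunc k) = algebraMap k[X] (RatFunc k) (C 2) := by simp [map_ofNat]
    rw [this, v.valuation_eq_one_iff_notMem]
    exact fun h => v.isPrime.ne_top (Ideal.eq_top_of_isUnit_mem _ h (isUnit_C.2 (isUnit_iff_ne_zero.2 h2)))
  obtain ⟨L, i1, i2, i3, i4, hL, hd, hn⟩ := exists_completion (v.valuation (RatFunc k)) ⟨_, hpv⟩ h2'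
  refine ⟨L, i1, i2, i3, i4, hL, hd, fun f => ?_, fun f => ?_, ?_⟩
  · rw [hn]; exact_mod_cast (toNNReal_le_one_iff (by norm_num)).2 (v.valuation_le_one f)
  · rw [hn, ← NNReal.coe_one, NNReal.coe_lt_coe, toNNReal_lt_one_iff (by norm_num), v.valuation_lt_one_iff_mem]
    exact Ideal.mem_span_singleton
  · rw [hn, hpv, toNNReal_neg_apply _ exp_ne_zero]
    have : (WithZero.unzero (exp_ne_zero (a := (-1 : ℤ)))).toAdd = -1 := rfl
    rw [this]; simp

theorem exists_infty (h2 : (2 : k) ≠ 0) :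
    ∃ (L : Type u) (_ : NontriviallyNormedField L) (_ : CompleteSpace L) (_ : IsUltrametricDist L) (_ : Algebra (RatFunc k) L),
      Loc L 2⁻¹ ∧ DenseRange (algebraMap (RatFunc k) L) ∧ (∀ f : k[X], f ≠ 0 → ‖algebraMap (RatFunc k) L (algebraMap k[X] (RatFunc k) f)‖ = 2 ^ f.natDegree) := by
  classical
  obtain ⟨L, i1, i2, i3, i4, hL, hd, hn⟩ := exists_completion (RatFunc.inftyValuation k) ⟨_, RatFunc.inftyValuation.X_inv k⟩ (by
    have : (2 : RatFunc k) = RatFunc.C 2 := by simp [map_ofNat]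
    rw [this]; exact RatFunc.inftyValuation.C k h2)
  refine ⟨L, i1, i2, i3, i4, hL, hd, fun f hf => ?_⟩
  rw [hn, RatFunc.inftyValuation_apply, RatFunc.inftyValuation.polynomial k hf, toNNReal_neg_apply _ exp_ne_zero]
  have : (WithZero.unzero (exp_ne_zero (a := (f.natDegree : ℤ)))).toAdd = f.natDegree := rfl
  rw [this]; simp
end J

/-- discriminant -/
noncomputable def dsc (F : Type*) {E : Type*} [Field F] [DivisionRing E] [Algebra F E] {m : ℕ} (b : Fin m → E) : F := (Matrix.of fun i j => rtr F E (b i * b j)).det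

section dsc
variable {F E : Type*} [Field F] [DivisionRing E] [Algebra F E] {m : ℕ}

theorem dsc_change (b b' : Fin m → E) (P : Matrix (Fin m) (Fin m) F) (h : ∀ i, b' i = ∑ j, P i j • b j) : dsc F b' = P.det ^ 2 * dsc F b := by
  have : (Matrix.of fun i j => rtr F E (b' i * b' j)) = P * (Matrix.of fun i j => rtr F E (b i * b j)) * P.transpose := by
    ext i j
    simp only [Matrix.of_apply, h, Finset.sum_mul, Finset.mul_sum, map_sum, Matrix.mul_apply, Matrix.transpose_apply, smul_mul_assoc, mul_smul_comm, map_smul, smul_eq_mul]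
    exact Finset.sum_congr rfl fun _ _ => Finset.sum_congr rfl fun _ _ => by ring
  rw [dsc, this, Matrix.det_mul, Matrix.det_mul, Matrix.det_transpose, dsc]; ring

theorem dsc_mem (S : Subring F) (b : Module.Basis (Fin m) F E) (hb : ∀ i j l, b.repr (b i * b j) l ∈ S) : dsc F b ∈ S := by
  have hr : ∀ i j, rtr F E (b i * b j) ∈ S := fun i j => by
    have : rtr F E (b i * b j) = ∑ n, b.repr (b i * b j) n * ∑ l, b.repr (b n * b l) l := by
      conv_lhs => rw [← b.sum_repr (b i * b j)]
      simp only [map_sum, map_smul, smul_eq_mul]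
      refine Finset.sum_congr rfl fun n _ => ?_
      congr 1
      change LinearMap.trace F E (Algebra.lmul F E (b n)) = _
      rw [LinearMap.trace_eq_matrix_trace F b]
      simp [Matrix.trace, LinearMap.toMatrix_apply]
    rw [this]
    exact sum_mem fun n _ => mul_mem (hb _ _ _) (sum_mem fun l _ => hb _ _ _)
  rw [dsc, Matrix.det_apply]
  exact sum_mem fun σ _ => by
    rw [Units.smul_def]; exact zsmul_mem (prod_mem fun i _ => hr _ _) _
end dsc

section imp
variable {k E L : Type u} [Field k] [DivisionRing E] [Algebra (RatFunc k) E] [NontriviallyNormedField L] [IsUltrametricDist L] [Algebra (RatFunc k) L]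

local notation "ι" => algebraMap (Polynomial k) (RatFunc k)
local notation "jj" => algebraMap (RatFunc k) L

theorem ι_inj : Function.Injective ι := IsFractionRing.injective _ _

theorem place_int {p : k[X]} (hp : p ≠ 0) (n2 : ∀ f : k[X], ‖jj (ι f)‖ < 1 ↔ p ∣ f) (n3 : ‖jj (ι p)‖ = 2⁻¹) (y : RatFunc k) (hy : ‖jj y‖ ≤ 1) (n : ℕ) :
    ∀ a, ι p ^ n * y = ι a → ∃ b, y = ι b := by
  have hp' : ι p ≠ 0 := (map_ne_zero_iff _ ι_inj).2 hp
  induction n with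
  | zero => intro a h; exact ⟨a, by simpa using h⟩
  | succ n ih =>
    intro a h
    obtain ⟨c, rfl⟩ : p ∣ a := (n2 a).1 (by
      rw [← h, map_mul, map_pow, norm_mul, norm_pow, n3, pow_succ]
      have : (2⁻¹ : ℝ) ^ n ≤ 1 := pow_le_one₀ (by norm_num) (by norm_num)
      have h0 : 0 ≤ (2⁻¹ : ℝ) ^ n := by positivity
      nlinarith [norm_nonneg (jj y), mul_le_mul this hy (norm_nonneg _) zero_le_one])
    exact ih c (mul_left_cancel₀ hp' (by rw [← mul_assoc, ← pow_succ', h, map_mul]))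

theorem place_approx {p : k[X]} (hp : Irreducible p) (n1 : ∀ f : k[X], ‖jj (ι f)‖ ≤ 1) (n2 : ∀ f : k[X], ‖jj (ι f)‖ < 1 ↔ p ∣ f) (n3 : ‖jj (ι p)‖ = 2⁻¹) (y : RatFunc k) (M : ℕ) :
    ∃ u, (∃ n a, ι p ^ n * u = ι a) ∧ ‖jj (y - u)‖ ≤ 2⁻¹ ^ M := by
  have hp' : ι p ≠ 0 := (map_ne_zero_iff _ ι_inj).2 hp.ne_zero
  obtain ⟨a, b, hb0, rfl⟩ := IsFractionRing.div_surjective (A := k[X]) y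
  have hb0 := nonZeroDivisors.ne_zero hb0
  obtain ⟨b', hb, hpb⟩ := (FiniteMultiplicity.of_not_isUnit hp.not_isUnit hb0).exists_eq_pow_mul_and_not_dvd
  generalize multiplicity p b = e at hb
  subst hb
  have hb'' : ι b' ≠ 0 := (map_ne_zero_iff _ ι_inj).2 (right_ne_zero_of_mul hb0)
  obtain ⟨t, s, hst⟩ := (IsCoprime.pow_left (m := M + e) (hp.coprime_iff_not_dvd.2 hpb))
  refine ⟨ι (a * s) / ι p ^ e, ⟨e, a * s, by field_simp⟩, ?_⟩
  have h1 : ‖jj (ι b')‖ = 1 := le_antisymm (n1 _) (not_lt.1 fun h => hpb ((n2 _).1 h))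
  have : ι a / ι (p ^ e * b') - ι (a * s) / ι p ^ e = ι p ^ M * ι (a * t) / ι b' := by
    have := congrArg ι hst
    simp only [map_add, map_mul, map_pow, map_one] at this ⊢
    field_simp
    linear_combination -(ι a) * this
  rw [this, map_div₀, map_mul, map_pow, norm_div, norm_mul, norm_pow, n3, h1, div_one]
  exact mul_le_of_le_one_right (by positivity) (n1 _)
end imp

section imp2
variable {k E L : Type u} [Field k] [DivisionRing E] [Algebra (RatFunc k) E] [NontriviallyNormedField L] [IsUltrametricDist L] [Algebra (RatFunc k) L]

local notation "ι" => algebraMap (Polynomial k) (RatFunc k)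
local notation "jj" => algebraMap (RatFunc k) L

set_option maxHeartbeats 2000000 in
theorem improve [FiniteDimensional (RatFunc k) E] {p : k[X]} (hp : Irreducible p) (n1 : ∀ f : k[X], ‖jj (ι f)‖ ≤ 1) (n2 : ∀ f : k[X], ‖jj (ι f)‖ < 1 ↔ p ∣ f) (n3 : ‖jj (ι p)‖ = 2⁻¹)
    {m : ℕ} (g h : Module.Basis (Fin m) (RatFunc k) E) (hg : ∀ i j l, g.repr (g i * g j) l ∈ (ι).range) {f : k[X]} (hf : dsc (RatFunc k) g = ι f) (hf0 : f ≠ 0) (hpf : p ∣ f)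
    (hh : ∀ i j l, ‖jj (h.repr (h i * h j) l)‖ ≤ 1) (hh2 : ‖jj (dsc (RatFunc k) h)‖ = 1) :
    ∃ (g' : Module.Basis (Fin m) (RatFunc k) E) (f' : k[X]), (∀ i j l, g'.repr (g' i * g' j) l ∈ (ι).range) ∧ dsc (RatFunc k) g' = ι f' ∧ f' ≠ 0 ∧ f'.natDegree < f.natDegree := by
  classical
  have hp0 : ι p ≠ 0 := (map_ne_zero_iff _ ι_inj).2 hp.ne_zero
  have hpn : ∀ n : ℕ, ‖jj (ι p ^ n)‖ = 2⁻¹ ^ n := fun n => by rw [map_pow, norm_pow, n3]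
  have hsum : ∀ (s : Fin m → RatFunc k) (t : ℝ), 0 ≤ t → (∀ i, ‖jj (s i)‖ ≤ t) → ‖jj (∑ i, s i)‖ ≤ t := fun s t ht hs => by
    rw [map_sum]; exact IsUltrametricDist.norm_sum_le_of_forall_le_of_nonneg ht fun i _ => hs i
  have bd : ∀ a : Fin m → Fin m → RatFunc k, ∃ N : ℕ, ∀ i j, ‖jj (ι p ^ N * a i j)‖ ≤ 1 := fun a => by
    obtain ⟨B, hB⟩ := Finite.exists_le (fun x : Fin m × Fin m => ‖jj (a x.1 x.2)‖)
    obtain ⟨N, hN⟩ := pow_unbounded_of_one_lt B one_lt_two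
    refine ⟨N, fun i j => ?_⟩
    rw [map_mul, norm_mul, hpn, inv_pow, inv_mul_le_iff₀ (by positivity), mul_one]
    exact (hB (i, j)).trans hN.le
  obtain ⟨N, hN⟩ := bd fun i l => g.repr (h i) l
  obtain ⟨M, hM⟩ := bd fun l i => h.repr (g l) i
  choose c hc using hg
  let A : E → Prop := fun x => ∀ l, ∃ n a, ι p ^ n * g.repr x l = ι a
  let B : E → Prop := fun x => ∀ i, ‖jj (h.repr x i)‖ ≤ 1
  let xv : (Fin m → k[X]) → E := fun v => ∑ l, ((ι p ^ N)⁻¹ * ι (v l)) • g l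
  have xadd : ∀ v w, xv (v + w) = xv v + xv w := fun v w => by
    simp only [xv, Pi.add_apply, map_add, mul_add, add_smul, Finset.sum_add_distrib]
  have xsmul : ∀ a v, xv (a • v) = ι a • xv v := fun a v => by
    simp only [xv, Pi.smul_apply, smul_eq_mul, map_mul, Finset.smul_sum, smul_smul, mul_left_comm]
  have Badd : ∀ x y, B x → B y → B (x + y) := fun x y hx hy i => by
    rw [map_add, Finsupp.add_apply, map_add]; exact (IsUltrametricDist.norm_add_le_max _ _).trans (max_le (hx i) (hy i))
  have Bsmul : ∀ a x, ‖jj a‖ ≤ 1 → B x → B (a • x) := fun a x ha hx i => by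
    rw [map_smul, Finsupp.smul_apply, smul_eq_mul, map_mul, norm_mul]; exact mul_le_one₀ ha (norm_nonneg _) (hx i)
  have B0 : B 0 := fun i => by simp
  have Bsum : ∀ s : Fin m → E, (∀ i, B (s i)) → B (∑ i, s i) := fun s hs =>
    Finset.sum_induction _ B Badd B0 fun i _ => hs i
  have Bmul : ∀ x y, B x → B y → B (x * y) := fun x y hx hy => by
    rw [← h.sum_repr x, ← h.sum_repr y, Finset.sum_mul]
    refine Bsum _ fun i => ?_
    rw [Finset.mul_sum]
    refine Bsum _ fun j => ?_
    rw [smul_mul_smul_comm]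
    exact Bsmul _ _ (by rw [map_mul, norm_mul]; exact mul_le_one₀ (hx i) (norm_nonneg _) (hy j)) fun l => hh i j l
  have BM : ∀ l, B (ι p ^ M • g l) := fun l i => by rw [map_smul]; exact hM l i
  have key : ∀ x, A x → B x → ∃ v, x = xv v := fun x hA hB => by
    have : ∀ l, ∃ v, ι p ^ N * g.repr x l = ι v := fun l => by
      obtain ⟨n, a, ha⟩ := hA l
      refine place_int hp.ne_zero n2 n3 _ ?_ n (p ^ N * a) (by rw [mul_left_comm, ha, map_mul, map_pow])
      have e : ι p ^ N * g.repr x l = ∑ i, h.repr x i * (ι p ^ N * g.repr (h i) l) := by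
        have := congrArg (fun y => g.repr y l) (h.sum_repr x)
        simp only [map_sum, map_smul, Finsupp.finset_sum_apply, Finsupp.smul_apply, smul_eq_mul] at this
        rw [← this, Finset.mul_sum]; exact Finset.sum_congr rfl fun _ _ => mul_left_comm _ _ _
      rw [e]
      exact hsum _ _ zero_le_one fun i => by rw [map_mul, norm_mul]; exact mul_le_one₀ (hB i) (norm_nonneg _) (hN i l)
    choose v hv using this
    refine ⟨v, ?_⟩
    conv_lhs => rw [← g.sum_repr x]
    exact Finset.sum_congr rfl fun l _ => by rw [← hv, inv_mul_cancel_left₀ (pow_ne_zero _ hp0)]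
  obtain ⟨Λ, hΛ⟩ : ∃ Λ : Submodule k[X] (Fin m → k[X]), ∀ v, v ∈ Λ ↔ B (xv v) := ⟨
    { carrier := {v | B (xv v)}
      add_mem' := fun {v w} hv hw => by change B _; rw [xadd]; exact Badd _ _ hv hw
      zero_mem' := by change B (xv 0); simpa [xv] using B0
      smul_mem' := fun a v hv => by change B _; rw [xsmul]; exact Bsmul _ _ (n1 a) hv }, fun _ => Iff.rfl⟩
  have xp : ∀ w, xv (p ^ (M + N) • w) = ∑ l, ι (w l) • ι p ^ M • g l := fun w => by
    rw [xsmul, Finset.smul_sum]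
    refine Finset.sum_congr rfl fun l _ => ?_
    rw [smul_smul, smul_smul]; congr 1
    rw [map_pow, pow_add]; field_simp
  have hfull : ∀ w, p ^ (M + N) • w ∈ Λ := fun w => by
    rw [hΛ, xp]; exact Bsum _ fun l => Bsmul _ _ (n1 _) (BM l)
  have hfr : Module.finrank k[X] Λ = m := by
    refine le_antisymm ((Submodule.finrank_le Λ).trans_eq (by simp)) ?_
    have := LinearMap.finrank_le_finrank_of_injective (R := k[X]) (f := (LinearMap.lsmul k[X] (Fin m → k[X]) (p ^ (M + N))).codRestrict Λ hfull)
      (fun x y hxy => smul_right_injective _ (pow_ne_zero (M + N) hp.ne_zero) (congrArg Subtype.val hxy))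
    rwa [Module.finrank_fin_fun] at this
  let e := Module.finBasisOfFinrankEq k[X] Λ hfr
  have star : ∀ v (hv : v ∈ Λ), xv v = ∑ j, ι (e.repr ⟨v, hv⟩ j) • xv (e j) := fun v hv => by
    have := congrArg Subtype.val (e.sum_repr ⟨v, hv⟩)
    conv_lhs => rw [show v = _ from this.symm]
    let xl : (Fin m → k[X]) →+ E := AddMonoidHom.mk' xv xadd
    have hxl : ∀ v, xl v = xv v := fun v => rfl
    rw [Submodule.coe_sum, ← hxl, map_sum]
    exact Finset.sum_congr rfl fun j _ => by rw [hxl, Submodule.coe_smul, xsmul]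
  have starg : ∀ l, g l = ∑ j, ((ι p ^ M)⁻¹ * ι (e.repr ⟨_, hfull (Pi.single l 1)⟩ j)) • xv (e j) := fun l => by
    have := star _ (hfull (Pi.single l 1))
    rw [xp] at this
    simp only [Pi.single_apply, apply_ite ι, map_one, map_zero, ite_smul, one_smul, zero_smul, Finset.sum_ite_eq', Finset.mem_univ, if_true] at this
    rw [← inv_smul_smul₀ (pow_ne_zero M hp0) (g l), this, Finset.smul_sum]
    simp_rw [smul_smul]
  let g' := basisOfTopLeSpanOfCardEqFinrank (fun j => xv (e j)) (by
    rw [← g.span_eq, Submodule.span_le]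
    rintro _ ⟨l, rfl⟩
    rw [SetLike.mem_coe, starg l]
    exact Submodule.sum_mem _ fun j _ => Submodule.smul_mem _ _ (Submodule.subset_span ⟨j, rfl⟩)) (Module.finrank_eq_card_basis g).symm
  have hg' : ∀ j, g' j = xv (e j) := fun j => by simp [g']
  have int : ∀ x, A x → B x → ∀ j, ∃ a, g'.repr x j = ι a := fun x hA hB j => by
    obtain ⟨v, rfl⟩ := key x hA hB
    rw [star v ((hΛ v).2 hB)]
    simp_rw [← hg']
    exact ⟨_, by rw [g'.repr_sum_self]⟩
  have st : ∀ i j l, g'.repr (g' i * g' j) l ∈ (ι).range := fun i j l => by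
    have hA : A (g' i * g' j) := fun l => by
      refine ⟨N + N, ∑ s, ∑ t, (e i).1 t * (e j).1 s * c t s l, ?_⟩
      rw [hg', hg']
      simp only [xv, Finset.sum_mul, Finset.mul_sum, map_sum, Finsupp.finset_sum_apply, smul_mul_smul_comm, map_smul, Finsupp.smul_apply, smul_eq_mul, ← hc, map_mul]
      exact Finset.sum_congr rfl fun s _ => Finset.sum_congr rfl fun t _ => by field_simp; ring
    obtain ⟨a, ha⟩ := int (g' i * g' j) hA (Bmul _ _ (by rw [hg']; exact (hΛ _).1 (e i).2) (by rw [hg']; exact (hΛ _).1 (e j).2)) l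
    exact ⟨a, ha.symm⟩
  obtain ⟨f', hf'⟩ := dsc_mem _ g' st
  have hnf : ¬ p ∣ f' := fun hd => by
    have hd := (n2 _).2 hd
    have ha : ∀ i j, ‖jj (g'.repr (h i) j)‖ ≤ 1 := fun i j => by
      choose u hu hu2 using fun l => place_approx hp n1 n2 n3 (g.repr (h i) l) M
      have e0 : h i = ∑ l, u l • g l + ∑ l, ((g.repr (h i) l - u l) * (ι p ^ M)⁻¹) • ι p ^ M • g l := by
        conv_lhs => rw [← g.sum_repr (h i)]
        rw [← Finset.sum_add_distrib]
        exact Finset.sum_congr rfl fun l _ => by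
          rw [smul_smul, inv_mul_cancel_right₀ (pow_ne_zero _ hp0), ← add_smul, add_sub_cancel]
      have hq : ∀ l, ‖jj ((g.repr (h i) l - u l) * (ι p ^ M)⁻¹)‖ ≤ 1 := fun l => by
        rw [map_mul, map_inv₀, norm_mul, norm_inv, hpn, mul_inv_le_iff₀ (by positivity), one_mul]; exact hu2 l
      have hB : B (∑ l, u l • g l) := by
        rw [eq_sub_of_add_eq e0.symm, sub_eq_add_neg, ← neg_one_smul (RatFunc k)]
        refine Badd _ _ (fun i' => ?_) (Bsmul _ _ (by simp) (Bsum _ fun l => Bsmul _ _ (hq l) (BM l)))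
        rw [h.repr_self, Finsupp.single_apply]; split_ifs <;> simp
      obtain ⟨a, ha⟩ := int _ (fun l => by rw [g.repr_sum_self]; exact hu l) hB j
      rw [e0, map_add, Finsupp.add_apply, ha, map_add]
      refine (IsUltrametricDist.norm_add_le_max _ _).trans (max_le (n1 a) ?_)
      rw [map_sum, Finsupp.finset_sum_apply]
      refine hsum _ _ zero_le_one fun l => ?_
      rw [map_smul, Finsupp.smul_apply, smul_eq_mul, map_mul, norm_mul]
      refine mul_le_one₀ (hq l) (norm_nonneg _) ?_
      rw [starg l, Finset.smul_sum]
      simp_rw [← hg', smul_smul, mul_inv_cancel_left₀ (pow_ne_zero M hp0)]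
      rw [g'.repr_sum_self]; exact n1 _
    have e1 := dsc_change (F := RatFunc k) g' h (Matrix.of fun i j => g'.repr (h i) j) (fun i => by simpa using (g'.sum_repr (h i)).symm)
    rw [e1, map_mul, map_pow, norm_mul, norm_pow, ← hf'] at hh2
    have := norm_det_le ((jj).mapMatrix (Matrix.of fun i j => g'.repr (h i) j)) (fun i j => ha i j)
    rw [← RingHom.map_det] at this
    have := pow_le_one₀ (n := 2) (norm_nonneg _) this
    nlinarith [norm_nonneg (jj (ι f'))]
  have hf'0 : f' ≠ 0 := fun h0 => hnf (h0 ▸ dvd_zero _)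
  refine ⟨g', f', st, hf'.symm, hf'0, ?_⟩
  let P : Matrix (Fin m) (Fin m) k[X] := Matrix.of fun j l => (e j).1 l
  let C : Matrix (Fin m) (Fin m) k[X] := Matrix.of fun l j => e.repr ⟨_, hfull (Pi.single l 1)⟩ j
  have hCP : C * P = p ^ (M + N) • (1 : Matrix (Fin m) (Fin m) k[X]) := by
    refine Matrix.ext fun l l' => ?_
    have := congrFun (congrArg Subtype.val (e.sum_repr ⟨_, hfull (Pi.single l 1)⟩)) l'
    rw [Submodule.coe_sum, Finset.sum_apply] at this
    rw [Matrix.mul_apply, Matrix.smul_apply, Matrix.one_apply]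
    refine this.trans ?_
    simp [Pi.single_apply, eq_comm]
  have hdet : P.det ∣ p ^ ((M + N) * m) := by
    have := congrArg Matrix.det hCP
    rw [Matrix.det_mul, Matrix.det_smul, Matrix.det_one, mul_one, Fintype.card_fin, ← pow_mul] at this
    exact Dvd.intro_left _ this
  obtain ⟨r, -, w, hw⟩ := (dvd_prime_pow hp.prime _).1 hdet
  have e2 := dsc_change (F := RatFunc k) g g' ((ι p ^ N)⁻¹ • (ι).mapMatrix P) (fun i => by rw [hg']; rfl)
  rw [← hf', hf, Matrix.det_smul, ← RingHom.map_det, Fintype.card_fin] at e2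
  have e3 : f' * p ^ (2 * (N * m)) * w ^ 2 = p ^ (2 * r) * f := ι_inj (by
    have := congrArg ι hw
    simp only [map_mul, map_pow] at this ⊢
    rw [e2, pow_mul' _ 2 r, ← this]
    have hx : ι p ^ (2 * (N * m)) * ((ι p ^ N)⁻¹ ^ m) ^ 2 = 1 := by
      rw [inv_pow, inv_pow, ← pow_mul, ← pow_mul, mul_comm 2, mul_assoc]; exact mul_inv_cancel₀ (pow_ne_zero _ hp0)
    linear_combination (ι P.det * ι w) ^ 2 * ι f * hx)
  have hw0 : (w : k[X]) ≠ 0 := w.ne_zero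
  have hr : r < N * m := by
    by_contra! hr
    obtain ⟨d, hd⟩ := Nat.exists_eq_add_of_le hr
    have e4 : f' * w ^ 2 = p ^ (2 * d) * f := mul_left_cancel₀ (pow_ne_zero (2 * (N * m)) hp.ne_zero) (by
      rw [hd, mul_add, pow_add] at e3; linear_combination e3)
    rcases hp.prime.dvd_or_dvd (e4 ▸ hpf.mul_left _ : p ∣ f' * w ^ 2) with h1 | h1
    · exact hnf h1
    · exact hp.not_isUnit (isUnit_of_dvd_unit h1 (w.isUnit.pow 2))
  have e5 := congrArg natDegree e3
  rw [natDegree_mul (mul_ne_zero hf'0 (pow_ne_zero _ hp.ne_zero)) (pow_ne_zero _ hw0), natDegree_mul hf'0 (pow_ne_zero _ hp.ne_zero), natDegree_mul (pow_ne_zero _ hp.ne_zero) hf0, natDegree_pow, natDegree_pow, natDegree_pow, natDegree_eq_zero_of_isUnit w.isUnit] at e5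
  nlinarith [hp.natDegree_pos]
end imp2

theorem dsc_ne_zero {F E : Type*} [Field F] [DivisionRing E] [Algebra F E] [FiniteDimensional F E] {m : ℕ} (h0 : (Module.finrank F E : F) ≠ 0) (b : Module.Basis (Fin m) F E) : dsc F b ≠ 0 := by
  intro h
  obtain ⟨v, hv, hv2⟩ := Matrix.exists_vecMul_eq_zero_iff.2 h
  set x := ∑ i, v i • b i with hx
  have hx0 : x ≠ 0 := fun h => hv (funext fun i => by
    have := congrArg (fun y => b.repr y i) h; simp only [hx, b.repr_sum_self] at this; simpa using this)
  have key : ∀ y, rtr F E (x * y) = 0 := fun y => by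
    rw [← b.sum_repr y, Finset.mul_sum, map_sum]
    refine Finset.sum_eq_zero fun j _ => ?_
    rw [mul_smul_comm, map_smul, hx, Finset.sum_mul, map_sum]
    have := congrFun hv2 j
    simp only [Matrix.vecMul, dotProduct, Matrix.of_apply, Pi.zero_apply] at this
    simp_rw [smul_mul_assoc, map_smul, smul_eq_mul, this, mul_zero]
  have := key x⁻¹
  rw [mul_inv_cancel₀ hx0] at this
  have h1 := rtr_algebraMap (F := F) (D := E) 1
  simp [this] at h1
  exact h0 h1.symm

section
variable {k E : Type u} [Field k] [DivisionRing E] [Algebra (RatFunc k) E]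
local notation "ι" => algebraMap (Polynomial k) (RatFunc k)

theorem exists_int_basis [FiniteDimensional (RatFunc k) E] (h0 : (Module.finrank (RatFunc k) E : RatFunc k) ≠ 0) : ∃ (g : Module.Basis (Fin (Module.finrank (RatFunc k) E)) (RatFunc k) E) (f : k[X]),
    (∀ i j l, g.repr (g i * g j) l ∈ (ι).range) ∧ dsc (RatFunc k) g = ι f ∧ f ≠ 0 := by
  let b := Module.finBasis (RatFunc k) E
  obtain ⟨d, hd⟩ := IsLocalization.exist_integer_multiples_of_finite (nonZeroDivisors k[X]) (fun x : Fin _ × Fin _ × Fin _ => b.repr (b x.1 * b x.2.1) x.2.2)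
  have hd0 : ι d ≠ 0 := (map_ne_zero_iff _ ι_inj).2 (nonZeroDivisors.coe_ne_zero d)
  let g := b.unitsSMul fun _ => Units.mk0 _ hd0
  have hg : ∀ i j l, g.repr (g i * g j) l ∈ (ι).range := fun i j l => by
    obtain ⟨a, ha⟩ := hd (i, j, l)
    refine ⟨a, ha.trans ?_⟩
    simp only [g, Module.Basis.unitsSMul_apply, Module.Basis.repr_unitsSMul, Units.smul_def, Units.val_mk0, Units.val_inv_eq_inv_val, smul_mul_smul_comm, map_smul, Finsupp.smul_apply, smul_eq_mul]
    rw [Algebra.smul_def]; field_simp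
  obtain ⟨f, hf⟩ := dsc_mem _ g hg
  exact ⟨g, f, hg, hf.symm, fun h => dsc_ne_zero h0 g (by rw [← hf, h, map_zero])⟩

theorem finite_order (h2 : (2 : k) ≠ 0) {D D' V : Type u} [DivisionRing D] [Algebra (RatFunc k) D] [FiniteDimensional (RatFunc k) D] [Algebra.IsCentral (RatFunc k) D]
    [DivisionRing D'] [Algebra (RatFunc k) D'] [FiniteDimensional (RatFunc k) D'] [Algebra.IsCentral (RatFunc k) D'] [AddCommGroup V] [Module (RatFunc k) V]
    [FiniteDimensional (RatFunc k) E] [Algebra.IsCentral (RatFunc k) E] (h0 : (Module.finrank (RatFunc k) E : RatFunc k) ≠ 0)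
    (θ : D →ₐ[RatFunc k] Dᵐᵒᵖ) (T : Tri (RatFunc k) D (RatFunc k) D' (RatFunc k) E (RatFunc k) V) (h : SameMaximalSubfields (RatFunc k) D D') :
    ∃ (g : Module.Basis (Fin (Module.finrank (RatFunc k) E)) (RatFunc k) E) (f : k[X]),
    (∀ i j l, g.repr (g i * g j) l ∈ (ι).range) ∧ dsc (RatFunc k) g = ι f ∧ IsUnit f := by
  obtain ⟨g, f, hg, hf, hf0⟩ := exists_int_basis (E := E) h0
  induction hn : f.natDegree using Nat.strong_induction_on generalizing g f with
  | _ n ih =>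
    by_cases hu : IsUnit f
    · exact ⟨g, f, hg, hf, hu⟩
    obtain ⟨p, hp, hpf⟩ := WfDvdMonoid.exists_irreducible_factor hu hf0
    obtain ⟨L, _, _, _, _, hL, hd, n1, n2, n3⟩ := exists_place hp h2
    obtain ⟨b, hb, hb2⟩ := place_order θ T h hL hd
    obtain ⟨g', f', h1, h2, h3, h4⟩ := improve hp n1 n2 n3 g b hg hf hf0 hpf hb hb2
    exact ih _ (hn ▸ h4) g' f' h1 h2 h3 rfl
end

theorem reduce_basis {k : Type*} [Field k] {m : ℕ} (S : ℤ → AddSubgroup (Fin m → k[X])) (mul : ∀ (n : ℤ) (d : ℕ) (f : k[X]) v, f.natDegree ≤ d → v ∈ S n → f • v ∈ S (n + d))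
    (div : ∀ (n : ℤ) (d : ℕ) v, (X ^ d : k[X]) • v ∈ S (n + d) → v ∈ S n) (neg : ∀ n < 0, ∀ v ∈ S n, v = 0) (ex : ∀ v, ∃ n, v ∈ S n) :
    ∃ (P : Matrix (Fin m) (Fin m) k[X]) (a : Fin m → ℕ), IsUnit P.det ∧ (∀ i, P i ∈ S (a i)) ∧ ∀ (c : Fin m → k[X]) n, ∑ i, c i • P i ∈ S n → ∀ i, c i ≠ 0 → ((c i).natDegree + a i : ℤ) ≤ n := by
  classical
  have mono : ∀ n n' : ℤ, n ≤ n' → ∀ v ∈ S n, v ∈ S n' := fun n n' h v hv => by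
    obtain ⟨d, rfl⟩ := Int.le.dest h
    simpa using mul n d 1 v (by simp) hv
  have key : ∀ N, ∀ (P : Matrix (Fin m) (Fin m) k[X]) (a : Fin m → ℕ), IsUnit P.det → (∀ i, P i ∈ S (a i)) → ∑ i, a i = N →
      ∃ (P : Matrix (Fin m) (Fin m) k[X]) (a : Fin m → ℕ), IsUnit P.det ∧ (∀ i, P i ∈ S (a i)) ∧ ∀ (c : Fin m → k[X]) n, ∑ i, c i • P i ∈ S n → ∀ i, c i ≠ 0 → ((c i).natDegree + a i : ℤ) ≤ n := by
    intro N
    induction N using Nat.strong_induction_on with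
    | _ N ih =>
    intro P a hP ha hN
    by_cases hfin : ∀ (c : Fin m → k[X]) n, ∑ i, c i • P i ∈ S n → ∀ i, c i ≠ 0 → ((c i).natDegree + a i : ℤ) ≤ n
    · exact ⟨P, a, hP, ha, hfin⟩
    push Not at hfin
    obtain ⟨c, n, hc, i1, hi1, hn⟩ := hfin
    obtain ⟨j, hj, hjm⟩ := Finset.exists_max_image (Finset.univ.filter fun i => c i ≠ 0) (fun i => (c i).natDegree + a i) ⟨i1, by simpa using hi1⟩
    simp only [Finset.mem_filter, Finset.mem_univ, true_and] at hj hjm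
    set t := (c j).natDegree + a j with ht
    obtain ⟨i0, hi0, him⟩ := Finset.exists_max_image (Finset.univ.filter fun i => c i ≠ 0 ∧ (c i).natDegree + a i = t) a ⟨j, Finset.mem_filter.2 ⟨Finset.mem_univ _, hj, rfl⟩⟩
    simp only [Finset.mem_filter, Finset.mem_univ, true_and] at hi0 him
    have htn : n ≤ (t : ℤ) - 1 := by have := hjm i1 hi1; omega
    let e : Fin m → k[X] := fun i => if c i ≠ 0 ∧ (c i).natDegree + a i = t then C (c i).leadingCoeff * X ^ (a i0 - a i) else 0
    let u := ∑ i, e i • P i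
    have hei : e i0 = C (c i0).leadingCoeff := by simp [e, hi0]
    have hu : u ∈ S ((a i0 : ℤ) - 1) := by
      refine div _ (c i0).natDegree _ ?_
      rw [show (a i0 : ℤ) - 1 + ((c i0).natDegree : ℤ) = t - 1 by omega]
      have : (X ^ (c i0).natDegree : k[X]) • u = ∑ i, c i • P i - ∑ i, (c i - X ^ (c i0).natDegree * e i) • P i := by
        simp only [u, Finset.smul_sum, sub_smul, Finset.sum_sub_distrib, smul_smul, sub_sub_cancel]
      rw [this]
      refine sub_mem (mono _ _ htn _ hc) (sum_mem fun i _ => ?_)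
      by_cases h0 : c i = 0
      · simp [e, h0, zero_mem]
      by_cases hi : (c i).natDegree + a i = t
      · have h1 := him i ⟨h0, hi⟩
        have h2 : c i - X ^ (c i0).natDegree * e i = (c i).eraseLead := by
          rw [← self_sub_C_mul_X_pow]
          simp only [e, if_pos (And.intro h0 hi)]
          rw [show (c i).natDegree = (c i0).natDegree + (a i0 - a i) by omega, pow_add]; ring
        rw [h2]
        by_cases h3 : (c i).natDegree = 0
        · rw [← self_sub_C_mul_X_pow, h3, pow_zero, mul_one, leadingCoeff, h3, ← eq_C_of_natDegree_eq_zero h3, sub_self, zero_smul]; exact zero_mem _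
        · have := mul _ _ _ _ (c i).eraseLead_natDegree_le (ha i)
          rwa [show (a i : ℤ) + ((c i).natDegree - 1 : ℕ) = t - 1 by omega] at this
      · have := hjm i h0
        simp only [e, hi, and_false, if_false, mul_zero, sub_zero]
        exact mono _ _ (by omega) _ (mul _ _ _ _ le_rfl (ha i))
    have hdet : IsUnit (P.updateRow i0 u).det := by
      rw [Matrix.det_updateRow_sum, hei, smul_eq_mul]
      exact (isUnit_C.2 (leadingCoeff_ne_zero.2 hi0.1).isUnit).mul hP
    have ha1 : 1 ≤ a i0 := by
      by_contra! h
      have : u = 0 := neg _ (by omega) _ hu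
      rw [this, Matrix.det_eq_zero_of_row_eq_zero i0 (by simp)] at hdet
      exact not_isUnit_zero hdet
    refine ih _ ?_ (P.updateRow i0 u) (Function.update a i0 (a i0 - 1)) hdet (fun i => ?_) rfl
    · rw [← hN]
      refine Finset.sum_lt_sum (fun i _ => ?_) ⟨i0, Finset.mem_univ _, by simp; omega⟩
      rcases eq_or_ne i i0 with rfl | h
      · simp
      · simp [h]
    · rcases eq_or_ne i i0 with rfl | h
      · rw [Function.update_self, Nat.cast_sub ha1]
        exact (congrArg (· ∈ S _) (Matrix.updateRow_self (b := u))).mpr hu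
      · rw [Function.update_of_ne h]
        exact (congrArg (· ∈ S _) (Matrix.updateRow_ne h)).mpr (ha i)
  choose a ha using fun i => ex ((1 : Matrix (Fin m) (Fin m) k[X]) i)
  exact key _ 1 (fun i => (a i).toNat) (by simp) (fun i => mono _ _ (Int.self_le_toNat _) _ (ha i)) rfl

section
variable {k E L : Type u} [Field k] [DivisionRing E] [Algebra (RatFunc k) E] [NontriviallyNormedField L] [IsUltrametricDist L] [Algebra (RatFunc k) L]
local notation "ι" => algebraMap (Polynomial k) (RatFunc k)
local notation "jj" => algebraMap (RatFunc k) L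

set_option maxHeartbeats 1000000 in
theorem const_order [FiniteDimensional (RatFunc k) E] (hn : ∀ f : k[X], f ≠ 0 → ‖jj (ι f)‖ = 2 ^ f.natDegree)
    {m : ℕ} (g h : Module.Basis (Fin m) (RatFunc k) E) (hg : ∀ i j l, g.repr (g i * g j) l ∈ (ι).range) {f : k[X]} (hf : dsc (RatFunc k) g = ι f) (hf1 : IsUnit f)
    (hh : ∀ i j l, ‖jj (h.repr (h i * h j) l)‖ ≤ 1) (hh2 : ‖jj (dsc (RatFunc k) h)‖ = 1) :
    ∃ b : Module.Basis (Fin m) (RatFunc k) E, ∀ i j l, ∃ c : k, b.repr (b i * b j) l = ι (C c) := by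
  classical
  have hn' : ∀ (f : k[X]) (d : ℕ), f.natDegree ≤ d → ‖jj (ι f)‖ ≤ 2 ^ d := fun f d hd => by
    rcases eq_or_ne f 0 with rfl | h0
    · simp
    · rw [hn f h0]; exact pow_le_pow_right₀ one_le_two hd
  have hnu : ∀ f : k[X], IsUnit f → ‖jj (ι f)‖ = 1 := fun f hf => by rw [hn f hf.ne_zero, natDegree_eq_zero_of_isUnit hf, pow_zero]
  have hX : ∀ d : ℕ, ‖jj (ι (X ^ d))‖ = 2 ^ d := fun d => by rw [hn _ (pow_ne_zero _ X_ne_zero), natDegree_X_pow]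
  have hsum : ∀ (s : Fin m → RatFunc k) (t : ℝ), 0 ≤ t → (∀ i, ‖jj (s i)‖ ≤ t) → ‖jj (∑ i, s i)‖ ≤ t := fun s t ht hs => by
    rw [map_sum]; exact IsUltrametricDist.norm_sum_le_of_forall_le_of_nonneg ht fun i _ => hs i
  choose c hc using hg
  let B : ℝ → E → Prop := fun t x => ∀ i, ‖jj (h.repr x i)‖ ≤ t
  have Bsum : ∀ t (s : Fin m → E), 0 ≤ t → (∀ i, B t (s i)) → B t (∑ i, s i) := fun t s ht hs i => by
    rw [map_sum, Finsupp.finset_sum_apply]; exact hsum _ _ ht fun j => hs j i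
  have Bsmul : ∀ r t a x, ‖jj a‖ ≤ r → B t x → B (r * t) (a • x) := fun r t a x ha hx i => by
    rw [map_smul, Finsupp.smul_apply, smul_eq_mul, map_mul, norm_mul]; exact mul_le_mul ha (hx i) (norm_nonneg _) ((norm_nonneg _).trans ha)
  have Bmul : ∀ r t x y, 0 ≤ r → 0 ≤ t → B r x → B t y → B (r * t) (x * y) := fun r t x y hr ht hx hy => by
    rw [← h.sum_repr x, ← h.sum_repr y, Finset.sum_mul]
    refine Bsum _ _ (by positivity) fun i => ?_
    rw [Finset.mul_sum]
    refine Bsum _ _ (by positivity) fun j => ?_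
    rw [smul_mul_smul_comm, ← mul_one (r * t)]
    exact Bsmul _ _ _ _ (by rw [map_mul, norm_mul]; exact mul_le_mul (hx i) (hy j) (norm_nonneg _) hr) fun l => hh i j l
  have Bh : ∀ i, B 1 (h i) := fun i i' => by rw [h.repr_self, Finsupp.single_apply]; split_ifs <;> simp
  let xv : (Fin m → k[X]) →+ E := AddMonoidHom.mk' (fun v => ∑ l, ι (v l) • g l) fun v w => by
    simp only [Pi.add_apply, map_add, add_smul, Finset.sum_add_distrib]
  have xv_def : ∀ v, xv v = ∑ l, ι (v l) • g l := fun v => rfl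
  have xsmul : ∀ a v, xv (a • v) = ι a • xv v := fun a v => by
    simp only [xv_def, Pi.smul_apply, smul_eq_mul, map_mul, Finset.smul_sum, smul_smul]
  have xrep : ∀ v l, g.repr (xv v) l = ι (v l) := fun v l => by rw [xv_def, g.repr_sum_self]
  have xmul : ∀ v w, ∃ u, xv v * xv w = xv u := fun v w => ⟨fun l => ∑ s, ∑ t, v t * w s * c t s l, by
    refine g.repr.injective (Finsupp.ext fun l => ?_)
    rw [xrep, xv_def, xv_def]
    simp only [Finset.sum_mul, Finset.mul_sum, map_sum, Finsupp.finset_sum_apply, smul_mul_smul_comm, map_smul, Finsupp.smul_apply, smul_eq_mul, ← hc, map_mul]⟩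
  let S : ℤ → AddSubgroup (Fin m → k[X]) := fun n =>
    { carrier := {v | B (2 ^ n) (xv v)}
      add_mem' := fun {v w} hv hw i => by
        rw [map_add, map_add, Finsupp.add_apply, map_add]; exact (IsUltrametricDist.norm_add_le_max _ _).trans (max_le (hv i) (hw i))
      zero_mem' := fun i => by simp; positivity
      neg_mem' := fun {v} hv i => by simpa using hv i }
  have hS : ∀ n v, v ∈ S n ↔ B (2 ^ n) (xv v) := fun n v => Iff.rfl
  have h20 : (2 : ℝ) ≠ 0 := two_ne_zero
  have hm : 0 < m := by rw [← Fintype.card_fin m, ← Module.finrank_eq_card_basis g]; exact Module.finrank_pos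
  obtain ⟨P, a, hP, hPa, hmin⟩ := reduce_basis S (fun n d f v hfd hv => by
      rw [hS, xsmul, zpow_add₀ h20, mul_comm, zpow_natCast]; exact Bsmul _ _ _ _ (hn' f d hfd) hv) (fun n d v hv i => by
      have := hv i
      rw [xsmul, map_smul, Finsupp.smul_apply, smul_eq_mul, map_mul, norm_mul, hX, zpow_add₀ h20, mul_comm, zpow_natCast] at this
      exact le_of_mul_le_mul_right this (by positivity)) (fun n hn0 v hv => by
      by_contra h0
      have hx0 : xv v ≠ 0 := fun h1 => h0 (funext fun l => ι_inj (by rw [← xrep, h1]; simp))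
      have h1 := (Algebra.norm_ne_zero_iff (R := RatFunc k)).2 hx0
      obtain ⟨f0, hf0⟩ : Algebra.norm (RatFunc k) (xv v) ∈ (ι).range := by
        rw [Algebra.norm_eq_matrix_det g]
        have : Algebra.leftMulMatrix g (xv v) = (ι).mapMatrix (Matrix.of fun i j => ∑ l, v l * c l j i) := by
          ext i j
          rw [Algebra.leftMulMatrix_eq_repr_mul, xv_def]
          simp [Finset.sum_mul, hc]
          exact Finset.sum_congr rfl fun x _ => Algebra.smul_def _ _
        rw [this, ← RingHom.map_det]; exact ⟨_, rfl⟩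
      rw [← hf0] at h1
      have h2 := hn f0 fun h => h1 (by rw [h, map_zero])
      have h3 := norm_det_le ((jj).mapMatrix (ι X • Algebra.leftMulMatrix h (xv v))) fun i j => by
        rw [RingHom.mapMatrix_apply, Matrix.map_apply, Matrix.smul_apply, smul_eq_mul, map_mul, norm_mul, Algebra.leftMulMatrix_eq_repr_mul]
        have := Bmul _ _ _ _ (by positivity) zero_le_one hv (Bh j) i
        rw [mul_one] at this
        have h4 := hX 1
        rw [pow_one, pow_one] at h4
        have h5 : (2 : ℝ) ^ n ≤ 2 ^ (-1 : ℤ) := zpow_le_zpow_right₀ one_le_two (by omega)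
        rw [h4]; norm_num at h5; linarith
      rw [← RingHom.map_det, Matrix.det_smul, map_mul, norm_mul, ← Algebra.norm_eq_matrix_det, ← hf0, h2, ← map_pow, hX, Fintype.card_fin] at h3
      have h4 : (1 : ℝ) < 2 ^ m := one_lt_pow₀ one_lt_two hm.ne'
      have h5 : (1 : ℝ) ≤ 2 ^ f0.natDegree := one_le_pow₀ one_le_two
      nlinarith) (fun v => by
      obtain ⟨C, hC⟩ := Finite.exists_le (fun i => ‖jj (h.repr (xv v) i)‖)
      obtain ⟨N, hN⟩ := pow_unbounded_of_one_lt C one_lt_two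
      exact ⟨N, fun i => (hC i).trans (by simpa using hN.le)⟩)
  have comb : ∀ v, ∃ d : Fin m → k[X], v = ∑ l, d l • P l := fun v => ⟨Matrix.vecMul v P⁻¹, by
    rw [← Matrix.vecMul_eq_sum, Matrix.vecMul_vecMul, Matrix.nonsing_inv_mul _ hP, Matrix.vecMul_one]⟩
  have comb2 : ∀ v (d : Fin m → k[X]), v = ∑ l, d l • P l → xv v = ∑ l, ι (d l) • xv (P l) := fun v d hd => by
    rw [hd, map_sum]; exact Finset.sum_congr rfl fun l _ => xsmul _ _
  let b := basisOfTopLeSpanOfCardEqFinrank (fun j => xv (P j)) (by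
    rw [← g.span_eq, Submodule.span_le]
    rintro _ ⟨l, rfl⟩
    obtain ⟨d, hd⟩ := comb (Pi.single l 1)
    have : g l = xv (Pi.single l 1) := g.repr.injective (Finsupp.ext fun l' => by
      rw [xrep, g.repr_self, Finsupp.single_apply, Pi.single_apply]; simp [eq_comm, apply_ite ι])
    rw [SetLike.mem_coe, this, comb2 _ _ hd]
    exact Submodule.sum_mem _ fun j _ => Submodule.smul_mem _ _ (Submodule.subset_span ⟨j, rfl⟩)) (Module.finrank_eq_card_basis g).symm
  have hb : ∀ j, b j = xv (P j) := fun j => by simp [b]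
  have comb3 : ∀ v, ∃ d : Fin m → k[X], v = ∑ l, d l • P l ∧ ∀ l, b.repr (xv v) l = ι (d l) := fun v => by
    obtain ⟨d, hd⟩ := comb v
    refine ⟨d, hd, fun l => ?_⟩
    rw [comb2 _ _ hd]; simp_rw [← hb]; rw [b.repr_sum_self]
  have ha : ∀ i, a i = 0 := by
    obtain ⟨d, hd⟩ := IsLocalization.exist_integer_multiples_of_finite (nonZeroDivisors k[X]) (fun x : Fin m × Fin m => g.repr (h x.1) x.2)
    have hd0 : (d : k[X]) ≠ 0 := nonZeroDivisors.coe_ne_zero d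
    choose w hw using fun i j => hd (i, j)
    have hwh : ∀ i, xv (w i) = ι d • h i := fun i => g.repr.injective (Finsupp.ext fun l => by
      rw [xrep, hw, map_smul, Finsupp.smul_apply, Algebra.smul_def, smul_eq_mul])
    choose q hq hq2 using fun i => comb3 (w i)
    have hle : ∀ i j, ‖jj (ι (q i j))‖ * 2 ^ a j ≤ 2 ^ (d : k[X]).natDegree := fun i j => by
      rcases eq_or_ne (q i j) 0 with h0 | h0
      · simp [h0]
      have := hmin (q i) (d : k[X]).natDegree (by
        rw [← hq i, hS, hwh, zpow_natCast, ← mul_one (2 ^ _ : ℝ)]; exact Bsmul _ _ _ _ (hn' _ _ le_rfl) (Bh i)) j h0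
      rw [hn _ h0, ← pow_add]; exact pow_le_pow_right₀ one_le_two (by omega)
    have e1 := dsc_change (F := RatFunc k) g b ((ι).mapMatrix P) fun i => by rw [hb, xv_def]; rfl
    have e2 := dsc_change (F := RatFunc k) b h ((ι d)⁻¹ • (ι).mapMatrix (Matrix.of q)) fun i => by
      have hd1 : ι d ≠ 0 := (map_ne_zero_iff _ ι_inj).2 hd0
      rw [← inv_smul_smul₀ hd1 (h i), ← hwh, ← b.sum_repr (xv (w i)), Finset.smul_sum]
      exact Finset.sum_congr rfl fun l _ => by rw [hq2, smul_smul]; rfl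
    rw [e1, hf, ← RingHom.map_det] at e2
    rw [e2, map_mul, map_mul, norm_mul, norm_mul, hnu f hf1, map_pow _ (ι P.det), norm_pow, hnu _ hP, one_pow, one_mul, mul_one, map_pow, norm_pow] at hh2
    have e3 := norm_det_le ((jj).mapMatrix (((ι d)⁻¹ • (ι).mapMatrix (Matrix.of q)) * Matrix.diagonal fun j => ι (X ^ a j))) fun i j => by
      rw [RingHom.mapMatrix_apply, Matrix.map_apply, Matrix.mul_diagonal, Matrix.smul_apply, smul_eq_mul, map_mul, map_mul, norm_mul, norm_mul, hX, map_inv₀, norm_inv, hn _ hd0, mul_assoc, inv_mul_le_iff₀ (by positivity), mul_one]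
      exact hle i j
    rw [← RingHom.map_det, Matrix.det_mul, map_mul, norm_mul, Matrix.det_diagonal, map_prod, norm_prod] at e3
    simp_rw [hX] at e3
    rw [(pow_eq_one_iff_of_nonneg (norm_nonneg _) two_ne_zero).1 hh2, one_mul, Finset.prod_pow_eq_pow_sum] at e3
    have : ∑ i, a i = 0 := by
      by_contra h0; exact absurd e3 (not_le.2 (one_lt_pow₀ one_lt_two h0))
    exact fun i => (Finset.sum_eq_zero_iff.1 this) i (Finset.mem_univ _)
  refine ⟨b, fun i j l => ?_⟩
  obtain ⟨u, hu⟩ := xmul (P i) (P j)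
  obtain ⟨d, hd, hd2⟩ := comb3 u
  have h0 : natDegree (d l) = 0 := by
    rcases eq_or_ne (d l) 0 with h0 | h0
    · simp [h0]
    have := hmin d 0 (by
      have := Bmul _ _ _ _ (by positivity) (by positivity) (hPa i) (hPa j)
      rw [hu, ha, ha] at this; rw [← hd, hS]; simpa using this) l h0
    omega
  exact ⟨_, by rw [hb, hb, hu, hd2, eq_C_of_natDegree_eq_zero h0]⟩
end

theorem DAct.exists_coord {L Δ X : Type*} [Field L] [DivisionRing Δ] [Algebra L Δ] [AddCommGroup X] [Module L X] [Nontrivial X] (B : DAct L Δ L X) :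
    ∃ φ : X → Δ, (∃ w, φ w = 1) ∧ ∀ x, ∃ a : Module.End L X, (∀ g w, B.a g (a w) = a (B.a g w)) ∧ ∀ w, a w = B.a (φ w) x := by
  letI : Module Δ X := Module.compHom X B.a
  have hs : ∀ (g : Δ) x, g • x = B.a g x := fun g x => rfl
  haveI : IsScalarTower L Δ X := ⟨fun c g x => by rw [hs, hs, B.map_smul]; rfl⟩
  let e := Module.Basis.ofVectorSpace Δ X
  obtain ⟨i⟩ := e.index_nonempty
  exact ⟨e.coord i, ⟨e i, by simp⟩, fun x => ⟨((e.coord i).smulRight x).restrictScalars L, fun g w => (((e.coord i).smulRight x).map_smul g w).symm, fun w => rfl⟩⟩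

section unram
variable {L W : Type*} [NontriviallyNormedField L] [CompleteSpace L] [IsUltrametricDist L] [AddCommGroup W] [Module L W]

theorem VNorm.inv_eq {Δ : Type*} [DivisionRing Δ] [Algebra L Δ] [FiniteDimensional L Δ] (A : DAct L Δ L W) (α : VNorm L W) (h : ∀ y w, α.v (A.a y w) ≤ nm L y * α.v w) (y : Δ) (w : W) :
    α.v (A.a y w) = nm L y * α.v w := by
  rcases eq_or_ne y 0 with rfl | hy
  · rw [map_zero, nm_zero, zero_mul]; exact α.v_zero
  refine le_antisymm (h y w) ?_
  have := h y⁻¹ (A.a y w)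
  rw [← Module.End.mul_apply, ← map_mul, inv_mul_cancel₀ hy, map_one, nm_inv, ← div_eq_inv_mul, le_div_iff₀' (nm_pos hy)] at this
  exact this

/-- invariance under an order -/
theorem VNorm.exists_order_inv [FiniteDimensional L W] {F D : Type*} [Field F] [DivisionRing D] [Algebra F D] [Algebra F L] {n : ℕ} (b : Module.Basis (Fin n) F D)
    (hb : ∀ i j l, ‖algebraMap F L (b.repr (b i * b j) l)‖ ≤ 1) (A : DAct F D L W) (β : VNorm L W) :
    ∃ α : VNorm L W, (∀ x, (∀ i, ‖algebraMap F L (b.repr x i)‖ ≤ 1) → ∀ w, α.v (A.a x w) ≤ α.v w) ∧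
    ∀ g : Module.End L W, (∀ y w, A.a y (g w) = g (A.a y w)) → ∀ c, 0 ≤ c →
      (∀ w, β.v (g w) ≤ c * β.v w) → ∀ w, α.v (g w) ≤ c * α.v w := by
  obtain ⟨C, hC0, hC⟩ := β.bdd_span fun i => A.a (b i)
  let I : Submonoid D :=
    { carrier := {x | x = 1 ∨ ∀ i, ‖algebraMap F L (b.repr x i)‖ ≤ 1}
      one_mem' := Or.inl rfl
      mul_mem' := by
        rintro x y (rfl | hx) (rfl | hy)
        · exact Or.inl (one_mul 1)
        · exact Or.inr (by simpa using hy)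
        · exact Or.inr (by simpa using hx)
        refine Or.inr fun l => ?_
        rw [← b.sum_repr x, ← b.sum_repr y]
        simp only [Finset.sum_mul, Finset.mul_sum, map_sum, Finsupp.finset_sum_apply, smul_mul_smul_comm, map_smul, Finsupp.smul_apply, smul_eq_mul, map_mul]
        refine IsUltrametricDist.norm_sum_le_of_forall_le_of_nonneg zero_le_one fun i _ => IsUltrametricDist.norm_sum_le_of_forall_le_of_nonneg zero_le_one fun j _ => ?_
        rw [norm_mul, norm_mul]
        exact mul_le_one₀ (mul_le_one₀ (hx _) (norm_nonneg _) (hy _)) (norm_nonneg _) (hb _ _ _) }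
  obtain ⟨α, h1, h2⟩ := β.exists_inv ((A.a : D →* Module.End L W).comp I.subtype) (fun _ => 1) rfl (fun _ _ => (one_mul _).symm) (fun _ => zero_le_one) (max 1 C) (by
    rintro ⟨x, rfl | hx⟩ w
    · simpa using le_mul_of_one_le_left (β.nonneg w) (le_max_left 1 C)
    · have := hC (fun i => algebraMap F L (b.repr x i)) 1 zero_le_one hx w
      have e : A.a x = ∑ i, algebraMap F L (b.repr x i) • A.a (b i) := by
        conv_lhs => rw [← b.sum_repr x, map_sum]
        simp_rw [A.map_smul]
      rw [← e] at this
      refine this.trans (mul_le_mul_of_nonneg_right ?_ (β.nonneg w))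
      simp)
  exact ⟨α, fun x hx w => by simpa using h1 ⟨x, Or.inr hx⟩ w, fun g hg c hc => h2 g (fun i w => hg _ _) c hc⟩

noncomputable def VNorm.round {q : ℝ} (hq : 0 < q) (h1 : q < 1) (γ : VNorm L W) (hn : ∀ c : L, c ≠ 0 → ∃ m : ℤ, ‖c‖ = q ^ m) : VNorm L W where
  v w := cl q (γ.v w)
  nonneg w := cl_nonneg hq _
  eq_zero w h := by
    by_contra h0
    exact (cl_pos hq (γ.pos h0)).ne' h
  add_le x y := (cl_mono hq h1 (γ.add_le x y)).trans (cl_max hq h1 _ _).le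
  smul c x := by
    rcases eq_or_ne c 0 with rfl | h
    · simp [γ.v_zero, cl_zero]
    · obtain ⟨m, hm⟩ := hn c h
      rw [γ.smul, hm, cl_mul hq h1]

theorem unram {F D Δ : Type*} [Field F] [DivisionRing D] [Algebra F D] [Algebra F L] [FiniteDimensional F D] [Algebra.IsCentral F D] [DivisionRing Δ] [Algebra L Δ] {q : ℝ} (hL : Loc L q)
    (Q : LocMod F D L W Δ) {a : ℕ} (hn : Module.finrank F D = (2 ^ a) ^ 2) {n : ℕ} (b : Module.Basis (Fin n) F D) (c : Fin n → D) (hbc : DualFam F D b c)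
    (hb : ∀ i j l, ‖algebraMap F L (b.repr (b i * b j) l)‖ ≤ 1) (hc : ∀ i l, ‖algebraMap F L (b.repr (c i) l)‖ ≤ 1) (y : Δ) (hy : y ≠ 0) : ∃ m : ℤ, nm L y = q ^ m := by
  haveI := Q.fin; haveI := Q.finΔ; haveI := Q.central; haveI := Q.nt
  have hq := hL.q0
  set K := Module.finrank L Δ with hK
  have hK0 : K ≠ 0 := (Module.finrank_pos (R := L) (M := Δ)).ne'
  set ρ : ℝ := q ^ (K : ℝ)⁻¹ with hρ
  have hρ0 : 0 < ρ := Real.rpow_pos_of_pos hq _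
  have hρ1 : ρ < 1 := Real.rpow_lt_one hq.le hL.q1 (by positivity)
  have hρK : ρ ^ K = q := Real.rpow_inv_natCast_pow hq.le hK0
  have hnm : ∀ y : Δ, y ≠ 0 → ∃ m : ℤ, nm L y = ρ ^ m := fun y hy => by
    obtain ⟨m, hm⟩ := nmV_disc (Δ := Δ) hL y hy
    refine ⟨m, (pow_left_inj₀ (nm_nonneg y) (zpow_pos hρ0 m).le hK0).1 ?_⟩
    rw [← zpow_natCast (ρ ^ m), zpow_comm, zpow_natCast, hρK]; exact hm
  obtain ⟨γ1, g1, -⟩ := Q.B.exists_inv (VNorm.ofBasis (Module.finBasis L W))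
  obtain ⟨γ, g2, g3⟩ := γ1.exists_order_inv b hb Q.A
  replace g3 := γ.inv_eq Q.B fun y w => g3 (Q.B.a y) (fun d w => Q.comm d y w) _ (nm_nonneg y) (g1 y) w
  let α := γ.round hρ0 hρ1 fun c hc => by
    obtain ⟨m, hm⟩ := hL.disc c hc
    exact ⟨K * m, by rw [hm, zpow_mul, zpow_natCast, hρK]⟩
  have a1 : ∀ x, (∀ i, ‖algebraMap F L (b.repr x i)‖ ≤ 1) → ∀ w, α.v (Q.A.a x w) ≤ α.v w := fun x hx w => cl_mono hρ0 hρ1 (g2 x hx w)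
  have a2 : ∀ y w, α.v (Q.B.a y w) = nm L y * α.v w := fun y w => by
    rcases eq_or_ne y 0 with rfl | hy
    · rw [map_zero, nm_zero, zero_mul]; exact α.v_zero
    obtain ⟨m, hm⟩ := hnm y hy
    change cl ρ _ = _ * cl ρ _
    rw [g3, hm, cl_mul hρ0 hρ1]
  obtain ⟨e, he⟩ := α.exists_orth hq hL.q1 hK0 (fun w hw => by
    obtain ⟨m, hm⟩ := cl_mem (q := ρ) (γ.pos hw)
    refine ⟨m, ?_⟩
    change cl ρ _ ^ K = _
    rw [hm, ← zpow_natCast, zpow_comm, zpow_natCast, hρK])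
  -- integrality
  have key : ∀ f : Module.End L W, (∀ g w, Q.B.a g (f w) = f (Q.B.a g w)) → (∀ w ≠ 0, α.v (f w) < q⁻¹ * α.v w) → ∀ w, α.v (f w) ≤ α.v w := fun f hf hlt w => by
    have hspan : f ∈ Submodule.span L (Set.range fun i => Q.A.a (b i)) := by
      refine Submodule.span_le.2 ?_ (Q.span f hf)
      rintro _ ⟨d, rfl⟩
      rw [← b.sum_repr d, map_sum]
      exact Submodule.sum_mem _ fun i _ => by
        rw [Q.A.map_smul]; exact Submodule.smul_mem _ _ (Submodule.subset_span ⟨i, rfl⟩)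
    obtain ⟨l, rfl⟩ := (Submodule.mem_span_range_iff_exists_fun L).1 hspan
    have hX : ‖(Module.finrank L W : L)‖ = 1 := by
      obtain ⟨b', hb'⟩ := Q.twoPow hn
      have := Q.finrank_eq
      rw [hn, hb', ← mul_pow] at this
      exact hL.two_pow (a := a + b') (by rw [pow_add]; exact (pow_left_inj₀ (Nat.zero_le _) (Nat.zero_le _) two_ne_zero).1 this)
    have hD : ‖(Module.finrank F D : L)‖ = 1 := hL.two_pow (hn.trans (pow_mul _ _ _).symm)
    have hl : ∀ j, ‖l j‖ ≤ 1 := fun j => by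
      have h1 := norm_trace_le α he ((∑ i, l i • Q.A.a (b i)) * Q.A.a (c j)) hL fun w hw => by
        have : Q.A.a (c j) w ≠ 0 := fun h => by
          have := hbc.d j j
          rw [Q.A.act_eq_zero hw h, zero_mul, if_pos rfl, rtr, LinearMap.map_zero] at this; exact zero_ne_one this
        exact (hlt _ this).trans_le (mul_le_mul_of_nonneg_left (a1 _ (hc j) w) (by positivity))
      have h2 : (Module.finrank F D : L) * LinearMap.trace L W ((∑ i, l i • Q.A.a (b i)) * Q.A.a (c j)) = Module.finrank L W * l j := by
        simp_rw [Finset.sum_mul, smul_mul_assoc, ← map_mul, map_sum, map_smul, Finset.mul_sum, smul_eq_mul, mul_left_comm _ (l _)]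
        have h0 : (Module.finrank F D : F) ≠ 0 := fun h => by
          have := congrArg (algebraMap F L) h
          rw [map_natCast, map_zero] at this; rw [this, norm_zero] at hD; exact zero_ne_one hD
        simp_rw [trace_action h0 Q.A, fun i => rtr_comm F D (b i) (c j), hbc.d]
        simp [mul_comm]
      have h3 := congrArg norm h2
      rw [norm_mul, norm_mul, hD, hX, one_mul, one_mul] at h3; exact h3 ▸ h1
    rw [LinearMap.sum_apply]
    refine α.sum_le _ _ _ (α.nonneg _) fun i _ => ?_
    rw [LinearMap.smul_apply, α.smul]
    refine (mul_le_of_le_one_left (α.nonneg _) (hl i)).trans (a1 _ (fun j => ?_) w)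
    rw [b.repr_self, Finsupp.single_apply]; split_ifs <;> simp
  have op : ∀ f : Module.End L W, (∀ g w, Q.B.a g (f w) = f (Q.B.a g w)) → f ≠ 0 → ∃ m : ℤ, (opV α e).v f = q ^ m := fun f hf hf0 => by
    obtain ⟨x, hx0, hx1, hx2⟩ := hL.exists_norm ((opV α e).pos hf0)
    obtain ⟨m, hm⟩ := hL.disc x hx0
    refine ⟨m, hm ▸ le_antisymm ?_ hx2⟩
    have h1 : (opV α e).v (x⁻¹ • f) ≤ 1 := (opV_le_iff α he _ zero_le_one).2 fun w => by
      rw [one_mul]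
      refine key _ (fun g w => by rw [LinearMap.smul_apply, LinearMap.smul_apply, map_smul, hf]) (fun w hw => ?_) w
      refine ((opV_le_iff α he _ ((opV α e).nonneg _)).1 le_rfl w).trans_lt (mul_lt_mul_of_pos_right ?_ (α.pos hw))
      rw [(opV α e).smul, norm_inv, inv_mul_lt_iff₀ (norm_pos_iff.2 hx0), ← div_eq_mul_inv, lt_div_iff₀ hq, mul_comm]; exact hx1
    rwa [(opV α e).smul, norm_inv, inv_mul_le_iff₀ (norm_pos_iff.2 hx0), mul_one] at h1
  obtain ⟨φ, ⟨w1, hw1⟩, hφ⟩ := Q.B.exists_coord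
  choose t ht ht2 using hφ
  obtain ⟨x0, hx0⟩ := exists_ne (0 : W)
  have t0 : ∀ x, x ≠ 0 → t x ≠ 0 := fun x hx h => hx (by simpa [hw1, h] using (ht2 x w1).symm)
  have hyx : Q.B.a y x0 ≠ 0 := fun h => hy (Q.B.act_eq_zero hx0 h)
  obtain ⟨m, hm⟩ := op _ (ht x0) (t0 _ hx0)
  obtain ⟨m', hm'⟩ := op _ (ht _) (t0 _ hyx)
  have : (opV α e).v (t (Q.B.a y x0)) = nm L y * (opV α e).v (t x0) := by
    change (⨆ j, _) = _ * ⨆ j, _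
    rw [Real.mul_iSup_of_nonneg (nm_nonneg y)]
    simp_rw [ht2, a2, ← mul_div_assoc, mul_left_comm]
  refine ⟨m' - m, ?_⟩
  rw [zpow_sub₀ hq.ne', ← hm, ← hm', this, mul_div_cancel_right₀]
  rw [hm]; exact zpow_ne_zero _ hq.ne'
end unram

section red
variable {k L W : Type*} [Field k] [NontriviallyNormedField L] [CompleteSpace L] [IsUltrametricDist L] [AddCommGroup W] [Module L W] [Algebra k L]

/-- `k` is the residue field -/
structure RPlace (k L : Type*) [Field k] [NontriviallyNormedField L] [Algebra k L] : Prop where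
  le : ∀ c : k, ‖algebraMap k L c‖ ≤ 1
  res : ∀ y : L, ‖y‖ ≤ 1 → ∃ c : k, ‖y - algebraMap k L c‖ < 1

theorem RPlace.zero (P : RPlace k L) {c : k} (h : ‖algebraMap k L c‖ < 1) : c = 0 := by
  by_contra h0
  have h1 := P.le c⁻¹
  have h2 : algebraMap k L c * algebraMap k L c⁻¹ = 1 := by rw [← map_mul, mul_inv_cancel₀ h0, map_one]
  have h3 := congrArg norm h2
  rw [norm_mul, norm_one] at h3
  nlinarith [norm_nonneg (algebraMap k L c), norm_nonneg (algebraMap k L c⁻¹)]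

theorem VNorm.exists_onb [FiniteDimensional L W] {q : ℝ} (hL : Loc L q) (α : VNorm L W) (hα : ∀ w ≠ 0, ∃ m : ℤ, α.v w = q ^ m) :
    ∃ e : Module.Basis (Fin (Module.finrank L W)) L W, (∀ i x, ‖e.repr x i‖ ≤ α.v x) ∧ ∀ i, α.v (e i) = 1 := by
  obtain ⟨e, he⟩ := α.exists_orth hL.q0 hL.q1 one_ne_zero (fun w hw => by simpa using hα w hw)
  have : ∀ i, ∃ c : Lˣ, ‖(c : L)‖ = α.v (e i) := fun i => by
    obtain ⟨m, hm⟩ := hα _ (e.ne_zero i)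
    obtain ⟨p, hp⟩ := hL.ex
    have h0 : p ≠ 0 := norm_pos_iff.1 (hp ▸ hL.q0)
    exact ⟨Units.mk0 (p ^ m) (zpow_ne_zero _ h0), by rw [Units.val_mk0, norm_zpow, hp, hm]⟩
  choose c hc using this
  refine ⟨e.unitsSMul fun i => (c i)⁻¹, fun i x => ?_, fun i => ?_⟩
  · have := he x i
    rw [← hc] at this
    rw [Module.Basis.repr_unitsSMul, inv_inv, Units.smul_def, norm_smul, mul_comm]; exact this
  · rw [Module.Basis.unitsSMul_apply, Units.smul_def, α.smul, ← hc, ← norm_mul, Units.inv_mul, norm_one]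

/-- reduction of a lattice -/
structure Red (k : Type*) [Field k] [Algebra k L] (α : VNorm L W) (U : Type*) [AddCommGroup U] [Module k U] where
  r : W → U
  add : ∀ {x y}, α.v x ≤ 1 → α.v y ≤ 1 → r (x + y) = r x + r y
  smul : ∀ (c : k) {x}, α.v x ≤ 1 → r (algebraMap k L c • x) = c • r x
  surj : ∀ u, ∃ x, α.v x ≤ 1 ∧ r x = u
  ker : ∀ {x}, α.v x ≤ 1 → (r x = 0 ↔ α.v x < 1)

variable {α : VNorm L W} {U : Type*} [AddCommGroup U] [Module k U]

theorem Red.eq (S : Red k α U) (P : RPlace k L) {x y : W} (hx : α.v x ≤ 1) (hy : α.v y ≤ 1) : S.r x = S.r y ↔ α.v (x - y) < 1 := by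
  rw [← S.ker ((α.sub_le x y).trans (max_le hx hy)), ← sub_eq_zero]
  have := S.add hx ((α.v_neg y).trans_le hy)
  rw [← sub_eq_add_neg] at this
  rw [this, show -y = algebraMap k L (-1) • y by simp, S.smul _ hy, neg_smul, one_smul, ← sub_eq_add_neg]

theorem Red.sum (S : Red k α U) {ι : Type*} (s : Finset ι) (f : ι → W) (hf : ∀ i, α.v (f i) ≤ 1) : S.r (∑ i ∈ s, f i) = ∑ i ∈ s, S.r (f i) := by
  classical
  induction s using Finset.induction_on with
  | empty => exact (S.ker (by simp [α.v_zero])).2 (by simp [α.v_zero])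
  | insert i s h ih => rw [Finset.sum_insert h, Finset.sum_insert h, S.add (hf i) (α.sum_le _ _ _ zero_le_one fun i _ => hf i), ih]

theorem Red.finrank [FiniteDimensional L W] (S : Red k α U) (P : RPlace k L) {q : ℝ} (hL : Loc L q) (hα : ∀ w ≠ 0, ∃ m : ℤ, α.v w = q ^ m) :
    FiniteDimensional k U ∧ Module.finrank k U = Module.finrank L W := by
  obtain ⟨e, he, he1⟩ := α.exists_onb hL hα
  have hc : ∀ (c : k) i, α.v (algebraMap k L c • e i) ≤ 1 := fun c i => by rw [α.smul, he1, mul_one]; exact P.le c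
  have hs : ∀ c : Fin _ → k, S.r (∑ i, algebraMap k L (c i) • e i) = ∑ i, c i • S.r (e i) := fun c => by
    rw [S.sum _ _ fun i => hc _ _]
    simp_rw [S.smul _ (he1 _).le]
  let b : Module.Basis (Fin (Module.finrank L W)) k U := Module.Basis.mk (v := fun i => S.r (e i)) (by
    rw [Fintype.linearIndependent_iff]
    intro c h i
    rw [← hs, S.ker (α.sum_le _ _ _ zero_le_one fun i _ => hc _ _)] at h
    apply P.zero
    refine lt_of_le_of_lt ?_ h
    have := he i (∑ i, algebraMap k L (c i) • e i)
    rwa [e.repr_sum_self] at this) (fun u _ => by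
    obtain ⟨x, hx, rfl⟩ := S.surj u
    choose c h using fun i => P.res _ ((he i x).trans hx)
    have : S.r x = ∑ i, c i • S.r (e i) := by
      rw [← hs, S.eq P hx (α.sum_le _ _ _ zero_le_one fun i _ => hc _ _)]
      conv_lhs => rw [← e.sum_repr x]
      rw [← Finset.sum_sub_distrib]
      refine α.sum_lt _ _ _ zero_lt_one fun i _ => ?_
      rw [← sub_smul, α.smul, he1, mul_one]; exact h i
    rw [this]
    exact Submodule.sum_mem _ fun i _ => Submodule.smul_mem _ _ (Submodule.subset_span ⟨i, rfl⟩))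
  exact ⟨b.finiteDimensional_of_finite, by rw [Module.finrank_eq_card_basis b, Fintype.card_fin]⟩

theorem Red.exists_red [FiniteDimensional L W] (P : RPlace k L) {q : ℝ} (hL : Loc L q) (hα : ∀ w ≠ 0, ∃ m : ℤ, α.v w = q ^ m) :
    Nonempty (Red k α (Fin (Module.finrank L W) → k)) := by
  classical
  obtain ⟨e, he, he1⟩ := α.exists_onb hL hα
  have : ∀ y : L, ∃ c : k, ‖y‖ ≤ 1 → ‖y - algebraMap k L c‖ < 1 := fun y => by
    by_cases h : ‖y‖ ≤ 1
    · obtain ⟨c, hc⟩ := P.res y h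
      exact ⟨c, fun _ => hc⟩
    · exact ⟨0, fun h' => absurd h' h⟩
  choose s hs using this
  have hu : ∀ (y : L) (c : k), ‖y‖ ≤ 1 → ‖y - algebraMap k L c‖ < 1 → s y = c := fun y c hy h => by
    rw [← sub_eq_zero]
    apply P.zero
    rw [map_sub, show algebraMap k L (s y) - algebraMap k L c = (y - algebraMap k L c) + -(y - algebraMap k L (s y)) by ring]
    exact (IsUltrametricDist.norm_add_le_max _ _).trans_lt (max_lt h ((norm_neg _).trans_lt (hs y hy)))
  refine ⟨⟨fun w i => s (e.repr w i), fun {x y} hx hy => funext fun i => ?_, fun c x hx => funext fun i => ?_, fun u => ?_, fun {x} hx => ?_⟩⟩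
  · have h1 := (he i x).trans hx
    have h2 := (he i y).trans hy
    rw [map_add, Finsupp.add_apply, Pi.add_apply]
    refine hu _ _ ((IsUltrametricDist.norm_add_le_max _ _).trans (max_le h1 h2)) ?_
    rw [map_add, add_sub_add_comm]
    exact (IsUltrametricDist.norm_add_le_max _ _).trans_lt (max_lt (hs _ h1) (hs _ h2))
  · have h1 := (he i x).trans hx
    rw [map_smul, Finsupp.smul_apply, Pi.smul_apply, smul_eq_mul, smul_eq_mul]
    refine hu _ _ ?_ ?_
    · rw [norm_mul]; exact mul_le_one₀ (P.le c) (norm_nonneg _) h1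
    · rw [map_mul, ← mul_sub, norm_mul]; exact mul_lt_one_of_nonneg_of_lt_one_right (P.le c) (norm_nonneg _) (hs _ h1)
  · refine ⟨∑ i, algebraMap k L (u i) • e i, α.sum_le _ _ _ zero_le_one fun i _ => ?_, funext fun i => hu _ _ ?_ ?_⟩
    · rw [α.smul, he1, mul_one]; exact P.le _
    · rw [e.repr_sum_self]; exact P.le (u i)
    · rw [e.repr_sum_self, sub_self, norm_zero]; exact zero_lt_one
  · constructor
    · intro h
      rw [← e.sum_repr x]
      refine α.sum_lt _ _ _ zero_lt_one fun i _ => ?_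
      have := hs _ ((he i x).trans hx)
      rw [show s (e.repr x i) = 0 from congrFun h i, map_zero, sub_zero] at this
      rwa [α.smul, he1, mul_one]
    · exact fun h => funext fun i => hu _ _ ((he i x).trans hx) (by rw [Pi.zero_apply, map_zero, sub_zero]; exact (he i x).trans_lt h)

theorem Red.lift (S : Red k α U) (P : RPlace k L) {I : Type*} [Ring I] (T : I →+* Module.End L W) (hT : ∀ i w, α.v (T i w) ≤ α.v w) :
    ∃ t : I →+* Module.End k U, ∀ i w, α.v w ≤ 1 → t i (S.r w) = S.r (T i w) := by
  choose x hx hx' using S.surj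
  have hT' : ∀ i {w}, α.v w ≤ 1 → α.v (T i w) ≤ 1 := fun i w h => (hT i w).trans h
  have hr : ∀ i w, α.v w ≤ 1 → S.r (T i (x (S.r w))) = S.r (T i w) := fun i w h => by
    rw [S.eq P (hT' i (hx _)) (hT' i h), ← map_sub]
    exact (hT _ _).trans_lt ((S.eq P (hx _) h).1 (hx' _))
  let t : I → Module.End k U := fun i =>
    { toFun := fun u => S.r (T i (x u))
      map_add' := fun u v => by
        rw [← S.add (hT' i (hx u)) (hT' i (hx v)), ← map_add]
        conv_lhs => rw [← hx' u, ← hx' v, ← S.add (hx u) (hx v)]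
        exact hr _ _ ((α.add_le _ _).trans (max_le (hx u) (hx v)))
      map_smul' := fun c u => by
        conv_lhs => rw [← hx' u, ← S.smul c (hx u)]
        rw [hr, map_smul, S.smul c (hT' i (hx u))]; rfl
        rw [α.smul]; exact mul_le_one₀ (P.le c) (α.nonneg _) (hx u) }
  have ht : ∀ i w, α.v w ≤ 1 → t i (S.r w) = S.r (T i w) := hr
  have key : ∀ f g : Module.End k U, (∀ w, α.v w ≤ 1 → f (S.r w) = g (S.r w)) → f = g := fun f g h => LinearMap.ext fun u => by
    rw [← hx' u]; exact h _ (hx u)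
  refine ⟨{ toFun := t, map_one' := key _ _ fun w hw => ?_, map_mul' := fun i j => key _ _ fun w hw => ?_, map_zero' := key _ _ fun w hw => ?_, map_add' := fun i j => key _ _ fun w hw => ?_ }, ht⟩
  · rw [ht _ _ hw, map_one]; rfl
  · rw [ht _ _ hw, map_mul, Module.End.mul_apply, Module.End.mul_apply, ht _ _ hw, ht _ _ (hT' j hw)]
  · rw [ht _ _ hw, map_zero]; exact (S.ker (by simp [α.v_zero])).2 (by simp [α.v_zero])
  · rw [ht _ _ hw, map_add, LinearMap.add_apply, LinearMap.add_apply, ht _ _ hw, ht _ _ hw, S.add (hT' i hw) (hT' j hw)]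
end red

theorem max_of_finrank {F D : Type*} [Field F] [DivisionRing D] [Algebra F D] [FiniteDimensional F D] [Algebra.IsCentral F D] (M : Subalgebra F D)
    (hM : ∀ x ∈ M, ∀ y ∈ M, x * y = y * x) (h : Module.finrank F D = Module.finrank F M ^ 2) : IsMaximalSubfield F D M := by
  obtain ⟨N, hMN, hN⟩ := exists_maximalSubfield M hM
  have h2 : M = N := Subalgebra.toSubmodule_injective (Submodule.eq_of_le_of_finrank_eq (S₁ := Subalgebra.toSubmodule M) (S₂ := Subalgebra.toSubmodule N) hMN
    (Nat.pow_left_injective (n := 2) two_ne_zero (h.symm.trans (finrank_eq_sq N hN.1 hN.2.1 hN.mem).1)))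
  rwa [h2]

section kres
variable {k L : Type*} [Field k] [NontriviallyNormedField L] [CompleteSpace L] [IsUltrametricDist L] [Algebra k L] 

theorem exists_kres {Δ : Type u} [DivisionRing Δ] [Algebra L Δ] [FiniteDimensional L Δ] (P : RPlace k L) : ∃ (R : Type u) (_ : DivisionRing R) (_ : Algebra k R) (ρ : Resid L Δ R),
    ∀ c, ρ.r (algebraMap L Δ (algebraMap k L c)) = algebraMap k R c := by
  obtain ⟨R, _, ⟨ρ⟩⟩ := exists_resid L Δ
  have h : ∀ c, nm L (algebraMap L Δ (algebraMap k L c)) ≤ 1 := fun c => (nm_algebraMap _).trans_le (P.le c)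
  let f : k →+* R := ρ.ψ.comp (((algebraMap L Δ).comp (algebraMap k L)).codRestrict (OO L Δ) h)
  have hf : ∀ c, ρ.r (algebraMap L Δ (algebraMap k L c)) = f c := fun c => ρ.r_def (h c)
  exact ⟨R, _, f.toAlgebra' fun c x => by
    rw [← hf]; exact (Subring.mem_center_iff.1 (ρ.r_alg_center (P.le c)) x).symm, ρ, hf⟩

variable {Δ : Type*} [DivisionRing Δ] [Algebra L Δ] [FiniteDimensional L Δ] {R : Type*} [DivisionRing R] [Algebra k R]

noncomputable def Resid.red (ρ : Resid L Δ R) (ha : ∀ c, ρ.r (algebraMap L Δ (algebraMap k L c)) = algebraMap k R c) (P : RPlace k L) : Red k (nmV L Δ) R where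
  r := ρ.r
  add hx hy := ρ.r_add hx hy
  smul c x hx := by
    rw [Algebra.smul_def, Algebra.smul_def, ρ.r_mul ((nm_algebraMap _).trans_le (P.le c)) hx, ha]
  surj := ρ.ex
  ker hx := ρ.r_zero_iff hx

theorem Resid.central [Algebra.IsCentral L Δ] (ρ : Resid L Δ R) (ha : ∀ c, ρ.r (algebraMap L Δ (algebraMap k L c)) = algebraMap k R c) (P : RPlace k L) 
    {q : ℝ} (hL : Loc L q) (hN : ‖(Module.finrank L Δ : L)‖ = 1) (hv : ∀ y : Δ, y ≠ 0 → ∃ m : ℤ, nm L y = q ^ m) : Algebra.IsCentral k R := ⟨fun t ht => by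
  rcases eq_or_ne t 0 with rfl | h0
  · exact Subalgebra.zero_mem _
  obtain ⟨p, hp⟩ := hL.ex
  have hp0 : p ≠ 0 := norm_pos_iff.1 (hp ▸ hL.q0)
  have hp' : algebraMap L Δ p ≠ 0 := by simpa using hp0
  obtain ⟨l, hl, h⟩ := ρ.fixed hL hN hp' (fun y hy => by rw [nm_algebraMap, hp]; exact hv y hy) t
    (Subring.mem_center_iff.2 fun x => Subalgebra.mem_center_iff.1 ht x) h0 (ρ.cj_algebraMap hp0 t)
  obtain ⟨c, hc⟩ := P.res l hl.le
  refine Algebra.mem_bot.2 ⟨c, ?_⟩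
  rw [← ha, ← h, ρ.r_eq ((nm_algebraMap _).trans_le (P.le c)) ((nm_algebraMap _).trans_le hl.le), ← map_sub, nm_algebraMap, norm_sub_rev]; exact hc⟩

theorem Resid.anti (ρ : Resid L Δ R) (ha : ∀ c, ρ.r (algebraMap L Δ (algebraMap k L c)) = algebraMap k R c) (P : RPlace k L) (θ : Δ →ₐ[L] Δᵐᵒᵖ) : Nonempty (R →ₐ[k] Rᵐᵒᵖ) := by
  obtain ⟨e, he⟩ := ρ.exists_op θ
  refine ⟨{ e with commutes' := fun c => ?_ }⟩
  change e _ = _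
  rw [← ha, he ⟨_, (nm_algebraMap _).trans_le (P.le c)⟩]
  change op (ρ.r (unop (θ (algebraMap L Δ _)))) = _
  rw [θ.commutes]; exact congrArg op (ha c)

theorem Resid.aeval (ρ : Resid L Δ R) (ha : ∀ c, ρ.r (algebraMap L Δ (algebraMap k L c)) = algebraMap k R c) (P : RPlace k L) {s : Δ} (hs : nm L s ≤ 1) (f : k[X]) : nm L (aeval s (f.map (algebraMap k L))) ≤ 1 ∧
    ρ.r (Polynomial.aeval s (f.map (algebraMap k L))) = Polynomial.aeval (ρ.r s) f := by
  have h : ∀ c, nm L (algebraMap L Δ (algebraMap k L c)) ≤ 1 := fun c => (nm_algebraMap _).trans_le (P.le c)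
  let κ := ((algebraMap L Δ).comp (algebraMap k L)).codRestrict (OO L Δ) h
  have e : Polynomial.aeval s (f.map (algebraMap k L)) = (f.eval₂ κ ⟨s, hs⟩).1 := by
    rw [aeval_def, eval₂_map]
    exact (hom_eval₂ f κ (OO L Δ).subtype ⟨s, hs⟩).symm
  rw [e]
  refine ⟨(f.eval₂ κ ⟨s, hs⟩).2, ?_⟩
  rw [ρ.r_def (f.eval₂ κ ⟨s, hs⟩).2, Subtype.coe_eta, hom_eval₂, aeval_def, ρ.r_def hs]
  congr 1
  ext c
  rw [← ha, ρ.r_def (h c)]; rfl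

theorem Resid.hensel (ρ : Resid L Δ R) (ha : ∀ c, ρ.r (algebraMap L Δ (algebraMap k L c)) = algebraMap k R c) (P : RPlace k L) (t : R) (ht : (minpoly k t).Separable) : ∃ s : Δ, nm L s ≤ 1 ∧ Polynomial.aeval s ((minpoly k t).map (algebraMap k L)) = 0 := by
  obtain ⟨x, hx, rfl⟩ := ρ.ex t
  obtain ⟨s, -, h1, h2⟩ := nm_hensel ((minpoly k (ρ.r x)).map (algebraMap k L)) (fun i => by rw [coeff_map]; exact P.le _) x hx (by
    rw [derivative_map]
    obtain ⟨h1, h2⟩ := ρ.aeval ha P hx (derivative (minpoly k (ρ.r x)))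
    refine le_antisymm h1 (not_lt.1 fun h => ?_)
    rw [← ρ.r_zero_iff h1, h2] at h
    obtain ⟨a, b, hab⟩ := ht
    have := congrArg (Polynomial.aeval (ρ.r x)) hab
    simp [h] at this) (by
    obtain ⟨h1, h2⟩ := ρ.aeval ha P hx (minpoly k (ρ.r x))
    rw [← ρ.r_zero_iff h1, h2, minpoly.aeval])
  refine ⟨s, ?_, h1⟩
  have := nm_add_le (L := L) (s - x) x
  rw [sub_add_cancel] at this
  exact this.trans (max_le h2.le hx)

theorem Resid.same (ρ : Resid L Δ R) (ha : ∀ c, ρ.r (algebraMap L Δ (algebraMap k L c)) = algebraMap k R c) (P : RPlace k L) {Δ' R' : Type*} [DivisionRing Δ'] [Algebra L Δ'] [FiniteDimensional L Δ'] [DivisionRing R'] [Algebra k R'] (ρ' : Resid L Δ' R')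
    (ha' : ∀ c, ρ'.r (algebraMap L Δ' (algebraMap k L c)) = algebraMap k R' c) [FiniteDimensional k R] [FiniteDimensional k R'] [Algebra.IsCentral k R] [Algebra.IsCentral k R']
    (h2 : (2 : k) ≠ 0) {b : ℕ} (hR : Module.finrank k R = (2 ^ b) ^ 2) (hR' : Module.finrank k R' = (2 ^ b) ^ 2)
    (hg : ∀ M : Subalgebra L Δ, (∀ x ∈ M, ∀ y ∈ M, x * y = y * x) → Nonempty (M →ₐ[L] Δ')) (M : Subalgebra k R) (hM : IsMaximalSubfield k R M) :
    ∃ M' : Subalgebra k R', IsMaximalSubfield k R' M' ∧ Nonempty (M ≃ₐ[k] M') := by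
  have h3 := (finrank_eq_sq M hM.1 hM.2.1 hM.mem).1
  have h4 : Module.finrank k M = 2 ^ b := Nat.pow_left_injective (n := 2) two_ne_zero (h3.symm.trans hR)
  letI := subField M hM.1 hM.2.1
  haveI : FiniteDimensional k M := inferInstanceAs (FiniteDimensional k (Subalgebra.toSubmodule M))
  haveI : Algebra.IsSeparable k M := sep_of_two h2 h4
  let pb := Field.powerBasisOfFiniteOfSeparable k M
  have e1 : minpoly k pb.gen.1 = minpoly k pb.gen := minpoly.algHom_eq M.val Subtype.val_injective _
  obtain ⟨s, hs, hs'⟩ := ρ.hensel ha P pb.gen.1 (e1 ▸ Algebra.IsSeparable.isSeparable k pb.gen)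
  obtain ⟨φ⟩ := hg _ (adjoin_comm s)
  let x : Algebra.adjoin L {s} := ⟨s, Algebra.self_mem_adjoin_singleton L s⟩
  have hx := nm_of_minpoly (emb_minpoly φ x)
  have hx' : Polynomial.aeval x ((minpoly k pb.gen.1).map (algebraMap k L)) = 0 := Subtype.val_injective
    ((aeval_algHom_apply (Algebra.adjoin L {s}).val x _).symm.trans hs')
  have h5 : Polynomial.aeval (φ x) ((minpoly k pb.gen.1).map (algebraMap k L)) = 0 := by rw [aeval_algHom_apply, hx', map_zero]
  have h6 := (ρ'.aeval ha' P (s := φ x) (hx.trans_le hs) (minpoly k pb.gen.1)).2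
  rw [h5, (ρ'.r_zero_iff (by rw [nm_zero]; exact zero_le_one)).2 (by rw [nm_zero]; exact zero_lt_one), e1] at h6
  let g := pb.lift _ h6.symm
  let e := AlgEquiv.ofInjective g g.injective
  refine ⟨g.range, max_of_finrank _ ?_ ?_, ⟨e⟩⟩
  · rintro _ ⟨a, rfl⟩ _ ⟨b, rfl⟩
    exact (g.map_mul a b).symm.trans ((congrArg g (mul_comm a b)).trans (g.map_mul b a))
  · rw [hR', ← h4, e.toLinearEquiv.finrank_eq]
end kres
open scoped TensorProduct

theorem HasExponentTwo.anti {F D : Type*} [Field F] [DivisionRing D] [Algebra F D] [FiniteDimensional F D] [Algebra.IsCentral F D] (h : HasExponentTwo F D) :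
    Nonempty (D →ₐ[F] Dᵐᵒᵖ) := by
  obtain ⟨-, n, hn, ⟨e⟩⟩ := h
  haveI : Nonempty (Fin n) := ⟨⟨0, hn⟩⟩
  obtain ⟨ψ⟩ : Nonempty (D ⊗[F] D →ₐ[F] Module.End F (Fin n → F)) := ⟨(Matrix.toLinAlgEquiv' : Matrix (Fin n) (Fin n) F ≃ₐ[F] _).toAlgHom.comp e.toAlgHom⟩
  have hc : ∀ (f : D →ₐ[F] D ⊗[F] D) c m, (ψ.comp f).toRingHom (algebraMap F D c) m = algebraMap F F c • m := fun f c m => by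
    have : (ψ.comp f).toRingHom (algebraMap F D c) = algebraMap F _ c := (ψ.comp f).commutes c
    rw [this]; rfl
  have hn' : Module.finrank F (Fin n → F) = Module.finrank F D := by
    have := e.toLinearEquiv.finrank_eq
    rw [Module.finrank_tensorProduct, Module.finrank_matrix, Module.finrank_self, Fintype.card_fin, mul_one] at this
    rw [Module.finrank_fintype_fun_eq_card, Fintype.card_fin]
    exact (Nat.mul_self_inj.1 this).symm
  let A : DAct F D F (Fin n → F) := ⟨_, hc Algebra.TensorProduct.includeLeft⟩
  let A' : DAct F D F (Fin n → F) := ⟨_, hc Algebra.TensorProduct.includeRight⟩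
  refine anti_hom A A' (fun x y v => ?_) hn'
  have : A.a x * A'.a y = A'.a y * A.a x := by
    change ψ _ * ψ _ = ψ _ * ψ _
    rw [← map_mul, ← map_mul]
    simp
  exact LinearMap.congr_fun this v

theorem exp_of_anti {F D : Type*} [Field F] [DivisionRing D] [Algebra F D] [FiniteDimensional F D] [Algebra.IsCentral F D] (θ : D →ₐ[F] Dᵐᵒᵖ) :
    ∃ n : ℕ, 0 < n ∧ Nonempty ((D ⊗[F] D) ≃ₐ[F] Matrix (Fin n) (Fin n) F) := by
  haveI : FiniteDimensional F Dᵐᵒᵖ := Module.Finite.equiv (opLinearEquiv F : D ≃ₗ[F] Dᵐᵒᵖ)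
  have hop : Module.finrank F D = Module.finrank F Dᵐᵒᵖ := (opLinearEquiv F : D ≃ₗ[F] Dᵐᵒᵖ).finrank_eq
  have hθ : Function.Surjective θ := (LinearMap.injective_iff_surjective_of_finrank_eq_finrank (f := θ.toLinearMap) hop).1 θ.injective
  let f : D ⊗[F] D →ₐ[F] Module.End F D := (AlgHom.mulLeftRight F D).comp (Algebra.TensorProduct.map (AlgHom.id F D) θ)
  have hf : Function.Surjective f := fun g => by
    obtain ⟨t, ht⟩ := sandwich_span (Module.finBasis F D) g
    choose s hs using fun l => hθ (op (Module.finBasis F D l))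
    refine ⟨∑ i, ∑ l, t i l • (Module.finBasis F D i ⊗ₜ s l), LinearMap.ext fun x => ?_⟩
    simp [f, ht, hs, AlgHom.mulLeftRight_apply]
  have hi : Function.Injective f := (LinearMap.injective_iff_surjective_of_finrank_eq_finrank (f := f.toLinearMap) (by
    rw [Module.finrank_tensorProduct, Module.finrank_linearMap])).2 hf
  exact ⟨_, Module.finrank_pos, ⟨(AlgEquiv.ofBijective f ⟨hi, hf⟩).trans (algEquivMatrix (Module.finBasis F D))⟩⟩

theorem exists_E0 {k F E : Type*} [Field k] [Field F] [Algebra k F] [DivisionRing E] [Algebra F E] [Algebra k E] [IsScalarTower k F E] {m : ℕ} (b : Module.Basis (Fin m) F E)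
    (h : ∀ i j l, ∃ c : k, b.repr (b i * b j) l = algebraMap k F c) : ∃ S : Subalgebra k E, FiniteDimensional k S ∧ Module.finrank k S = m ∧ (∀ i, b i ∈ S) ∧
      ∀ x ∈ S, ∀ l, ∃ c : k, b.repr x l = algebraMap k F c := by
  have hm : ∀ x, x ∈ Submodule.span k (Set.range b) ↔ ∀ l, ∃ c : k, b.repr x l = algebraMap k F c := fun x => by
    constructor
    · intro hx
      obtain ⟨c, rfl⟩ := (Submodule.mem_span_range_iff_exists_fun k).1 hx
      have : ∑ i, c i • b i = ∑ i, algebraMap k F (c i) • b i := Finset.sum_congr rfl fun i _ => (algebraMap_smul F _ _).symm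
      rw [this]
      exact fun l => ⟨c l, by rw [b.repr_sum_self]⟩
    · intro h
      choose c hc using h
      rw [← b.sum_repr x]
      exact Submodule.sum_mem _ fun i _ => by rw [hc, algebraMap_smul]; exact Submodule.smul_mem _ _ (Submodule.subset_span ⟨i, rfl⟩)
  set p := Submodule.span k (Set.range b) with hp
  haveI : FiniteDimensional k p := FiniteDimensional.span_of_finite k (Set.finite_range b)
  have hmul : p * p ≤ p := by
    rw [hp, Submodule.span_mul_span, Submodule.span_le]
    rintro _ ⟨_, ⟨i, rfl⟩, _, ⟨j, rfl⟩, rfl⟩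
    exact (hm _).2 (h i j)
  have hone : (1 : E) ∈ p := by
    obtain ⟨i⟩ := b.index_nonempty
    let T : p →ₗ[k] p := ((LinearMap.mulLeft k (b i)).comp p.subtype).codRestrict p fun x => hmul (Submodule.mul_mem_mul (Submodule.subset_span ⟨i, rfl⟩) x.2)
    have hT : ∀ x, (T x).1 = b i * x := fun x => rfl
    have hi : Function.Injective T := fun x y hxy => Subtype.ext (mul_left_cancel₀ (b.ne_zero i) (congrArg Subtype.val hxy))
    obtain ⟨x, hx⟩ := LinearMap.injective_iff_surjective.1 hi ⟨b i, Submodule.subset_span ⟨i, rfl⟩⟩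
    have : x.1 = 1 := mul_left_cancel₀ (b.ne_zero i) ((congrArg Subtype.val hx).trans (mul_one _).symm)
    exact this ▸ x.2
  refine ⟨p.toSubalgebra hone fun x y hx hy => hmul (Submodule.mul_mem_mul hx hy), ‹FiniteDimensional k p›, ?_, fun i => Submodule.subset_span ⟨i, rfl⟩, fun x hx => (hm x).1 hx⟩
  have : LinearIndependent k b := b.linearIndependent.restrict_scalars (by
    intro a b h; simpa [Algebra.smul_def] using h)
  exact (finrank_span_eq_card this).trans (Fintype.card_fin m)

theorem good_place {k : Type*} [Field k] [Infinite k] {ι : Type*} [Finite ι] (s : ι → RatFunc k) : ∃ a : k, ∀ i, ∃ f g : k[X], g.eval a ≠ 0 ∧ s i * algebraMap k[X] (RatFunc k) g = algebraMap k[X] (RatFunc k) f := by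
  obtain ⟨d, hd⟩ := IsLocalization.exist_integer_multiples_of_finite (nonZeroDivisors k[X]) s
  obtain ⟨a, ha⟩ : ∃ a, d.1.eval a ≠ 0 := by
    by_contra! h
    exact nonZeroDivisors.coe_ne_zero d (Polynomial.funext fun r => by rw [h, eval_zero])
  refine ⟨a, fun i => ?_⟩
  obtain ⟨f, hf⟩ := hd i
  exact ⟨f, d.1, ha, by rw [hf, Algebra.smul_def, mul_comm]⟩

theorem exists_int_place {k : Type u} [Field k] [Infinite k] (h2 : (2 : k) ≠ 0) {ι : Type*} [Finite ι] (s : ι → RatFunc k) :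
    ∃ (L : Type u) (_ : NontriviallyNormedField L) (_ : CompleteSpace L) (_ : IsUltrametricDist L) (_ : Algebra (RatFunc k) L) (_ : Algebra k L) (_ : IsScalarTower k (RatFunc k) L),
      Loc L 2⁻¹ ∧ DenseRange (algebraMap (RatFunc k) L) ∧ RPlace k L ∧ ∀ i, ‖algebraMap (RatFunc k) L (s i)‖ ≤ 1 := by
  obtain ⟨a, ha⟩ := good_place s
  obtain ⟨L, i1, i2, i3, i4, hL, hd, h1, hp, hq⟩ := exists_place (irreducible_X_sub_C a) h2
  letI := i1; letI := i4
  letI i5 : Algebra k L := ((algebraMap (RatFunc k) L).comp (algebraMap k (RatFunc k))).toAlgebra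
  have hg : ∀ g : k[X], g.eval a ≠ 0 → ‖algebraMap (RatFunc k) L (algebraMap k[X] (RatFunc k) g)‖ = 1 := fun g hg =>
    le_antisymm (h1 g) (not_lt.1 fun h => hg (dvd_iff_isRoot.1 ((hp g).1 h)))
  have hC : ∀ c : k, algebraMap k L c = algebraMap (RatFunc k) L (algebraMap k[X] (RatFunc k) (C c)) := fun c => by
    change algebraMap (RatFunc k) L (algebraMap k (RatFunc k) c) = _
    rw [IsScalarTower.algebraMap_apply k k[X] (RatFunc k)]; rfl
  refine ⟨L, i1, i2, i3, i4, i5, IsScalarTower.of_algebraMap_eq fun _ => rfl, hL, hd, ⟨fun c => by rw [hC]; exact h1 _, fun y hy => ?_⟩, fun i => ?_⟩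
  · obtain ⟨z, hz⟩ := hd.exists_dist_lt y one_pos
    rw [dist_eq_norm] at hz
    have hz1 : ‖algebraMap (RatFunc k) L z‖ ≤ 1 := by
      rw [show algebraMap (RatFunc k) L z = y + -(y - algebraMap (RatFunc k) L z) by abel]
      exact (IsUltrametricDist.norm_add_le_max _ _).trans (max_le hy (by rw [norm_neg]; exact hz.le))
    suffices h : ∃ c : k, ‖algebraMap (RatFunc k) L z - algebraMap k L c‖ < 1 by
      obtain ⟨c, hc⟩ := h
      refine ⟨c, ?_⟩
      rw [← sub_add_sub_cancel y (algebraMap (RatFunc k) L z)]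
      exact (IsUltrametricDist.norm_add_le_max _ _).trans_lt (max_lt hz hc)
    obtain ⟨f, g, hfg, hz0⟩ : ∃ f g : k[X], IsCoprime f g ∧ z * algebraMap k[X] (RatFunc k) g = algebraMap k[X] (RatFunc k) f := by
      refine ⟨z.num, z.denom, z.isCoprime_num_denom, ?_⟩
      exact (eq_div_iff (RatFunc.algebraMap_ne_zero z.denom_ne_zero)).1 z.num_div_denom.symm
    have hz2 := congrArg (fun t => algebraMap (RatFunc k) L t) hz0
    simp only [map_mul] at hz2
    have hga : g.eval a ≠ 0 := fun h => by
      have h3 := (hp g).2 (dvd_iff_isRoot.2 h)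
      have h4 : ‖algebraMap (RatFunc k) L (algebraMap k[X] (RatFunc k) f)‖ < 1 := by
        rw [← hz2, norm_mul]; exact (mul_le_of_le_one_left (norm_nonneg _) hz1).trans_lt h3
      exact (irreducible_X_sub_C a).not_isUnit (hfg.isUnit_of_dvd' ((hp f).1 h4) (dvd_iff_isRoot.2 h))
    refine ⟨f.eval a / g.eval a, ?_⟩
    have h5 : ‖(algebraMap (RatFunc k) L z - algebraMap k L (f.eval a / g.eval a)) * algebraMap (RatFunc k) L (algebraMap k[X] (RatFunc k) g)‖ < 1 := by
      rw [sub_mul, hz2, hC, ← map_mul, ← map_mul, ← map_sub, ← map_sub, hp, dvd_iff_isRoot]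
      simp [div_mul_cancel₀ _ hga]
    rwa [norm_mul, hg g hga, mul_one] at h5
  · obtain ⟨f, g, h, e⟩ := ha i
    have := h1 f
    rwa [← e, map_mul, norm_mul, hg g h, mul_one] at this

section fin
variable {F L W Δ Δ' E : Type*} [Field F] [NontriviallyNormedField L] [CompleteSpace L] [IsUltrametricDist L] [AddCommGroup W] [Module L W] [Algebra F L]
  [DivisionRing Δ] [Algebra L Δ] [FiniteDimensional L Δ] [DivisionRing Δ'] [Algebra L Δ'] [FiniteDimensional L Δ'] [DivisionRing E] [Algebra F E] {q : ℝ}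

theorem VNorm.round_le (hL : Loc L q) (A : DAct L Δ L W) (hv : ∀ y : Δ, y ≠ 0 → ∃ m : ℤ, nm L y = q ^ m) (α : VNorm L W) (h : ∀ y w, α.v (A.a y w) ≤ nm L y * α.v w) (y : Δ) (w : W) :
    (α.round hL.q0 hL.q1 hL.disc).v (A.a y w) ≤ nm L y * (α.round hL.q0 hL.q1 hL.disc).v w := by
  rcases eq_or_ne y 0 with rfl | hy
  · simp [nm_zero, VNorm.v_zero]
  · obtain ⟨m, hm⟩ := hv y hy
    change cl q _ ≤ _ * cl q _
    rw [hm, ← cl_mul hL.q0 hL.q1, ← hm]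
    exact cl_mono hL.q0 hL.q1 (h y w)

theorem Tri.exists_norm (hL : Loc L q) (T : Tri L Δ L Δ' F E L W) (hv : ∀ y : Δ, y ≠ 0 → ∃ m : ℤ, nm L y = q ^ m) (hv' : ∀ y : Δ', y ≠ 0 → ∃ m : ℤ, nm L y = q ^ m)
    {n : ℕ} (b : Module.Basis (Fin n) F E) (hb : ∀ i j l, ‖algebraMap F L (b.repr (b i * b j) l)‖ ≤ 1) :
    ∃ α : VNorm L W, (∀ w ≠ 0, ∃ m : ℤ, α.v w = q ^ m) ∧ (∀ y w, α.v (T.A.a y w) ≤ nm L y * α.v w) ∧ (∀ y w, α.v (T.A'.a y w) ≤ nm L y * α.v w) ∧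
      ∀ x, (∀ i, ‖algebraMap F L (b.repr x i)‖ ≤ 1) → ∀ w, α.v (T.B.a x w) ≤ α.v w := by
  haveI := T.fin
  obtain ⟨α1, h1, -⟩ := T.A.exists_inv (VNorm.ofBasis (Module.finBasis L W))
  obtain ⟨α2, h2, h2'⟩ := T.A'.exists_inv α1
  obtain ⟨α3, h3, h3'⟩ := α2.exists_order_inv b hb T.B
  refine ⟨α3.round hL.q0 hL.q1 hL.disc, fun w hw => cl_mem (α3.pos hw), VNorm.round_le hL _ hv _ fun y => ?_, VNorm.round_le hL _ hv' _ fun y => ?_, fun x hx w => cl_mono hL.q0 hL.q1 (h3 x hx w)⟩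
  · exact h3' _ (fun z w => (T.cA _ _ _).symm) _ (nm_nonneg y) (h2' _ (fun z w => (T.c _ _ _).symm) _ (nm_nonneg y) (h1 y))
  · exact h3' _ (fun z w => (T.cA' _ _ _).symm) _ (nm_nonneg y) (h2 y)

variable {k R U : Type*} [Field k] [Algebra k L] [DivisionRing R] [Algebra k R] [AddCommGroup U] [Module k U] {α : VNorm L W}

theorem Red.act (S : Red k α U) (P : RPlace k L) (A : DAct L Δ L W) (hA : ∀ y w, α.v (A.a y w) ≤ nm L y * α.v w) (ρ : Resid L Δ R)
    (ha : ∀ c, ρ.r (algebraMap L Δ (algebraMap k L c)) = algebraMap k R c) :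
    ∃ t : DAct k R k U, ∀ x, nm L x ≤ 1 → ∀ w, α.v w ≤ 1 → t.a (ρ.r x) (S.r w) = S.r (A.a x w) := by
  have h1 : ∀ (x : OO L Δ) w, α.v (A.a x.1 w) ≤ α.v w := fun x w => (hA _ _).trans (mul_le_of_le_one_left (α.nonneg w) x.2)
  obtain ⟨t, ht⟩ := S.lift P (A.a.comp (OO L Δ).subtype) h1
  obtain ⟨e, he⟩ := ρ.exists_lift t fun x hx => LinearMap.ext fun u => by
    obtain ⟨w, hw, rfl⟩ := S.surj u
    rw [ht x w hw, LinearMap.zero_apply]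
    refine (S.ker ((h1 x w).trans hw)).2 ((hA _ _).trans_lt ?_)
    exact (mul_le_of_le_one_right (nm_nonneg _) hw).trans_lt hx
  have hR : ∀ x, nm L x ≤ 1 → ∀ w, α.v w ≤ 1 → e (ρ.r x) (S.r w) = S.r (A.a x w) := fun x hx w hw => by
    rw [he ⟨x, hx⟩, ht _ _ hw]; rfl
  refine ⟨⟨e, fun c u => ?_⟩, hR⟩
  obtain ⟨w, hw, rfl⟩ := S.surj u
  rw [← ha, hR _ ((nm_algebraMap _).trans_le (P.le c)) w hw, A.ha]
  exact S.smul c hw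

variable {R' : Type*} [DivisionRing R'] [Algebra k R'] [Algebra k F] [IsScalarTower k F L] [Algebra k E] [IsScalarTower k F E]

theorem Tri.final [FiniteDimensional k R] [Algebra.IsCentral k R] (hL : Loc L q) (T : Tri L Δ L Δ' F E L W) (P : RPlace k L)
    (hv : ∀ y : Δ, y ≠ 0 → ∃ m : ℤ, nm L y = q ^ m) (hv' : ∀ y : Δ', y ≠ 0 → ∃ m : ℤ, nm L y = q ^ m) (ρ : Resid L Δ R) (ha : ∀ c, ρ.r (algebraMap L Δ (algebraMap k L c)) = algebraMap k R c)
    (ρ' : Resid L Δ' R') (ha' : ∀ c, ρ'.r (algebraMap L Δ' (algebraMap k L c)) = algebraMap k R' c) (hd : Module.finrank L Δ = Module.finrank L Δ') (hdR : Module.finrank k R = Module.finrank L Δ) (e : Rᵐᵒᵖ →ₐ[k] R')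
    {n : ℕ} (b : Module.Basis (Fin n) F E) (hb : ∀ i j l, ∃ c : k, b.repr (b i * b j) l = algebraMap k F c) : n = 1 := by
  have hb' : ∀ s : F, (∃ c : k, s = algebraMap k F c) → ‖algebraMap F L s‖ ≤ 1 := by
    rintro _ ⟨c, rfl⟩
    rw [← IsScalarTower.algebraMap_apply]; exact P.le c
  haveI := T.fin
  haveI : FiniteDimensional F E := b.finiteDimensional_of_finite
  haveI := T.nt
  obtain ⟨S, hS1, hS2, -, hS3⟩ := exists_E0 b hb
  obtain ⟨α, h0, h1, h2, h3⟩ := T.exists_norm hL hv hv' b fun i j l => hb' _ (hb i j l)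
  obtain ⟨σ⟩ := Red.exists_red (k := k) P hL h0
  obtain ⟨t, ht⟩ := σ.act P T.A h1 ρ ha
  obtain ⟨t', ht'⟩ := σ.act P T.A' h2 ρ' ha'
  obtain ⟨s, hs⟩ := σ.lift P (T.B.a.comp S.val.toRingHom) fun (x : S) w => h3 x.1 (fun l => hb' _ (hS3 x.1 x.2 l)) w
  let B : DBimod k R k (Fin (Module.finrank L W) → k) :=
    { l := t.a
      r := t'.a.comp e.toRingHom
      hl := t.ha
      hr := fun c m => by
        change t'.a (e (algebraMap k Rᵐᵒᵖ c)) m = _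
        rw [e.commutes, t'.ha]
      comm := fun x y m => by
        obtain ⟨w, hw, rfl⟩ := σ.surj m
        obtain ⟨x, hx, rfl⟩ := ρ.ex x
        change t.a _ (t'.a (e y) _) = t'.a (e y) _
        obtain ⟨y, hy, h⟩ := ρ'.ex (e y)
        rw [← h, ht _ hx _ hw, ht' _ hy _ hw, ht _ hx, ht' _ hy, T.c]
        · exact (h1 _ _).trans (mul_le_one₀ hx (α.nonneg _) hw)
        · exact (h2 _ _).trans (mul_le_one₀ hy (α.nonneg _) hw) }
  have hw : Module.finrank L W ^ 2 = Module.finrank L Δ * Module.finrank L Δ' * Module.finrank F E := T.dim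
  have hB := B.finrank_eq
  rw [Module.finrank_fintype_fun_eq_card, Fintype.card_fin, hdR] at hB
  rw [hB, ← hd, Module.finrank_eq_card_basis b, Fintype.card_fin] at hw
  have hN : 0 < Module.finrank L Δ := Module.finrank_pos
  have hn : n = Module.finrank k B.inv ^ 2 := Nat.eq_of_mul_eq_mul_left (Nat.mul_pos hN hN) (by linear_combination -hw)
  haveI : Nonempty (Fin (Module.finrank L W)) := ⟨⟨0, Module.finrank_pos⟩⟩
  obtain ⟨v, hv, hv0⟩ := (Submodule.ne_bot_iff _).1 B.inv_ne_bot
  have hsl : ∀ (x : S) w, α.v w ≤ 1 → α.v (T.B.a x.1 w) ≤ 1 := fun x w hw => (h3 x.1 (fun l => hb' _ (hS3 x.1 x.2 l)) w).trans hw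
  have hs' : ∀ (x : S) w, α.v w ≤ 1 → s x (σ.r w) = σ.r (T.B.a x.1 w) := hs
  have c1 : ∀ (x : S) y u, t.a y (s x u) = s x (t.a y u) := fun x y u => by
    obtain ⟨w, hw, rfl⟩ := σ.surj u
    obtain ⟨y, hy, rfl⟩ := ρ.ex y
    rw [hs' _ _ hw, ht _ hy _ hw, ht _ hy _ (hsl x w hw), hs', T.cA]
    exact (h1 _ _).trans (mul_le_one₀ hy (α.nonneg _) hw)
  have c2 : ∀ (x : S) y u, t'.a y (s x u) = s x (t'.a y u) := fun x y u => by
    obtain ⟨w, hw, rfl⟩ := σ.surj u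
    obtain ⟨y, hy, rfl⟩ := ρ'.ex y
    rw [hs' _ _ hw, ht' _ hy _ hw, ht' _ hy _ (hsl x w hw), hs', T.cA']
    exact (h2 _ _).trans (mul_le_one₀ hy (α.nonneg _) hw)
  have c3 : ∀ (c : k) u, s (algebraMap k S c) u = c • u := fun c u => by
    obtain ⟨w, hw, rfl⟩ := σ.surj u
    rw [hs' _ _ hw]
    change σ.r (T.B.a (algebraMap k E c) w) = _
    rw [IsScalarTower.algebraMap_apply k F E, T.B.ha, ← IsScalarTower.algebraMap_apply, σ.smul c hw]
  let φ : S →ₗ[k] B.inv :=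
    { toFun := fun x => ⟨s x v, B.mem_inv.2 fun y => by
        change t.a y _ = t'.a _ _
        rw [c1, c2]; exact congrArg _ (B.mem_inv.1 hv y)⟩
      map_add' := fun x y => Subtype.ext (by simp)
      map_smul' := fun c x => Subtype.ext (by
        change s (c • x) v = c • s x v
        rw [Algebra.smul_def, map_mul, Module.End.mul_apply, c3]) }
  have hφ : Function.Injective φ := by
    rw [← LinearMap.ker_eq_bot, LinearMap.ker_eq_bot']
    intro x hx
    by_contra h
    have hi : Function.Injective (LinearMap.mulRight k x) := fun y z h' => Subtype.ext (mul_right_cancel₀ (fun h' => h (Subtype.ext h')) (congrArg Subtype.val h'))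
    obtain ⟨y, hy⟩ := LinearMap.injective_iff_surjective.1 hi 1
    have : s (y * x) v = s y (s x v) := by rw [map_mul]; rfl
    rw [show y * x = 1 from hy, map_one, show s x v = 0 from congrArg Subtype.val hx, map_zero] at this
    exact hv0 this
  have := LinearMap.finrank_le_finrank_of_injective hφ
  rw [hS2] at this
  have h0 : Module.finrank k B.inv ≠ 0 := fun h => by
    rw [h] at hn; exact b.index_nonempty.elim fun i => by have := i.2; omega
  have : Module.finrank k B.inv = 1 := by
    rw [hn] at this; nlinarith [Nat.pos_of_ne_zero h0]
  rw [hn, this, one_pow]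
end fin

section op
variable {k L Δ R : Type*} [NontriviallyNormedField L] [CompleteSpace L] [IsUltrametricDist L] [DivisionRing Δ] [Algebra L Δ] [FiniteDimensional L Δ] [DivisionRing R]

instance finite_mop : FiniteDimensional L Δᵐᵒᵖ := Module.Finite.equiv (opLinearEquiv L : Δ ≃ₗ[L] Δᵐᵒᵖ)

theorem Resid.exists_mop (ρ : Resid L Δ R) : ∃ ρ' : Resid L Δᵐᵒᵖ Rᵐᵒᵖ, ∀ x, nm L x ≤ 1 → ρ'.r (op x) = op (ρ.r x) := by
  have hx : ∀ x : OO L Δᵐᵒᵖ, nm L (unop x.1) ≤ 1 := fun x => (nm_op x.1).trans_le x.2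
  let ρ' : Resid L Δᵐᵒᵖ Rᵐᵒᵖ :=
    { ψ :=
      { toFun := fun x => op (ρ.r (unop x.1))
        map_one' := by rw [show unop (1 : OO L Δᵐᵒᵖ).1 = 1 from rfl, ρ.r_one]; rfl
        map_zero' := congrArg op ((ρ.r_zero_iff (hx 0)).2 ((nm_op _).trans_lt (by rw [show ((0 : OO L Δᵐᵒᵖ) : Δᵐᵒᵖ) = 0 from rfl, nm_zero]; exact one_pos)))
        map_mul' := fun x y => congrArg op (ρ.r_mul (hx y) (hx x))
        map_add' := fun x y => congrArg op (ρ.r_add (hx x) (hx y)) }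
      surj := fun r => by
        obtain ⟨x, h, e⟩ := ρ.ex (unop r)
        exact ⟨⟨op x, (nm_op (op x)).symm.trans_le h⟩, congrArg op e⟩
      ker := fun x => by
        change op (ρ.r (unop x.1)) = 0 ↔ nm L x.1 < 1
        rw [← nm_op, ← ρ.r_zero_iff (hx x)]
        exact op_eq_zero_iff _ }
  exact ⟨ρ', fun x h => ρ'.r_def ((nm_op (op x)).symm.trans_le h)⟩
end op

theorem local_final {k : Type u} [Field k] [Infinite k] (h2 : (2 : k) ≠ 0)
    (H : ∀ (D : Type u) [DivisionRing D] [Algebra k D], FiniteDimensional k D → Algebra.IsCentral k D → HasExponentTwo k D → GenusOne k D)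
    {D D' V E : Type u} [DivisionRing D] [Algebra (RatFunc k) D] [FiniteDimensional (RatFunc k) D] [Algebra.IsCentral (RatFunc k) D]
    [DivisionRing D'] [Algebra (RatFunc k) D'] [FiniteDimensional (RatFunc k) D'] [Algebra.IsCentral (RatFunc k) D'] [AddCommGroup V] [Module (RatFunc k) V]
    [DivisionRing E] [Algebra (RatFunc k) E] [FiniteDimensional (RatFunc k) E] [Algebra k E] [IsScalarTower k (RatFunc k) E]
    (θ : D →ₐ[RatFunc k] Dᵐᵒᵖ) (T : Tri (RatFunc k) D (RatFunc k) D' (RatFunc k) E (RatFunc k) V) (h : SameMaximalSubfields (RatFunc k) D D')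
    {n : ℕ} (b : Module.Basis (Fin n) (RatFunc k) E) (hb : ∀ i j l, ∃ c : k, b.repr (b i * b j) l = algebraMap k (RatFunc k) c) : n = 1 := by
  obtain ⟨a, hn⟩ := two_power θ
  have hn' := (finrank_same h).symm.trans hn
  have h2' : (2 : RatFunc k) ≠ 0 := by
    rw [← map_ofNat (algebraMap k (RatFunc k)) 2]; exact (_root_.map_ne_zero _).2 h2
  have h0 : ((2 ^ a : ℕ) ^ 2 : RatFunc k) ≠ 0 := by
    push_cast; exact pow_ne_zero _ (pow_ne_zero _ h2')
  let d := Module.finBasis (RatFunc k) D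
  let d' := Module.finBasis (RatFunc k) D'
  obtain ⟨c, hc⟩ := DualFam.exists_dual (by rw [hn]; exact_mod_cast h0) d
  obtain ⟨c', hc'⟩ := DualFam.exists_dual (by rw [hn']; exact_mod_cast h0) d'
  let s : ((Fin _ × Fin _ × Fin _) ⊕ (Fin _ × Fin _)) ⊕ ((Fin _ × Fin _ × Fin _) ⊕ (Fin _ × Fin _)) → RatFunc k :=
    Sum.elim (Sum.elim (fun i => d.repr (d i.1 * d i.2.1) i.2.2) fun i => d.repr (c i.1) i.2)
      (Sum.elim (fun i => d'.repr (d' i.1 * d' i.2.1) i.2.2) fun i => d'.repr (c' i.1) i.2)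
  obtain ⟨L, _, _, _, _, _, _, hL, hd, P, hs⟩ := exists_int_place h2 s
  obtain ⟨X, Δ, _, _, _, _, ⟨Q⟩⟩ := exists_locMod (RatFunc k) D L
  obtain ⟨X', Δ', _, _, _, _, ⟨Q'⟩⟩ := exists_locMod (RatFunc k) D' L
  haveI := Q.finΔ; haveI := Q'.finΔ; haveI := Q.central; haveI := Q'.central
  have hL2 : (2 : L) ≠ 0 := norm_pos_iff.1 (hL.two ▸ one_pos)
  have hE := local_emb hd Q Q' hL2 hn h
  have hv := unram hL Q hn d c hc (fun i j l => hs (.inl (.inl (i, j, l)))) fun i j => hs (.inl (.inr (i, j)))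
  have hv' := unram hL Q' hn' d' c' hc' (fun i j l => hs (.inr (.inl (i, j, l)))) fun i j => hs (.inr (.inr (i, j)))
  obtain ⟨m, hm⟩ := Q.twoPow hn
  have hm' := hE.dim.symm.trans hm
  obtain ⟨R, _, _, ρ, ha⟩ := exists_kres (Δ := Δ) P
  obtain ⟨R', _, _, ρ', ha'⟩ := exists_kres (Δ := Δ') P
  obtain ⟨f1, f2⟩ := (ρ.red ha P).finrank P hL hv
  obtain ⟨f1', f2'⟩ := (ρ'.red ha' P).finrank P hL hv'
  haveI : Algebra.IsCentral k R := ρ.central ha P hL (hL.two_pow (hm.trans (pow_mul _ _ _).symm)) hv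
  haveI : Algebra.IsCentral k R' := ρ'.central ha' P hL (hL.two_pow (hm'.trans (pow_mul _ _ _).symm)) hv'
  obtain ⟨θΔ⟩ := Q.anti θ
  obtain ⟨θR⟩ := ρ.anti ha P θΔ
  have hsame : SameMaximalSubfields k R R' := ⟨ρ.same ha P ρ' ha' h2 (f2.trans hm) (f2'.trans hm') hE.g, fun M hM => by
    obtain ⟨M', hM', ⟨e⟩⟩ := ρ'.same ha' P ρ ha h2 (f2'.trans hm') (f2.trans hm) hE.f M hM
    exact ⟨M', hM', ⟨e.symm⟩⟩⟩
  obtain ⟨e⟩ : Nonempty (R →ₐ[k] R') := by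
    by_cases hk : Nonempty (R ≃ₐ[k] k)
    · obtain ⟨e⟩ := hk
      exact ⟨(Algebra.ofId k R').comp e.toAlgHom⟩
    · obtain ⟨e⟩ := H R f1 inferInstance ⟨hk, exp_of_anti θR⟩ R' f1' inferInstance hsame
      exact ⟨e.symm.toAlgHom⟩
  obtain ⟨W, _, _, ⟨T'⟩⟩ := exists_wmod T Q Q'
  obtain ⟨τ, hτ⟩ := ρ.exists_mop
  obtain ⟨τ', hτ'⟩ := ρ'.exists_mop
  have hle : ∀ c : k, ‖algebraMap k L c‖ ≤ 1 := P.le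
  have o1 : Module.finrank L Δᵐᵒᵖ = Module.finrank L Δ := (opLinearEquiv L : Δ ≃ₗ[L] Δᵐᵒᵖ).finrank_eq.symm
  have o2 : Module.finrank L Δ'ᵐᵒᵖ = Module.finrank L Δ' := (opLinearEquiv L : Δ' ≃ₗ[L] Δ'ᵐᵒᵖ).finrank_eq.symm
  have o3 : Module.finrank k Rᵐᵒᵖ = Module.finrank k R := (opLinearEquiv k : R ≃ₗ[k] Rᵐᵒᵖ).finrank_eq.symm
  haveI : FiniteDimensional k Rᵐᵒᵖ := Module.Finite.equiv (opLinearEquiv k : R ≃ₗ[k] Rᵐᵒᵖ)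
  have ht : ∀ c, τ.r (algebraMap L Δᵐᵒᵖ (algebraMap k L c)) = algebraMap k Rᵐᵒᵖ c := fun c => by
    rw [MulOpposite.algebraMap_apply, hτ _ ((nm_algebraMap _).trans_le (P.le c)), ha]; rfl
  have ht' : ∀ c, τ'.r (algebraMap L Δ'ᵐᵒᵖ (algebraMap k L c)) = algebraMap k R'ᵐᵒᵖ c := fun c => by
    rw [MulOpposite.algebraMap_apply, hτ' _ ((nm_algebraMap _).trans_le (P.le c)), ha']; rfl
  refine T'.final hL P (fun y hy => ?_) (fun y hy => ?_) τ ht τ' ht' (o1.trans (hE.dim.trans o2.symm)) (o3.trans (f2.trans o1.symm)) ((AlgHom.op e).comp (θR.comp (AlgEquiv.opOp k R).symm.toAlgHom)) b hb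
  · rw [← nm_op]; exact hv _ (by simpa using hy)
  · rw [← nm_op]; exact hv' _ (by simpa using hy)

theorem stability_theorem (K : Type u) [Field K] (hchar : ringChar K ≠ 2)
    (H : ∀ (D : Type u) [DivisionRing D] [Algebra K D],
      FiniteDimensional K D → Algebra.IsCentral K D → HasExponentTwo K D →
      GenusOne K D) :
    ∀ (D' : Type u) [DivisionRing D'] [Algebra (RatFunc K) D'],
      FiniteDimensional (RatFunc K) D' → Algebra.IsCentral (RatFunc K) D' →
      HasExponentTwo (RatFunc K) D' → GenusOne (RatFunc K) D' := by
  intro D _ _ _ _ hD D' _ _ _ _ h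
  have h2 : (2 : K) ≠ 0 := Ring.two_ne_zero hchar
  obtain ⟨θ⟩ := hD.anti
  obtain ⟨a, hn⟩ := two_power θ
  have hn' := (finrank_same h).symm.trans hn
  have h2' : (2 : RatFunc K) ≠ 0 := by
    rw [← map_ofNat (algebraMap K (RatFunc K)) 2]; exact (_root_.map_ne_zero _).2 h2
  obtain ⟨V, E, _, _, _, _, ⟨T⟩, _, _⟩ := exists_pair (RatFunc K) D D'
  haveI := T.fin
  haveI := T.nt
  obtain ⟨e, he⟩ := T.two hn hn'
  obtain ⟨g, f, hg, hf, hf1⟩ := finite_order h2 (by rw [he]; push_cast; exact pow_ne_zero _ h2') θ T h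
  obtain ⟨b, hb⟩ : ∃ b : Module.Basis (Fin (Module.finrank (RatFunc K) E)) (RatFunc K) E, ∀ i j l, ∃ c : K, b.repr (b i * b j) l = algebraMap K[X] (RatFunc K) (C c) := by
    obtain ⟨L, _, _, _, _, hL, hd, hi⟩ := exists_infty h2
    obtain ⟨w, hw, hw'⟩ := place_order θ T h hL hd
    exact const_order hi g w hg hf hf1 hw hw'
  letI : Algebra K E := Algebra.compHom E (algebraMap K (RatFunc K))
  haveI : IsScalarTower K (RatFunc K) E := IsScalarTower.of_algebraMap_eq fun _ => rfl
  have hb' : ∀ i j l, ∃ c : K, b.repr (b i * b j) l = algebraMap K (RatFunc K) c := fun i j l => by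
    obtain ⟨c, hc⟩ := hb i j l
    exact ⟨c, by rw [hc, IsScalarTower.algebraMap_apply K K[X] (RatFunc K)]; rfl⟩
  have h1 : Module.finrank (RatFunc K) E = 1 := by
    rcases finite_or_infinite K with hK | hK
    · obtain ⟨S, hS, -, hbS, -⟩ := exists_E0 b hb'
      haveI : Finite S := Module.finite_of_finite K
      have hS' := Finite.isDomain_to_isField S
      have hc : ∀ x y : E, x * y = y * x := fun x y => by
        rw [← b.sum_repr x, ← b.sum_repr y]
        simp only [Finset.sum_mul, Finset.mul_sum, smul_mul_smul_comm]
        rw [Finset.sum_comm]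
        refine Finset.sum_congr rfl fun i _ => Finset.sum_congr rfl fun j _ => ?_
        rw [mul_comm, show b _ * b _ = b _ * b _ from congrArg Subtype.val (hS'.mul_comm ⟨_, hbS i⟩ ⟨_, hbS j⟩)]
      rw [← Subalgebra.bot_eq_top_iff_finrank_eq_one]
      refine (Algebra.IsCentral.center_eq_bot (RatFunc K) E).symm.trans ?_
      exact eq_top_iff.2 fun x _ => Subalgebra.mem_center_iff.2 fun y => hc _ _
    · exact local_final h2 H θ T h b hb'
  have hdim := T.dim
  rw [h1, ← finrank_same h, mul_one, ← sq] at hdim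
  obtain ⟨φ⟩ := anti_hom T.A T.A' T.c (Nat.pow_left_injective (n := 2) two_ne_zero hdim)
  let ψ : D' →ₐ[RatFunc K] D := (AlgEquiv.opOp (RatFunc K) D).symm.toAlgHom.comp ((AlgHom.op θ).comp φ)
  exact ⟨AlgEquiv.ofBijective ψ ⟨ψ.injective, (LinearMap.injective_iff_surjective_of_finrank_eq_finrank (f := ψ.toLinearMap) (finrank_same h).symm).1 ψ.injective⟩⟩
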